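/- The fifth group cohomology H^5(Γ_0(13), ℂ) has dimension 1 as a ℂ-vector space. -/

import Mathlib

/-- The congruence subgroup `Γ₀(N) ⊆ SL(4, ℤ)` consisting of matrices whose last row is
congruent to `(0,0,0,*)` modulo `N`, i.e. whose first three entries of the last row are
divisible by `N`. -/
def Gamma0 (N : ℕ) : Subgroup (Matrix.SpecialLinearGroup (Fin 4) ℤ) where
  carrier := {A | ∀ j : Fin 4, j ≠ 3 → (N : ℤ) ∣ A.1 3 j}
  one_mem' := by
    intro j hj
    simp [Matrix.one_apply_ne' hj]
  mul_mem' := by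
    intro A B hA hB j hj
    show (N : ℤ) ∣ (A.1 * B.1) 3 j
    rw [Matrix.mul_apply]
    refine Finset.dvd_sum fun k _ => ?_
    by_cases hk : k = 3
    · subst hk
      exact (hB j hj).mul_left _
    · exact (hA k hk).mul_right _
  inv_mem' := by
    intro A hA j hj
    have hAB : (A.1 : Matrix (Fin 4) (Fin 4) ℤ) * (A⁻¹).1 = 1 := by
      rw [← Matrix.SpecialLinearGroup.coe_mul, mul_inv_cancel,
        Matrix.SpecialLinearGroup.coe_one]
    set f : ℤ →+* ZMod N := Int.castRingHom (ZMod N) with hf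
    have hab : (A.1.map f) * ((A⁻¹).1.map f) = 1 := by
      rw [← Matrix.map_mul, hAB, Matrix.map_one f f.map_zero f.map_one]
    have ha0 : ∀ k : Fin 4, k ≠ 3 → (A.1.map f) 3 k = 0 := by
      intro k hk
      have := hA k hk
      simpa [Matrix.map_apply, hf, ZMod.intCast_zmod_eq_zero_iff_dvd] using this
    have hsum : ∀ i, ∑ k, (A.1.map f) 3 k * ((A⁻¹).1.map f) k i
        = (1 : Matrix (Fin 4) (Fin 4) (ZMod N)) 3 i := by
      intro i
      rw [← Matrix.mul_apply, hab]
    have hsum' : ∀ i, (A.1.map f) 3 3 * ((A⁻¹).1.map f) 3 i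
        = (1 : Matrix (Fin 4) (Fin 4) (ZMod N)) 3 i := by
      intro i
      have h := hsum i
      rw [Fin.sum_univ_four, ha0 0 (by decide), ha0 1 (by decide),
        ha0 2 (by decide), zero_mul, zero_mul, zero_mul, zero_add, zero_add,
        zero_add] at h
      exact h
    have hunit : (A.1.map f) 3 3 * ((A⁻¹).1.map f) 3 3 = 1 := by
      simpa [Matrix.one_apply] using hsum' 3
    have hzero : (A.1.map f) 3 3 * ((A⁻¹).1.map f) 3 j = 0 := by
      simpa [Matrix.one_apply_ne' hj] using hsum' j
    have hb : ((A⁻¹).1.map f) 3 j = 0 := by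
      calc ((A⁻¹).1.map f) 3 j
          = ((A.1.map f) 3 3 * ((A⁻¹).1.map f) 3 3) * ((A⁻¹).1.map f) 3 j := by
            rw [hunit, one_mul]
        _ = ((A⁻¹).1.map f) 3 3 * ((A.1.map f) 3 3 * ((A⁻¹).1.map f) 3 j) := by ring
        _ = 0 := by rw [hzero, mul_zero]
    show (N : ℤ) ∣ (A⁻¹).1 3 j
    rw [← ZMod.intCast_zmod_eq_zero_iff_dvd]
    simpa [Matrix.map_apply, hf] using hb

section AlternatingChains

open scoped Classical

variable {X : Type} {k : Type} [Field k]

/-- Functions on lists that change sign under swapping two adjacent entries. -/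
def IsAlt (f : List X → k) : Prop :=
  ∀ l₁ a b l₂, f (l₁ ++ a :: b :: l₂) = -f (l₁ ++ b :: a :: l₂)

theorem IsAlt.cons {f : List X → k} (hf : IsAlt f) (a : X) : IsAlt fun l => f (a :: l) :=
  fun l₁ => hf (a :: l₁)

/-- Alternating sum of the values of `f` on the lists obtained by deleting one entry. -/
def faceSum : (List X → k) → List X → k
  | _, [] => 0
  | f, a :: l => f l - faceSum (fun l' => f (a :: l')) l

theorem faceSum_nil (f : List X → k) : faceSum f [] = 0 := by simp [faceSum]

theorem faceSum_cons (f : List X → k) (a : X) (l : List X) :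
    faceSum f (a :: l) = f l - faceSum (fun l' => f (a :: l')) l := by simp [faceSum]

theorem faceSum_congr {f g : List X → k} {l : List X}
    (h : ∀ l', l'.Sublist l → l'.length + 1 = l.length → f l' = g l') :
    faceSum f l = faceSum g l := by
  induction l generalizing f g with
  | nil => simp [faceSum_nil]
  | cons a l ih =>
    rw [faceSum_cons, faceSum_cons, h l (List.sublist_cons_self a l) rfl]
    congr 1
    exact ih fun l' hl hlen => h _ (hl.cons_cons a) (by simp [hlen])

theorem faceSum_zero (l : List X) : faceSum (fun _ => (0 : k)) l = 0 := by
  induction l with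
  | nil => simp [faceSum_nil]
  | cons a l ih => simp [faceSum_cons, ih]

theorem faceSum_ne_zero {f : List X → k} {l : List X} (h : faceSum f l ≠ 0) :
    ∃ l', l'.Sublist l ∧ l'.length + 1 = l.length ∧ f l' ≠ 0 := by
  by_contra! h'
  exact h ((faceSum_congr h').trans (faceSum_zero l))

theorem faceSum_add (f g : List X → k) (l : List X) :
    faceSum (fun x => f x + g x) l = faceSum f l + faceSum g l := by
  induction l generalizing f g with
  | nil => simp [faceSum_nil]
  | cons a l ih => rw [faceSum_cons, faceSum_cons, faceSum_cons, ih]; ring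

theorem faceSum_smul (c : k) (f : List X → k) (l : List X) :
    faceSum (fun x => c * f x) l = c * faceSum f l := by
  induction l generalizing f with
  | nil => simp [faceSum_nil]
  | cons a l ih => rw [faceSum_cons, faceSum_cons, ih]; ring

theorem faceSum_sub (f g : List X → k) (l : List X) :
    faceSum (fun x => f x - g x) l = faceSum f l - faceSum g l := by
  have := faceSum_add f (fun x => (-1) * g x) l
  rw [faceSum_smul] at this
  convert this using 2 <;> (try funext) <;> ring

theorem faceSum_faceSum (f : List X → k) (l : List X) : faceSum (faceSum f) l = 0 := by
  induction l generalizing f with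
  | nil => simp [faceSum_nil]
  | cons a l ih =>
    rw [faceSum_cons]
    simp only [faceSum_cons]
    rw [faceSum_sub, ih]
    ring

theorem IsAlt.faceSum {f : List X → k} (hf : IsAlt f) : IsAlt (faceSum f) := by
  intro l₁ a b l₂
  induction l₁ generalizing f with
  | nil =>
    simp only [List.nil_append, faceSum_cons]
    have : (fun l => f (a :: b :: l)) = fun l => (-1) * f (b :: a :: l) := by
      funext l
      rw [neg_one_mul]
      exact hf [] a b l
    rw [this, faceSum_smul]
    ring
  | cons c l₁ ih =>
    rw [List.cons_append, List.cons_append, faceSum_cons, faceSum_cons, ih (hf.cons c), hf]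
    ring

theorem faceSum_map {Y : Type} (F : X → Y) (f : List Y → k) (l : List X) :
    faceSum f (l.map F) = faceSum (fun l' => f (l'.map F)) l := by
  induction l generalizing f with
  | nil => simp [faceSum_nil]
  | cons a l ih => rw [List.map_cons, faceSum_cons, faceSum_cons, ih]; rfl

/-- Permuting a list multiplies all alternating functions by a common sign. -/
theorem exists_sign_of_perm (k : Type) [Field k] {l l' : List X} (h : l.Perm l') :
    ∃ s : k, (s = 1 ∨ s = -1) ∧ ∀ f : List X → k, IsAlt f → f l' = s * f l := by
  induction h with
  | nil => exact ⟨1, Or.inl rfl, fun f _ => by simp⟩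
  | cons a _ ih =>
    obtain ⟨s, hs, h⟩ := ih
    exact ⟨s, hs, fun f hf => h _ (hf.cons a)⟩
  | swap a b l =>
    exact ⟨-1, Or.inr rfl, fun f hf => by rw [neg_one_mul]; exact hf [] a b l⟩
  | trans _ _ ih₁ ih₂ =>
    obtain ⟨s, hs, h⟩ := ih₁
    obtain ⟨t, ht, h'⟩ := ih₂
    refine ⟨t * s, ?_, fun f hf => by rw [h' f hf, h f hf, mul_assoc]⟩
    rcases hs with rfl | rfl <;> rcases ht with rfl | rfl <;> simp

theorem IsAlt.eq_zero_of_perm {f : List X → k} (hf : IsAlt f) {l l' : List X} (h : l.Perm l')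
    (h0 : f l = 0) : f l' = 0 := by
  obtain ⟨s, -, hs⟩ := exists_sign_of_perm k h
  rw [hs f hf, h0, mul_zero]

theorem IsAlt.mul_of_perm {f : List X → k} (hf : IsAlt f) {g : List X → k}
    (hg : ∀ l l' : List X, l.Perm l' → g l = g l') : IsAlt fun l => g l * f l := by
  intro l₁ a b l₂
  simp only
  rw [hg _ _ ((List.Perm.swap b a l₂).append_left l₁), hf]
  ring

theorem IsAlt.ite {f : List X → k} (hf : IsAlt f) {p : List X → Prop}
    [DecidablePred p]
    (hp : ∀ l l' : List X, l.Perm l' → (p l ↔ p l')) : IsAlt fun l => if p l then f l else 0 := by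
  have := hf.mul_of_perm (g := fun l => if p l then 1 else 0) fun l l' h => by simp [hp l l' h]
  simpa using this

/-- A sign on lists without repetition, alternating under permutations. -/
noncomputable def listSign (k : Type) [Field k] [LinearOrder X] : List X → k
  | [] => 1
  | a :: l => (l.map fun b => if a < b then (1 : k) else -1).prod * listSign k l

theorem listSign_sq [LinearOrder X] (l : List X) : listSign k l * listSign k l = 1 := by
  induction l with
  | nil => simp [listSign]
  | cons a l ih =>
    have : ∀ l' : List X, (l'.map fun b => if a < b then (1 : k) else -1).prod *
        (l'.map fun b => if a < b then (1 : k) else -1).prod = 1 := by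
      intro l'
      induction l' with
      | nil => simp
      | cons b l' ih' =>
        rw [List.map_cons, List.prod_cons, mul_mul_mul_comm, ih']
        split_ifs <;> simp
    rw [listSign, mul_mul_mul_comm, this, ih, one_mul]

theorem listSign_swap [LinearOrder X] (l₁ : List X) {a b : X} (hab : a ≠ b) (l₂ : List X) :
    listSign k (l₁ ++ a :: b :: l₂) = -listSign k (l₁ ++ b :: a :: l₂) := by
  induction l₁ with
  | nil =>
    simp only [List.nil_append, listSign, List.map_cons, List.prod_cons]
    rcases lt_or_gt_of_ne hab with h | h
    · simp only [h, h.not_gt, if_true, if_false]; ring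
    · simp only [h, h.not_gt, if_true, if_false]; ring
  | cons c l₁ ih =>
    have h : ((l₁ ++ a :: b :: l₂).map fun x => if c < x then (1 : k) else -1).prod =
        ((l₁ ++ b :: a :: l₂).map fun x => if c < x then (1 : k) else -1).prod :=
      (((List.Perm.swap b a l₂).append_left l₁).map _).prod_eq
    rw [List.cons_append, List.cons_append, listSign, listSign, ih, h]
    ring

/-- The alternating function supported on the permutations of `x`, with value `1` at `x`. -/
noncomputable def altDelta (k : Type) [Field k] [LinearOrder X] (x l : List X) : k :=
  if x.Nodup ∧ l.Perm x then listSign k l * listSign k x else 0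

theorem isAlt_altDelta [LinearOrder X] (x : List X) : IsAlt (altDelta k x) := by
  intro l₁ a b l₂
  have hp := (List.Perm.swap b a l₂).append_left l₁
  unfold altDelta
  by_cases h : x.Nodup ∧ (l₁ ++ a :: b :: l₂).Perm x
  · have hab : a ≠ b := by
      rintro rfl
      have := h.2.nodup_iff.2 h.1
      rw [List.nodup_append] at this
      simp at this
    rw [if_pos h, if_pos ⟨h.1, hp.symm.trans h.2⟩, listSign_swap _ hab]
    ring
  · rw [if_neg h, if_neg fun h' => h ⟨h'.1, hp.trans h'.2⟩, neg_zero]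

theorem altDelta_self [LinearOrder X] {x : List X} (hx : x.Nodup) : altDelta k x x = 1 := by
  simp [altDelta, hx, listSign_sq]

theorem altDelta_ne_zero [LinearOrder X] {x l : List X} (h : altDelta k x l ≠ 0) :
    x.Nodup ∧ l.Perm x := by
  by_contra h'
  exact h (if_neg h')

variable [DecidableEq X]

theorem List.Sublist.toFinset_subset {l l' : List X} (h : l.Sublist l') :
    l.toFinset ⊆ l'.toFinset := fun x hx => by simpa using h.subset (by simpa using hx)

variable (K : Finset X → Prop)

/-- Lists enumerating a cell without repetition. -/
def IsCellList (l : List X) : Prop := l.Nodup ∧ K l.toFinset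

theorem isCellList_perm {l l' : List X} (h : l.Perm l') : IsCellList K l ↔ IsCellList K l' := by
  unfold IsCellList
  rw [h.nodup_iff, List.toFinset_eq_of_perm _ _ h]

variable (k) in
/-- Finitely supported alternating functions on enumerations of cells of cardinality `9 - n`. -/
noncomputable def altChains (n : ℕ) : Submodule k (List X → k) where
  carrier := {f | f.support.Finite ∧ (∀ l, f l ≠ 0 → IsCellList K l ∧ l.length + n = 9) ∧ IsAlt f}
  zero_mem' := ⟨by simp, by simp, fun _ _ _ _ => by simp⟩
  add_mem' := by
    rintro f g ⟨hf, hf', hf''⟩ ⟨hg, hg', hg''⟩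
    refine ⟨(hf.union hg).subset (Function.support_add f g), fun l hl => ?_,
      fun l₁ a b l₂ => ?_⟩
    · by_cases h : f l = 0
      · exact hg' l fun h' => hl (by simp [h, h'])
      · exact hf' l h
    · rw [Pi.add_apply, Pi.add_apply, hf'', hg'']; ring
  smul_mem' := by
    rintro c f ⟨hf, hf', hf''⟩
    refine ⟨hf.subset (Function.support_const_smul_subset c f), fun l hl => ?_,
      fun l₁ a b l₂ => ?_⟩
    · exact hf' l fun h => hl (by simp [h])
    · rw [Pi.smul_apply, Pi.smul_apply, hf'', smul_neg]

/-- Closure properties of the family of cells making the boundary operator well defined. -/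
structure CellFamily : Prop where
  finite_above : ∀ S, K S → {T | K T ∧ S ⊆ T}.Finite
  convex : ∀ S T U, S ⊆ T → T ⊆ U → K S → K U → K T

/-- Boundary: add one element in all possible ways. -/
noncomputable def cellBoundary (f : List X → k) (l : List X) : k :=
  if IsCellList K l then faceSum f l else 0

variable {K}

theorem finite_cellLists {𝓕 : Set (Finset X)} (h : 𝓕.Finite) :
    {l : List X | l.Nodup ∧ l.toFinset ∈ 𝓕}.Finite := by
  refine (h.biUnion fun S _ => (S.toList.permutations.toFinset).finite_toSet).subset ?_
  rintro l ⟨hl, hl'⟩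
  simp only [Set.mem_iUnion]
  refine ⟨l.toFinset, hl', ?_⟩
  simp only [List.coe_toFinset, List.mem_permutations]
  exact (List.toFinset_toList hl).symm

theorem cellBoundary_add (f g : List X → k) :
    cellBoundary K (f + g) = cellBoundary K f + cellBoundary K g := by
  funext l
  simp only [cellBoundary, Pi.add_apply]
  split_ifs
  · exact faceSum_add _ _ _
  · simp

theorem cellBoundary_smul (c : k) (f : List X → k) :
    cellBoundary K (c • f) = c • cellBoundary K f := by
  funext l
  simp only [cellBoundary, Pi.smul_apply]
  split_ifs
  · exact faceSum_smul _ _ _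
  · simp

theorem cellBoundary_sub (f g : List X → k) :
    cellBoundary K (f - g) = cellBoundary K f - cellBoundary K g := by
  funext l
  simp only [cellBoundary, Pi.sub_apply]
  split_ifs
  · exact faceSum_sub _ _ _
  · simp

theorem cellBoundary_mem (hK : CellFamily K) {n : ℕ} {f : List X → k}
    (hf : f ∈ altChains k K (n + 1)) : cellBoundary K f ∈ altChains k K n := by
  obtain ⟨h1, h2, h3⟩ := hf
  have key : ∀ l, cellBoundary K f l ≠ 0 → IsCellList K l ∧
      ∃ l', l'.Sublist l ∧ l'.length + 1 = l.length ∧ f l' ≠ 0 := by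
    intro l hl
    unfold cellBoundary at hl
    split_ifs at hl with h
    · exact ⟨h, faceSum_ne_zero hl⟩
    · exact absurd rfl hl
  refine ⟨?_, ?_, ?_⟩
  · have hfin : (⋃ l' ∈ f.support, {T | K T ∧ l'.toFinset ⊆ T}).Finite :=
      h1.biUnion fun l' hl' => hK.finite_above _ (h2 l' hl').1.2
    refine (finite_cellLists hfin).subset fun l hl => ?_
    obtain ⟨hc, l', hs, -, hne⟩ := key l hl
    refine ⟨hc.1, ?_⟩
    simp only [Set.mem_iUnion]
    exact ⟨l', hne, hc.2, hs.toFinset_subset⟩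
  · intro l hl
    obtain ⟨hc, l', -, hlen, hne⟩ := key l hl
    have := (h2 l' hne).2
    exact ⟨hc, by omega⟩
  · exact h3.faceSum.ite fun l l' h => isCellList_perm K h

/-- The boundary operator as a linear map. -/
noncomputable def cellBoundaryMap (hK : CellFamily K) (n : ℕ) :
    altChains k K (n + 1) →ₗ[k] altChains k K n where
  toFun f := ⟨cellBoundary K f.1, cellBoundary_mem hK f.2⟩
  map_add' f g := Subtype.ext (cellBoundary_add f.1 g.1)
  map_smul' c f := Subtype.ext (cellBoundary_smul c f.1)

theorem cellBoundary_cellBoundary (hK : CellFamily K) {n : ℕ} {f : List X → k}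
    (hf : f ∈ altChains k K (n + 2)) : cellBoundary K (cellBoundary K f) = 0 := by
  funext l
  unfold cellBoundary
  split_ifs with h
  · refine (faceSum_congr (g := faceSum f) fun l' hs _ => ?_).trans (faceSum_faceSum f l)
    split_ifs with h'
    · rfl
    · by_contra h0
      obtain ⟨l'', hs', -, hne⟩ := faceSum_ne_zero (Ne.symm h0)
      refine h' ⟨hs.nodup h.1, hK.convex _ _ _ hs'.toFinset_subset
        (hs.toFinset_subset) (hf.2.1 _ hne).1.2 h.2⟩
  · rfl

/-- A rank function and pivots matching the cells of cardinality at most nine. -/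
structure PivotData (K : Finset X → Prop) (rk : Finset X → ℕ) (pv : ℕ → X) : Prop where
  anti : ∀ S T, K S → K T → S ⊆ T → rk T ≤ rk S
  insert : ∀ S, K S → S.card ≤ 8 → pv (rk S) ∉ S →
    K (insert (pv (rk S)) S) ∧ rk (insert (pv (rk S)) S) = rk S
  erase : ∀ S, K S → pv (rk S) ∈ S →
    K (S.erase (pv (rk S))) ∧ rk (S.erase (pv (rk S))) = rk S

variable {rk : Finset X → ℕ} {pv : ℕ → X}

theorem PivotData.exists_reduction (hK : CellFamily K) (hp : PivotData K rk pv) {n r : ℕ}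
    {f : List X → k} (hf : f ∈ altChains k K n) (hr : ∀ l, f l ≠ 0 → rk l.toFinset ≤ r) :
    ∃ h ∈ altChains k K (n + 1), ∀ l, f l - cellBoundary K h l ≠ 0 →
      rk l.toFinset < r ∨ rk l.toFinset = r ∧ pv r ∉ l := by
  let q : List X → Prop := fun l => K l.toFinset ∧ rk l.toFinset = r ∧ pv r ∉ l
  have hq : ∀ l l' : List X, l.Perm l' → (q l ↔ q l') := fun l l' h => by
    simp only [q, List.toFinset_eq_of_perm _ _ h, h.mem_iff]
  let h : List X → k := fun l => if q l then f (pv r :: l) else 0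
  have hne : ∀ l, h l ≠ 0 → q l ∧ f (pv r :: l) ≠ 0 := by
    intro l hl
    simp only [h] at hl
    split_ifs at hl with h'
    · exact ⟨h', hl⟩
    · exact absurd rfl hl
  have hmem : h ∈ altChains k K (n + 1) := by
    refine ⟨?_, ?_, ?_⟩
    · refine (hf.1.preimage (f := fun l => pv r :: l) ?_).subset fun l hl => (hne l hl).2
      intro a _ b _ hab
      exact (List.cons.inj hab).2
    · intro l hl
      obtain ⟨h1, h2⟩ := hne l hl
      obtain ⟨⟨h3, -⟩, h4⟩ := hf.2.1 _ h2
      rw [List.length_cons] at h4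
      exact ⟨⟨h3.of_cons, h1.1⟩, by omega⟩
    · exact IsAlt.ite (p := q) (hf.2.2.cons (pv r)) hq
  refine ⟨h, hmem, fun l hl => ?_⟩
  by_contra! hcon
  obtain ⟨hle, hpv⟩ := hcon
  have hg := (Submodule.sub_mem _ hf (cellBoundary_mem hK hmem)).2
  obtain ⟨hcell, hlen⟩ := hg.1 l hl
  by_cases hlr : rk l.toFinset = r
  swap
  · have hlt : r < rk l.toFinset := lt_of_le_of_ne hle (Ne.symm hlr)
    have h0 : f l = 0 := by
      by_contra h0
      exact absurd (hr l h0) (not_le.2 hlt)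
    rw [h0, zero_sub, neg_ne_zero] at hl
    unfold cellBoundary at hl
    rw [if_pos hcell] at hl
    obtain ⟨l', hs, -, hne'⟩ := faceSum_ne_zero hl
    obtain ⟨h1, -⟩ := hne l' hne'
    have := hp.anti _ _ h1.1 hcell.2 (hs.toFinset_subset)
    omega
  have hpl := hpv hlr
  have hperm : l.Perm (pv r :: l.erase (pv r)) := List.perm_cons_erase hpl
  set l₀ := l.erase (pv r) with hl₀
  refine hl (IsAlt.eq_zero_of_perm hg.2 hperm.symm ?_)
  have hcell' := (isCellList_perm K hperm).1 hcell
  simp only [Pi.sub_apply]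
  unfold cellBoundary
  rw [if_pos hcell', faceSum_cons]
  have h1 : faceSum (fun l' => h (pv r :: l')) l₀ = 0 := by
    rw [← faceSum_zero (k := k) l₀]
    refine faceSum_congr fun l' _ _ => ?_
    by_contra h'
    exact (hne _ h').1.2.2 (by simp)
  have hpn : pv r ∉ l₀ := (List.nodup_cons.1 hcell'.1).1
  have h2 : h l₀ = f (pv r :: l₀) := by
    have he := hp.erase l.toFinset hcell.2 (by rw [hlr]; simpa using hpl)
    rw [hlr] at he
    have : l.toFinset.erase (pv r) = l₀.toFinset := by
      rw [List.toFinset_eq_of_perm _ _ hperm, List.toFinset_cons, Finset.erase_insert]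
      simpa using hpn
    rw [this] at he
    exact if_pos ⟨he.1, he.2, hpn⟩
  rw [h1, h2]
  ring

theorem PivotData.exact (hK : CellFamily K) (hp : PivotData K rk pv) {n : ℕ}
    {f : List X → k} (hf : f ∈ altChains k K (n + 1)) (hd : cellBoundary K f = 0) :
    ∃ h ∈ altChains k K (n + 2), cellBoundary K h = f := by
  suffices H : ∀ r, ∀ f ∈ altChains k K (n + 1), cellBoundary K f = 0 →
      (∀ l, f l ≠ 0 → rk l.toFinset < r) → ∃ h ∈ altChains k K (n + 2), cellBoundary K h = f by
    obtain ⟨r, hr⟩ := (hf.1.image fun l => rk l.toFinset).bddAbove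
    exact H (r + 1) f hf hd fun l hl => Nat.lt_succ_of_le (hr ⟨l, hl, rfl⟩)
  intro r
  induction r with
  | zero =>
    intro f hf _ h0
    refine ⟨0, Submodule.zero_mem _, ?_⟩
    have : f = 0 := by
      funext l
      by_contra h
      exact absurd (h0 l h) (by simp)
    rw [this]
    funext l
    unfold cellBoundary
    split_ifs
    · exact faceSum_zero l
    · rfl
  | succ r ih =>
    intro f hf hd hr
    obtain ⟨h, hh, hsupp⟩ := hp.exists_reduction hK hf fun l hl => Nat.le_of_lt_succ (hr l hl)
    have hgm := Submodule.sub_mem _ hf (cellBoundary_mem hK hh)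
    have hgd : cellBoundary K (f - cellBoundary K h) = 0 := by
      rw [cellBoundary_sub, hd, cellBoundary_cellBoundary hK hh, sub_zero]
    obtain ⟨h', hh', e⟩ := ih (f - cellBoundary K h) hgm hgd fun l hl => by
      rcases hsupp l hl with h1 | ⟨h1, h2⟩
      · exact h1
      exfalso
      obtain ⟨hcell, hlen⟩ := hgm.2.1 l hl
      have hcard : l.toFinset.card ≤ 8 := by
        rw [List.toFinset_card_of_nodup hcell.1]; omega
      have hi := hp.insert l.toFinset hcell.2 hcard (by rw [h1]; simpa using h2)
      rw [h1] at hi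
      have hc : IsCellList K (pv r :: l) := ⟨List.nodup_cons.2 ⟨h2, hcell.1⟩, by
        rw [List.toFinset_cons]; exact hi.1⟩
      have h3 := congrFun hgd (pv r :: l)
      rw [cellBoundary, if_pos hc, faceSum_cons, Pi.zero_apply, sub_eq_zero] at h3
      refine hl ?_
      refine h3.trans ?_
      by_contra hne0
      obtain ⟨l', hs, -, hne⟩ := faceSum_ne_zero hne0
      have hc' := (hgm.2.1 _ hne).1
      have := hp.anti _ _ hc'.2 hc.2
        ((hs.cons_cons (pv r)).toFinset_subset)
      rw [List.toFinset_cons (l := l), hi.2] at this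
      rcases hsupp _ hne with h4 | h4
      · omega
      · exact h4.2 (by simp)
    refine ⟨h' + h, Submodule.add_mem _ hh' hh, ?_⟩
    rw [cellBoundary_add, e]
    exact sub_add_cancel _ _

end AlternatingChains

section Representations

open CategoryTheory

namespace Rep

/-- A representation is projective as soon as it carries a linear endomorphism whose
conjugates under the group sum to the identity. -/
theorem projective_of_average {k G : Type} [Field k] [Group G] (A : Rep.{0} k G)
    (u : A →ₗ[k] A) (hfin : ∀ a, {g : G | u (A.ρ g⁻¹ a) ≠ 0}.Finite)
    (hsum : ∀ a, ∑ᶠ g : G, A.ρ g (u (A.ρ g⁻¹ a)) = a) : Projective A where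
  factors {E X} f e he := by
    have hsurj := (Rep.epi_iff_surjective e).1 he
    obtain ⟨s, hs⟩ := e.hom.toLinearMap.exists_rightInverse_of_surjective
      (LinearMap.range_eq_top.2 hsurj)
    have hs' : ∀ x, e.hom (s x) = x := fun x => LinearMap.congr_fun hs x
    let t : A →ₗ[k] E := s ∘ₗ f.hom.toLinearMap ∘ₗ u
    have ht : ∀ a, (Function.support fun g : G => E.ρ g (t (A.ρ g⁻¹ a))).Finite := by
      intro a
      refine (hfin a).subset fun g hg => ?_
      contrapose! hg
      simp only [Set.mem_ofPred_eq, not_not] at hg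
      simp [t, hg]
    have hf : ∀ a, (Function.support fun g : G => A.ρ g (u (A.ρ g⁻¹ a))).Finite := by
      intro a
      refine (hfin a).subset fun g hg => ?_
      contrapose! hg
      simp only [Set.mem_ofPred_eq, not_not] at hg
      simp [hg]
    let Ψ : A →ₗ[k] E :=
      { toFun := fun a => ∑ᶠ g : G, E.ρ g (t (A.ρ g⁻¹ a))
        map_add' := fun a b => by
          rw [← finsum_add_distrib (ht a) (ht b)]
          simp
        map_smul' := fun c a => by
          rw [RingHom.id_apply, smul_finsum' _ (ht a)]
          simp }
    have hΨ : ∀ h a, Ψ (A.ρ h a) = E.ρ h (Ψ a) := by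
      intro h a
      change ∑ᶠ g : G, E.ρ g (t (A.ρ g⁻¹ (A.ρ h a))) = E.ρ h (∑ᶠ g : G, E.ρ g (t (A.ρ g⁻¹ a)))
      have h1 := (E.ρ h).toAddMonoidHom.map_finsum (ht a)
      simp only [LinearMap.toAddMonoidHom_coe] at h1
      rw [h1, ← finsum_comp_equiv (Equiv.mulLeft h)]
      refine finsum_congr fun g => ?_
      simp [map_mul]
    refine ⟨Rep.ofHom (ρ := A.ρ) (σ := E.ρ) ⟨Ψ, fun h => LinearMap.ext fun a => hΨ h a⟩, ?_⟩
    ext a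
    change e.hom (∑ᶠ g : G, E.ρ g (t (A.ρ g⁻¹ a))) = f.hom a
    have h1 := e.hom.toLinearMap.toAddMonoidHom.map_finsum (ht a)
    have h2 := f.hom.toLinearMap.toAddMonoidHom.map_finsum (hf a)
    simp only [LinearMap.toAddMonoidHom_coe, Representation.IntertwiningMap.coe_toLinearMap] at h1 h2
    rw [h1]
    conv_rhs => rw [← hsum a, h2]
    refine finsum_congr fun g => ?_
    rw [Rep.hom_comm_apply, Rep.hom_comm_apply]
    simp [t, hs']

variable {k G : Type} [Field k] [Group G]

/-- A resolution of the trivial representation from an exact sequence of projectives. -/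
noncomputable def resolutionOfExact (D : ℕ → Rep.{0} k G) (d : ∀ n, D (n + 1) ⟶ D n)
    (ε : D 0 ⟶ trivial k G k) (hproj : ∀ n, Projective (D n))
    (dd : ∀ n, d (n + 1) ≫ d n = 0) (dε : d 0 ≫ ε = 0)
    (hε : Function.Surjective ε.hom)
    (ex0 : ∀ x, ε.hom x = 0 → ∃ y, (d 0).hom y = x)
    (ex : ∀ n x, (d n).hom x = 0 → ∃ y, (d (n + 1)).hom y = x) :
    ProjectiveResolution (trivial k G k) where
  complex := ChainComplex.of D d dd
  projective n := hproj n
  π := ((ChainComplex.of D d dd).toSingle₀Equiv _).symm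
    ⟨ε, (congrArg (· ≫ ε) (ChainComplex.of_d D d 0)).trans dε⟩
  quasiIso := by
    refine ⟨fun m => ?_⟩
    cases m with
    | zero =>
      rw [ChainComplex.quasiIsoAt₀_iff, ShortComplex.quasiIso_iff_of_zeros' _ rfl rfl rfl]
      constructor
      · apply (forget₂ _ (ModuleCat k)).reflects_exact_of_faithful
        rw [ShortComplex.moduleCat_exact_iff]
        intro x hx
        obtain ⟨y, hy⟩ := ex0 x (by
          simpa [ChainComplex.toSingle₀Equiv] using! hx)
        refine ⟨y, ?_⟩
        refine Eq.trans ?_ hy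
        exact congrArg (fun f : D 1 ⟶ D 0 => f.hom y) (ChainComplex.of_d D d 0)
      · rw [Rep.epi_iff_surjective]
        intro x
        obtain ⟨y, hy⟩ := hε x
        refine ⟨y, ?_⟩
        simpa [ChainComplex.toSingle₀Equiv] using! hy
    | succ m =>
      rw [quasiIsoAt_iff_exactAt' (hL := ChainComplex.exactAt_succ_single_obj ..),
          HomologicalComplex.exactAt_iff' _ (m + 2) (m + 1) m (by simp) (by simp)]
      apply (forget₂ _ (ModuleCat k)).reflects_exact_of_faithful
      rw [ShortComplex.moduleCat_exact_iff]
      intro x hx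
      obtain ⟨y, hy⟩ := ex m x (by
        refine Eq.trans ?_ hx
        exact congrArg (fun f : D (m + 1) ⟶ D m => f.hom x) (ChainComplex.of_d D d m).symm)
      refine ⟨y, Eq.trans ?_ hy⟩
      exact congrArg (fun f : D (m + 2) ⟶ D (m + 1) => f.hom y) (ChainComplex.of_d D d (m + 1))

theorem _root_.CategoryTheory.ShortComplex.finrank_homology_eq_one (S : ShortComplex (ModuleCat k))
    (v : S.X₂) (hv : S.g.hom v = 0) (h1 : ∀ x, S.f.hom x ≠ v)
    (h2 : ∀ w, S.g.hom w = 0 → ∃ (c : k) (x : S.X₁), w = c • v + S.f.hom x) :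
    Module.finrank k S.homology = 1 := by
  rw [S.moduleCatHomologyIso.toLinearEquiv.finrank_eq]
  change Module.finrank k (LinearMap.ker S.g.hom ⧸ LinearMap.range S.moduleCatToCycles) = 1
  rw [finrank_eq_one_iff' (K := k)]
  refine ⟨Submodule.Quotient.mk ⟨v, hv⟩, ?_, ?_⟩
  · intro h
    rw [Submodule.Quotient.mk_eq_zero] at h
    obtain ⟨x, hx⟩ := h
    exact h1 x (congrArg Subtype.val hx)
  · intro w
    obtain ⟨⟨w, hw⟩, rfl⟩ := Submodule.Quotient.mk_surjective _ w
    obtain ⟨c, x, h⟩ := h2 w hw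
    refine ⟨c, ?_⟩
    rw [← Submodule.Quotient.mk_smul, Submodule.Quotient.eq]
    refine ⟨-x, Subtype.ext ?_⟩
    change S.f.hom (-x) = c • v - w
    rw [h, map_neg]
    abel

theorem finrank_groupCohomology_eq_one (D : ℕ → Rep.{0} k G) (d : ∀ n, D (n + 1) ⟶ D n)
    (ε : D 0 ⟶ trivial k G k) (hproj : ∀ n, Projective (D n))
    (dd : ∀ n, d (n + 1) ≫ d n = 0) (dε : d 0 ≫ ε = 0)
    (hε : Function.Surjective ε.hom)
    (ex0 : ∀ x, ε.hom x = 0 → ∃ y, (d 0).hom y = x)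
    (ex : ∀ n x, (d n).hom x = 0 → ∃ y, (d (n + 1)).hom y = x)
    (n : ℕ) (φ₀ : D (n + 1) ⟶ trivial k G k) (h0 : d (n + 1) ≫ φ₀ = 0)
    (h1 : ∀ ψ, φ₀ ≠ d n ≫ ψ)
    (h2 : ∀ φ : D (n + 1) ⟶ trivial k G k, d (n + 1) ≫ φ = 0 → ∃ (c : k) (ψ : _),
      φ = c • φ₀ + d n ≫ ψ) :
    Module.finrank k (groupCohomology (trivial k G k) (n + 1)) = 1 := by
  let P := resolutionOfExact D d ε hproj dd dε hε ex0 ex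
  let K := P.complex.linearYonedaObj k (trivial k G k)
  let S := K.sc' n (n + 1) (n + 2)
  have e : groupCohomology (trivial k G k) (n + 1) ≅ S.homology :=
    groupCohomologyIso _ _ P ≪≫
      ShortComplex.homologyMapIso (K.isoSc' n (n + 1) (n + 2) (by simp) (by simp))
  rw [e.toLinearEquiv.finrank_eq]
  have hS1 : ∀ ψ : D n ⟶ trivial k G k, S.f.hom ψ = d n ≫ ψ := by
    intro ψ
    exact congrArg (fun f : D (n + 1) ⟶ D n => f ≫ ψ) (ChainComplex.of_d D d n)
  have hS2 : ∀ ψ : D (n + 1) ⟶ trivial k G k, S.g.hom ψ = d (n + 1) ≫ ψ := by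
    intro ψ
    exact congrArg (fun f : D (n + 2) ⟶ D (n + 1) => f ≫ ψ) (ChainComplex.of_d D d (n + 1))
  refine S.finrank_homology_eq_one φ₀ ((hS2 φ₀).trans h0)
    (fun ψ h => h1 ψ (h.symm.trans (hS1 ψ))) fun φ hφ => ?_
  obtain ⟨c, ψ, h⟩ := h2 φ ((hS2 φ).symm.trans hφ)
  exact ⟨c, ψ, h.trans (congrArg (c • φ₀ + ·) (hS1 ψ).symm)⟩

end Rep

section Weight

variable {k G Z : Type} [Field k] [Group G]

/-- A left action given by an unbundled function. -/
structure IsLeftAction (act : G → Z → Z) : Prop where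
  one : ∀ z, act 1 z = z
  mul : ∀ g h z, act (g * h) z = act g (act h z)

namespace IsLeftAction

variable {act : G → Z → Z}

theorem inv_act (ha : IsLeftAction act) (g : G) (z : Z) : act g⁻¹ (act g z) = z := by
  rw [← ha.mul, inv_mul_cancel, ha.one]

theorem act_inv (ha : IsLeftAction act) (g : G) (z : Z) : act g (act g⁻¹ z) = z := by
  rw [← ha.mul, mul_inv_cancel, ha.one]

theorem inv_act_eq (ha : IsLeftAction act) {g : G} {y z : Z} : act g⁻¹ z = y ↔ act g y = z :=
  ⟨fun h => by rw [← h, ha.act_inv], fun h => by rw [← h, ha.inv_act]⟩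

/-- A partition of unity on the points of an action with finite transporters. -/
theorem exists_weight [CharZero k] (ha : IsLeftAction act) : ∃ ω : Z → k, ∀ z,
    (∀ z', {g | act g z' = z}.Finite) →
      {g | ω (act g⁻¹ z) ≠ 0}.Finite ∧ ∑ᶠ g, ω (act g⁻¹ z) = 1 := by
  classical
  let r : Setoid Z :=
    { r := fun y z => ∃ g, act g y = z
      iseqv :=
        { refl := fun z => ⟨1, ha.one z⟩
          symm := fun {y z} ⟨g, hg⟩ => ⟨g⁻¹, ha.inv_act_eq.2 hg⟩
          trans := fun {x y z} ⟨g, hg⟩ ⟨h, hh⟩ => ⟨h * g, by rw [ha.mul, hg, hh]⟩ } }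
  let rep : Z → Z := fun z => (Quotient.mk r z).out
  have hrep : ∀ z, ∃ g, act g (rep z) = z := fun z =>
    Quotient.exact (Quotient.out_eq (Quotient.mk r z))
  have hrep' : ∀ g z, rep (act g z) = rep z := fun g z =>
    congrArg Quotient.out (Quotient.sound (s := r) ⟨g⁻¹, ha.inv_act g z⟩)
  let ω : Z → k := fun z => if z = rep z then ((Nat.card {g | act g z = z} : ℕ) : k)⁻¹ else 0
  refine ⟨ω, fun z hz => ?_⟩
  obtain ⟨g₀, hg₀⟩ := hrep z
  have hω : ∀ g, ω (act g⁻¹ z) =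
      if act g (rep z) = z then ((Nat.card {g | act g (rep z) = rep z} : ℕ) : k)⁻¹ else 0 := by
    intro g
    simp only [ω, hrep']
    by_cases h : act g (rep z) = z
    · rw [if_pos (ha.inv_act_eq.2 h), if_pos h, ha.inv_act_eq.2 h]
    · rw [if_neg (fun h' => h (ha.inv_act_eq.1 h')), if_neg h]
  have hfin := hz (rep z)
  refine ⟨hfin.subset fun g hg => ?_, ?_⟩
  · by_contra h
    exact hg ((hω g).trans (if_neg h))
  have hcard : Nat.card {g | act g (rep z) = rep z} = Nat.card {g | act g (rep z) = z} := by
    refine Nat.card_congr ⟨fun g => ⟨g₀ * g.1, ?_⟩, fun g => ⟨g₀⁻¹ * g.1, ?_⟩, ?_, ?_⟩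
    · change act _ _ = _
      rw [ha.mul, g.2, hg₀]
    · change act _ _ = _
      rw [ha.mul, g.2, ha.inv_act_eq, hg₀]
    · intro g; simp
    · intro g; simp
  rw [finsum_congr hω, finsum_eq_sum_of_support_subset (s := hfin.toFinset), Finset.sum_ite,
    Finset.sum_const_zero, add_zero, Finset.sum_const, nsmul_eq_mul, hcard]
  · have hne : (Nat.card {g | act g (rep z) = z} : k) ≠ 0 := by
      rw [Nat.cast_ne_zero]
      have := hfin.to_subtype
      have : Nonempty {g | act g (rep z) = z} := ⟨⟨g₀, hg₀⟩⟩
      exact Nat.card_pos.ne'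
    rw [Finset.filter_true_of_mem fun g hg => by simpa using hg, ← Nat.card_eq_card_finite_toFinset]
    exact mul_inv_cancel₀ hne
  · intro g hg
    rw [Set.Finite.coe_toFinset]
    by_contra h
    exact hg (if_neg h)

end IsLeftAction

end Weight

section FunRep

variable {k G Y : Type} [Field k] [Group G]

/-- The translation representation on an invariant space of functions. -/
def translation {act : G → Y → Y} (ha : IsLeftAction act) (A : Submodule k (Y → k))
    (hA : ∀ g, ∀ f ∈ A, (fun y => f (act g⁻¹ y)) ∈ A) : Representation k G A where
  toFun g :=
    { toFun := fun f => ⟨fun y => f.1 (act g⁻¹ y), hA g f.1 f.2⟩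
      map_add' := fun _ _ => rfl
      map_smul' := fun _ _ => rfl }
  map_one' := by
    ext f y
    change f.1 (act 1⁻¹ y) = f.1 y
    rw [inv_one, ha.one]
  map_mul' g h := by
    ext f y
    change f.1 (act (g * h)⁻¹ y) = f.1 (act h⁻¹ (act g⁻¹ y))
    rw [mul_inv_rev, ha.mul]

theorem projective_translation {act : G → Y → Y} (ha : IsLeftAction act) {A : Submodule k (Y → k)}
    (hA : ∀ g, ∀ f ∈ A, (fun y => f (act g⁻¹ y)) ∈ A) (hfin : ∀ f ∈ A, f.support.Finite)
    (ω : Y → k) (hmul : ∀ f ∈ A, (fun y => ω y * f y) ∈ A)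
    (hω : ∀ f ∈ A, ∀ y, f y ≠ 0 →
      {g | ω (act g⁻¹ y) ≠ 0}.Finite ∧ ∑ᶠ g, ω (act g⁻¹ y) = 1) :
    Projective (Rep.of (translation ha A hA)) := by
  let u : A →ₗ[k] A :=
    { toFun := fun f => ⟨fun y => ω y * f.1 y, hmul f.1 f.2⟩
      map_add' := fun f g => Subtype.ext (funext fun y => mul_add _ _ _)
      map_smul' := fun c f => Subtype.ext (funext fun y => mul_left_comm _ _ _) }
  have hval : ∀ (f : A) g y, ((translation ha A hA) g (u ((translation ha A hA) g⁻¹ f))).1 y =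
      ω (act g⁻¹ y) * f.1 y := by
    intro f g y
    change ω (act g⁻¹ y) * f.1 (act g⁻¹⁻¹ (act g⁻¹ y)) = _
    rw [inv_inv, ha.act_inv]
  have hsupp : ∀ f : A, {g | u ((translation ha A hA) g⁻¹ f) ≠ 0}.Finite := by
    intro f
    refine ((hfin f.1 f.2).biUnion fun y hy => (hω f.1 f.2 y hy).1).subset fun g hg => ?_
    have : ∃ y, (u ((translation ha A hA) g⁻¹ f)).1 y ≠ 0 := by
      by_contra! h
      exact hg (Subtype.ext (funext h))
    obtain ⟨y, hy⟩ := this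
    have h1 := left_ne_zero_of_mul hy
    have h2 : f.1 (act g⁻¹⁻¹ y) ≠ 0 := right_ne_zero_of_mul hy
    rw [inv_inv] at h2
    simp only [Set.mem_iUnion]
    refine ⟨act g y, h2, ?_⟩
    change ω (act g⁻¹ (act g y)) ≠ 0
    rwa [ha.inv_act]
  refine Rep.projective_of_average (Rep.of (translation ha A hA)) u hsupp fun f => ?_
  refine Subtype.ext (funext fun y => ?_)
  let ev : A →ₗ[k] k := (LinearMap.proj y).comp A.subtype
  have hs : (Function.support fun g : G =>
      (translation ha A hA) g (u ((translation ha A hA) g⁻¹ f))).Finite := by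
    refine (hsupp f).subset fun g hg h0 => hg ?_
    change (translation ha A hA) g _ = 0
    rw [h0, map_zero]
  change ev (∑ᶠ g : G, (translation ha A hA) g (u ((translation ha A hA) g⁻¹ f))) = f.1 y
  rw [map_finsum ev hs]
  change ∑ᶠ g, ((translation ha A hA) g (u ((translation ha A hA) g⁻¹ f))).1 y = f.1 y
  rw [finsum_congr fun g => hval f g y]
  by_cases hy : f.1 y = 0
  · simp [hy]
  · rw [← finsum_mul _ _, (hω f.1 f.2 y hy).2, one_mul]

end FunRep

end Representations

section Voronoi

open Matrix

section PerfectForms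

abbrev Mat := Matrix (Fin 4) (Fin 4) ℤ

abbrev SL4 := Matrix.SpecialLinearGroup (Fin 4) ℤ

/-- The rank one symmetric matrix `w wᵀ`. -/
def rk1 (w : Fin 4 → ℤ) : Mat := vecMulVec w w

/-- The trace pairing between quadratic forms and symmetric matrices. -/
def pair (Q x : Mat) : ℤ := (Q * x).trace

def cong (g : SL4) (x : Mat) : Mat := g.1 * x * g.1ᵀ

def coact (g : SL4) (Q : Mat) : Mat := (g⁻¹).1ᵀ * Q * (g⁻¹).1

theorem rk1_apply (w : Fin 4 → ℤ) (i j : Fin 4) : rk1 w i j = w i * w j := rfl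

theorem rk1_symm (w : Fin 4 → ℤ) : (rk1 w)ᵀ = rk1 w := by
  ext i j; simp [rk1_apply, mul_comm]

theorem pair_rk1 (Q : Mat) (w : Fin 4 → ℤ) : pair Q (rk1 w) = w ⬝ᵥ Q *ᵥ w := by
  simp [pair, rk1, mul_vecMulVec, trace_vecMulVec, dotProduct_comm]

theorem pair_add (Q x y : Mat) : pair Q (x + y) = pair Q x + pair Q y := by
  simp [pair, mul_add]

theorem pair_sub_left (Q Q' x : Mat) : pair (Q - Q') x = pair Q x - pair Q' x := by
  simp [pair, sub_mul]

theorem pair_smul (Q : Mat) (c : ℤ) (x : Mat) : pair Q (c • x) = c * pair Q x := by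
  rw [pair, Matrix.mul_smul, trace_smul, smul_eq_mul]; rfl

theorem pair_sum {ι : Type*} (Q : Mat) (s : Finset ι) (f : ι → Mat) :
    pair Q (∑ i ∈ s, f i) = ∑ i ∈ s, pair Q (f i) := by
  simp [pair, Finset.mul_sum, trace_sum]

theorem SL4.val_mul (g h : SL4) : (g * h).1 = g.1 * h.1 := rfl

theorem SL4.val_mul_inv (g : SL4) : g.1 * (g⁻¹).1 = 1 := by
  rw [← SL4.val_mul, mul_inv_cancel]; rfl

theorem cong_one (x : Mat) : cong 1 x = x := by simp [cong]

theorem cong_mul (g h : SL4) (x : Mat) : cong (g * h) x = cong g (cong h x) := by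
  simp [cong, transpose_mul, Matrix.mul_assoc]

theorem coact_one (x : Mat) : coact 1 x = x := by simp [coact]

theorem coact_mul (g h : SL4) (x : Mat) : coact (g * h) x = coact g (coact h x) := by
  simp only [coact, _root_.mul_inv_rev, SL4.val_mul, transpose_mul, Matrix.mul_assoc]

theorem cong_inv_cong (g : SL4) (x : Mat) : cong g⁻¹ (cong g x) = x := by
  rw [← cong_mul, inv_mul_cancel, cong_one]

theorem cong_cong_inv (g : SL4) (x : Mat) : cong g (cong g⁻¹ x) = x := by
  rw [← cong_mul, mul_inv_cancel, cong_one]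

theorem coact_inv_coact (g : SL4) (x : Mat) : coact g⁻¹ (coact g x) = x := by
  rw [← coact_mul, inv_mul_cancel, coact_one]

theorem coact_coact_inv (g : SL4) (x : Mat) : coact g (coact g⁻¹ x) = x := by
  rw [← coact_mul, mul_inv_cancel, coact_one]

theorem cong_injective (g : SL4) : Function.Injective (cong g) :=
  Function.LeftInverse.injective (cong_inv_cong g)

theorem coact_injective (g : SL4) : Function.Injective (coact g) :=
  Function.LeftInverse.injective (coact_inv_coact g)

theorem cong_rk1 (g : SL4) (w : Fin 4 → ℤ) : cong g (rk1 w) = rk1 (g.1 *ᵥ w) := by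
  rw [cong, rk1, rk1, mul_vecMulVec, vecMulVec_mul, vecMul_transpose]

theorem cong_sum {ι : Type*} (g : SL4) (s : Finset ι) (f : ι → Mat) :
    cong g (∑ i ∈ s, f i) = ∑ i ∈ s, cong g (f i) := by
  simp [cong, Finset.mul_sum, Finset.sum_mul]

theorem cong_add (g : SL4) (x y : Mat) : cong g (x + y) = cong g x + cong g y := by
  simp [cong, mul_add, add_mul]

theorem cong_smul (g : SL4) (c : ℤ) (x : Mat) : cong g (c • x) = c • cong g x := by
  rw [cong, Matrix.mul_smul, Matrix.smul_mul]; rfl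

theorem cong_transpose (g : SL4) (x : Mat) : (cong g x)ᵀ = cong g xᵀ := by
  simp [cong, transpose_mul, Matrix.mul_assoc]

theorem coact_transpose (g : SL4) (x : Mat) : (coact g x)ᵀ = coact g xᵀ := by
  simp [coact, transpose_mul, Matrix.mul_assoc]

theorem det_cong (g : SL4) (x : Mat) : (cong g x).det = x.det := by
  simp [cong, det_mul]

theorem pair_coact (g : SL4) (Q x : Mat) : pair (coact g Q) x = pair Q (cong g⁻¹ x) := by
  unfold pair coact cong
  rw [Matrix.mul_assoc, Matrix.mul_assoc, Matrix.trace_mul_comm]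
  simp only [Matrix.mul_assoc]

theorem pair_coact_cong (g : SL4) (Q x : Mat) : pair (coact g Q) (cong g x) = pair Q x := by
  rw [pair_coact, cong_inv_cong]

/-- The form `A₄`. -/
def formA : Mat := !![2, 1, 1, 1; 1, 2, 1, 1; 1, 1, 2, 1; 1, 1, 1, 2]

/-- The form `D₄`. -/
def formD : Mat := !![2, -1, 0, 0; -1, 2, -1, -1; 0, -1, 2, 0; 0, -1, 0, 2]

/-- Perfect forms with minimum `2`. -/
def Perf : Set Mat := {Q | ∃ g, Q = coact g formA ∨ Q = coact g formD}

def MinSet (Q : Mat) : Set Mat := {x | ∃ w, x = rk1 w ∧ pair Q x = 2}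

theorem coact_mem_Perf {Q : Mat} (g : SL4) (h : Q ∈ Perf) : coact g Q ∈ Perf := by
  obtain ⟨h, rfl | rfl⟩ := h
  · exact ⟨g * h, Or.inl (coact_mul _ _ _).symm⟩
  · exact ⟨g * h, Or.inr (coact_mul _ _ _).symm⟩

theorem cong_mem_MinSet {Q x : Mat} (g : SL4) (h : x ∈ MinSet Q) :
    cong g x ∈ MinSet (coact g Q) := by
  obtain ⟨w, rfl, h⟩ := h
  exact ⟨_, cong_rk1 g w, by rw [pair_coact_cong, h]⟩

theorem cong_mem_MinSet_iff {Q x : Mat} (g : SL4) :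
    cong g x ∈ MinSet (coact g Q) ↔ x ∈ MinSet Q := by
  refine ⟨fun h => ?_, cong_mem_MinSet g⟩
  have := cong_mem_MinSet g⁻¹ h
  rwa [cong_inv_cong, coact_inv_coact] at this

theorem mem_MinSet_coact {Q x : Mat} (g : SL4) :
    x ∈ MinSet (coact g Q) ↔ cong g⁻¹ x ∈ MinSet Q := by
  rw [← cong_mem_MinSet_iff g (x := cong g⁻¹ x), cong_cong_inv]

/-- No four elements span a sublattice of index two. -/
def Unimod (S : Finset Mat) : Prop := ∀ T ⊆ S, T.card = 4 → (∑ x ∈ T, x).det ≠ 4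

/-- The vectors of `S` span. -/
def Spanning (S : Finset Mat) : Prop := ∀ v : Fin 4 → ℤ, (∀ x ∈ S, v ⬝ᵥ x *ᵥ v = 0) → v = 0

theorem image_cong_image (g : SL4) (S : Finset Mat) : (S.image (cong g)).image (cong g⁻¹) = S := by
  rw [Finset.image_image, show cong g⁻¹ ∘ cong g = id from funext (cong_inv_cong g),
    Finset.image_id]

theorem image_cong_image' (g : SL4) (S : Finset Mat) : (S.image (cong g⁻¹)).image (cong g) = S := by
  have := image_cong_image g⁻¹ S
  rwa [inv_inv] at this

theorem Unimod.image {S : Finset Mat} (h : Unimod S) (g : SL4) : Unimod (S.image (cong g)) := by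
  intro T hT hc
  have hT' : T.image (cong g⁻¹) ⊆ S := by
    rw [← image_cong_image g S]; exact Finset.image_subset_image hT
  have := h _ hT' (by rw [Finset.card_image_of_injective _ (cong_injective _), hc])
  rwa [Finset.sum_image fun _ _ _ _ h => cong_injective _ h, ← cong_sum, det_cong] at this

theorem Spanning.image {S : Finset Mat} (h : Spanning S) (g : SL4) :
    Spanning (S.image (cong g)) := by
  intro v hv
  have h1 : g.1ᵀ *ᵥ v = 0 := h _ fun x hx => by
    have := hv _ (Finset.mem_image_of_mem _ hx)
    rw [cong, ← mulVec_mulVec, ← mulVec_mulVec, dotProduct_mulVec, ← mulVec_transpose] at this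
    exact this
  have h2 : (g⁻¹).1ᵀ *ᵥ (g.1ᵀ *ᵥ v) = v := by
    rw [mulVec_mulVec, ← transpose_mul, SL4.val_mul_inv]
    simp
  rw [← h2, h1, mulVec_zero]

theorem Spanning.mono {S T : Finset Mat} (h : Spanning S) (hST : S ⊆ T) : Spanning T :=
  fun v hv => h v fun x hx => hv x (hST hx)

theorem Unimod.mono {S T : Finset Mat} (h : Unimod T) (hST : S ⊆ T) : Unimod S :=
  fun U hU => h U (hU.trans hST)

/-- The local structure of the perfect cone complex at a perfect form: the minimal vectors fall
into `n` blocks with equal sum, and facets arise by dropping one vector from each block. -/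
structure Loc (Q : Mat) (n : ℕ) (B : ℕ → Finset Mat) : Prop where
  perf : Q ∈ Perf
  symm : Qᵀ = Q
  two_le : ∀ w, w ≠ 0 → 2 ≤ pair Q (rk1 w)
  pos : 0 < n
  le_three : n ≤ 3
  mem_iff : ∀ x, x ∈ MinSet Q ↔ ∃ a < n, x ∈ B a
  disj : ∀ a < n, ∀ b < n, ∀ x, x ∈ B a → x ∈ B b → a = b
  card : ∑ a ∈ Finset.range n, (B a).card = 9 + n
  block : ∃ s, ∀ a < n, ∑ x ∈ B a, x = s
  span : ∀ x : Mat, xᵀ = x → x ∈ Submodule.span ℤ (MinSet Q)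
  facet : ∀ σ : ℕ → Mat, (∀ a < n, σ a ∈ B a) →
    ∃ Q' ∈ Perf, Q' ≠ Q ∧ ∀ a < n, ∀ x ∈ B a, x ≠ σ a → x ∈ MinSet Q'
  unimod : ∀ S : Finset Mat, ↑S ⊆ MinSet Q → S.card ≤ 9 →
    (Unimod S ↔ ∀ a < n, ∃ x ∈ B a, x ∉ S)

theorem Loc.coact {Q : Mat} {n : ℕ} {B : ℕ → Finset Mat} (h : Loc Q n B) (g : SL4) :
    Loc (coact g Q) n fun a => (B a).image (cong g) where
  perf := coact_mem_Perf g h.perf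
  symm := by rw [coact_transpose, h.symm]
  two_le w hw := by
    rw [pair_coact, cong_rk1]
    refine h.two_le _ fun h0 => hw ?_
    have : g.1 *ᵥ (g⁻¹).1 *ᵥ w = w := by
      rw [mulVec_mulVec, SL4.val_mul_inv]; simp
    rw [← this, h0, mulVec_zero]
  pos := h.pos
  le_three := h.le_three
  mem_iff x := by
    rw [mem_MinSet_coact, h.mem_iff]
    refine exists_congr fun a => and_congr_right fun _ => ?_
    rw [Finset.mem_image]
    exact ⟨fun hx => ⟨_, hx, cong_cong_inv g x⟩, by rintro ⟨y, hy, rfl⟩; rwa [cong_inv_cong]⟩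
  disj a ha b hb x hxa hxb := by
    obtain ⟨y, hy, rfl⟩ := Finset.mem_image.1 hxa
    obtain ⟨z, hz, hzy⟩ := Finset.mem_image.1 hxb
    rw [cong_injective g hzy] at hz
    exact h.disj a ha b hb y hy hz
  card := by
    rw [← h.card]
    exact Finset.sum_congr rfl fun a _ => Finset.card_image_of_injective _ (cong_injective g)
  block := by
    obtain ⟨s, hs⟩ := h.block
    refine ⟨cong g s, fun a ha => ?_⟩
    rw [Finset.sum_image fun _ _ _ _ h => cong_injective _ h, ← cong_sum, hs a ha]
  span x hx := by
    have h1 := h.span (cong g⁻¹ x) (by rw [cong_transpose, hx])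
    let L : Mat →ₗ[ℤ] Mat := { toFun := cong g, map_add' := cong_add g, map_smul' := cong_smul g }
    have h2 := Submodule.mem_map_of_mem (f := L) h1
    rw [Submodule.map_span] at h2
    have e : L (cong g⁻¹ x) = x := cong_cong_inv g x
    rw [e] at h2
    refine Submodule.span_mono ?_ h2
    rintro _ ⟨y, hy, rfl⟩
    exact cong_mem_MinSet g hy
  facet σ hσ := by
    obtain ⟨Q', h1, h2, h3⟩ := h.facet (fun a => cong g⁻¹ (σ a)) fun a ha => by
      obtain ⟨y, hy, e⟩ := Finset.mem_image.1 (hσ a ha)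
      rwa [← e, cong_inv_cong]
    refine ⟨_, coact_mem_Perf g h1, fun e => h2 (coact_injective g e), fun a ha x hx hne => ?_⟩
    obtain ⟨y, hy, rfl⟩ := Finset.mem_image.1 hx
    refine cong_mem_MinSet g (h3 a ha y hy fun e => hne ?_)
    rw [e, cong_cong_inv]
  unimod S hS hc := by
    have h1 : Unimod S ↔ Unimod (S.image (cong g⁻¹)) :=
      ⟨fun h => h.image _, fun h => by
        have := h.image g
        rwa [image_cong_image'] at this⟩
    rw [h1, h.unimod]
    · refine forall₂_congr fun a _ => ⟨?_, ?_⟩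
      · rintro ⟨x, hx, hx'⟩
        refine ⟨_, Finset.mem_image_of_mem _ hx, fun h => hx' ?_⟩
        rw [← cong_inv_cong g x]
        exact Finset.mem_image_of_mem _ h
      · rintro ⟨x, hx, hx'⟩
        obtain ⟨y, hy, rfl⟩ := Finset.mem_image.1 hx
        refine ⟨y, hy, fun h => hx' ?_⟩
        obtain ⟨z, hz, rfl⟩ := Finset.mem_image.1 h
        rwa [cong_cong_inv]
    · intro x hx
      obtain ⟨y, hy, rfl⟩ := Finset.mem_image.1 (Finset.mem_coe.1 hx)
      exact (mem_MinSet_coact g).1 (hS hy)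
    · rwa [Finset.card_image_of_injective _ (cong_injective _)]

end PerfectForms

section BaseForms

def facetCertA : List ℕ :=
  [221252047031, 221496578906, 190978922531, 221545407031, 374084469531, 343322735131,
   349436047656, 221545485156, 374084860156, 190978985151]

def facetCertD : List ℕ :=
  [508381783431, 259116585955, 234702211555, 234741663955, 204272852180, 411057705306,
   234741664680, 204223711555, 356811211555, 235180273555, 532835033531, 204272851555,
   235180274055, 234936211555, 259116586555, 380491142681, 356860804580, 386311157931,
   204429086055, 411704163955, 411058017806, 204516914180, 411704164680, 204711836055,
   357250586055, 357006523555, 356860804680, 258225204681, 357006524055, 235180586055,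
   533030658531, 204516914055, 407065052180, 376352473555, 533118548451, 528891614055,
   351928724055, 376635364680, 376304098555, 380491673451, 380491282826, 351977551555,
   529135817180, 407348254680, 376391536555, 380442767201, 406870114680, 230151301555,
   533823304580, 357104866580, 356821742180, 355549360931, 356811602180, 235229414180,
   532835424156, 204516992180, 356860742180, 258225282806, 533823304680, 356811601555,
   380491533306, 235034492180, 357104867180, 235229414055]

def minVecA : List (Fin 4 → ℤ) :=
  [![0, 0, 0, 1], ![0, 0, 1, -1], ![0, 0, 1, 0], ![0, 1, -1, 0], ![0, 1, 0, -1], ![0, 1, 0, 0],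
   ![1, -1, 0, 0], ![1, 0, -1, 0], ![1, 0, 0, -1], ![1, 0, 0, 0]]

def minVecD₀ : List (Fin 4 → ℤ) := [![0, 0, 0, 1], ![0, 0, 1, 0], ![1, 0, 0, 0], ![1, 2, 1, 1]]

def minVecD₁ : List (Fin 4 → ℤ) := [![0, 1, 0, 0], ![0, 1, 1, 1], ![1, 1, 0, 1], ![1, 1, 1, 0]]

def minVecD₂ : List (Fin 4 → ℤ) := [![0, 1, 0, 1], ![0, 1, 1, 0], ![1, 1, 0, 0], ![1, 1, 1, 1]]

/-- Values of the two base quadratic forms. -/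
def qform : ℤ → (Fin 4 → ℤ) → ℤ
  | 0, w => w 0 * w 0 + w 1 * w 1 + w 2 * w 2 + w 3 * w 3 +
      (w 0 + w 1 + w 2 + w 3) * (w 0 + w 1 + w 2 + w 3)
  | _, w => 2 * (w 0 * w 0 + w 1 * w 1 + w 2 * w 2 + w 3 * w 3 - w 1 * (w 0 + w 2 + w 3))

def baseForm : ℤ → Mat
  | 0 => formA
  | _ => formD

theorem pair_baseForm (t : ℤ) (w : Fin 4 → ℤ) : pair (baseForm t) (rk1 w) = qform t w := by
  rw [pair_rk1]
  unfold baseForm qform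
  split <;>
  simp [formA, formD, dotProduct, mulVec, Fin.sum_univ_four] <;> ring

theorem qform_bound (t : ℤ) (w : Fin 4 → ℤ) (h : qform t w ≤ 2) (i : Fin 4) :
    w i ∈ Finset.Icc (-2 : ℤ) 2 := by
  have key : ∀ a b c d e : ℤ, a * a + b * b + c * c + d * d ≤ 2 →
      (-1 ≤ a ∧ a ≤ 1) ∧ (-1 ≤ b ∧ b ≤ 1) ∧ (-1 ≤ c ∧ c ≤ 1) ∧ (-1 ≤ d ∧ d ≤ 1) := by
    intro a b c d _ h
    refine ⟨⟨?_, ?_⟩, ⟨?_, ?_⟩, ⟨?_, ?_⟩, ⟨?_, ?_⟩⟩ <;> nlinarith [mul_self_nonneg a,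
      mul_self_nonneg b, mul_self_nonneg c, mul_self_nonneg d]
  rw [Finset.mem_Icc]
  unfold qform at h
  split at h
  · have := key (w 0) (w 1) (w 2) (w 3) 0 (by
      nlinarith [mul_self_nonneg (w 0 + w 1 + w 2 + w 3)])
    fin_cases i <;> simp <;> omega
  · have := key (w 0) (w 1 - w 0) (w 2 + w 3 - w 1) (w 3 - w 2) 0 (by nlinarith)
    fin_cases i <;> simp <;> omega

theorem fin4_eta (w : Fin 4 → ℤ) : w = ![w 0, w 1, w 2, w 3] := by
  ext i; fin_cases i <;> rfl

theorem qform_ge (t : ℤ) (ht : t = 0 ∨ t = 1) (w : Fin 4 → ℤ) (hw : w ≠ 0) : 2 ≤ qform t w := by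
  by_contra! h
  have hb := qform_bound t w h.le
  have key : ∀ t ∈ ([0, 1] : List ℤ), ∀ a ∈ Finset.Icc (-2 : ℤ) 2, ∀ b ∈ Finset.Icc (-2 : ℤ) 2,
      ∀ c ∈ Finset.Icc (-2 : ℤ) 2, ∀ d ∈ Finset.Icc (-2 : ℤ) 2,
      qform t ![a, b, c, d] < 2 → a = 0 ∧ b = 0 ∧ c = 0 ∧ d = 0 := by decide +kernel
  rw [fin4_eta w] at h
  have := key t (by simpa using ht) _ (hb 0) _ (hb 1) _ (hb 2) _ (hb 3) h
  refine hw ?_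
  rw [fin4_eta w, this.1, this.2.1, this.2.2.1, this.2.2.2]
  ext i; fin_cases i <;> rfl

def minVec : ℤ → List (Fin 4 → ℤ)
  | 0 => minVecA
  | _ => minVecD₀ ++ (minVecD₁ ++ minVecD₂)

theorem qform_eq_two (t : ℤ) (ht : t = 0 ∨ t = 1) (w : Fin 4 → ℤ) (h : qform t w = 2) :
    w ∈ minVec t ∨ -w ∈ minVec t := by
  have hb := qform_bound t w h.le
  have key : ∀ t ∈ ([0, 1] : List ℤ), ∀ a ∈ Finset.Icc (-2 : ℤ) 2, ∀ b ∈ Finset.Icc (-2 : ℤ) 2,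
      ∀ c ∈ Finset.Icc (-2 : ℤ) 2, ∀ d ∈ Finset.Icc (-2 : ℤ) 2,
      qform t ![a, b, c, d] = 2 → ![a, b, c, d] ∈ minVec t ∨ -![a, b, c, d] ∈ minVec t := by
    decide +kernel
  rw [fin4_eta w] at h ⊢
  exact key t (by simpa using ht) _ (hb 0) _ (hb 1) _ (hb 2) _ (hb 3) h

theorem rk1_neg (w : Fin 4 → ℤ) : rk1 (-w) = rk1 w := by
  ext i j; simp [rk1_apply]

theorem mem_MinSet_baseForm (t : ℤ) (ht : t = 0 ∨ t = 1) (x : Mat) :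
    x ∈ MinSet (baseForm t) ↔ ∃ w ∈ minVec t, x = rk1 w := by
  constructor
  · rintro ⟨w, rfl, h⟩
    rw [pair_baseForm] at h
    rcases qform_eq_two t ht w h with h | h
    · exact ⟨w, h, rfl⟩
    · exact ⟨-w, h, (rk1_neg w).symm⟩
  · rintro ⟨w, h, rfl⟩
    refine ⟨w, rfl, ?_⟩
    rw [pair_baseForm]
    have key : ∀ t ∈ ([0, 1] : List ℤ), ∀ w ∈ minVec t, qform t w = 2 := by decide +kernel
    exact key t (by simpa using ht) w h

/-- The determinant of the matrix with the given rows. -/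
def detRows (a b c d : Fin 4 → ℤ) : ℤ :=
  (a 0 * b 1 - a 1 * b 0) * (c 2 * d 3 - c 3 * d 2) -
  (a 0 * b 2 - a 2 * b 0) * (c 1 * d 3 - c 3 * d 1) +
  (a 0 * b 3 - a 3 * b 0) * (c 1 * d 2 - c 2 * d 1) +
  (a 1 * b 2 - a 2 * b 1) * (c 0 * d 3 - c 3 * d 0) -
  (a 1 * b 3 - a 3 * b 1) * (c 0 * d 2 - c 2 * d 0) +
  (a 2 * b 3 - a 3 * b 2) * (c 0 * d 1 - c 1 * d 0)

theorem det_of_rows (a b c d : Fin 4 → ℤ) : (of ![a, b, c, d] : Mat).det = detRows a b c d := by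
  rw [det_succ_row_zero]
  simp [Fin.sum_univ_succ, det_fin_three, detRows, submatrix, Fin.succAbove]
  ring

theorem det_sum_rk1 (a b c d : Fin 4 → ℤ) :
    (rk1 a + (rk1 b + (rk1 c + rk1 d))).det = detRows a b c d ^ 2 := by
  rw [← det_of_rows, pow_two]
  nth_rewrite 1 [← det_transpose (of ![a, b, c, d])]
  rw [← det_mul]
  congr 1
  ext i j
  rw [mul_apply, Fin.sum_univ_four]
  simp only [Matrix.add_apply, rk1_apply, transpose_apply, of_apply]
  simp only [cons_val]
  ring

def detList : List (Fin 4 → ℤ) → ℤ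
  | [a, b, c, d] => detRows a b c d
  | _ => 0

theorem rk1_injOn (t : ℤ) (ht : t = 0 ∨ t = 1) : ∀ w ∈ minVec t, ∀ w' ∈ minVec t,
    rk1 w = rk1 w' → w = w' := by
  have key : ∀ t ∈ ([0, 1] : List ℤ), ∀ w ∈ minVec t, ∀ w' ∈ minVec t,
    rk1 w = rk1 w' → w = w' := by decide +kernel
  exact key t (by simpa using ht)

theorem minVec_nodup (t : ℤ) (ht : t = 0 ∨ t = 1) : (minVec t).Nodup := by
  have key : ∀ t ∈ ([0, 1] : List ℤ), (minVec t).Nodup := by decide +kernel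
  exact key t (by simpa using ht)

theorem exists_sublist {α β : Type*} [DecidableEq β] (f : α → β) {L : List α} (hL : L.Nodup)
    (hf : ∀ w ∈ L, ∀ w' ∈ L, f w = f w' → w = w') (T : Finset β)
    (hT : ∀ x ∈ T, ∃ w ∈ L, x = f w) :
    ∃ l : List α, l.Sublist L ∧ T = (l.map f).toFinset ∧ l.length = T.card ∧ (l.map f).Nodup := by
  have hs : (L.filter (f · ∈ T)).Sublist L := List.filter_sublist
  have e : T = ((L.filter (f · ∈ T)).map f).toFinset := by
    ext x
    simp only [List.mem_toFinset, List.mem_map, List.mem_filter, decide_eq_true_eq]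
    constructor
    · intro hx
      obtain ⟨w, hw, rfl⟩ := hT x hx
      exact ⟨w, ⟨hw, hx⟩, rfl⟩
    · rintro ⟨w, ⟨_, h⟩, rfl⟩
      exact h
  have hn : ((L.filter (f · ∈ T)).map f).Nodup :=
    (hs.nodup hL).map_on fun x hx y hy h => hf x (hs.subset hx) y (hs.subset hy) h
  refine ⟨_, hs, e, ?_, hn⟩
  conv_rhs => rw [e]
  rw [List.toFinset_card_of_nodup hn, List.length_map]

theorem unimod_baseForm (t : ℤ) (ht : t = 0 ∨ t = 1) (S : Finset Mat)
    (hS : ↑S ⊆ MinSet (baseForm t)) : Unimod S ↔ ∀ l ∈ (minVec t).sublistsLen 4,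
      (∀ w ∈ l, rk1 w ∈ S) → detList l ^ 2 ≠ 4 := by
  have hsum : ∀ l : List (Fin 4 → ℤ), l.length = 4 → (l.map rk1).Nodup →
      (∑ x ∈ (l.map rk1).toFinset, x).det = detList l ^ 2 := by
    intro l hl hn
    rw [List.sum_toFinset _ hn]
    match l, hl with
    | [a, b, c, d], _ => simpa [detList] using det_sum_rk1 a b c d
  constructor
  · intro h l hl hlS
    rw [List.mem_sublistsLen] at hl
    have hn : (l.map rk1).Nodup := (hl.1.nodup (minVec_nodup t ht)).map_on
      fun x hx y hy h => rk1_injOn t ht x (hl.1.subset hx) y (hl.1.subset hy) h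
    rw [← hsum l hl.2 hn]
    refine h _ (fun x hx => ?_) ?_
    · simp only [List.mem_toFinset, List.mem_map] at hx
      obtain ⟨w, hw, rfl⟩ := hx
      exact hlS w hw
    · rw [List.toFinset_card_of_nodup hn, List.length_map, hl.2]
  · intro h T hT hc
    obtain ⟨l, h1, h2, h3, h4⟩ := exists_sublist rk1 (minVec_nodup t ht) (rk1_injOn t ht) T
      fun x hx => (mem_MinSet_baseForm t ht x).1 (hS (hT hx))
    rw [h2, hsum l (h3.trans hc) h4]
    refine h l (List.mem_sublistsLen.2 ⟨h1, h3.trans hc⟩) fun w hw => hT ?_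
    rw [h2, List.mem_toFinset]
    exact List.mem_map_of_mem hw

/-- Unpacks a matrix with entries in `{-2, …, 2}` from its base 5 digits. -/
def certMat (l : ℕ) : Mat := of fun i j => ((l / 5 ^ (4 * i.1 + j.1 + 1) % 5 : ℕ) : ℤ) - 2

def certType (l : ℕ) : ℤ := ((l % 5 : ℕ) : ℤ)

def certOK (T : List (Fin 4 → ℤ)) (w₀ : List (Fin 4 → ℤ)) (l : ℕ) : Bool :=
  let g := certMat l
  decide (certType l = 0 ∨ certType l = 1) &&
  decide (detRows (g 0) (g 1) (g 2) (g 3) = 1) &&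
  T.all (fun w => w ∈ w₀ || decide (qform (certType l) (g *ᵥ w) = 2)) &&
  T.any (fun w => decide (qform (certType l) (g *ᵥ w) ≠ 2))

theorem facet_of_certOK {t : ℤ} {w₀ : List (Fin 4 → ℤ)} {l : ℕ}
    (ht : t = 0 ∨ t = 1) (h : certOK (minVec t) w₀ l = true) :
    ∃ Q' ∈ Perf, Q' ≠ baseForm t ∧ ∀ w ∈ minVec t, w ∉ w₀ → rk1 w ∈ MinSet Q' := by
  simp only [certOK, Bool.and_eq_true, decide_eq_true_eq, List.all_eq_true, List.any_eq_true,
    Bool.or_eq_true] at h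
  obtain ⟨⟨⟨h0, h1⟩, h2⟩, h3⟩ := h
  rw [← det_of_rows] at h1
  set g := certMat l
  have hg : g.det = 1 := by
    rw [← h1]; congr 1; ext i j; fin_cases i <;> rfl
  let g' : SL4 := ⟨g, hg⟩
  have hp : ∀ w, pair (coact g'⁻¹ (baseForm (certType l))) (rk1 w) =
      qform (certType l) (g *ᵥ w) := by
    intro w
    rw [pair_coact, inv_inv, cong_rk1, pair_baseForm]
  refine ⟨coact g'⁻¹ (baseForm (certType l)), ⟨g'⁻¹, ?_⟩, ?_, ?_⟩
  · rcases h0 with h0 | h0 <;> rw [h0]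
    · exact Or.inl rfl
    · exact Or.inr rfl
  · intro e
    obtain ⟨w, hw, hw'⟩ := h3
    refine hw' ?_
    rw [← hp, e, pair_baseForm]
    have key : ∀ t ∈ ([0, 1] : List ℤ), ∀ w ∈ minVec t, qform t w = 2 := by decide +kernel
    exact key t (by simpa using ht) w hw
  · intro w hw hw'
    refine ⟨w, rfl, ?_⟩
    rw [hp]
    exact (h2 w hw).resolve_left hw'

theorem facetCertA_ok : ∀ i : Fin 10,
    certOK (minVec 0) [minVecA.getD i.1 0] (facetCertA.getD i.1 0) = true := by decide +kernel

theorem facetCertD_ok : ∀ i j k : Fin 4,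
    certOK (minVec 1) [minVecD₀.getD i.1 0, minVecD₁.getD j.1 0, minVecD₂.getD k.1 0]
      (facetCertD.getD (16 * i.1 + 4 * j.1 + k.1) 0) = true := by decide +kernel

def blockA : ℕ → Finset Mat
  | 0 => (minVecA.map rk1).toFinset
  | _ => ∅

def blockD : ℕ → Finset Mat
  | 0 => (minVecD₀.map rk1).toFinset
  | 1 => (minVecD₁.map rk1).toFinset
  | 2 => (minVecD₂.map rk1).toFinset
  | _ => ∅

theorem mem_map_toFinset {L : List (Fin 4 → ℤ)} {x : Mat} :
    x ∈ (L.map rk1).toFinset ↔ ∃ w ∈ L, x = rk1 w := by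
  simp [eq_comm]

theorem loc_formA : Loc formA 1 blockA where
  perf := ⟨1, Or.inl (coact_one _).symm⟩
  symm := by decide +kernel
  two_le w hw := by
    have := qform_ge 0 (Or.inl rfl) w hw
    rwa [← pair_baseForm] at this
  pos := by norm_num
  le_three := by norm_num
  mem_iff x := by
    refine (mem_MinSet_baseForm 0 (Or.inl rfl) x).trans ?_
    simp only [Nat.lt_one_iff, exists_eq_left]
    exact mem_map_toFinset.symm
  disj a ha b hb _ _ _ := by omega
  card := by decide +kernel
  block := ⟨_, fun a ha => by rw [Nat.lt_one_iff.1 ha]⟩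
  span x hx := by
    have hm : ∀ w ∈ minVec 0, rk1 w ∈ Submodule.span ℤ (MinSet formA) := fun w hw =>
      Submodule.subset_span ((mem_MinSet_baseForm 0 (Or.inl rfl) _).2 ⟨w, hw, rfl⟩)
    have e : x = (x 0 0 + x 0 1 + x 0 2 + x 0 3) • rk1 ![1, 0, 0, 0] +
        (x 1 1 + x 0 1 + x 1 2 + x 1 3) • rk1 ![0, 1, 0, 0] +
        (x 2 2 + x 0 2 + x 1 2 + x 2 3) • rk1 ![0, 0, 1, 0] +
        (x 3 3 + x 0 3 + x 1 3 + x 2 3) • rk1 ![0, 0, 0, 1] +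
        (-x 0 1) • rk1 ![1, -1, 0, 0] + (-x 0 2) • rk1 ![1, 0, -1, 0] +
        (-x 0 3) • rk1 ![1, 0, 0, -1] + (-x 1 2) • rk1 ![0, 1, -1, 0] +
        (-x 1 3) • rk1 ![0, 1, 0, -1] + (-x 2 3) • rk1 ![0, 0, 1, -1] := by
      have hs : ∀ i j, x i j = x j i := fun i j => congrFun (congrFun hx.symm i) j
      have := hs 1 0; have := hs 2 0; have := hs 3 0; have := hs 2 1
      have := hs 3 1; have := hs 3 2
      ext i j
      simp only [Matrix.add_apply, Matrix.smul_apply, smul_eq_mul, rk1_apply]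
      fin_cases i <;> fin_cases j <;> simp <;> linarith
    rw [e]
    refine add_mem (add_mem (add_mem (add_mem (add_mem (add_mem (add_mem (add_mem (add_mem
      ?_ ?_) ?_) ?_) ?_) ?_) ?_) ?_) ?_) ?_ <;>
    exact Submodule.smul_mem _ _ (hm _ (by decide +kernel))
  facet σ hσ := by
    obtain ⟨w, hw, e⟩ := mem_map_toFinset.1 (hσ 0 Nat.one_pos)
    obtain ⟨i, hi, rfl⟩ := List.getElem_of_mem hw
    obtain ⟨Q', h1, h2, h3⟩ := facet_of_certOK (Or.inl rfl) (facetCertA_ok ⟨i, hi⟩)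
    refine ⟨Q', h1, h2, fun a ha x hx hne => ?_⟩
    rw [Nat.lt_one_iff.1 ha] at hx hne
    obtain ⟨w', hw', rfl⟩ := mem_map_toFinset.1 hx
    refine h3 w' hw' fun h => hne ?_
    rw [List.mem_singleton] at h
    rw [h, e, List.getD_eq_getElem _ _ hi]
  unimod S hS hc := by
    rw [unimod_baseForm 0 (Or.inl rfl) S hS]
    have key : ∀ l ∈ (minVec 0).sublistsLen 4, detList l ^ 2 ≠ 4 := by decide +kernel
    refine iff_of_true (fun l hl _ => key l hl) fun a ha => ?_
    rw [Nat.lt_one_iff.1 ha]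
    have h10 : (blockA 0).card = 10 := by decide +kernel
    exact Finset.exists_mem_notMem_of_card_lt_card (by omega)

theorem loc_formD : Loc formD 3 blockD where
  perf := ⟨1, Or.inr (coact_one _).symm⟩
  symm := by decide +kernel
  two_le w hw := by
    have := qform_ge 1 (Or.inr rfl) w hw
    rwa [← pair_baseForm] at this
  pos := by norm_num
  le_three := by norm_num
  mem_iff x := by
    refine (mem_MinSet_baseForm 1 (Or.inr rfl) x).trans ?_
    simp only [minVec, List.mem_append]
    constructor
    · rintro ⟨w, h | h | h, rfl⟩
      · exact ⟨0, by norm_num, mem_map_toFinset.2 ⟨w, h, rfl⟩⟩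
      · exact ⟨1, by norm_num, mem_map_toFinset.2 ⟨w, h, rfl⟩⟩
      · exact ⟨2, by norm_num, mem_map_toFinset.2 ⟨w, h, rfl⟩⟩
    · rintro ⟨a, ha, h⟩
      interval_cases a <;> obtain ⟨w, h', rfl⟩ := mem_map_toFinset.1 h
      · exact ⟨w, Or.inl h', rfl⟩
      · exact ⟨w, Or.inr (Or.inl h'), rfl⟩
      · exact ⟨w, Or.inr (Or.inr h'), rfl⟩
  disj a ha b hb x hxa hxb := by
    have key : ∀ a < 3, ∀ b < 3, ∀ x ∈ blockD a, x ∈ blockD b → a = b := by decide +kernel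
    exact key a ha b hb x hxa hxb
  card := by decide +kernel
  block := ⟨∑ x ∈ blockD 0, x, by decide +kernel⟩
  span x hx := by
    have hm : ∀ w ∈ minVec 1, rk1 w ∈ Submodule.span ℤ (MinSet formD) := fun w hw =>
      Submodule.subset_span ((mem_MinSet_baseForm 1 (Or.inr rfl) _).2 ⟨w, hw, rfl⟩)
    have e : x = (-x 1 2 + x 1 3 + x 2 2 - x 3 3) • rk1 ![0, 0, 1, 0] +
        (x 0 0 - x 0 1 + x 1 3 - x 3 3) • rk1 ![1, 0, 0, 0] +
        (x 1 3 - x 3 3) • rk1 ![1, 2, 1, 1] +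
        (x 0 1 - x 0 2 - x 0 3 - x 1 1 + x 1 2 + x 1 3) • rk1 ![0, 1, 1, 1] +
        (x 0 1 - x 0 2 - x 1 1 + x 1 2 + x 1 3 - x 2 3) • rk1 ![1, 1, 0, 1] +
        (x 0 1 - x 0 3 - x 1 1 + x 1 2 + x 1 3 - x 2 3) • rk1 ![1, 1, 1, 0] +
        (-x 0 1 + x 0 2 + x 1 1 - x 1 2 - x 1 3 + x 3 3) • rk1 ![0, 1, 0, 1] +
        (-x 0 1 + x 0 3 + x 1 1 - 2 * x 1 3 + x 3 3) • rk1 ![0, 1, 1, 0] +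
        (x 1 1 - x 1 2 - 2 * x 1 3 + x 2 3 + x 3 3) • rk1 ![1, 1, 0, 0] +
        (-x 0 1 + x 0 2 + x 0 3 + x 1 1 - x 1 2 - 2 * x 1 3 + x 2 3 + x 3 3) •
          rk1 ![1, 1, 1, 1] := by
      have hs : ∀ i j, x i j = x j i := fun i j => congrFun (congrFun hx.symm i) j
      have := hs 1 0; have := hs 2 0; have := hs 3 0; have := hs 2 1
      have := hs 3 1; have := hs 3 2
      ext i j
      simp only [Matrix.add_apply, Matrix.smul_apply, smul_eq_mul, rk1_apply]
      fin_cases i <;> fin_cases j <;> simp <;> linarith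
    rw [e]
    refine add_mem (add_mem (add_mem (add_mem (add_mem (add_mem (add_mem (add_mem (add_mem
      ?_ ?_) ?_) ?_) ?_) ?_) ?_) ?_) ?_) ?_ <;>
    exact Submodule.smul_mem _ _ (hm _ (by decide +kernel))
  facet σ hσ := by
    obtain ⟨w₀, hw₀, e₀⟩ := mem_map_toFinset.1 (hσ 0 (by norm_num))
    obtain ⟨i, hi, rfl⟩ := List.getElem_of_mem hw₀
    obtain ⟨w₁, hw₁, e₁⟩ := mem_map_toFinset.1 (hσ 1 (by norm_num))
    obtain ⟨j, hj, rfl⟩ := List.getElem_of_mem hw₁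
    obtain ⟨w₂, hw₂, e₂⟩ := mem_map_toFinset.1 (hσ 2 (by norm_num))
    obtain ⟨k, hk, rfl⟩ := List.getElem_of_mem hw₂
    obtain ⟨Q', h1, h2, h3⟩ := facet_of_certOK (Or.inr rfl) (facetCertD_ok ⟨i, hi⟩ ⟨j, hj⟩ ⟨k, hk⟩)
    simp only [List.getD_eq_getElem _ _ hi, List.getD_eq_getElem _ _ hj,
      List.getD_eq_getElem _ _ hk, List.mem_cons, List.not_mem_nil, or_false, not_or] at h3
    have d01 : ∀ w ∈ minVecD₀, ∀ w' ∈ minVecD₁, w ≠ w' := by decide +kernel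
    have d02 : ∀ w ∈ minVecD₀, ∀ w' ∈ minVecD₂, w ≠ w' := by decide +kernel
    have d12 : ∀ w ∈ minVecD₁, ∀ w' ∈ minVecD₂, w ≠ w' := by decide +kernel
    refine ⟨Q', h1, h2, fun a ha x hx hne => ?_⟩
    interval_cases a <;> obtain ⟨w', hw', rfl⟩ := mem_map_toFinset.1 hx
    · exact h3 w' (by simp [minVec, hw'])
        ⟨fun h => hne (by rw [h, e₀]), d01 _ hw' _ hw₁, d02 _ hw' _ hw₂⟩
    · exact h3 w' (by simp [minVec, hw'])
        ⟨(d01 _ hw₀ _ hw').symm, fun h => hne (by rw [h, e₁]), d12 _ hw' _ hw₂⟩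
    · exact h3 w' (by simp [minVec, hw'])
        ⟨(d02 _ hw₀ _ hw').symm, (d12 _ hw₁ _ hw').symm, fun h => hne (by rw [h, e₂])⟩
  unimod S hS hc := by
    rw [unimod_baseForm 1 (Or.inr rfl) S hS]
    have key : ∀ l ∈ (minVec 1).sublistsLen 4, detList l ^ 2 ≠ 4 ∨
        l = minVecD₀ ∨ l = minVecD₁ ∨ l = minVecD₂ := by decide +kernel
    constructor
    · intro h a ha
      by_contra! hcon
      interval_cases a
      · exact h minVecD₀ (by decide +kernel)
          (fun w hw => hcon _ (mem_map_toFinset.2 ⟨w, hw, rfl⟩)) (by decide +kernel)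
      · exact h minVecD₁ (by decide +kernel)
          (fun w hw => hcon _ (mem_map_toFinset.2 ⟨w, hw, rfl⟩)) (by decide +kernel)
      · exact h minVecD₂ (by decide +kernel)
          (fun w hw => hcon _ (mem_map_toFinset.2 ⟨w, hw, rfl⟩)) (by decide +kernel)
    · intro h l hl hlS
      rcases key l hl with h' | rfl | rfl | rfl
      · exact h'
      · obtain ⟨x, hx, hx'⟩ := h 0 (by norm_num)
        obtain ⟨w, hw, rfl⟩ := mem_map_toFinset.1 hx
        exact absurd (hlS w hw) hx'
      · obtain ⟨x, hx, hx'⟩ := h 1 (by norm_num)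
        obtain ⟨w, hw, rfl⟩ := mem_map_toFinset.1 hx
        exact absurd (hlS w hw) hx'
      · obtain ⟨x, hx, hx'⟩ := h 2 (by norm_num)
        obtain ⟨w, hw, rfl⟩ := mem_map_toFinset.1 hx
        exact absurd (hlS w hw) hx'

theorem exists_loc {Q : Mat} (hQ : Q ∈ Perf) : ∃ n B, Loc Q n B := by
  obtain ⟨g, rfl | rfl⟩ := hQ
  · exact ⟨_, _, loc_formA.coact g⟩
  · exact ⟨_, _, loc_formD.coact g⟩

end BaseForms

section Finiteness

theorem dotProduct_rk1_mulVec (v w : Fin 4 → ℤ) : v ⬝ᵥ rk1 w *ᵥ v = (v ⬝ᵥ w) ^ 2 := by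
  rw [rk1, vecMulVec_mulVec, op_smul_eq_smul, dotProduct_smul, smul_eq_mul,
    dotProduct_comm w v, pow_two]

theorem eq_zero_of_mulVec_eq_zero {W : Finset (Fin 4 → ℤ)}
    (hW : ∀ v, (∀ w ∈ W, v ⬝ᵥ w = 0) → v = 0) {M : Mat} (hM : ∀ w ∈ W, M *ᵥ w = 0) : M = 0 := by
  ext i j
  exact congrFun (hW (M i) fun w hw => congrFun (hM w hw) i) j

theorem finite_forms {W : Finset (Fin 4 → ℤ)} (hW : ∀ v, (∀ w ∈ W, v ⬝ᵥ w = 0) → v = 0) (C : ℤ) :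
    {Q : Mat | Qᵀ = Q ∧ (∀ v, 0 ≤ pair Q (rk1 v)) ∧ ∀ w ∈ W, pair Q (rk1 w) ≤ C}.Finite := by
  have hfin : {f : W → W → ℤ | ∀ w w', f w w' ∈ Set.Icc (-C) C}.Finite := by
    have := Set.Finite.pi' (fun _ : W => Set.Finite.pi' fun _ : W => Set.finite_Icc (-C) C)
    exact this
  refine Set.Finite.of_injOn (f := fun Q (w w' : W) => w.1 ⬝ᵥ Q *ᵥ w'.1) ?_ ?_ hfin
  · rintro Q ⟨h1, h2, h3⟩ w w'
    have hs : w'.1 ⬝ᵥ Q *ᵥ w.1 = w.1 ⬝ᵥ Q *ᵥ w'.1 := by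
      rw [dotProduct_mulVec, ← mulVec_transpose, h1, dotProduct_comm]
    have hw := h3 _ w.2
    have hw' := h3 _ w'.2
    have hp := h2 (w.1 + w'.1)
    have hm := h2 (w.1 - w'.1)
    rw [pair_rk1] at hw hw' hp hm
    rw [mulVec_add, add_dotProduct, dotProduct_add, dotProduct_add, hs] at hp
    rw [mulVec_sub, sub_dotProduct, dotProduct_sub, dotProduct_sub, hs] at hm
    exact ⟨by linarith, by linarith⟩
  · rintro Q - Q' - h
    have h' : ∀ w ∈ W, ∀ w' ∈ W, w ⬝ᵥ Q *ᵥ w' = w ⬝ᵥ Q' *ᵥ w' := fun w hw w' hw' =>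
      congrFun (congrFun h ⟨w, hw⟩) ⟨w', hw'⟩
    rw [← sub_eq_zero]
    refine eq_zero_of_mulVec_eq_zero hW fun w' hw' => hW _ fun w hw => ?_
    rw [dotProduct_comm, sub_mulVec, dotProduct_sub, h' w hw w' hw', sub_self]

theorem exists_vectors {S : Finset Mat} (hS : Spanning S) (h1 : ∀ x ∈ S, ∃ w, x = rk1 w) :
    ∃ W : Finset (Fin 4 → ℤ), (∀ w ∈ W, rk1 w ∈ S) ∧
      ∀ v, (∀ w ∈ W, v ⬝ᵥ w = 0) → v = 0 := by
  classical
  choose! f hf using h1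
  refine ⟨S.image f, fun w hw => ?_, fun v hv => hS v fun x hx => ?_⟩
  · obtain ⟨x, hx, rfl⟩ := Finset.mem_image.1 hw
    rwa [← hf x hx]
  · rw [hf x hx, dotProduct_rk1_mulVec, hv _ (Finset.mem_image_of_mem f hx)]
    rfl

theorem pair_rk1_nonneg {Q : Mat} (hQ : Q ∈ Perf) (v : Fin 4 → ℤ) : 0 ≤ pair Q (rk1 v) := by
  obtain ⟨n, B, h⟩ := exists_loc hQ
  by_cases hv : v = 0
  · rw [hv, pair_rk1]; simp
  · exact (h.two_le v hv).trans' (by norm_num)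

theorem transpose_of_mem_Perf {Q : Mat} (hQ : Q ∈ Perf) : Qᵀ = Q := by
  obtain ⟨n, B, h⟩ := exists_loc hQ
  exact h.symm

theorem finite_perf_above {S : Finset Mat} (hS : Spanning S) :
    {Q | Q ∈ Perf ∧ ↑S ⊆ MinSet Q}.Finite := by
  by_cases h1 : ∀ x ∈ S, ∃ w, x = rk1 w
  · obtain ⟨W, hWS, hW⟩ := exists_vectors hS h1
    refine (finite_forms hW 2).subset fun Q hQ => ⟨transpose_of_mem_Perf hQ.1, pair_rk1_nonneg hQ.1, ?_⟩
    intro w hw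
    obtain ⟨-, -, h⟩ := hQ.2 (hWS w hw)
    exact h.le
  · refine Set.Finite.subset Set.finite_empty fun Q hQ => h1 fun x hx => ?_
    obtain ⟨w, h, -⟩ := hQ.2 hx
    exact ⟨w, h⟩

theorem finite_rk1_fiber (t : Mat) : {v : Fin 4 → ℤ | rk1 v = t}.Finite := by
  refine (Set.Finite.pi' fun i : Fin 4 => Set.finite_Icc (-|t i i|) |t i i|).subset ?_
  rintro v rfl i
  rw [rk1_apply, abs_mul_self, Set.mem_Icc]
  constructor <;> rcases lt_trichotomy (v i) 0 with h | h | h <;> nlinarith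

theorem finite_cong {S T : Finset Mat} (hS : Spanning S) (h1 : ∀ x ∈ S, ∃ w, x = rk1 w) :
    {g : SL4 | ∀ x ∈ S, cong g x ∈ T}.Finite := by
  obtain ⟨W, hWS, hW⟩ := exists_vectors hS h1
  have hfin : (⋃ t ∈ T, {v : Fin 4 → ℤ | rk1 v = t}).Finite :=
    T.finite_toSet.biUnion fun t _ => finite_rk1_fiber t
  refine Set.Finite.of_injOn (f := fun (g : SL4) (w : W) => g.1 *ᵥ w.1)
    (t := {f | ∀ w, f w ∈ ⋃ t ∈ T, {v : Fin 4 → ℤ | rk1 v = t}}) ?_ ?_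
    (Set.Finite.pi' fun _ => hfin)
  · intro g hg w
    have := hg _ (hWS _ w.2)
    rw [cong_rk1] at this
    simp only [Set.mem_iUnion]
    exact ⟨_, this, rfl⟩
  · intro g _ g' _ h
    refine Subtype.ext (sub_eq_zero.1 (eq_zero_of_mulVec_eq_zero hW fun w hw => ?_))
    rw [sub_mulVec, sub_eq_zero]
    exact congrFun h ⟨w, hw⟩

/-- The finite set of minimal vectors. -/
noncomputable def minF (Q : Mat) : Finset Mat := by
  classical exact if h : (MinSet Q).Finite then h.toFinset else ∅

theorem Loc.coe_biUnion {Q : Mat} {n : ℕ} {B : ℕ → Finset Mat} (h : Loc Q n B) :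
    ((Finset.range n).biUnion B : Set Mat) = MinSet Q := by
  ext x
  simp [h.mem_iff]

theorem mem_minF {Q : Mat} (hQ : Q ∈ Perf) (x : Mat) : x ∈ minF Q ↔ x ∈ MinSet Q := by
  obtain ⟨n, B, h⟩ := exists_loc hQ
  have : (MinSet Q).Finite := by
    rw [← h.coe_biUnion]; exact Finset.finite_toSet _
  rw [minF, dif_pos this, Set.Finite.mem_toFinset]

theorem coe_minF {Q : Mat} (hQ : Q ∈ Perf) : (minF Q : Set Mat) = MinSet Q :=
  Set.ext fun x => mem_minF hQ x

theorem Loc.minF_eq {Q : Mat} {n : ℕ} {B : ℕ → Finset Mat} (h : Loc Q n B) :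
    minF Q = (Finset.range n).biUnion B := by
  rw [← Finset.coe_inj, coe_minF h.perf, h.coe_biUnion]

theorem spanning_minF {Q : Mat} (hQ : Q ∈ Perf) : Spanning (minF Q) := by
  obtain ⟨n, B, h⟩ := exists_loc hQ
  intro v hv
  have h1 : ∀ y ∈ Submodule.span ℤ (MinSet Q), v ⬝ᵥ y *ᵥ v = 0 := by
    intro y this
    induction this using Submodule.span_induction with
    | mem x hx => exact hv x ((mem_minF hQ x).2 hx)
    | zero => simp
    | add x y _ _ hx hy => rw [add_mulVec, dotProduct_add, hx, hy, add_zero]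
    | smul a x _ hx => rw [smul_mulVec, dotProduct_smul, hx, smul_zero]
  have h1 := h1 _ (h.span (rk1 v) (rk1_symm v))
  rw [dotProduct_rk1_mulVec] at h1
  exact dotProduct_self_eq_zero.1 (pow_eq_zero_iff (two_ne_zero) |>.1 h1)

theorem minF_coact {Q : Mat} (hQ : Q ∈ Perf) (g : SL4) :
    minF (coact g Q) = (minF Q).image (cong g) := by
  ext x
  rw [mem_minF (coact_mem_Perf g hQ), mem_MinSet_coact, ← mem_minF hQ, Finset.mem_image]
  exact ⟨fun h => ⟨_, h, cong_cong_inv g x⟩, by rintro ⟨y, hy, rfl⟩; rwa [cong_inv_cong]⟩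

theorem exists_rk1_of_mem_minF {Q : Mat} (hQ : Q ∈ Perf) : ∀ x ∈ minF Q, ∃ w, x = rk1 w :=
  fun x hx => by
    obtain ⟨w, h, -⟩ := (mem_minF hQ x).1 hx
    exact ⟨w, h⟩

theorem finite_coact {Q : Mat} (hQ : Q ∈ Perf) (Q' : Mat) : {g : SL4 | coact g Q = Q'}.Finite := by
  refine (finite_cong (T := minF Q') (spanning_minF hQ) (exists_rk1_of_mem_minF hQ)).subset ?_
  rintro g rfl x hx
  rw [minF_coact hQ]
  exact Finset.mem_image_of_mem _ hx

end Finiteness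

section Height

theorem exists_transcendental : ∃ x : ℝ, 1 < x ∧ Transcendental ℤ x := by
  by_contra! h
  have : (Set.Ioi (1 : ℝ)) ⊆ {x : ℝ | IsAlgebraic ℤ x} := fun x hx => by
    have := h x hx
    rwa [Transcendental, not_not] at this
  have hc := Cardinal.le_aleph0_iff_set_countable.2 ((Algebraic.countable ℤ ℝ).mono this)
  rw [Cardinal.mk_Ioi_real] at hc
  exact absurd hc Cardinal.aleph0_lt_continuum.not_ge

noncomputable def htBase : ℝ := exists_transcendental.choose

theorem one_lt_htBase : 1 < htBase := exists_transcendental.choose_spec.1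

theorem transcendental_htBase : Transcendental ℤ htBase := exists_transcendental.choose_spec.2

def htVec (k : ℕ) : Fin 4 → ℤ :=
  [![1, 0, 0, 0], ![0, 1, 0, 0], ![0, 0, 1, 0], ![0, 0, 0, 1], ![1, 1, 0, 0], ![1, 0, 1, 0],
    ![1, 0, 0, 1], ![0, 1, 1, 0], ![0, 1, 0, 1], ![0, 0, 1, 1]].getD k 0

/-- A generic linear functional on quadratic forms, positive on positive definite forms. -/
noncomputable def ht (Q : Mat) : ℝ := ∑ k ∈ Finset.range 10, htBase ^ k * pair Q (rk1 (htVec k))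

theorem eq_zero_of_ht {Q : Mat} (hQ : Qᵀ = Q) (h : ht Q = 0) : Q = 0 := by
  let p : Polynomial ℤ :=
    ∑ k ∈ Finset.range 10, Polynomial.C (pair Q (rk1 (htVec k))) * Polynomial.X ^ k
  have hp : p = 0 := by
    by_contra hp
    refine transcendental_htBase ⟨p, hp, ?_⟩
    rw [← h]
    simp [p, ht, mul_comm]
  have hc : ∀ k < 10, pair Q (rk1 (htVec k)) = 0 := by
    intro k hk
    have : p.coeff k = 0 := by rw [hp]; simp
    simp only [p, Polynomial.finsetSum_coeff, Polynomial.coeff_C_mul_X_pow] at this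
    rw [Finset.sum_eq_single k] at this
    · simpa using this
    · intro b _ hb
      rw [if_neg hb.symm]
    · simp [hk]
  have hs : ∀ i j, Q i j = Q j i := fun i j => congrFun (congrFun hQ.symm i) j
  have h0 := hc 0 (by norm_num)
  have h1 := hc 1 (by norm_num)
  have h2 := hc 2 (by norm_num)
  have h3 := hc 3 (by norm_num)
  have h4 := hc 4 (by norm_num)
  have h5 := hc 5 (by norm_num)
  have h6 := hc 6 (by norm_num)
  have h7 := hc 7 (by norm_num)
  have h8 := hc 8 (by norm_num)
  have h9 := hc 9 (by norm_num)
  have := hs 1 0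
  have := hs 2 0
  have := hs 3 0
  have := hs 2 1
  have := hs 3 1
  have := hs 3 2
  simp [pair_rk1, htVec, dotProduct, mulVec, Fin.sum_univ_four] at h0 h1 h2 h3 h4 h5 h6 h7 h8 h9
  ext i j
  fin_cases i <;> fin_cases j <;> simp <;> omega

theorem ht_sub (Q Q' : Mat) : ht (Q - Q') = ht Q - ht Q' := by
  rw [ht, ht, ht, ← Finset.sum_sub_distrib]
  refine Finset.sum_congr rfl fun k _ => ?_
  rw [pair_sub_left]; push_cast; ring

theorem ht_injOn : Set.InjOn ht Perf := by
  intro Q hQ Q' hQ' h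
  rw [← sub_eq_zero]
  refine eq_zero_of_ht ?_ (by rw [ht_sub, h, sub_self])
  rw [transpose_sub, transpose_of_mem_Perf hQ, transpose_of_mem_Perf hQ']

theorem le_ht {Q : Mat} (hQ : ∀ v, 0 ≤ pair Q (rk1 v)) {k : ℕ} (hk : k < 10) :
    (pair Q (rk1 (htVec k)) : ℝ) ≤ ht Q := by
  have h0 : ∀ k, (0 : ℝ) ≤ pair Q (rk1 (htVec k)) := fun k => by exact_mod_cast hQ _
  have hx : ∀ k, (1 : ℝ) ≤ htBase ^ k := fun k => one_le_pow₀ one_lt_htBase.le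
  calc (pair Q (rk1 (htVec k)) : ℝ) ≤ htBase ^ k * pair Q (rk1 (htVec k)) :=
        le_mul_of_one_le_left (h0 k) (hx k)
    _ ≤ ht Q := Finset.single_le_sum (f := fun k => htBase ^ k * (pair Q (rk1 (htVec k)) : ℝ))
        (fun i _ => mul_nonneg (zero_le_one.trans (hx i)) (h0 i)) (Finset.mem_range.2 hk)

theorem htVec_spanning (v : Fin 4 → ℤ)
    (hv : ∀ w ∈ (Finset.range 10).image htVec, v ⬝ᵥ w = 0) : v = 0 := by
  have h : ∀ k < 10, v ⬝ᵥ htVec k = 0 := fun k hk =>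
    hv _ (Finset.mem_image_of_mem _ (Finset.mem_range.2 hk))
  have h0 := h 0 (by norm_num)
  have h1 := h 1 (by norm_num)
  have h2 := h 2 (by norm_num)
  have h3 := h 3 (by norm_num)
  simp [htVec, dotProduct, Fin.sum_univ_four] at h0 h1 h2 h3
  ext i
  fin_cases i <;> simp [*]

theorem finite_perf_ht_le (C : ℝ) : {Q | Q ∈ Perf ∧ ht Q ≤ C}.Finite := by
  refine (finite_forms htVec_spanning ⌊C⌋).subset fun Q hQ => ⟨transpose_of_mem_Perf hQ.1, pair_rk1_nonneg hQ.1, ?_⟩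
  intro w hw
  obtain ⟨k, hk, rfl⟩ := Finset.mem_image.1 hw
  exact Int.le_floor.2 ((le_ht (pair_rk1_nonneg hQ.1) (Finset.mem_range.1 hk)).trans hQ.2)

theorem ht_rk1_pos {v : Fin 4 → ℤ} (hv : v ≠ 0) : 0 < ht (rk1 v) := by
  have hp : ∀ w, pair (rk1 v) (rk1 w) = (w ⬝ᵥ v) ^ 2 := fun w => by
    rw [pair_rk1, dotProduct_rk1_mulVec]
  by_contra! h
  refine hv (htVec_spanning v fun w hw => ?_)
  obtain ⟨k, hk, rfl⟩ := Finset.mem_image.1 hw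
  have h1 := (le_ht (Q := rk1 v) (fun w => by rw [hp]; positivity) (Finset.mem_range.1 hk)).trans h
  rw [hp] at h1
  have h2 : (htVec k ⬝ᵥ v) ^ 2 ≤ 0 := by exact_mod_cast h1
  rw [dotProduct_comm]
  exact pow_eq_zero_iff (two_ne_zero) |>.1 (le_antisymm h2 (sq_nonneg _))

end Height

section Cells

/-- The cells: sets of minimal vectors of perfect forms which span and are unimodular. -/
def IsCell (S : Finset Mat) : Prop :=
  S.card ≤ 9 ∧ (∃ Q ∈ Perf, ↑S ⊆ MinSet Q) ∧ Spanning S ∧ Unimod S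

theorem cellFamily_isCell : CellFamily IsCell where
  finite_above S hS := by
    refine ((finite_perf_above hS.2.2.1).biUnion fun Q _ =>
      (minF Q).powerset.finite_toSet).subset ?_
    rintro T ⟨⟨-, ⟨Q, hQ, hTQ⟩, -⟩, hST⟩
    simp only [Set.mem_iUnion]
    refine ⟨Q, ⟨hQ, (Finset.coe_subset.2 hST).trans hTQ⟩, ?_⟩
    rw [Finset.mem_coe, Finset.mem_powerset, ← Finset.coe_subset, coe_minF hQ]
    exact hTQ
  convex S T U hST hTU hS hU := by
    obtain ⟨Q, hQ, hUQ⟩ := hU.2.1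
    exact ⟨(Finset.card_le_card hTU).trans hU.1,
      ⟨Q, hQ, (Finset.coe_subset.2 hTU).trans hUQ⟩, hS.2.2.1.mono hST, hU.2.2.2.mono hTU⟩

theorem IsCell.image {S : Finset Mat} (h : IsCell S) (g : SL4) : IsCell (S.image (cong g)) := by
  obtain ⟨h1, ⟨Q, hQ, hSQ⟩, h2, h3⟩ := h
  refine ⟨Finset.card_image_le.trans h1, ⟨coact g Q, coact_mem_Perf g hQ, fun x hx => ?_⟩,
    h2.image g, h3.image g⟩
  obtain ⟨y, hy, rfl⟩ := Finset.mem_image.1 (Finset.mem_coe.1 hx)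
  exact cong_mem_MinSet g (hSQ hy)

theorem isCell_image_iff {S : Finset Mat} (g : SL4) : IsCell (S.image (cong g)) ↔ IsCell S :=
  ⟨fun h => by
    have := h.image g⁻¹
    rwa [image_cong_image] at this, fun h => h.image g⟩

/-- `Q` is the form of largest height among those having `S` as minimal vectors. -/
def IsTopForm (S : Finset Mat) (Q : Mat) : Prop :=
  Q ∈ Perf ∧ ↑S ⊆ MinSet Q ∧ ∀ Q' ∈ Perf, ↑S ⊆ MinSet Q' → ht Q' ≤ ht Q

theorem IsTopForm.unique {S : Finset Mat} {Q Q' : Mat} (h : IsTopForm S Q) (h' : IsTopForm S Q') : Q = Q' :=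
  ht_injOn h.1 h'.1 (le_antisymm (h'.2.2 Q h.1 h.2.1) (h.2.2 Q' h'.1 h'.2.1))

theorem IsCell.exists_isTop {S : Finset Mat} (h : IsCell S) : ∃ Q, IsTopForm S Q := by
  obtain ⟨Q, hQ, h'⟩ := Set.exists_max_image _ ht (finite_perf_above h.2.2.1) h.2.1
  exact ⟨Q, hQ.1, hQ.2, fun Q' h1 h2 => h' Q' ⟨h1, h2⟩⟩

structure LocData where
  n : ℕ
  B : ℕ → Finset Mat
  c : Mat → ℝ
  m : ℕ → Mat

/-- A local structure together with an expression of the height in terms of the minimal vectors,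
and in each block an element of smallest coefficient. -/
structure WLoc (Q : Mat) (D : LocData) : Prop extends Loc Q D.n D.B where
  ht_eq : ∀ R, ht R = ∑ a ∈ Finset.range D.n, ∑ y ∈ D.B a, D.c y * pair R y
  m_mem : ∀ a < D.n, D.m a ∈ D.B a
  m_le : ∀ a < D.n, ∀ y ∈ D.B a, D.c (D.m a) ≤ D.c y

theorem Loc.disjoint {Q : Mat} {n : ℕ} {B : ℕ → Finset Mat} (h : Loc Q n B) :
    (↑(Finset.range n) : Set ℕ).PairwiseDisjoint B := by
  intro a ha b hb hab
  simp only [Finset.coe_range, Set.mem_Iio] at ha hb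
  exact Finset.disjoint_left.2 fun x hx hx' => hab (h.disj a ha b hb x hx hx')

theorem Loc.two_mul_card {Q s : Mat} {n : ℕ} {B : ℕ → Finset Mat} (h : Loc Q n B)
    (hs : ∀ a < n, ∑ x ∈ B a, x = s) {a : ℕ} (ha : a < n) : pair Q s = 2 * (B a).card := by
  rw [← hs a ha, pair_sum, Finset.sum_congr rfl (g := fun _ => (2 : ℤ)), Finset.sum_const,
    nsmul_eq_mul, mul_comm]
  intro x hx
  obtain ⟨w, -, h2⟩ := (h.mem_iff x).2 ⟨a, ha, hx⟩
  exact h2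

theorem Loc.nonempty {Q : Mat} {n : ℕ} {B : ℕ → Finset Mat} (h : Loc Q n B) :
    ∀ a < n, (B a).Nonempty := by
  intro a ha
  by_contra hn
  obtain ⟨s, hs⟩ := h.block
  have h0 := h.two_mul_card hs ha
  have hz : ∀ b < n, (B b).card = 0 := fun b hb => by
    have := h.two_mul_card hs hb
    rw [Finset.not_nonempty_iff_eq_empty.1 hn, Finset.card_empty] at h0
    omega
  have := h.card
  rw [Finset.sum_eq_zero fun b hb => hz b (Finset.mem_range.1 hb)] at this
  omega

theorem exists_wLoc {Q : Mat} (hQ : Q ∈ Perf) : ∃ D, WLoc Q D := by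
  obtain ⟨n, B, h⟩ := exists_loc hQ
  have h1 : ∀ k, ∃ f : Mat → ℤ, ∑ y ∈ (Finset.range n).biUnion B, f y • y = rk1 (htVec k) := by
    intro k
    have := h.span _ (rk1_symm (htVec k))
    rw [← h.coe_biUnion, Submodule.mem_span_finset] at this
    obtain ⟨f, -, hf⟩ := this
    exact ⟨f, hf⟩
  choose f hf using h1
  let c : Mat → ℝ := fun y => ∑ k ∈ Finset.range 10, htBase ^ k * f k y
  have h2 : ∀ a, ∃ m, a < n → m ∈ B a ∧ ∀ y ∈ B a, c m ≤ c y := by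
    intro a
    by_cases ha : a < n
    · obtain ⟨m, hm, hm'⟩ := (B a).exists_min_image c (h.nonempty a ha)
      exact ⟨m, fun _ => ⟨hm, hm'⟩⟩
    · exact ⟨0, fun h => absurd h ha⟩
  choose m hm using h2
  refine ⟨⟨n, B, c, m⟩, { h with
    ht_eq := fun R => ?_
    m_mem := fun a ha => (hm a ha).1
    m_le := fun a ha => (hm a ha).2 }⟩
  rw [ht, ← Finset.sum_biUnion h.disjoint]
  simp only [c, Finset.sum_mul]
  rw [Finset.sum_comm]
  refine Finset.sum_congr rfl fun k _ => ?_
  rw [← hf k, pair_sum, Int.cast_sum, Finset.mul_sum]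
  refine Finset.sum_congr rfl fun y _ => ?_
  rw [pair_smul]; push_cast; ring

def LocData.Crit (D : LocData) (S : Finset Mat) : Prop :=
  ∀ σ : ℕ → Mat, (∀ a < D.n, σ a ∈ D.B a ∧ σ a ∉ S) → ∑ a ∈ Finset.range D.n, D.c (σ a) < 0

variable {Q : Mat} {D : LocData} {S : Finset Mat}

theorem WLoc.exists_notMem (h : WLoc Q D) (hS : ↑S ⊆ MinSet Q) (hc : S.card ≤ 9)
    (hu : Unimod S) : ∀ a < D.n, ∃ x ∈ D.B a, x ∉ S := (h.unimod S hS hc).1 hu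

theorem WLoc.ht_nonpos (h : WLoc Q D) (hne : ∀ a < D.n, ∃ x ∈ D.B a, x ∉ S) (hC : D.Crit S)
    {R : Mat} (hR : ∀ y ∈ MinSet Q, 0 ≤ pair R y) (h0 : ∀ y ∈ MinSet Q, y ∈ S → pair R y = 0) :
    ht R ≤ 0 ∧ (ht R = 0 → ∀ y ∈ MinSet Q, pair R y = 0) := by
  classical
  have hex : ∀ a, ∃ x, a < D.n → (x ∈ D.B a ∧ x ∉ S) ∧
      ∀ y ∈ D.B a, y ∉ S → D.c y ≤ D.c x := by
    intro a
    by_cases ha : a < D.n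
    · obtain ⟨x, hx, hx'⟩ := (D.B a \ S).exists_max_image D.c (by
        obtain ⟨x, h1, h2⟩ := hne a ha
        exact ⟨x, Finset.mem_sdiff.2 ⟨h1, h2⟩⟩)
      exact ⟨x, fun _ => ⟨Finset.mem_sdiff.1 hx, fun y h1 h2 =>
        hx' y (Finset.mem_sdiff.2 ⟨h1, h2⟩)⟩⟩
    · exact ⟨0, fun h => absurd h ha⟩
  choose σ hσ using hex
  obtain ⟨s, hs⟩ := h.block
  have hmem : ∀ a < D.n, ∀ y ∈ D.B a, y ∈ MinSet Q := fun a ha y hy => (h.mem_iff y).2 ⟨a, ha, hy⟩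
  have hsum : ∀ a < D.n, ∑ y ∈ D.B a, (pair R y : ℝ) = pair R s := fun a ha => by
    rw [← hs a ha, pair_sum, Int.cast_sum]
  have hle : ht R ≤ (∑ a ∈ Finset.range D.n, D.c (σ a)) * pair R s := by
    rw [h.ht_eq, Finset.sum_mul]
    refine Finset.sum_le_sum fun a ha => ?_
    have ha := Finset.mem_range.1 ha
    rw [← hsum a ha, Finset.mul_sum]
    refine Finset.sum_le_sum fun y hy => ?_
    by_cases hyS : y ∈ S
    · rw [h0 y (hmem a ha y hy) hyS]; simp
    · exact mul_le_mul_of_nonneg_right ((hσ a ha).2 y hy hyS)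
        (by exact_mod_cast hR y (hmem a ha y hy))
  have hneg := hC σ fun a ha => (hσ a ha).1
  have ht0 : (0 : ℝ) ≤ pair R s := by
    rw [← hsum 0 h.pos]
    exact Finset.sum_nonneg fun y hy => by exact_mod_cast hR y (hmem 0 h.pos y hy)
  refine ⟨hle.trans (mul_nonpos_of_nonpos_of_nonneg hneg.le ht0), fun he y hy => ?_⟩
  rw [he] at hle
  have hs0 : (pair R s : ℝ) = 0 := by nlinarith
  obtain ⟨a, ha, hy'⟩ := (h.mem_iff y).1 hy
  have := hsum a ha
  rw [hs0, Finset.sum_eq_zero_iff_of_nonneg fun y hy => by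
    exact_mod_cast hR y (hmem a ha y hy)] at this
  exact_mod_cast this y hy'

theorem Loc.eq_zero {n : ℕ} {B : ℕ → Finset Mat} (h : Loc Q n B) {R : Mat} (hR : Rᵀ = R)
    (h0 : ∀ y ∈ MinSet Q, pair R y = 0) : R = 0 := by
  refine eq_zero_of_ht hR ?_
  have : ∀ y ∈ Submodule.span ℤ (MinSet Q), pair R y = 0 := by
    intro y hy
    induction hy using Submodule.span_induction with
    | mem x hx => exact h0 x hx
    | zero => simp [pair]
    | add x y _ _ hx hy => rw [pair_add, hx, hy, add_zero]
    | smul a x _ hx => rw [pair_smul, hx, mul_zero]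
  rw [ht]
  refine Finset.sum_eq_zero fun k _ => ?_
  rw [this _ (h.span _ (rk1_symm _))]
  simp

theorem MinSet.pair_sub_nonneg {Q' y : Mat} (hQ' : Q' ∈ Perf) (hy : y ∈ MinSet Q) :
    0 ≤ pair (Q' - Q) y := by
  obtain ⟨w, rfl, h2⟩ := hy
  obtain ⟨n, B, h⟩ := exists_loc hQ'
  have : w ≠ 0 := by
    rintro rfl
    rw [pair_rk1] at h2
    simp at h2
  rw [pair_sub_left, h2]
  linarith [h.two_le w this]

theorem MinSet.pair_sub_eq_zero {Q' y : Mat} (hy' : y ∈ MinSet Q') (hy : y ∈ MinSet Q) :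
    pair (Q' - Q) y = 0 := by
  obtain ⟨w, -, h1⟩ := hy
  obtain ⟨w', -, h2⟩ := hy'
  rw [pair_sub_left, h1, h2, sub_self]

theorem Loc.eq_of_pair_sub {n : ℕ} {B : ℕ → Finset Mat} (h : Loc Q n B) {Q' : Mat}
    (hQ' : Q' ∈ Perf) (h0 : ∀ y ∈ MinSet Q, pair (Q' - Q) y = 0) : Q' = Q :=
  sub_eq_zero.1 (h.eq_zero (by rw [transpose_sub, h.symm, transpose_of_mem_Perf hQ']) h0)

theorem WLoc.isTop (h : WLoc Q D) (hS : ↑S ⊆ MinSet Q) (hne : ∀ a < D.n, ∃ x ∈ D.B a, x ∉ S)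
    (hC : D.Crit S) : IsTopForm S Q := by
  refine ⟨h.perf, hS, fun Q' hQ' hS' => ?_⟩
  have := (h.ht_nonpos hne hC (R := Q' - Q) (fun y hy => MinSet.pair_sub_nonneg hQ' hy)
    fun y hy hyS => MinSet.pair_sub_eq_zero (hS' hyS) hy).1
  rw [ht_sub] at this
  linarith

theorem WLoc.spanning (h : WLoc Q D) (hne : ∀ a < D.n, ∃ x ∈ D.B a, x ∉ S)
    (hC : D.Crit S) : Spanning S := by
  intro v hv
  by_contra hv0
  have hp : ∀ w, pair (rk1 v) (rk1 w) = v ⬝ᵥ rk1 w *ᵥ v := fun w => by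
    rw [pair_rk1, dotProduct_rk1_mulVec, dotProduct_rk1_mulVec, dotProduct_comm]
  have := (h.ht_nonpos hne hC (R := rk1 v) (fun y hy => ?_) fun y hy hyS => ?_).1
  · exact absurd (ht_rk1_pos hv0) this.not_gt
  · obtain ⟨w, rfl, -⟩ := hy
    rw [hp, dotProduct_rk1_mulVec]
    positivity
  · have := hv y hyS
    obtain ⟨w, rfl, -⟩ := hy
    rw [hp, this]

theorem WLoc.isCell (h : WLoc Q D) (hS : ↑S ⊆ MinSet Q) (hc : S.card ≤ 9)
    (hne : ∀ a < D.n, ∃ x ∈ D.B a, x ∉ S) (hC : D.Crit S) : IsCell S :=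
  ⟨hc, ⟨Q, h.perf, hS⟩, h.spanning hne hC, (h.unimod S hS hc).2 hne⟩

theorem WLoc.crit (h : WLoc Q D) (hT : IsTopForm S Q) : D.Crit S := by
  intro σ hσ
  obtain ⟨Q', hQ', hne, hmem⟩ := h.facet σ fun a ha => (hσ a ha).1
  have hmin : ∀ a < D.n, ∀ y ∈ D.B a, y ∈ MinSet Q := fun a ha y hy => (h.mem_iff y).2 ⟨a, ha, hy⟩
  have hS' : ↑S ⊆ MinSet Q' := by
    intro x hx
    obtain ⟨a, ha, hxa⟩ := (h.mem_iff x).1 (hT.2.1 hx)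
    exact hmem a ha x hxa fun e => (hσ a ha).2 (e ▸ hx)
  have hlt : ht (Q' - Q) < 0 := by
    rw [ht_sub, sub_neg]
    exact lt_of_le_of_ne (hT.2.2 Q' hQ' hS') fun e => hne (ht_injOn hQ' h.perf e)
  obtain ⟨s, hs⟩ := h.block
  have hz : ∀ a < D.n, ∀ y ∈ D.B a, y ≠ σ a → pair (Q' - Q) y = 0 := fun a ha y hy hy' =>
    MinSet.pair_sub_eq_zero (hmem a ha y hy hy') (hmin a ha y hy)
  have ht' : ∀ a < D.n, pair (Q' - Q) (σ a) = pair (Q' - Q) s := by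
    intro a ha
    rw [← hs a ha, pair_sum, Finset.sum_eq_single (σ a) (fun y hy => hz a ha y hy)
      fun h' => absurd (hσ a ha).1 h']
  have heq : ht (Q' - Q) = (∑ a ∈ Finset.range D.n, D.c (σ a)) * pair (Q' - Q) s := by
    rw [h.ht_eq, Finset.sum_mul]
    refine Finset.sum_congr rfl fun a ha => ?_
    have ha := Finset.mem_range.1 ha
    rw [Finset.sum_eq_single (σ a) (fun y hy hy' => by rw [hz a ha y hy hy']; simp)
      fun h' => absurd (hσ a ha).1 h', ht' a ha]
  have ht0 : (0 : ℝ) ≤ pair (Q' - Q) s := by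
    rw [← ht' 0 h.pos]
    exact_mod_cast MinSet.pair_sub_nonneg hQ' (hmin 0 h.pos _ (hσ 0 h.pos).1)
  rw [heq] at hlt
  by_contra! h1
  exact absurd (mul_nonneg h1 ht0) hlt.not_ge

open Classical in
/-- The first block whose complement is not the distinguished element; the last block if there is
none. -/
noncomputable def LocData.stage (D : LocData) (S : Finset Mat) : ℕ :=
  Nat.find (p := fun a => D.n ≤ a + 1 ∨ ¬ ∀ x ∈ D.B a, x ∉ S → x = D.m a)
    ⟨D.n, Or.inl (Nat.le_succ _)⟩

theorem LocData.stage_spec (D : LocData) (S : Finset Mat) :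
    D.n ≤ D.stage S + 1 ∨ ¬ ∀ x ∈ D.B (D.stage S), x ∉ S → x = D.m (D.stage S) := by
  classical
  exact Nat.find_spec (p := fun a => D.n ≤ a + 1 ∨ ¬ ∀ x ∈ D.B a, x ∉ S → x = D.m a) _

theorem LocData.of_lt_stage {a : ℕ} (ha : a < D.stage S) :
    a + 1 < D.n ∧ ∀ x ∈ D.B a, x ∉ S → x = D.m a := by
  classical
  have := Nat.find_min (p := fun a => D.n ≤ a + 1 ∨ ¬ ∀ x ∈ D.B a, x ∉ S → x = D.m a) _ ha
  push Not at this
  exact this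

theorem LocData.le_stage {b : ℕ} (h : ∀ a < b, a + 1 < D.n ∧ ∀ x ∈ D.B a, x ∉ S → x = D.m a) :
    b ≤ D.stage S := by
  classical
  refine (Nat.le_find_iff _ _).2 fun a ha => ?_
  push Not
  exact h a ha

theorem LocData.stage_le {a : ℕ} (h : D.n ≤ a + 1 ∨ ¬ ∀ x ∈ D.B a, x ∉ S → x = D.m a) :
    D.stage S ≤ a := by
  classical
  exact Nat.find_le h

theorem WLoc.stage_lt (h : WLoc Q D) : D.stage S < D.n := by
  have := h.pos
  have := D.stage_le (S := S) (a := D.n - 1) (Or.inl (by omega))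
  omega

theorem WLoc.stage_le_two (h : WLoc Q D) : D.stage S ≤ 2 := by
  have := h.stage_lt (S := S)
  have := h.le_three
  omega

theorem WLoc.stage_mono (_h : WLoc Q D) {T : Finset Mat} (hST : S ⊆ T) :
    D.stage S ≤ D.stage T :=
  D.le_stage fun _ ha => ⟨(D.of_lt_stage ha).1,
    fun x hx hxT => (D.of_lt_stage ha).2 x hx fun h => hxT (hST h)⟩

theorem exists_locData : ∃ D : Mat → LocData, ∀ Q ∈ Perf, WLoc Q (D Q) := by
  classical
  have : ∀ Q, ∃ D, Q ∈ Perf → WLoc Q D := fun Q => by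
    by_cases h : Q ∈ Perf
    · obtain ⟨D, hD⟩ := exists_wLoc h
      exact ⟨D, fun _ => hD⟩
    · exact ⟨⟨0, fun _ => ∅, 0, 0⟩, fun h' => absurd h' h⟩
  choose D hD using this
  exact ⟨D, hD⟩

noncomputable def locData : Mat → LocData := exists_locData.choose

theorem wLoc {Q : Mat} (hQ : Q ∈ Perf) : WLoc Q (locData Q) := exists_locData.choose_spec Q hQ

/-- The number of perfect forms of smaller height. -/
noncomputable def htIndex (Q : Mat) : ℕ := {Q' | Q' ∈ Perf ∧ ht Q' < ht Q}.ncard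

theorem htIndex_lt {Q Q' : Mat} (hQ : Q ∈ Perf) (h : ht Q < ht Q') : htIndex Q < htIndex Q' := by
  refine Set.ncard_lt_ncard ⟨fun R hR => ⟨hR.1, hR.2.trans h⟩, fun h' => ?_⟩
    ((finite_perf_ht_le (ht Q')).subset fun R hR => ⟨hR.1, hR.2.le⟩)
  exact lt_irrefl _ (h' (show Q ∈ _ from ⟨hQ, h⟩)).2

theorem htIndex_le {Q Q' : Mat} (hQ : Q ∈ Perf) (hQ' : Q' ∈ Perf) (h : ht Q ≤ ht Q') :
    htIndex Q ≤ htIndex Q' := by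
  rcases h.lt_or_eq with h | h
  · exact (htIndex_lt hQ h).le
  · rw [ht_injOn hQ hQ' h]

theorem htIndex_injOn : Set.InjOn htIndex Perf := by
  intro Q hQ Q' hQ' h
  rcases lt_trichotomy (ht Q) (ht Q') with h' | h' | h'
  · exact absurd h (htIndex_lt hQ h').ne
  · exact ht_injOn hQ hQ' h'
  · exact absurd h (htIndex_lt hQ' h').ne'

open Classical in
noncomputable def topForm (S : Finset Mat) : Mat := if h : ∃ Q, IsTopForm S Q then h.choose else 0

theorem IsCell.isTop (h : IsCell S) : IsTopForm S (topForm S) := by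
  rw [topForm, dif_pos h.exists_isTop]
  exact h.exists_isTop.choose_spec

theorem topForm_eq (h : IsTopForm S Q) : topForm S = Q := by
  have h' : ∃ Q, IsTopForm S Q := ⟨Q, h⟩
  rw [topForm, dif_pos h']
  exact h'.choose_spec.unique h

noncomputable def cellRank (S : Finset Mat) : ℕ :=
  4 * htIndex (topForm S) + (3 - (locData (topForm S)).stage S)

open Classical in
noncomputable def cellPivot (r : ℕ) : Mat :=
  if h : ∃ Q ∈ Perf, htIndex Q = r / 4 then (locData h.choose).m (3 - r % 4) else 0

theorem cellRank_eq (h : IsTopForm S Q) :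
    cellRank S = 4 * htIndex Q + (3 - (locData Q).stage S) := by
  rw [cellRank, topForm_eq h]

theorem cellPivot_cellRank (h : IsTopForm S Q) :
    cellPivot (cellRank S) = (locData Q).m ((locData Q).stage S) := by
  have hs := (wLoc h.1).stage_le_two (S := S)
  have h' : ∃ Q' ∈ Perf, htIndex Q' = cellRank S / 4 := ⟨Q, h.1, by
    rw [cellRank_eq h]; omega⟩
  rw [cellPivot, dif_pos h', htIndex_injOn h'.choose_spec.1 h.1 (h'.choose_spec.2.trans (by
    rw [cellRank_eq h]; omega)), cellRank_eq h]
  congr 1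
  omega

theorem WLoc.subset_card (h : WLoc Q D) (hS : ↑S ⊆ MinSet Q) :
    S.card + ∑ a ∈ Finset.range D.n, (D.B a \ S).card = 9 + D.n := by
  have hsub : S ⊆ (Finset.range D.n).biUnion D.B := by
    rw [← Finset.coe_subset, h.coe_biUnion]
    exact hS
  rw [← h.card, ← Finset.card_biUnion h.disjoint, ← Finset.card_biUnion fun a ha b hb hab =>
    (h.disjoint ha hb hab).mono Finset.sdiff_subset Finset.sdiff_subset,
    ← Finset.card_sdiff_add_card_eq_card hsub, add_comm]
  congr 2
  ext x
  simp only [Finset.mem_biUnion, Finset.mem_sdiff]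
  exact ⟨fun ⟨a, h1, h2, h3⟩ => ⟨⟨a, h1, h2⟩, h3⟩, fun ⟨⟨a, h1, h2⟩, h3⟩ => ⟨a, h1, h2, h3⟩⟩

theorem WLoc.card_eq_nine (h : WLoc Q D) (hS : ↑S ⊆ MinSet Q)
    (hne : ∀ a < D.n, ∃ x ∈ D.B a, x ∉ S)
    (hm : ∀ a < D.n, ∀ x ∈ D.B a, x ∉ S → x = D.m a) : S.card = 9 := by
  have := h.subset_card hS
  rw [Finset.sum_congr rfl (g := fun _ => 1)] at this
  · simpa using this
  · intro a ha
    have ha := Finset.mem_range.1 ha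
    obtain ⟨x, hx, hx'⟩ := hne a ha
    rw [Finset.card_eq_one]
    refine ⟨D.m a, Finset.eq_singleton_iff_unique_mem.2 ⟨?_, fun y hy => ?_⟩⟩
    · rw [← hm a ha x hx hx']
      exact Finset.mem_sdiff.2 ⟨hx, hx'⟩
    · exact hm a ha y (Finset.mem_sdiff.1 hy).1 (Finset.mem_sdiff.1 hy).2

theorem pivotData_isCell : PivotData IsCell cellRank cellPivot where
  anti S T hS hT hST := by
    have h1 := hS.isTop
    have h2 := hT.isTop
    rw [cellRank_eq h1, cellRank_eq h2]
    have hle := h1.2.2 _ h2.1 ((Finset.coe_subset.2 hST).trans h2.2.1)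
    rcases hle.lt_or_eq with h | h
    · have := htIndex_lt h2.1 h
      omega
    · rw [ht_injOn h2.1 h1.1 h]
      have := (wLoc h1.1).stage_mono hST
      omega
  insert S hS hc hp := by
    have hT := hS.isTop
    set Q := topForm S
    have hW := wLoc hT.1
    rw [cellPivot_cellRank hT] at hp ⊢
    set D := locData Q
    set a := D.stage S with ha
    have han : a < D.n := hW.stage_lt
    have hne := hW.exists_notMem hT.2.1 hS.1 hS.2.2.2
    have hsub : ↑(insert (D.m a) S) ⊆ MinSet Q := by
      rw [Finset.coe_insert, Set.insert_subset_iff]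
      exact ⟨(hW.mem_iff _).2 ⟨a, han, hW.m_mem a han⟩, hT.2.1⟩
    have hex : ∃ x ∈ D.B a, x ∉ S ∧ x ≠ D.m a := by
      by_contra! hcon
      have : S.card = 9 := hW.card_eq_nine hT.2.1 hne fun b hb => by
        rcases lt_or_ge b a with hba | hba
        · exact (D.of_lt_stage hba).2
        · rcases D.stage_spec S with h | h
          · have : b = a := by omega
            rw [this]; exact hcon
          · exact absurd hcon h
      omega
    have hne' : ∀ b < D.n, ∃ x ∈ D.B b, x ∉ insert (D.m a) S := by
      intro b hb
      by_cases hba : b = a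
      · obtain ⟨x, h1, h2, h3⟩ := hex
        exact ⟨x, hba ▸ h1, by simp [h2, h3]⟩
      · obtain ⟨x, h1, h2⟩ := hne b hb
        refine ⟨x, h1, fun h => ?_⟩
        rcases Finset.mem_insert.1 h with rfl | h
        · exact hba (hW.disj b hb a han _ h1 (hW.m_mem a han))
        · exact h2 h
    have hC : D.Crit (insert (D.m a) S) := fun σ hσ => hW.crit hT σ fun b hb =>
      ⟨(hσ b hb).1, fun h => (hσ b hb).2 (Finset.mem_insert_of_mem h)⟩
    have hst : D.stage (insert (D.m a) S) = a := by
      refine le_antisymm (D.stage_le (Or.inr fun h => ?_)) (hW.stage_mono (Finset.subset_insert _ _))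
      obtain ⟨x, h1, h2, h3⟩ := hex
      exact h3 (h x h1 (by simp [h2, h3]))
    refine ⟨hW.isCell hsub ?_ hne' hC, ?_⟩
    · rw [Finset.card_insert_of_notMem hp]; omega
    · rw [cellRank_eq (hW.isTop hsub hne' hC), cellRank_eq hT, hst]
  erase S hS hp := by
    have hT := hS.isTop
    set Q := topForm S
    have hW := wLoc hT.1
    rw [cellPivot_cellRank hT] at hp ⊢
    set D := locData Q
    set a := D.stage S with ha
    have han : a < D.n := hW.stage_lt
    have hne := hW.exists_notMem hT.2.1 hS.1 hS.2.2.2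
    have hsub : ↑(S.erase (D.m a)) ⊆ MinSet Q :=
      (Finset.coe_subset.2 (Finset.erase_subset _ _)).trans hT.2.1
    have hne' : ∀ b < D.n, ∃ x ∈ D.B b, x ∉ S.erase (D.m a) := fun b hb => by
      obtain ⟨x, h1, h2⟩ := hne b hb
      exact ⟨x, h1, fun h => h2 (Finset.mem_of_mem_erase h)⟩
    have hC : D.Crit (S.erase (D.m a)) := by
      classical
      intro σ hσ
      obtain ⟨x, hx, hx'⟩ := hne a han
      refine lt_of_le_of_lt (Finset.sum_le_sum fun b hb => ?_)
        (hW.crit hT (fun b => if b = a ∧ σ b = D.m a then x else σ b) fun b hb => ?_)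
      · split_ifs with h
        · rw [h.2]
          exact hW.m_le a han x hx
        · exact le_rfl
      · split_ifs with h
        · exact ⟨h.1 ▸ hx, hx'⟩
        · refine ⟨(hσ b hb).1, fun hS' => (hσ b hb).2 (Finset.mem_erase.2 ⟨fun e => h ⟨?_, e⟩, hS'⟩)⟩
          exact hW.disj b hb a han _ (hσ b hb).1 (e ▸ hW.m_mem a han)
    have hst : D.stage (S.erase (D.m a)) = a := by
      obtain ⟨x, hx, hx'⟩ := hne a han
      refine le_antisymm (D.stage_le (Or.inr fun h => ?_)) (D.le_stage fun b hb => ?_)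
      · have := h x hx fun h => hx' (Finset.mem_of_mem_erase h)
        exact hx' (this ▸ hp)
      · obtain ⟨h1, h2⟩ := D.of_lt_stage hb
        refine ⟨h1, fun y hy hy' => h2 y hy fun hyS => hy' (Finset.mem_erase.2 ⟨?_, hyS⟩)⟩
        rintro rfl
        exact hb.ne (hW.disj b (by omega) a han _ hy (hW.m_mem a han))
    refine ⟨hW.isCell hsub ((Finset.card_le_card (Finset.erase_subset _ _)).trans hS.1) hne' hC, ?_⟩
    rw [cellRank_eq (hW.isTop hsub hne' hC), cellRank_eq hT, hst]

end Cells

section Orientation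

abbrev QMat := Matrix (Fin 4) (Fin 4) ℚ

def rowIdx : Fin 10 → Fin 4 := ![0, 0, 0, 0, 1, 1, 1, 2, 2, 3]

def colIdx : Fin 10 → Fin 4 := ![0, 1, 2, 3, 1, 2, 3, 2, 3, 3]

/-- The upper triangular part of a matrix. -/
def upper : QMat →ₗ[ℚ] Fin 10 → ℚ where
  toFun x k := x (rowIdx k) (colIdx k)
  map_add' _ _ := rfl
  map_smul' _ _ := rfl

/-- The symmetric matrix with given upper triangular part. -/
def symMat : (Fin 10 → ℚ) →ₗ[ℚ] QMat where
  toFun v := !![v 0, v 1, v 2, v 3; v 1, v 4, v 5, v 6; v 2, v 5, v 7, v 8; v 3, v 6, v 8, v 9]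
  map_add' v w := by ext i j; fin_cases i <;> fin_cases j <;> rfl
  map_smul' c v := by ext i j; fin_cases i <;> fin_cases j <;> rfl

theorem symMat_upper {x : QMat} (hx : xᵀ = x) : symMat (upper x) = x := by
  have hs : ∀ i j, x i j = x j i := fun i j => congrFun (congrFun hx.symm i) j
  ext i j
  fin_cases i <;> fin_cases j <;> first | rfl | exact hs _ _

theorem upper_symMat (v : Fin 10 → ℚ) : upper (symMat v) = v := by
  ext k; fin_cases k <;> rfl

theorem symMat_transpose (v : Fin 10 → ℚ) : (symMat v)ᵀ = symMat v := by
  ext i j; fin_cases i <;> fin_cases j <;> rfl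

/-- The symmetric square of a matrix, acting on upper triangular parts. -/
def symSquare (M : QMat) : (Fin 10 → ℚ) →ₗ[ℚ] Fin 10 → ℚ where
  toFun v := upper (M * symMat v * Mᵀ)
  map_add' v w := by rw [map_add, mul_add, add_mul, map_add]
  map_smul' c v := by
    rw [map_smul, Matrix.mul_smul, Matrix.smul_mul, map_smul, RingHom.id_apply]

theorem symSquare_apply (M : QMat) (v : Fin 10 → ℚ) :
    symSquare M v = upper (M * symMat v * Mᵀ) := rfl

theorem symSquare_upper (M : QMat) {x : QMat} (hx : xᵀ = x) :
    symSquare M (upper x) = upper (M * x * Mᵀ) := by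
  rw [symSquare_apply, symMat_upper hx]

theorem symSquare_mul (M N : QMat) : symSquare (M * N) = symSquare M * symSquare N := by
  refine LinearMap.ext fun v => ?_
  rw [Module.End.mul_apply, symSquare_apply N, symSquare_upper, symSquare_apply, transpose_mul]
  · simp only [Matrix.mul_assoc]
  · rw [transpose_mul, transpose_mul, transpose_transpose, symMat_transpose, Matrix.mul_assoc]

theorem symSquare_one : symSquare 1 = 1 := by
  refine LinearMap.ext fun v => ?_
  rw [symSquare_apply, Module.End.one_apply, transpose_one, mul_one, one_mul, upper_symMat]

theorem det_symSquare_diagonal (d : Fin 4 → ℚ) :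
    LinearMap.det (symSquare (diagonal d)) = (diagonal d).det ^ 5 := by
  have : symSquare (diagonal d) = toLin' (diagonal fun k => d (rowIdx k) * d (colIdx k)) := by
    refine LinearMap.ext fun v => ?_
    ext k
    rw [toLin'_apply, mulVec_diagonal]
    change (diagonal d * symMat v * (diagonal d)ᵀ) (rowIdx k) (colIdx k) = _
    rw [diagonal_transpose, mul_diagonal, diagonal_mul]
    have : symMat v (rowIdx k) (colIdx k) = v k := congrFun (upper_symMat v) k
    rw [this]; ring
  rw [this, LinearMap.det_toLin', det_diagonal, det_diagonal]
  simp [Fin.prod_univ_succ, rowIdx, colIdx]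
  ring

theorem det_symSquare_pos (M : QMat) (hM : M.det ≠ 0) :
    0 < M.det * LinearMap.det (symSquare M) := by
  refine diagonal_transvection_induction_of_det_ne_zero
    (fun M => 0 < M.det * LinearMap.det (symSquare M)) M hM ?_ ?_ ?_
  · intro d hd
    rw [det_symSquare_diagonal, ← pow_succ']
    exact (even_two_mul 3).pow_pos hd
  · intro t
    obtain ⟨i, j, hij, c⟩ := t
    have h2 : transvection i j c = transvection i j (c / 2) * transvection i j (c / 2) := by
      rw [transvection_mul_transvection_same _ _ hij, add_halves]
    have h1 : symSquare (transvection i j (c / 2)) * symSquare (transvection i j (-(c / 2))) = 1 := by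
      rw [← symSquare_mul, transvection_mul_transvection_same _ _ hij, add_neg_cancel,
        transvection_zero, symSquare_one]
    have h0 : LinearMap.det (symSquare (transvection i j (c / 2))) ≠ 0 := by
      intro h
      have := congrArg LinearMap.det h1
      rw [map_mul, h, zero_mul, map_one] at this
      exact zero_ne_one this
    change 0 < (transvection i j c).det * LinearMap.det (symSquare (transvection i j c))
    rw [det_transvection_of_ne _ _ hij, one_mul, h2, symSquare_mul, map_mul]
    exact mul_self_pos.2 h0
  · intro A B _ _ hA hB
    rw [symSquare_mul, map_mul, det_mul]
    nlinarith [mul_pos hA hB]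

def ratMat : Mat →+ QMat where
  toFun x := x.map (Int.cast : ℤ → ℚ)
  map_zero' := by ext; simp
  map_add' x y := by ext; simp

theorem ratMat_mul (x y : Mat) : ratMat (x * y) = ratMat x * ratMat y :=
  Matrix.map_mul (f := Int.castRingHom ℚ)

theorem ratMat_transpose (x : Mat) : ratMat xᵀ = (ratMat x)ᵀ := rfl

theorem det_ratMat (x : Mat) : (ratMat x).det = x.det := by
  have := RingHom.map_det (Int.castRingHom ℚ) x
  exact this.symm

/-- The determinant of a list of ten symmetric matrices, zero for lists of other lengths. -/
noncomputable def ori (l : List Mat) : ℚ :=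
  if l.length = 10 then
    (Pi.basisFun ℚ (Fin 10)).det fun i => upper (ratMat (l.getD i 0))
  else 0

theorem ori_eq {l : List Mat} (hl : l.length = 10) :
    ori l = (Pi.basisFun ℚ (Fin 10)).det fun i => upper (ratMat (l.getD i 0)) := if_pos hl

theorem ori_cong_pos (g : SL4) {l : List Mat} (hl : ∀ x ∈ l, xᵀ = x) :
    SignType.sign (ori (l.map (cong g))) = SignType.sign (ori l) := by
  by_cases h : l.length = 10
  · rw [ori_eq h, ori_eq (by rw [List.length_map, h])]
    have hpos := det_symSquare_pos (ratMat g.1) (by rw [det_ratMat, g.2]; norm_num)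
    rw [det_ratMat, g.2, Int.cast_one, one_mul] at hpos
    have : (fun i : Fin 10 => upper (ratMat ((l.map (cong g)).getD i 0))) =
        symSquare (ratMat g.1) ∘ fun i : Fin 10 => upper (ratMat (l.getD i 0)) := by
      funext i
      have hi : (i : ℕ) < l.length := lt_of_lt_of_eq i.2 h.symm
      rw [List.getD_eq_getElem _ _ (by simpa using hi), Function.comp_apply,
        List.getD_eq_getElem _ _ hi, List.getElem_map, symSquare_upper, cong, ratMat_mul,
        ratMat_mul, ratMat_transpose]
      rw [← ratMat_transpose, hl _ (List.getElem_mem hi)]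
    rw [this, Module.Basis.det_comp, sign_mul, sign_pos hpos, one_mul]
  · rw [ori, ori, if_neg h, if_neg (by rwa [List.length_map])]

theorem isAlt_ori : IsAlt ori := by
  intro l₁ a b l₂
  by_cases h : (l₁ ++ a :: b :: l₂).length = 10
  · have h' : (l₁ ++ b :: a :: l₂).length = 10 := by simpa using h
    have hlen : l₁.length + 1 < 10 := by simp at h; omega
    let i : Fin 10 := ⟨l₁.length, by omega⟩
    let j : Fin 10 := ⟨l₁.length + 1, hlen⟩
    have hij : i ≠ j := by simp [i, j, Fin.ext_iff]
    rw [ori_eq h, ori_eq h', ← (Pi.basisFun ℚ (Fin 10)).det.map_swap _ hij]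
    congr 1
    funext k
    rw [Function.comp_apply]
    congr 2
    by_cases hi : k = i
    · rw [hi, Equiv.swap_apply_left]
      simp [i, j]
    · by_cases hj : k = j
      · rw [hj, Equiv.swap_apply_right]
        simp [i, j]
      · rw [Equiv.swap_apply_of_ne_of_ne hi hj]
        have hi' : (k : ℕ) ≠ l₁.length := fun e => hi (Fin.ext e)
        have hj' : (k : ℕ) ≠ l₁.length + 1 := fun e => hj (Fin.ext e)
        rcases lt_or_ge (k : ℕ) l₁.length with hk | hk
        · simp [List.getElem?_append_left hk]
        · obtain ⟨m, hm⟩ : ∃ m, (k : ℕ) = l₁.length + (m + 2) := ⟨k - l₁.length - 2, by omega⟩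
          simp [hm, List.getElem?_append_right]
  · rw [ori, ori, if_neg h, if_neg (by simpa using h), neg_zero]

theorem ori_add (x y : Mat) (l : List Mat) : ori ((x + y) :: l) = ori (x :: l) + ori (y :: l) := by
  by_cases h : l.length = 9
  · have key : ∀ u : Mat, ori (u :: l) = (Pi.basisFun ℚ (Fin 10)).det
        (Function.update (fun i => upper (ratMat ((0 :: l).getD i 0))) 0 (upper (ratMat u))) := by
      intro u
      rw [ori_eq (by simp [h])]
      congr 1
      funext i
      refine Fin.cases ?_ (fun i => ?_) i
      · simp
      · rw [Function.update_of_ne (Fin.succ_ne_zero i)]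
        simp
    rw [key, key, key, map_add, map_add, AlternatingMap.map_update_add]
  · simp [ori, h]

/-- The orientation as an additive function of the first entry. -/
noncomputable def oriHom (l : List Mat) : Mat →+ ℚ :=
  AddMonoidHom.mk' (fun x => ori (x :: l)) fun x y => ori_add x y l

theorem oriHom_apply (l : List Mat) (x : Mat) : oriHom l x = ori (x :: l) := rfl

theorem ori_ne_zero {l : List Mat} (hl : l.length = 10)
    (h : ∀ x : Mat, xᵀ = x → x ∈ Submodule.span ℤ {y | y ∈ l}) : ori l ≠ 0 := by
  rw [ori_eq hl]
  set v : Fin 10 → Fin 10 → ℚ := fun i => upper (ratMat (l.getD i 0)) with hv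
  have hmem : ∀ x : Mat, xᵀ = x → upper (ratMat x) ∈ Submodule.span ℚ (Set.range v) := by
    intro x hx
    have := h x hx
    clear hx
    induction this using Submodule.span_induction with
    | mem x hx =>
      obtain ⟨i, hi, rfl⟩ := List.getElem_of_mem (Set.mem_ofPred.1 hx)
      refine Submodule.subset_span ⟨⟨i, hl ▸ hi⟩, ?_⟩
      simp only [hv]
      rw [List.getD_eq_getElem _ _ hi]
    | zero => simp
    | add x y _ _ hx hy => rw [map_add, map_add]; exact add_mem hx hy
    | smul a x _ hx =>
      rw [map_zsmul, map_zsmul]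
      exact zsmul_mem hx a
  have hspan : ⊤ ≤ Submodule.span ℚ (Set.range v) := by
    rw [← (Pi.basisFun ℚ (Fin 10)).span_eq, Submodule.span_le]
    rintro _ ⟨k, rfl⟩
    let E : Mat := Matrix.of fun i j => if (i = rowIdx k ∧ j = colIdx k) ∨ (j = rowIdx k ∧ i = colIdx k)
      then 1 else 0
    have hE : Eᵀ = E := by
      ext i j
      simp only [E, transpose_apply, Matrix.of_apply, or_comm]
    have : Pi.basisFun ℚ (Fin 10) k = upper (ratMat E) := by
      ext m
      change (Pi.basisFun ℚ (Fin 10) k) m = ((E (rowIdx m) (colIdx m) : ℤ) : ℚ)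
      rw [Pi.basisFun_apply, Pi.single_apply]
      simp only [E, Matrix.of_apply]
      have hdec : ∀ k m : Fin 10, (m = k ↔ (rowIdx m = rowIdx k ∧ colIdx m = colIdx k) ∨
        (colIdx m = rowIdx k ∧ rowIdx m = colIdx k)) := by decide
      by_cases hmk : m = k
      · rw [if_pos hmk, if_pos ((hdec k m).1 hmk)]; simp
      · rw [if_neg hmk, if_neg fun h => hmk ((hdec k m).2 h)]; simp
    rw [this]
    exact hmem E hE
  have hli : LinearIndependent ℚ v :=
    linearIndependent_of_top_le_span_of_card_eq_finrank hspan (by simp)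
  exact ((Pi.basisFun ℚ (Fin 10)).is_basis_iff_det.1 ⟨hli, top_le_iff.1 hspan⟩).ne_zero

end Orientation

section Nine

variable {Q Q' : Mat} {D : LocData} {S : Finset Mat}

/-- Pairing with a fixed form, as an additive map. -/
def pairHom (R : Mat) : Mat →+ ℤ := AddMonoidHom.mk' (pair R) (pair_add R)

theorem pairHom_apply (R x : Mat) : pairHom R x = pair R x := rfl

theorem WLoc.exists_compl (h : WLoc Q D) (hS : ↑S ⊆ MinSet Q) (hc : S.card = 9)
    (hne : ∀ a < D.n, ∃ x ∈ D.B a, x ∉ S) :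
    ∃ σ : ℕ → Mat, ∀ a < D.n, (σ a ∈ D.B a ∧ σ a ∉ S) ∧ ∀ x ∈ D.B a, x ∉ S → x = σ a := by
  have hsum := h.subset_card hS
  have h1 : ∀ a ∈ Finset.range D.n, 1 ≤ (D.B a \ S).card := fun a ha => by
    obtain ⟨x, hx, hx'⟩ := hne a (Finset.mem_range.1 ha)
    exact Finset.card_pos.2 ⟨x, Finset.mem_sdiff.2 ⟨hx, hx'⟩⟩
  have h2 : ∑ a ∈ Finset.range D.n, 1 = ∑ a ∈ Finset.range D.n, (D.B a \ S).card := by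
    rw [Finset.sum_const, Finset.card_range, smul_eq_mul, mul_one]; omega
  have h3 := (Finset.sum_eq_sum_iff_of_le h1).1 h2
  have h4 : ∀ a, ∃ x, a < D.n → D.B a \ S = {x} := fun a => by
    by_cases ha : a < D.n
    · obtain ⟨x, hx⟩ := Finset.card_eq_one.1 (h3 a (Finset.mem_range.2 ha)).symm
      exact ⟨x, fun _ => hx⟩
    · exact ⟨0, fun h => absurd h ha⟩
  choose σ hσ using h4
  have key : ∀ a < D.n, ∀ x, x ∈ D.B a ∧ x ∉ S ↔ x = σ a := fun a ha x => by
    rw [← Finset.mem_sdiff, hσ a ha, Finset.mem_singleton]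
  exact ⟨σ, fun a ha => ⟨(key a ha _).2 rfl, fun x hx hx' => (key a ha x).1 ⟨hx, hx'⟩⟩⟩

theorem map_block {A : Type*} [AddCommGroup A] (φ : Mat →+ A) {B : Finset Mat} {s y : Mat}
    (hs : ∑ x ∈ B, x = s) (hy : y ∈ B) (h0 : ∀ x ∈ B, x ≠ y → φ x = 0) : φ y = φ s := by
  rw [← hs, map_sum, Finset.sum_eq_single_of_mem y hy h0]

theorem Loc.exists_notMem_of_ne {n : ℕ} {B : ℕ → Finset Mat} (h : Loc Q n B) (hQ' : Q' ∈ Perf)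
    (hne : Q' ≠ Q) (hS' : ↑S ⊆ MinSet Q') : ∀ a < n, ∃ x ∈ B a, x ∉ S := by
  intro a ha
  by_contra! hB
  refine hne (h.eq_of_pair_sub hQ' ?_)
  obtain ⟨s, hs⟩ := h.block
  have hmin : ∀ a < n, ∀ y ∈ B a, y ∈ MinSet Q := fun a ha y hy => (h.mem_iff y).2 ⟨a, ha, hy⟩
  have h0 : pair (Q' - Q) s = 0 := by
    rw [← hs a ha, pair_sum]
    exact Finset.sum_eq_zero fun x hx => MinSet.pair_sub_eq_zero (hS' (hB x hx)) (hmin a ha x hx)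
  intro y hy
  obtain ⟨b, hb, hyb⟩ := (h.mem_iff y).1 hy
  rw [← hs b hb, pair_sum, Finset.sum_eq_zero_iff_of_nonneg fun x hx =>
    MinSet.pair_sub_nonneg hQ' (hmin b hb x hx)] at h0
  exact h0 y hyb

theorem WLoc.crit_of_lt (h : WLoc Q D) (hS : ↑S ⊆ MinSet Q) (hc : S.card = 9)
    (hQ' : Q' ∈ Perf) (hS' : ↑S ⊆ MinSet Q') (hlt : ht Q' < ht Q) : D.Crit S := by
  have hne : Q' ≠ Q := by rintro rfl; exact lt_irrefl _ hlt
  obtain ⟨σ, hσ⟩ := h.exists_compl hS hc (h.toLoc.exists_notMem_of_ne hQ' hne hS')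
  obtain ⟨s, hs⟩ := h.block
  have hmin : ∀ a < D.n, ∀ y ∈ D.B a, y ∈ MinSet Q :=
    fun a ha y hy => (h.mem_iff y).2 ⟨a, ha, hy⟩
  have h0 : ∀ a < D.n, ∀ y ∈ D.B a, y ≠ σ a → pair (Q' - Q) y = 0 := fun a ha y hy hya => by
    have : y ∈ S := by
      by_contra hyS
      exact hya ((hσ a ha).2 y hy hyS)
    exact MinSet.pair_sub_eq_zero (hS' this) (hS this)
  have h1 : ∀ a < D.n, pair (Q' - Q) (σ a) = pair (Q' - Q) s := fun a ha =>
    map_block (pairHom (Q' - Q)) (hs a ha) (hσ a ha).1.1 (h0 a ha)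
  have hht : ht (Q' - Q) = (∑ a ∈ Finset.range D.n, D.c (σ a)) * pair (Q' - Q) s := by
    rw [h.ht_eq, Finset.sum_mul]
    refine Finset.sum_congr rfl fun a ha => ?_
    have ha := Finset.mem_range.1 ha
    rw [Finset.sum_eq_single_of_mem (σ a) (hσ a ha).1.1, h1 a ha]
    intro y hy hya
    rw [h0 a ha y hy hya, Int.cast_zero, mul_zero]
  have ht0 : (0 : ℝ) ≤ pair (Q' - Q) s := by
    rw [← h1 0 h.pos]
    exact_mod_cast MinSet.pair_sub_nonneg hQ' (hmin 0 h.pos _ (hσ 0 h.pos).1.1)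
  have hneg : ∑ a ∈ Finset.range D.n, D.c (σ a) < 0 := by
    by_contra! hpos
    rw [ht_sub] at hht
    nlinarith [mul_nonneg hpos ht0]
  intro τ hτ
  refine lt_of_eq_of_lt (Finset.sum_congr rfl fun a ha => ?_) hneg
  have ha := Finset.mem_range.1 ha
  rw [(hσ a ha).2 _ (hτ a ha).1 (hτ a ha).2]

theorem WLoc.exists_other (h : WLoc Q D) (hS : ↑S ⊆ MinSet Q) (hc : S.card = 9)
    (hne : ∀ a < D.n, ∃ x ∈ D.B a, x ∉ S) : ∃ Q' ∈ Perf, Q' ≠ Q ∧ ↑S ⊆ MinSet Q' := by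
  obtain ⟨σ, hσ⟩ := h.exists_compl hS hc hne
  obtain ⟨Q', hQ', hQne, hmem⟩ := h.facet σ fun a ha => (hσ a ha).1.1
  refine ⟨Q', hQ', hQne, fun x hx => ?_⟩
  obtain ⟨a, ha, hxa⟩ := (h.mem_iff x).1 (hS hx)
  exact hmem a ha x hxa fun e => (hσ a ha).1.2 (e ▸ hx)

theorem WLoc.isCell_nine (h : WLoc Q D) (hS : ↑S ⊆ MinSet Q) (hc : S.card = 9)
    (hne : ∀ a < D.n, ∃ x ∈ D.B a, x ∉ S) : IsCell S := by
  obtain ⟨Q', hQ', hQne, hS'⟩ := h.exists_other hS hc hne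
  rcases lt_trichotomy (ht Q') (ht Q) with hlt | heq | hlt
  · exact h.isCell hS hc.le hne (h.crit_of_lt hS hc hQ' hS' hlt)
  · exact absurd (ht_injOn hQ' h.perf heq) hQne
  · have h' := wLoc hQ'
    exact h'.isCell hS' hc.le (h'.toLoc.exists_notMem_of_ne h.perf hQne.symm hS)
      (h'.crit_of_lt hS' hc h.perf hS hlt)

theorem MinSet.two_le {y : Mat} (hy : y ∈ MinSet Q) (hQ' : Q' ∈ Perf) : 2 ≤ pair Q' y := by
  have := MinSet.pair_sub_nonneg hQ' hy
  obtain ⟨w, -, h⟩ := hy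
  rw [pair_sub_left] at this
  linarith

theorem eq_of_three_aux {Q'' : Mat} (hQ : Q ∈ Perf) (hQ' : Q' ∈ Perf) (hQ'' : Q'' ∈ Perf)
    {t u : ℤ} (ht : 0 ≤ t) (htu : t < u) (h : ∀ y : Mat, yᵀ = y →
    u * pair (Q' - Q) y = t * pair (Q'' - Q) y) : Q = Q' := by
  refine (wLoc hQ').eq_of_pair_sub hQ fun y hy => ?_
  have h1 := MinSet.two_le hy hQ
  have h2 := MinSet.two_le hy hQ''
  obtain ⟨w, rfl, h3⟩ := hy
  have h4 := h _ (rk1_symm w)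
  simp only [pair_sub_left] at h4 ⊢
  rw [h3] at h4 ⊢
  have : pair Q (rk1 w) ≤ 2 := by
    by_contra! hlt
    nlinarith [mul_nonneg ht (sub_nonneg.2 h2)]
  linarith

theorem Loc.induction_symm {n : ℕ} {B : ℕ → Finset Mat} (h : Loc Q n B) {A : Type*} [AddCommGroup A]
    (φ : Mat →+ A) (h0 : ∀ y ∈ MinSet Q, φ y = 0) (y : Mat) (hy : yᵀ = y) : φ y = 0 := by
  have := h.span y hy
  clear hy
  induction this using Submodule.span_induction with
  | mem x hx => exact h0 x hx
  | zero => exact map_zero φ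
  | add x y _ _ hx hy => rw [map_add, hx, hy, add_zero]
  | smul a x _ hx => rw [map_zsmul, hx, smul_zero]

/-- Additive maps vanishing on nine minimal vectors are proportional. -/
theorem WLoc.proportional (h : WLoc Q D) (hS : ↑S ⊆ MinSet Q) (hc : S.card = 9)
    (hne : ∀ a < D.n, ∃ x ∈ D.B a, x ∉ S) {A : Type*} [CommRing A] {s : Mat}
    (hs : ∀ a < D.n, ∑ x ∈ D.B a, x = s) (φ ψ : Mat →+ A) (hφ : ∀ y ∈ S, φ y = 0)
    (hψ : ∀ y ∈ S, ψ y = 0) (y : Mat) (hy : yᵀ = y) : φ s * ψ y = ψ s * φ y := by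
  obtain ⟨σ, hσ⟩ := h.exists_compl hS hc hne
  have hb : ∀ χ : Mat →+ A, (∀ y ∈ S, χ y = 0) → ∀ a < D.n, χ (σ a) = χ s := by
    intro χ hχ a ha
    refine map_block χ (hs a ha) (hσ a ha).1.1 fun x hx hxa => hχ x ?_
    by_contra hxS
    exact hxa ((hσ a ha).2 x hx hxS)
  have := h.induction_symm ((AddMonoidHom.mulLeft (φ s)).comp ψ -
    (AddMonoidHom.mulLeft (ψ s)).comp φ) (fun y hy => ?_) y hy
  · simpa [sub_eq_zero] using this
  · simp only [AddMonoidHom.sub_apply, AddMonoidHom.comp_apply, AddMonoidHom.coe_mulLeft]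
    by_cases hyS : y ∈ S
    · rw [hφ y hyS, hψ y hyS]; simp
    · obtain ⟨a, ha, hya⟩ := (h.mem_iff y).1 hy
      rw [(hσ a ha).2 y hya hyS, hb φ hφ a ha, hb ψ hψ a ha, mul_comm, sub_self]

theorem WLoc.pair_block_pos (h : WLoc Q D) {s : Mat} (hs : ∀ a < D.n, ∑ x ∈ D.B a, x = s)
    (hQ' : Q' ∈ Perf) (hne : Q' ≠ Q) : 0 < pair (Q' - Q) s := by
  have hmin : ∀ a < D.n, ∀ y ∈ D.B a, y ∈ MinSet Q :=
    fun a ha y hy => (h.mem_iff y).2 ⟨a, ha, hy⟩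
  have hnn : ∀ a < D.n, ∀ x ∈ D.B a, 0 ≤ pair (Q' - Q) x := fun a ha x hx =>
    MinSet.pair_sub_nonneg hQ' (hmin a ha x hx)
  refine lt_of_le_of_ne ?_ fun h0 => hne (h.eq_of_pair_sub hQ' fun y hy => ?_)
  · rw [← hs 0 h.pos, pair_sum]
    exact Finset.sum_nonneg (hnn 0 h.pos)
  · obtain ⟨b, hb, hyb⟩ := (h.mem_iff y).1 hy
    rw [← hs b hb, pair_sum, eq_comm, Finset.sum_eq_zero_iff_of_nonneg (hnn b hb)] at h0
    exact h0 y hyb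

theorem eq_of_three {Q'' : Mat} (hQ : Q ∈ Perf) (hQ' : Q' ∈ Perf) (hQ'' : Q'' ∈ Perf)
    (hc : S.card = 9) (hS : ↑S ⊆ MinSet Q) (hS' : ↑S ⊆ MinSet Q') (hS'' : ↑S ⊆ MinSet Q'')
    (h1 : Q' ≠ Q) (h2 : Q'' ≠ Q) : Q' = Q'' := by
  have h := wLoc hQ
  obtain ⟨s, hs⟩ := h.block
  have hz : ∀ R, ↑S ⊆ MinSet R → ∀ y ∈ S, pairHom (R - Q) y = 0 := fun R hR y hy =>
    MinSet.pair_sub_eq_zero (hR hy) (hS hy)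
  have key := h.proportional hS hc (h.toLoc.exists_notMem_of_ne hQ' h1 hS') hs
    (pairHom (Q' - Q)) (pairHom (Q'' - Q)) (hz _ hS') (hz _ hS'')
  simp only [pairHom_apply] at key
  have p1 := h.pair_block_pos hs hQ' h1
  have p2 := h.pair_block_pos hs hQ'' h2
  rcases lt_trichotomy (pair (Q' - Q) s) (pair (Q'' - Q) s) with hlt | heq | hlt
  · exact absurd (eq_of_three_aux hQ hQ' hQ'' p1.le hlt fun y hy => (key y hy).symm).symm h1
  · refine sub_left_injective (b := Q) (sub_eq_zero.1 (h.eq_zero ?_ fun y hy => ?_))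
    · simp [transpose_sub, transpose_of_mem_Perf hQ', transpose_of_mem_Perf hQ'']
    · obtain ⟨w, rfl, -⟩ := hy
      have := key _ (rk1_symm w)
      rw [heq] at this
      have := mul_left_cancel₀ p2.ne' this
      rw [pair_sub_left, this, sub_self]
  · exact absurd (eq_of_three_aux hQ hQ'' hQ' p2.le hlt fun y hy => key y hy).symm h2

end Nine

section Signs

/-- The sum of the minimal vectors. -/
noncomputable def minSum (Q : Mat) : Mat := ∑ x ∈ minF Q, x

theorem minSum_coact {Q : Mat} (hQ : Q ∈ Perf) (g : SL4) :
    minSum (coact g Q) = cong g (minSum Q) := by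
  rw [minSum, minF_coact hQ, Finset.sum_image fun x _ y _ h => cong_injective g h, minSum, cong_sum]

theorem transpose_minSum {Q : Mat} (hQ : Q ∈ Perf) : (minSum Q)ᵀ = minSum Q := by
  rw [minSum, transpose_sum]
  refine Finset.sum_congr rfl fun x hx => ?_
  obtain ⟨w, rfl⟩ := exists_rk1_of_mem_minF hQ x hx
  exact rk1_symm w

/-- Orientation of nine minimal vectors relative to the perfect form. -/
noncomputable def orient (k : Type) [Field k] (Q : Mat) (l : List Mat) : k :=
  ((SignType.sign (ori (minSum Q :: l)) : SignType) : k)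

variable {k : Type} [Field k] {Q Q' : Mat} {D : LocData} {S : Finset Mat}

theorem isAlt_orient (Q : Mat) : IsAlt (orient k Q) := by
  intro l₁ a b l₂
  have := isAlt_ori (minSum Q :: l₁) a b l₂
  rw [List.cons_append, List.cons_append] at this
  rw [orient, orient, this, Left.sign_neg, SignType.coe_neg]

theorem ori_eq_zero_of_mem {x : Mat} {l : List Mat} (hx : x ∈ l) : ori (x :: l) = 0 := by
  have hp := (List.perm_cons_erase hx).cons x
  refine isAlt_ori.eq_zero_of_perm hp.symm ?_
  have := isAlt_ori [] x x (l.erase x)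
  simp only [List.nil_append] at this
  linarith

theorem orient_coact (hQ : Q ∈ Perf) (g : SL4) {l : List Mat} (hl : ∀ x ∈ l, xᵀ = x) :
    orient k (coact g Q) (l.map (cong g)) = orient k Q l := by
  rw [orient, orient, minSum_coact hQ, ← List.map_cons, ori_cong_pos g]
  simpa [transpose_minSum hQ] using hl

theorem WLoc.minSum_eq (h : WLoc Q D) {s : Mat} (hs : ∀ a < D.n, ∑ x ∈ D.B a, x = s) :
    minSum Q = D.n • s := by
  rw [minSum, h.minF_eq, Finset.sum_biUnion h.disjoint,
    Finset.sum_congr rfl fun a ha => hs a (Finset.mem_range.1 ha), Finset.sum_const,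
    Finset.card_range]

theorem WLoc.ori_minSum (h : WLoc Q D) {s : Mat} (hs : ∀ a < D.n, ∑ x ∈ D.B a, x = s)
    (l : List Mat) : ori (minSum Q :: l) = D.n * ori (s :: l) := by
  rw [h.minSum_eq hs, ← oriHom_apply, map_nsmul, nsmul_eq_mul, oriHom_apply]

theorem WLoc.orient_eq_zero (h : WLoc Q D) {l : List Mat} {a : ℕ} (ha : a < D.n)
    (hl : ∀ x ∈ D.B a, x ∈ l) : orient k Q l = 0 := by
  obtain ⟨s, hs⟩ := h.block
  have : ori (s :: l) = 0 := by
    rw [← oriHom_apply, ← hs a ha, map_sum]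
    exact Finset.sum_eq_zero fun x hx => ori_eq_zero_of_mem (hl x hx)
  rw [orient, h.ori_minSum hs, this, mul_zero, sign_zero, SignType.coe_zero]

theorem WLoc.orient_eq_zero_of_not_isCell (h : WLoc Q D) (hS : ↑S ⊆ MinSet Q) (hc : S.card = 9)
    (hS' : ¬ IsCell S) {l : List Mat} (hl : ∀ x ∈ S, x ∈ l) : orient k Q l = 0 := by
  have : ∃ a < D.n, ∀ x ∈ D.B a, x ∈ S := by
    by_contra! hne
    exact hS' (h.isCell_nine hS hc hne)
  obtain ⟨a, ha, hB⟩ := this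
  exact h.orient_eq_zero ha fun x hx => hl x (hB x hx)

theorem coe_sign_ne_zero {x : ℚ} (hx : x ≠ 0) : ((SignType.sign x : SignType) : k) ≠ 0 := by
  rcases lt_or_gt_of_ne hx with h | h
  · rw [sign_neg h]; simp
  · rw [sign_pos h]; simp

theorem WLoc.orient_ne_zero (h : WLoc Q D) (hS : ↑S ⊆ MinSet Q) (hc : S.card = 9)
    (hne : ∀ a < D.n, ∃ x ∈ D.B a, x ∉ S) : orient k Q S.toList ≠ 0 := by
  obtain ⟨s, hs⟩ := h.block
  obtain ⟨σ, hσ⟩ := h.exists_compl hS hc hne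
  have hSl : ∀ a < D.n, ∀ y ∈ D.B a, y ≠ σ a → y ∈ S := fun a ha y hy hya => by
    by_contra hyS
    exact hya ((hσ a ha).2 y hy hyS)
  have h0 : ori (σ 0 :: S.toList) = ori (s :: S.toList) :=
    map_block (oriHom S.toList) (hs 0 h.pos) (hσ 0 h.pos).1.1 fun x hx hx0 =>
      ori_eq_zero_of_mem (Finset.mem_toList.2 (hSl 0 h.pos x hx hx0))
  have h1 : ori (σ 0 :: S.toList) ≠ 0 := by
    refine ori_ne_zero (by simp [hc]) fun x hx => ?_
    refine Submodule.span_le.2 ?_ (h.span x hx)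
    set V := Submodule.span ℤ {y | y ∈ σ 0 :: S.toList} with hV
    have hVS : ∀ y ∈ S, y ∈ V := fun y hy => Submodule.subset_span (by simp [hy])
    have hV0 : σ 0 ∈ V := Submodule.subset_span (by simp)
    have hVs : s ∈ V := by
      rw [← hs 0 h.pos]
      refine sum_mem fun y hy => ?_
      by_cases hy0 : y = σ 0
      · rw [hy0]; exact hV0
      · exact hVS y (hSl 0 h.pos y hy hy0)
    intro y hy
    obtain ⟨a, ha, hya⟩ := (h.mem_iff y).1 hy
    by_cases hyσ : y = σ a
    · have : y = s - ∑ x ∈ (D.B a).erase y, x := by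
        rw [eq_sub_iff_add_eq, ← hs a ha, Finset.add_sum_erase _ (fun x => x) hya]
      rw [this]
      refine sub_mem hVs (sum_mem fun x hx => ?_)
      rw [Finset.mem_erase] at hx
      exact hVS x (hSl a ha x hx.2 (hyσ ▸ hx.1))
    · exact hVS y (hSl a ha y hya hyσ)
  rw [orient, h.ori_minSum hs]
  refine coe_sign_ne_zero (mul_ne_zero ?_ (h0 ▸ h1))
  exact_mod_cast h.pos.ne'

theorem WLoc.orient_add_eq_zero (h : WLoc Q D) (hQ' : Q' ∈ Perf) (hne : Q' ≠ Q)
    (hc : S.card = 9) (hS : ↑S ⊆ MinSet Q) (hS' : ↑S ⊆ MinSet Q') :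
    orient k Q S.toList + orient k Q' S.toList = 0 := by
  obtain ⟨s, hs⟩ := h.block
  have key := h.proportional hS hc (h.toLoc.exists_notMem_of_ne hQ' hne hS') hs
    ((Int.castAddHom ℚ).comp (pairHom (Q' - Q))) (oriHom S.toList)
    (fun y hy => by
      have := MinSet.pair_sub_eq_zero (hS' hy) (hS hy)
      simp [pairHom_apply, this])
    (fun y hy => ori_eq_zero_of_mem (Finset.mem_toList.2 hy)) (minSum Q') (transpose_minSum hQ')
  simp only [AddMonoidHom.comp_apply, pairHom_apply, Int.coe_castAddHom, oriHom_apply] at key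
  have p1 : (0 : ℚ) < pair (Q' - Q) s := by exact_mod_cast h.pair_block_pos hs hQ' hne
  have p2 : (pair (Q' - Q) (minSum Q') : ℚ) < 0 := by
    obtain ⟨s', hs'⟩ := (wLoc hQ').block
    have := (wLoc hQ').pair_block_pos hs' h.perf hne.symm
    rw [(wLoc hQ').minSum_eq hs', ← natCast_zsmul, pair_smul]
    rw [pair_sub_left] at this ⊢
    have hn := (wLoc hQ').pos
    have : (((locData Q').n : ℤ) * (pair Q' s' - pair Q s')) < 0 :=
      mul_neg_of_pos_of_neg (by exact_mod_cast hn) (by linarith)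
    exact_mod_cast this
  have hn : (0 : ℚ) < D.n := by exact_mod_cast h.pos
  have e := congrArg SignType.sign key
  rw [sign_mul, sign_mul, sign_pos p1, sign_neg p2, one_mul, mul_neg_one] at e
  rw [orient, orient, e, h.ori_minSum hs, sign_mul, sign_pos hn, one_mul, SignType.coe_neg,
    add_neg_cancel]

end Signs

section FaceSum

variable {X : Type} {k : Type} [Field k]

theorem IsAlt.mul_eq_mul_of_perm {f o : List X → k} (hf : IsAlt f) (ho : IsAlt o) {l l' : List X}
    (h : l.Perm l') : f l * o l = f l' * o l' := by
  obtain ⟨s, hs, h⟩ := exists_sign_of_perm k h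
  rw [h f hf, h o ho]
  rcases hs with rfl | rfl <;> ring

variable [DecidableEq X]

theorem faceSum_mul {f o : List X → k} (hf : IsAlt f) (ho : IsAlt o) {l : List X} (hl : l.Nodup) :
    faceSum f l * o l = ∑ w ∈ l.toFinset, f (l.erase w) * o (w :: l.erase w) := by
  induction l generalizing f o with
  | nil => simp [faceSum_nil]
  | cons a l ih =>
    obtain ⟨ha, hl⟩ := List.nodup_cons.1 hl
    have ha' : a ∉ l.toFinset := by simpa using ha
    rw [List.toFinset_cons, Finset.sum_insert ha', List.erase_cons_head, faceSum_cons, sub_mul,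
      ih (hf.cons a) (ho.cons a) hl, sub_eq_add_neg, ← Finset.sum_neg_distrib]
    congr 1
    refine Finset.sum_congr rfl fun w hw => ?_
    have hwa : w ≠ a := fun e => ha' (e ▸ hw)
    rw [List.erase_cons_tail (by simpa using hwa.symm)]
    have := ho [] a w (l.erase w)
    simp only [List.nil_append] at this
    rw [this]; ring

theorem sum_powersetCard_faceSum {f o : List X → k} (hf : IsAlt f) (ho : IsAlt o) (U : Finset X)
    (m : ℕ) : ∑ S ∈ U.powersetCard (m + 1), faceSum f S.toList * o S.toList =
      ∑ Y ∈ U.powersetCard m, f Y.toList * ∑ w ∈ U \ Y, o (w :: Y.toList) := by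
  have h1 : ∀ S : Finset X, faceSum f S.toList * o S.toList =
      ∑ w ∈ S, f (S.erase w).toList * o (w :: (S.erase w).toList) := fun S => by
    rw [faceSum_mul hf ho S.nodup_toList, Finset.toList_toFinset]
    refine Finset.sum_congr rfl fun w _ => ?_
    refine hf.mul_eq_mul_of_perm (ho.cons w) ?_
    refine (List.perm_ext_iff_of_nodup (S.nodup_toList.erase w) (Finset.nodup_toList _)).2
      fun x => ?_
    rw [S.nodup_toList.mem_erase_iff]
    simp
  simp only [h1, Finset.mul_sum]
  rw [Finset.sum_sigma', Finset.sum_sigma']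
  refine Finset.sum_bij' (fun p _ => ⟨p.1.erase p.2, p.2⟩) (fun p _ => ⟨insert p.2 p.1, p.2⟩)
    ?_ ?_ ?_ ?_ ?_
  · rintro ⟨S, w⟩ h
    simp only [Finset.mem_sigma, Finset.mem_powersetCard, Finset.mem_sdiff] at h ⊢
    refine ⟨⟨(Finset.erase_subset _ _).trans h.1.1, ?_⟩, h.1.1 h.2, Finset.notMem_erase _ _⟩
    rw [Finset.card_erase_of_mem h.2, h.1.2, Nat.add_sub_cancel]
  · rintro ⟨Y, w⟩ h
    simp only [Finset.mem_sigma, Finset.mem_powersetCard, Finset.mem_sdiff] at h ⊢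
    refine ⟨⟨Finset.insert_subset h.2.1 h.1.1, ?_⟩, Finset.mem_insert_self _ _⟩
    rw [Finset.card_insert_of_notMem h.2.2, h.1.2]
  · rintro ⟨S, w⟩ h
    simp only [Finset.mem_sigma] at h
    simp only [Finset.insert_erase h.2]
  · rintro ⟨Y, w⟩ h
    simp only [Finset.mem_sigma, Finset.mem_sdiff] at h
    simp only [Finset.erase_insert h.2.2]
  · rintro ⟨S, w⟩ _
    rfl

end FaceSum

section TopBoundary

variable {k : Type} [Field k]

variable (k) in
/-- Finitely supported functions on the perfect forms. -/
def perfChains : Submodule k (Mat → k) where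
  carrier := {f | f.support.Finite ∧ ∀ Q, f Q ≠ 0 → Q ∈ Perf}
  zero_mem' := ⟨by simp, by simp⟩
  add_mem' := by
    rintro f g ⟨hf, hf'⟩ ⟨hg, hg'⟩
    refine ⟨(hf.union hg).subset (Function.support_add f g), fun Q hQ => ?_⟩
    by_cases h : f Q = 0
    · exact hg' Q fun h' => hQ (by simp [h, h'])
    · exact hf' Q h
  smul_mem' := by
    rintro c f ⟨hf, hf'⟩
    refine ⟨hf.subset fun Q hQ hQ' => hQ ?_, fun Q hQ => hf' Q fun h => hQ ?_⟩
    · simp [hQ']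
    · simp [h]

open Classical in
/-- The boundary from chains on cells with nine elements to chains on perfect forms. -/
noncomputable def topBoundary (f : List Mat → k) (Q : Mat) : k :=
  if Q ∈ Perf then ∑ S ∈ (minF Q).powersetCard 9, f S.toList * orient k Q S.toList else 0

theorem topBoundary_of_mem (f : List Mat → k) {Q : Mat} (hQ : Q ∈ Perf) :
    topBoundary f Q = ∑ S ∈ (minF Q).powersetCard 9, f S.toList * orient k Q S.toList := if_pos hQ

theorem topBoundary_of_notMem (f : List Mat → k) {Q : Mat} (hQ : Q ∉ Perf) :
    topBoundary f Q = 0 := if_neg hQ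

theorem topBoundary_add (f g : List Mat → k) :
    topBoundary (f + g) = topBoundary f + topBoundary g := by
  funext Q
  by_cases hQ : Q ∈ Perf
  · simp only [Pi.add_apply, topBoundary_of_mem _ hQ, add_mul, Finset.sum_add_distrib]
  · simp only [Pi.add_apply, topBoundary_of_notMem _ hQ, add_zero]

theorem topBoundary_smul (c : k) (f : List Mat → k) :
    topBoundary (c • f) = c • topBoundary f := by
  funext Q
  by_cases hQ : Q ∈ Perf
  · simp only [Pi.smul_apply, topBoundary_of_mem _ hQ, smul_eq_mul, mul_assoc, Finset.mul_sum]
  · simp only [Pi.smul_apply, topBoundary_of_notMem _ hQ, smul_zero]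

theorem exists_of_topBoundary_ne_zero {f : List Mat → k} {Q : Mat} (h : topBoundary f Q ≠ 0) :
    Q ∈ Perf ∧ ∃ S ⊆ minF Q, S.card = 9 ∧ f S.toList ≠ 0 := by
  have hQ : Q ∈ Perf := by
    by_contra hQ
    exact h (topBoundary_of_notMem f hQ)
  rw [topBoundary_of_mem f hQ] at h
  obtain ⟨S, hS, hne⟩ := Finset.exists_ne_zero_of_sum_ne_zero h
  rw [Finset.mem_powersetCard] at hS
  exact ⟨hQ, S, hS.1, hS.2, left_ne_zero_of_mul hne⟩

theorem isCell_of_altChains {n : ℕ} {f : List Mat → k} (hf : f ∈ altChains k IsCell n)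
    {S : Finset Mat} (h : f S.toList ≠ 0) : IsCell S := by
  have := (hf.2.1 _ h).1.2
  rwa [Finset.toList_toFinset] at this

theorem topBoundary_mem {f : List Mat → k} (hf : f ∈ altChains k IsCell 0) :
    topBoundary f ∈ perfChains k := by
  refine ⟨?_, fun Q hQ => (exists_of_topBoundary_ne_zero hQ).1⟩
  have hfin : (⋃ l ∈ f.support, {Q | Q ∈ Perf ∧ ↑l.toFinset ⊆ MinSet Q}).Finite :=
    hf.1.biUnion fun l hl => finite_perf_above (hf.2.1 l hl).1.2.2.2.1
  refine hfin.subset fun Q hQ => ?_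
  obtain ⟨hQ, S, hS, -, hne⟩ := exists_of_topBoundary_ne_zero hQ
  simp only [Set.mem_iUnion]
  refine ⟨S.toList, hne, hQ, ?_⟩
  rw [Finset.toList_toFinset, ← coe_minF hQ]
  exact Finset.coe_subset.2 hS

variable (k) in
noncomputable def topBoundaryMap : altChains k IsCell 0 →ₗ[k] perfChains k where
  toFun f := ⟨topBoundary f.1, topBoundary_mem f.2⟩
  map_add' f g := Subtype.ext (topBoundary_add f.1 g.1)
  map_smul' c f := Subtype.ext (topBoundary_smul c f.1)

theorem sum_orient_eq_zero {Q : Mat} (hQ : Q ∈ Perf) {Y : Finset Mat} (hY : Y ⊆ minF Q)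
    (hc : Y.card = 8) (hu : Unimod Y) : ∑ w ∈ minF Q \ Y, orient k Q (w :: Y.toList) = 0 := by
  have h := wLoc hQ
  set D := locData Q
  have hYQ : ↑Y ⊆ MinSet Q := by rw [← coe_minF hQ]; exact Finset.coe_subset.2 hY
  have hne := h.exists_notMem hYQ (by omega) hu
  have hsum := h.subset_card hYQ
  have h1 : ∀ a ∈ Finset.range D.n, 1 ≤ (D.B a \ Y).card := fun a ha => by
    obtain ⟨x, hx, hx'⟩ := hne a (Finset.mem_range.1 ha)
    exact Finset.card_pos.2 ⟨x, Finset.mem_sdiff.2 ⟨hx, hx'⟩⟩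
  obtain ⟨b, hb, hb2⟩ : ∃ b ∈ Finset.range D.n, 1 < (D.B b \ Y).card := by
    by_contra! hle
    have : ∑ a ∈ Finset.range D.n, (D.B a \ Y).card = ∑ a ∈ Finset.range D.n, 1 :=
      Finset.sum_congr rfl fun a ha => le_antisymm (hle a ha) (h1 a ha)
    rw [this] at hsum
    simp at hsum
    omega
  have hbn := Finset.mem_range.1 hb
  have hb3 : (D.B b \ Y).card = 2 := by
    have : ∑ a ∈ (Finset.range D.n).erase b, 1 ≤ ∑ a ∈ (Finset.range D.n).erase b,
      (D.B a \ Y).card := Finset.sum_le_sum fun a ha => h1 a (Finset.mem_of_mem_erase ha)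
    rw [← Finset.add_sum_erase _ _ hb] at hsum
    rw [Finset.sum_const, Finset.card_erase_of_mem hb, Finset.card_range, smul_eq_mul] at this
    omega
  obtain ⟨w₁, w₂, hw, hT⟩ := Finset.card_eq_two.1 hb3
  have hTsub : D.B b \ Y ⊆ minF Q \ Y := by
    refine Finset.sdiff_subset_sdiff (fun x hx => ?_) le_rfl
    exact (mem_minF hQ x).2 ((h.mem_iff x).2 ⟨b, hbn, hx⟩)
  have hmemT : ∀ x, x ∈ D.B b ∧ x ∉ Y ↔ x = w₁ ∨ x = w₂ := fun x => by
    rw [← Finset.mem_sdiff, hT]; simp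
  rw [← Finset.sum_subset hTsub, hT, Finset.sum_pair hw]
  · obtain ⟨s, hs⟩ := h.block
    have e1 : ori (minSum Q :: w₁ :: Y.toList) + ori (minSum Q :: w₂ :: Y.toList) = 0 := by
      have hswap : ∀ x, ori (minSum Q :: x :: Y.toList) =
          -oriHom (minSum Q :: Y.toList) x := fun x => isAlt_ori [] _ _ _
      have hz : oriHom (minSum Q :: Y.toList) s = 0 := by
        have h2 := isAlt_ori [] s (minSum Q) Y.toList
        simp only [List.nil_append] at h2
        rw [oriHom_apply, h2, h.ori_minSum hs, ori_eq_zero_of_mem (by simp), mul_zero, neg_zero]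
      have hw1 := (hmemT w₁).2 (Or.inl rfl)
      rw [← hs b hbn, map_sum, ← Finset.sum_subset (s₁ := {w₁, w₂}), Finset.sum_pair hw] at hz
      · rw [hswap, hswap, ← neg_add, hz, neg_zero]
      · rw [← hT]; exact Finset.sdiff_subset
      · intro x hx hxw
        refine ori_eq_zero_of_mem (List.mem_cons_of_mem _ (Finset.mem_toList.2 ?_))
        by_contra hxY
        have := (hmemT x).1 ⟨hx, hxY⟩
        exact hxw (by simpa using this)
    rw [orient, orient, eq_neg_of_add_eq_zero_left e1, Left.sign_neg, SignType.coe_neg,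
      neg_add_cancel]
  · intro w hwU hwT
    rw [Finset.mem_sdiff] at hwU
    obtain ⟨a, ha, hwa⟩ := (h.mem_iff w).1 ((mem_minF hQ w).1 hwU.1)
    have hab : a ≠ b := by
      rintro rfl
      exact hwT (Finset.mem_sdiff.2 ⟨hwa, hwU.2⟩)
    have hcard : (D.B a \ Y).card = 1 := by
      have hae : a ∈ (Finset.range D.n).erase b :=
        Finset.mem_erase.2 ⟨hab, Finset.mem_range.2 ha⟩
      have : ∑ a ∈ ((Finset.range D.n).erase b).erase a, 1 ≤
        ∑ a ∈ ((Finset.range D.n).erase b).erase a, (D.B a \ Y).card :=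
        Finset.sum_le_sum fun a ha =>
          h1 a (Finset.mem_of_mem_erase (Finset.mem_of_mem_erase ha))
      rw [← Finset.add_sum_erase _ _ hb, ← Finset.add_sum_erase _ _ hae] at hsum
      rw [Finset.sum_const, Finset.card_erase_of_mem hae, Finset.card_erase_of_mem hb,
        Finset.card_range, smul_eq_mul] at this
      have := h1 a (Finset.mem_range.2 ha)
      omega
    obtain ⟨x, hx⟩ := Finset.card_eq_one.1 hcard
    have hmem : ∀ y, y ∈ D.B a ∧ y ∉ Y ↔ y = x := fun y => by
      rw [← Finset.mem_sdiff, hx, Finset.mem_singleton]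
    refine h.orient_eq_zero ha fun y hy => ?_
    by_cases hyY : y ∈ Y
    · exact List.mem_cons_of_mem _ (Finset.mem_toList.2 hyY)
    · rw [(hmem y).1 ⟨hy, hyY⟩, ← (hmem w).1 ⟨hwa, hwU.2⟩]
      exact List.mem_cons_self

theorem topBoundary_cellBoundary {f : List Mat → k} (hf : f ∈ altChains k IsCell 1) :
    topBoundary (cellBoundary IsCell f) = 0 := by
  funext Q
  by_cases hQ : Q ∈ Perf
  swap
  · exact topBoundary_of_notMem _ hQ
  have h1 : ∀ S ∈ (minF Q).powersetCard 9, cellBoundary IsCell f S.toList * orient k Q S.toList =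
      faceSum f S.toList * orient k Q S.toList := by
    intro S hS
    rw [Finset.mem_powersetCard] at hS
    by_cases hcell : IsCell S
    · rw [cellBoundary, if_pos ⟨S.nodup_toList, by rwa [Finset.toList_toFinset]⟩]
    · rw [(wLoc hQ).orient_eq_zero_of_not_isCell (by
        rw [← coe_minF hQ]; exact Finset.coe_subset.2 hS.1) hS.2 hcell
        fun x hx => Finset.mem_toList.2 hx, mul_zero, mul_zero]
  rw [topBoundary_of_mem _ hQ, Finset.sum_congr rfl h1,
    sum_powersetCard_faceSum hf.2.2 (isAlt_orient Q)]
  refine Finset.sum_eq_zero fun Y hY => ?_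
  rw [Finset.mem_powersetCard] at hY
  by_cases hfY : f Y.toList = 0
  · rw [hfY, zero_mul]
  · rw [sum_orient_eq_zero hQ hY.1 hY.2 (isCell_of_altChains hf hfY).2.2.2, mul_zero]

theorem IsCell.exists_pair {S : Finset Mat} (hS : IsCell S) (hc : S.card = 9) :
    ∃ Q Q', Q' ≠ Q ∧ (∀ R, R ∈ Perf ∧ ↑S ⊆ MinSet R ↔ R = Q ∨ R = Q') ∧
      orient k Q S.toList + orient k Q' S.toList = 0 := by
  obtain ⟨Q, hQ, hSQ⟩ := hS.2.1
  have h := wLoc hQ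
  obtain ⟨Q', hQ', hne, hSQ'⟩ := h.exists_other hSQ hc (h.exists_notMem hSQ hS.1 hS.2.2.2)
  refine ⟨Q, Q', hne, fun R => ⟨fun hR => ?_, ?_⟩, h.orient_add_eq_zero hQ' hne hc hSQ hSQ'⟩
  · by_cases hRQ : R = Q
    · exact Or.inl hRQ
    · exact Or.inr (eq_of_three hQ hR.1 hQ' hc hSQ hR.2 hSQ' hRQ hne)
  · rintro (rfl | rfl)
    exacts [⟨hQ, hSQ⟩, ⟨hQ', hSQ'⟩]

theorem finsum_topBoundary {f : List Mat → k} (hf : f ∈ altChains k IsCell 0) :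
    ∑ᶠ Q, topBoundary f Q = 0 := by
  classical
  let 𝓢 : Finset (Finset Mat) := hf.1.toFinset.image List.toFinset
  have h𝓢 : ∀ S, f S.toList ≠ 0 → S ∈ 𝓢 := fun S hS =>
    Finset.mem_image.2 ⟨S.toList, hf.1.mem_toFinset.2 hS, Finset.toList_toFinset S⟩
  have h𝓢' : ∀ S ∈ 𝓢, IsCell S ∧ S.card = 9 := by
    intro S hS
    obtain ⟨l, hl, rfl⟩ := Finset.mem_image.1 hS
    have := hf.2.1 l (hf.1.mem_toFinset.1 hl)
    exact ⟨this.1.2, by rw [List.toFinset_card_of_nodup this.1.1]; exact this.2⟩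
  have hfin : (⋃ S ∈ 𝓢, {Q | Q ∈ Perf ∧ ↑S ⊆ MinSet Q}).Finite :=
    𝓢.finite_toSet.biUnion fun S hS => finite_perf_above (h𝓢' S hS).1.2.2.1
  let 𝓠 := hfin.toFinset
  have h𝓠 : ∀ Q, Q ∈ 𝓠 ↔ ∃ S ∈ 𝓢, Q ∈ Perf ∧ ↑S ⊆ MinSet Q := fun Q => by
    rw [hfin.mem_toFinset]; simp only [Set.mem_iUnion, exists_prop]; rfl
  rw [finsum_eq_sum_of_support_subset (s := 𝓠)]
  swap
  · intro Q hQ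
    obtain ⟨hQ, S, hS, -, hne⟩ := exists_of_topBoundary_ne_zero hQ
    refine Finset.mem_coe.2 ((h𝓠 Q).2 ⟨S, h𝓢 S hne, hQ, ?_⟩)
    rw [← coe_minF hQ]
    exact Finset.coe_subset.2 hS
  have h1 : ∀ Q ∈ 𝓠, topBoundary f Q =
      ∑ S ∈ 𝓢, if ↑S ⊆ MinSet Q then f S.toList * orient k Q S.toList else 0 := by
    intro Q hQ
    obtain ⟨-, -, hQ, -⟩ := (h𝓠 Q).1 hQ
    rw [topBoundary_of_mem f hQ, ← Finset.sum_filter]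
    have hsub : ∀ S : Finset Mat, S ⊆ minF Q ↔ ↑S ⊆ MinSet Q := fun S => by
      rw [← coe_minF hQ, Finset.coe_subset]
    refine (Finset.sum_subset (fun S hS => ?_) fun S hS hS' => ?_).symm
    · rw [Finset.mem_filter] at hS
      exact Finset.mem_powersetCard.2 ⟨(hsub S).2 hS.2, (h𝓢' S hS.1).2⟩
    · rw [Finset.mem_powersetCard] at hS
      rw [Finset.mem_filter] at hS'
      by_cases hne : f S.toList = 0
      · rw [hne, zero_mul]
      · exact absurd ⟨h𝓢 S hne, (hsub S).1 hS.1⟩ hS'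
  rw [Finset.sum_congr rfl h1, Finset.sum_comm]
  refine Finset.sum_eq_zero fun S hS => ?_
  obtain ⟨Q, Q', hne, hiff, hor⟩ := (h𝓢' S hS).1.exists_pair (k := k) (h𝓢' S hS).2
  rw [← Finset.sum_filter]
  have : 𝓠.filter (fun Q => ↑S ⊆ MinSet Q) = {Q, Q'} := by
    ext R
    rw [Finset.mem_filter, h𝓠, Finset.mem_insert, Finset.mem_singleton, ← hiff]
    exact ⟨fun ⟨⟨_, _, h1, _⟩, h2⟩ => ⟨h1, h2⟩, fun h => ⟨⟨S, hS, h⟩, h.2⟩⟩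
  rw [this, Finset.sum_pair hne.symm, ← mul_add, hor, mul_zero]

end TopBoundary

section CellDelta

variable {k : Type} [Field k]

/-- An arbitrary linear order on matrices, used to choose signs. -/
@[reducible] noncomputable def matOrder : LinearOrder Mat :=
  haveI := Classical.decRel (WellOrderingRel (α := Mat))
  linearOrderOfSTO (WellOrderingRel (α := Mat))

variable (k) in
/-- The alternating delta function at an enumeration of a cell. -/
noncomputable def cellDelta (x l : List Mat) : k :=
  @altDelta Mat k _ matOrder x l

theorem isAlt_cellDelta (x : List Mat) : IsAlt (cellDelta k x) :=
  @isAlt_altDelta Mat k _ matOrder x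

theorem cellDelta_self {x : List Mat} (hx : x.Nodup) : cellDelta k x x = 1 :=
  @altDelta_self Mat k _ matOrder x hx

theorem cellDelta_ne_zero {x l : List Mat} (h : cellDelta k x l ≠ 0) : x.Nodup ∧ l.Perm x :=
  @altDelta_ne_zero Mat k _ matOrder x l h

theorem cellDelta_eq_zero {x l : List Mat} (h : ¬ l.Perm x) : cellDelta k x l = 0 := by
  by_contra h'
  exact h (cellDelta_ne_zero h').2

theorem cellDelta_mem {n : ℕ} {x : List Mat} (hx : IsCell x.toFinset) (hn : x.length + n = 9) :
    cellDelta k x ∈ altChains k IsCell n := by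
  refine ⟨?_, fun l hl => ?_, isAlt_cellDelta x⟩
  · refine (x.permutations.toFinset.finite_toSet).subset fun l hl => ?_
    simpa using (cellDelta_ne_zero hl).2
  · obtain ⟨h1, h2⟩ := cellDelta_ne_zero hl
    exact ⟨⟨h2.nodup_iff.2 h1, by rwa [List.toFinset_eq_of_perm _ _ h2]⟩, by rw [h2.length_eq, hn]⟩

end CellDelta

section Exactness

variable {k : Type} [Field k] {Q : Mat} {D : LocData}

theorem WLoc.sum_m_neg (h : WLoc Q D) {Q' : Mat} (hQ' : Q' ∈ Perf) (hlt : ht Q' < ht Q) :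
    ∑ a ∈ Finset.range D.n, D.c (D.m a) < 0 := by
  obtain ⟨s, hs⟩ := h.block
  have hmin : ∀ a < D.n, ∀ y ∈ D.B a, y ∈ MinSet Q :=
    fun a ha y hy => (h.mem_iff y).2 ⟨a, ha, hy⟩
  have hne : Q' ≠ Q := by rintro rfl; exact lt_irrefl _ hlt
  have hpos : (0 : ℝ) < pair (Q' - Q) s := by exact_mod_cast h.pair_block_pos hs hQ' hne
  have hge : (∑ a ∈ Finset.range D.n, D.c (D.m a)) * pair (Q' - Q) s ≤ ht (Q' - Q) := by
    rw [h.ht_eq, Finset.sum_mul]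
    refine Finset.sum_le_sum fun a ha => ?_
    have ha := Finset.mem_range.1 ha
    rw [← hs a ha, pair_sum, Int.cast_sum, Finset.mul_sum]
    refine Finset.sum_le_sum fun y hy => mul_le_mul_of_nonneg_right (h.m_le a ha y hy) ?_
    exact_mod_cast MinSet.pair_sub_nonneg hQ' (hmin a ha y hy)
  by_contra! hnn
  rw [ht_sub] at hge
  nlinarith [mul_nonneg hnn hpos.le]

/-- The minimal vectors of `Q` other than the distinguished ones. -/
noncomputable def topCell (Q : Mat) : Finset Mat :=
  minF Q \ (Finset.range (locData Q).n).image (locData Q).m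

theorem mem_topCell {x : Mat} :
    x ∈ topCell Q ↔ x ∈ minF Q ∧ ∀ a < (locData Q).n, x ≠ (locData Q).m a := by
  simp only [topCell, Finset.mem_sdiff, Finset.mem_image, Finset.mem_range, not_exists, not_and]
  exact and_congr_right fun _ => forall₂_congr fun _ _ => ne_comm

theorem topCell_subset (hQ : Q ∈ Perf) : ↑(topCell Q) ⊆ MinSet Q := by
  rw [← coe_minF hQ]
  exact Finset.coe_subset.2 Finset.sdiff_subset

theorem topCell_compl (hQ : Q ∈ Perf) : ∀ a < (locData Q).n, ∀ x ∈ (locData Q).B a,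
    x ∉ topCell Q → x = (locData Q).m a := by
  intro a ha x hx hx'
  have h := wLoc hQ
  have hxQ : x ∈ minF Q := (mem_minF hQ x).2 ((h.mem_iff x).2 ⟨a, ha, hx⟩)
  by_contra hne
  refine hx' (mem_topCell.2 ⟨hxQ, fun b hb hxb => ?_⟩)
  have := h.disj a ha b hb x hx (hxb ▸ h.m_mem b hb)
  exact hne (this ▸ hxb)

theorem topCell_notMem (hQ : Q ∈ Perf) : ∀ a < (locData Q).n, ∃ x ∈ (locData Q).B a,
    x ∉ topCell Q := fun a ha =>
  ⟨_, (wLoc hQ).m_mem a ha, fun h => (mem_topCell.1 h).2 a ha rfl⟩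

theorem topCell_card (hQ : Q ∈ Perf) : (topCell Q).card = 9 :=
  (wLoc hQ).card_eq_nine (topCell_subset hQ) (topCell_notMem hQ) (topCell_compl hQ)

theorem topCell_crit (hQ : Q ∈ Perf) {Q' : Mat} (hQ' : Q' ∈ Perf) (hlt : ht Q' < ht Q) :
    (locData Q).Crit (topCell Q) := fun σ hσ => by
  refine lt_of_eq_of_lt (Finset.sum_congr rfl fun a ha => ?_) ((wLoc hQ).sum_m_neg hQ' hlt)
  have ha := Finset.mem_range.1 ha
  rw [topCell_compl hQ a ha _ (hσ a ha).1 (hσ a ha).2]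

theorem topBoundary_cellDelta {Q : Mat} (hQ : Q ∈ Perf) {S : Finset Mat} (hS : S ⊆ minF Q)
    (hc : S.card = 9) : topBoundary (cellDelta k S.toList) Q = orient k Q S.toList := by
  rw [topBoundary_of_mem _ hQ, Finset.sum_eq_single_of_mem S (Finset.mem_powersetCard.2 ⟨hS, hc⟩),
    cellDelta_self S.nodup_toList, one_mul]
  intro T _ hTS
  rw [cellDelta_eq_zero, zero_mul]
  intro hp
  have := List.toFinset_eq_of_perm _ _ hp
  rw [Finset.toList_toFinset, Finset.toList_toFinset] at this
  exact hTS this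

theorem topBoundary_sub (f g : List Mat → k) :
    topBoundary (f - g) = topBoundary f - topBoundary g := by
  rw [sub_eq_add_neg, topBoundary_add, ← neg_one_smul k g, topBoundary_smul, neg_one_smul,
    sub_eq_add_neg]

theorem finsum_sub_topBoundary {f : Mat → k} (hf : f ∈ perfChains k) {h : List Mat → k}
    (hh : h ∈ altChains k IsCell 0) : ∑ᶠ Q, (f - topBoundary h) Q = ∑ᶠ Q, f Q := by
  simp only [Pi.sub_apply]
  rw [finsum_sub_distrib hf.1 (topBoundary_mem hh).1, finsum_topBoundary hh, sub_zero]

theorem topBoundary_exact_zero {f : Mat → k} (hf : f ∈ perfChains k) (h0 : ∑ᶠ Q, f Q = 0) :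
    ∃ h ∈ altChains k IsCell 0, topBoundary h = f := by
  suffices H : ∀ N, ∀ f ∈ perfChains k, ∑ᶠ Q, f Q = 0 → (∀ Q, f Q ≠ 0 → htIndex Q ≤ N) →
      ∃ h ∈ altChains k IsCell 0, topBoundary h = f by
    obtain ⟨N, hN⟩ := (hf.1.image htIndex).bddAbove
    exact H N f hf h0 fun Q hQ => hN ⟨Q, hQ, rfl⟩
  intro N
  induction N with
  | zero =>
    intro f hf h0 hN
    refine ⟨0, zero_mem _, ?_⟩
    have hz : topBoundary (0 : List Mat → k) = 0 := by
      rw [← sub_self (0 : List Mat → k), topBoundary_sub, sub_self]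
    rw [hz, eq_comm]
    funext Q
    by_contra hQ
    have h1 : ∀ Q', Q' ≠ Q → f Q' = 0 := fun Q' hne => by
      by_contra hQ'
      exact hne (htIndex_injOn (hf.2 _ hQ') (hf.2 _ hQ)
        ((Nat.le_zero.1 (hN Q' hQ')).trans (Nat.le_zero.1 (hN Q hQ)).symm))
    rw [finsum_eq_single f Q h1] at h0
    exact hQ h0
  | succ N ih =>
    intro f hf h0 hN
    by_cases hex : ∃ Q, f Q ≠ 0 ∧ htIndex Q = N + 1
    swap
    · push Not at hex
      exact ih f hf h0 fun Q hQ => by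
        have := hN Q hQ
        have := hex Q hQ
        omega
    obtain ⟨Q, hfQ, hQN⟩ := hex
    have hQ := hf.2 Q hfQ
    obtain ⟨Q', hQ', hlt⟩ : ∃ Q' ∈ Perf, ht Q' < ht Q := by
      by_contra! hno
      have : {Q' | Q' ∈ Perf ∧ ht Q' < ht Q} = ∅ :=
        Set.eq_empty_of_forall_notMem fun R hR => absurd hR.2 (not_lt.2 (hno R hR.1))
      rw [htIndex, this, Set.ncard_empty] at hQN
      omega
    have hw := wLoc hQ
    have hcrit := topCell_crit hQ hQ' hlt
    have hcell := hw.isCell (topCell_subset hQ) (topCell_card hQ).le (topCell_notMem hQ) hcrit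
    have htop := hw.isTop (topCell_subset hQ) (topCell_notMem hQ) hcrit
    have hSm : topCell Q ⊆ minF Q := Finset.sdiff_subset
    set S := topCell Q with hS
    have hor : orient k Q S.toList ≠ 0 :=
      hw.orient_ne_zero (topCell_subset hQ) (topCell_card hQ) (topCell_notMem hQ)
    let g : List Mat → k := (f Q / orient k Q S.toList) • cellDelta k S.toList
    have hg : g ∈ altChains k IsCell 0 := Submodule.smul_mem _ _
      (cellDelta_mem (by rwa [Finset.toList_toFinset]) (by
        rw [Finset.length_toList, topCell_card hQ]))
    have hgQ : topBoundary g Q = f Q := by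
      rw [topBoundary_smul, Pi.smul_apply, topBoundary_cellDelta hQ hSm
        (topCell_card hQ), smul_eq_mul, div_mul_cancel₀ _ hor]
    obtain ⟨h, hh, hhf⟩ := ih (f - topBoundary g) (sub_mem hf (topBoundary_mem hg))
      (by rw [finsum_sub_topBoundary hf hg, h0]) fun R hR => by
        have hRQ : R ≠ Q := by
          rintro rfl
          exact hR (by rw [Pi.sub_apply, hgQ, sub_self])
        have hle : htIndex R ≤ N + 1 ∧ R ∈ Perf := by
          by_cases hfR : f R = 0
          · have hgR : topBoundary g R ≠ 0 := fun h => hR (by rw [Pi.sub_apply, hfR, h, sub_self])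
            obtain ⟨hRP, T, hTR, -, hT⟩ := exists_of_topBoundary_ne_zero hgR
            have hp := (cellDelta_ne_zero (right_ne_zero_of_mul hT)).2
            have hTS := List.toFinset_eq_of_perm _ _ hp
            rw [Finset.toList_toFinset, Finset.toList_toFinset] at hTS
            refine ⟨hQN ▸ htIndex_le hRP hQ (htop.2.2 R hRP ?_), hRP⟩
            rw [← coe_minF hRP, ← hTS]
            exact Finset.coe_subset.2 hTR
          · exact ⟨hN R hfR, hf.2 R hfR⟩
        have : htIndex R ≠ N + 1 := fun e => hRQ (htIndex_injOn hle.2 hQ (e.trans hQN.symm))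
        omega
    exact ⟨h + g, add_mem hh hg, by rw [topBoundary_add, hhf, sub_add_cancel]⟩

theorem eq_topCell {S : Finset Mat} (h : IsTopForm S Q) (hS : IsCell S) (hc : S.card = 9)
    (hp : cellPivot (cellRank S) ∉ S) :
    S = topCell Q ∧ (locData Q).stage S + 1 = (locData Q).n := by
  have hw := wLoc h.1
  obtain ⟨σ, hσ⟩ := hw.exists_compl h.2.1 hc (hw.exists_notMem h.2.1 hS.1 hS.2.2.2)
  rw [cellPivot_cellRank h] at hp
  set a := (locData Q).stage S with ha
  have han : a < (locData Q).n := hw.stage_lt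
  have hlast : a + 1 = (locData Q).n := by
    by_contra hne
    rcases (locData Q).stage_spec S with h1 | h1
    · omega
    · refine h1 fun x hx hxS => ?_
      rw [← ha] at hx ⊢
      rw [(hσ a han).2 x hx hxS, (hσ a han).2 _ (hw.m_mem a han) hp]
  have hall : ∀ b < (locData Q).n, (locData Q).m b = σ b := by
    intro b hb
    by_cases hba : b < a
    · exact ((locData Q).of_lt_stage hba).2 _ (hσ b hb).1.1 (hσ b hb).1.2 |>.symm
    · obtain rfl : b = a := by omega
      exact (hσ a han).2 _ (hw.m_mem a han) hp
  refine ⟨?_, hlast⟩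
  ext x
  rw [mem_topCell]
  constructor
  · intro hx
    refine ⟨(mem_minF h.1 x).2 (h.2.1 hx), fun b hb hxb => (hσ b hb).1.2 ?_⟩
    rw [← hall b hb, ← hxb]
    exact hx
  · rintro ⟨hx, hx'⟩
    obtain ⟨b, hb, hxb⟩ := (hw.mem_iff x).1 ((mem_minF h.1 x).1 hx)
    by_contra hxS
    exact hx' b hb (((hσ b hb).2 x hxb hxS).trans (hall b hb).symm)

theorem topBoundary_exact_one {f : List Mat → k} (hf : f ∈ altChains k IsCell 0)
    (hd : topBoundary f = 0) : ∃ h ∈ altChains k IsCell 1, cellBoundary IsCell h = f := by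
  suffices H : ∀ r, ∀ f ∈ altChains k IsCell 0, topBoundary f = 0 →
      (∀ l, f l ≠ 0 → cellRank l.toFinset < r) →
      ∃ h ∈ altChains k IsCell 1, cellBoundary IsCell h = f by
    obtain ⟨r, hr⟩ := (hf.1.image fun l => cellRank l.toFinset).bddAbove
    exact H (r + 1) f hf hd fun l hl => Nat.lt_succ_of_le (hr ⟨l, hl, rfl⟩)
  intro r
  induction r with
  | zero =>
    intro f hf _ hr
    refine ⟨0, zero_mem _, ?_⟩
    have : f = 0 := by
      funext l
      by_contra h
      exact absurd (hr l h) (Nat.not_lt_zero _)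
    have hz : cellBoundary IsCell (0 : List Mat → k) = 0 := by
      rw [← sub_self (0 : List Mat → k), cellBoundary_sub, sub_self, sub_zero]
    rw [this, hz]
  | succ r ih =>
    intro f hf hd hr
    obtain ⟨h, hh, hred⟩ := pivotData_isCell.exists_reduction cellFamily_isCell hf
      fun l hl => Nat.le_of_lt_succ (hr l hl)
    have hf' : f - cellBoundary IsCell h ∈ altChains k IsCell 0 :=
      sub_mem hf (cellBoundary_mem cellFamily_isCell hh)
    set f' := f - cellBoundary IsCell h with hf'def
    have hd' : topBoundary f' = 0 := by
      rw [hf'def, topBoundary_sub, hd, topBoundary_cellBoundary hh, sub_zero]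
    obtain ⟨h', hh', he⟩ := ih f' hf' hd' fun l hl => by
      rcases hred l hl with hlt | ⟨hrk, hpv⟩
      · exact hlt
      exfalso
      have hcl := hf'.2.1 l hl
      have hcard : l.toFinset.card = 9 := by rw [List.toFinset_card_of_nodup hcl.1.1]; exact hcl.2
      obtain ⟨S, hS⟩ : ∃ S, S = l.toFinset := ⟨_, rfl⟩
      have hcS : IsCell S := hS ▸ hcl.1.2
      rw [← hS] at hcard hrk
      have htop := hcS.isTop
      obtain ⟨Q, hQdef⟩ : ∃ Q, Q = topForm S := ⟨_, rfl⟩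
      rw [← hQdef] at htop
      have hpS : cellPivot (cellRank S) ∉ S := by
        rw [hrk, hS]; simpa using hpv
      obtain ⟨hSQ, hst⟩ := eq_topCell htop hcS hcard hpS
      have hw := wLoc htop.1
      have hp : l.Perm S.toList := by
        rw [hS]
        exact (List.perm_ext_iff_of_nodup hcl.1.1 (Finset.nodup_toList _)).2 fun x => by simp
      have hSne : f' S.toList ≠ 0 := fun h0 => hl (hf'.2.2.eq_zero_of_perm hp.symm h0)
      have hSm : S ⊆ minF Q := fun x hx => (mem_minF htop.1 x).2 (htop.2.1 hx)
      have hval := congrFun hd' Q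
      rw [topBoundary_of_mem _ htop.1, Finset.sum_eq_single_of_mem S
        (Finset.mem_powersetCard.2 ⟨hSm, hcard⟩)] at hval
      · exact (mul_ne_zero hSne (hw.orient_ne_zero htop.2.1 hcard
          (hw.exists_notMem htop.2.1 hcS.1 hcS.2.2.2))) hval
      · intro T hT hTS
        rw [Finset.mem_powersetCard] at hT
        by_contra hne
        have hTne := left_ne_zero_of_mul hne
        have hTcell := isCell_of_altChains hf' hTne
        have hTtop := hTcell.isTop
        have hrT : cellRank T ≤ r ∧ (cellRank T = r → cellPivot r ∉ T) := by
          have := hred _ hTne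
          rw [Finset.toList_toFinset] at this
          rcases this with h1 | ⟨h1, h2⟩
          · exact ⟨h1.le, fun h => absurd h h1.ne⟩
          · exact ⟨h1.le, fun _ => by simpa using h2⟩
        have hTQ : ↑T ⊆ MinSet Q := by
          rw [← coe_minF htop.1]
          exact Finset.coe_subset.2 hT.1
        have hle := htIndex_le htop.1 hTtop.1 (hTtop.2.2 Q htop.1 hTQ)
        have e1 := cellRank_eq htop
        have e2 := cellRank_eq hTtop
        have b1 := hw.stage_le_two (S := S)
        have b2 := (wLoc hTtop.1).stage_le_two (S := T)
        have hidx : htIndex (topForm T) = htIndex Q := by omega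
        have hQT : topForm T = Q := htIndex_injOn hTtop.1 htop.1 hidx
        rw [hQT] at hTtop e2 b2
        have b3 := hw.stage_lt (S := T)
        have hrk' : cellRank T = r := by omega
        exact hTS ((eq_topCell hTtop hTcell hT.2 (hrk'.symm ▸ hrT.2 hrk')).1.trans hSQ.symm)
    refine ⟨h' + h, add_mem hh' hh, ?_⟩
    rw [cellBoundary_add, he, hf'def, sub_add_cancel]

end Exactness

section Complex

open scoped CategoryTheory

variable {k : Type} [Field k]

theorem toFinset_map_cong (g : SL4) (l : List Mat) :
    (l.map (cong g)).toFinset = l.toFinset.image (cong g) := by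
  ext x
  simp

theorem isCellList_map_cong (g : SL4) (l : List Mat) :
    IsCellList IsCell (l.map (cong g)) ↔ IsCellList IsCell l := by
  rw [IsCellList, IsCellList, toFinset_map_cong, isCell_image_iff,
    List.nodup_map_iff (cong_injective g)]

theorem IsAlt.map {X Y : Type} {f : List Y → k} (hf : IsAlt f) (F : X → Y) :
    IsAlt fun l => f (l.map F) := fun l₁ a b l₂ => by
  simp only [List.map_append, List.map_cons]
  exact hf _ _ _ _

theorem map_cong_mul (g h : SL4) (l : List Mat) :
    l.map (cong (g * h)) = (l.map (cong h)).map (cong g) := by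
  rw [List.map_map]
  exact List.map_congr_left fun x _ => cong_mul g h x

theorem map_cong_inv_map_cong (g : SL4) (l : List Mat) :
    (l.map (cong g)).map (cong g⁻¹) = l := by
  rw [← map_cong_mul, inv_mul_cancel, funext cong_one, List.map_id']

theorem map_cong_map_cong_inv (g : SL4) (l : List Mat) :
    (l.map (cong g⁻¹)).map (cong g) = l := by
  rw [← map_cong_mul, mul_inv_cancel, funext cong_one, List.map_id']

theorem altChains_map {n : ℕ} (g : SL4) {f : List Mat → k} (hf : f ∈ altChains k IsCell n) :
    (fun l => f (l.map (cong g))) ∈ altChains k IsCell n := by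
  refine ⟨hf.1.preimage ((List.map_injective_iff.2 (cong_injective g)).injOn), fun l hl => ?_,
    hf.2.2.map _⟩
  obtain ⟨h1, h2⟩ := hf.2.1 _ hl
  rw [List.length_map] at h2
  exact ⟨(isCellList_map_cong g l).1 h1, h2⟩

theorem perfChains_coact (g : SL4) {f : Mat → k} (hf : f ∈ perfChains k) :
    (fun Q => f (coact g Q)) ∈ perfChains k := by
  refine ⟨hf.1.preimage (coact_injective g).injOn, fun Q hQ => ?_⟩
  have := coact_mem_Perf g⁻¹ (hf.2 _ hQ)
  rwa [coact_inv_coact] at this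

theorem cellBoundary_map (g : SL4) (f : List Mat → k) (l : List Mat) :
    cellBoundary IsCell (fun l => f (l.map (cong g))) l = cellBoundary IsCell f (l.map (cong g)) := by
  rw [cellBoundary, cellBoundary, faceSum_map]
  by_cases h : IsCellList IsCell l
  · rw [if_pos h, if_pos ((isCellList_map_cong g l).2 h)]
  · rw [if_neg h, if_neg fun h' => h ((isCellList_map_cong g l).1 h')]

theorem topBoundary_map (g : SL4) {f : List Mat → k} (hf : f ∈ altChains k IsCell 0) (Q : Mat) :
    topBoundary (fun l => f (l.map (cong g))) Q = topBoundary f (coact g Q) := by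
  by_cases hQ : Q ∈ Perf
  swap
  · rw [topBoundary_of_notMem _ hQ, topBoundary_of_notMem]
    intro h
    have := coact_mem_Perf g⁻¹ h
    rw [coact_inv_coact] at this
    exact hQ this
  rw [topBoundary_of_mem _ hQ, topBoundary_of_mem _ (coact_mem_Perf g hQ), minF_coact hQ,
    show (minF Q).image (cong g) = (minF Q).map ⟨cong g, cong_injective g⟩ by
      rw [Finset.map_eq_image]; rfl, Finset.powersetCard_map, Finset.sum_map]
  refine Finset.sum_congr rfl fun S hS => ?_
  rw [Finset.mem_powersetCard] at hS
  have hsymm : ∀ x ∈ S.toList, xᵀ = x := fun x hx => by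
    obtain ⟨w, rfl⟩ := exists_rk1_of_mem_minF hQ x (hS.1 (Finset.mem_toList.1 hx))
    exact rk1_symm w
  rw [← orient_coact hQ g hsymm]
  refine hf.2.2.mul_eq_mul_of_perm (isAlt_orient _) ?_
  refine (List.perm_ext_iff_of_nodup (S.nodup_toList.map (cong_injective g))
    (Finset.nodup_toList _)).2 fun x => ?_
  simp

variable (Γ : Subgroup SL4)

theorem isLeftAction_map_cong : IsLeftAction fun (g : Γ) (l : List Mat) => l.map (cong g) where
  one l := by
    change l.map (cong 1) = l
    rw [funext cong_one, List.map_id']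
  mul g h l := map_cong_mul g h l

theorem isLeftAction_coact : IsLeftAction fun (g : Γ) (Q : Mat) => coact g Q where
  one := coact_one
  mul g h := coact_mul g h

variable (k)

/-- The representation on alternating chains. -/
noncomputable def altRep (n : ℕ) : Representation k Γ (altChains k IsCell n) :=
  translation (isLeftAction_map_cong Γ) _ fun g _ hf => altChains_map (g⁻¹ : Γ) hf

/-- The representation on chains of perfect forms. -/
noncomputable def perfRep : Representation k Γ (perfChains k) :=
  translation (isLeftAction_coact Γ) _ fun g _ hf => perfChains_coact (g⁻¹ : Γ) hf

theorem projective_perfRep [CharZero k] : CategoryTheory.Projective (Rep.of (perfRep k Γ)) := by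
  obtain ⟨ω, hω⟩ := (isLeftAction_coact Γ).exists_weight (k := k)
  refine projective_translation _ _ (fun f hf => hf.1) ω (fun f hf => ?_) fun f hf Q hQ => hω Q ?_
  · exact ⟨hf.1.subset fun Q hQ => right_ne_zero_of_mul hQ,
      fun Q hQ => hf.2 Q (right_ne_zero_of_mul hQ)⟩
  · intro Q'
    have : {g : SL4 | coact g Q' = Q}.Finite := by
      by_cases hQ' : Q' ∈ Perf
      · exact finite_coact hQ' Q
      · refine Set.finite_empty.subset fun g hg => hQ' ?_
        have := coact_mem_Perf g⁻¹ (hf.2 Q hQ)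
        rwa [← show coact g Q' = Q from hg, coact_inv_coact] at this
    exact this.preimage Subtype.val_injective.injOn

theorem projective_altRep [CharZero k] (n : ℕ) : CategoryTheory.Projective (Rep.of (altRep k Γ n)) := by
  have ha : IsLeftAction fun (g : Γ) (S : Finset Mat) => S.image (cong g) :=
    { one := fun S => by
        change S.image (cong 1) = S
        rw [funext cong_one, Finset.image_id']
      mul := fun g h S => by
        rw [Finset.image_image]
        exact Finset.image_congr fun x _ => cong_mul g h x }
  obtain ⟨ω, hω⟩ := ha.exists_weight (k := k)
  refine projective_translation _ _ (fun f hf => hf.1) (fun l => ω l.toFinset) (fun f hf => ?_)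
    fun f hf l hl => ?_
  · refine ⟨hf.1.subset fun l hl => right_ne_zero_of_mul hl,
      fun l hl => hf.2.1 l (right_ne_zero_of_mul hl), fun l₁ a b l₂ => ?_⟩
    change ω _ * _ = -(ω _ * _)
    rw [hf.2.2 l₁ a b l₂, List.toFinset_eq_of_perm _ _ (List.Perm.append_left l₁ (List.Perm.swap b a l₂))]
    ring
  · have hS := (hf.2.1 l hl).1.2
    have key := hω l.toFinset fun T => ?_
    · simpa only [toFinset_map_cong] using key
    have hrk : ∀ S, IsCell S → ∀ x ∈ S, ∃ w, x = rk1 w := fun S hS x hx => by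
      obtain ⟨Q, -, h⟩ := hS.2.1
      obtain ⟨w, hw, -⟩ := h hx
      exact ⟨w, hw⟩
    have : {g : SL4 | T.image (cong g) = l.toFinset}.Finite := by
      by_cases hT : IsCell T
      · refine (finite_cong (T := l.toFinset) hT.2.2.1 (hrk T hT)).subset fun g hg x hx => ?_
        rw [← show T.image (cong g) = l.toFinset from hg]
        exact Finset.mem_image_of_mem _ hx
      · refine Set.finite_empty.subset fun g hg => hT ?_
        rw [← isCell_image_iff g, show T.image (cong g) = l.toFinset from hg]
        exact hS
    exact this.preimage Subtype.val_injective.injOn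

/-- The terms of the well-rounded resolution. -/
noncomputable def wellRounded : ℕ → Rep.{0} k Γ
  | 0 => Rep.of (perfRep k Γ)
  | n + 1 => Rep.of (altRep k Γ n)

/-- The differentials of the well-rounded resolution. -/
noncomputable def wellRoundedD : ∀ n, wellRounded k Γ (n + 1) ⟶ wellRounded k Γ n
  | 0 => Rep.ofHom (ρ := altRep k Γ 0) (σ := perfRep k Γ) ⟨topBoundaryMap k, fun g =>
      LinearMap.ext fun f => Subtype.ext (funext fun Q => topBoundary_map (g⁻¹ : Γ) f.2 Q)⟩
  | n + 1 => Rep.ofHom (ρ := altRep k Γ (n + 1)) (σ := altRep k Γ n)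
      ⟨cellBoundaryMap cellFamily_isCell n, fun g =>
        LinearMap.ext fun f => Subtype.ext (funext fun l => cellBoundary_map (g⁻¹ : Γ) f.1 l)⟩

/-- The augmentation of the well-rounded resolution. -/
noncomputable def wellRoundedε : wellRounded k Γ 0 ⟶ Rep.trivial k Γ k :=
  Rep.ofHom (ρ := perfRep k Γ) (σ := Representation.trivial k Γ k)
    ⟨{ toFun := fun f => ∑ᶠ Q, f.1 Q
       map_add' := fun f g => finsum_add_distrib f.2.1 g.2.1
       map_smul' := fun c f => (smul_finsum c _).symm }, fun g => LinearMap.ext fun f => by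
      change ∑ᶠ Q, f.1 (coact (g⁻¹ : Γ) Q) = ∑ᶠ Q, f.1 Q
      exact finsum_comp_equiv (⟨coact (g⁻¹ : Γ), coact g, fun Q => coact_coact_inv g.1 Q,
        fun Q => coact_inv_coact g.1 Q⟩ : Mat ≃ Mat)⟩

variable {k}

/-- Invariance of a functional on alternating chains. -/
def IsInvariantFunctional {n : ℕ} (φ : altChains k IsCell n →ₗ[k] k) : Prop :=
  ∀ (g : Γ) (f : altChains k IsCell n), φ (altRep k Γ n g f) = φ f

variable {Γ}

/-- An invariant functional as a morphism of representations. -/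
noncomputable def IsInvariantFunctional.toHom {n : ℕ} {φ : altChains k IsCell n →ₗ[k] k}
    (h : IsInvariantFunctional Γ φ) : wellRounded k Γ (n + 1) ⟶ Rep.trivial k Γ k :=
  Rep.ofHom (ρ := altRep k Γ n) (σ := Representation.trivial k Γ k)
    ⟨φ, fun g => LinearMap.ext fun f => h g f⟩

theorem hom_ext_altRep {n : ℕ} {φ ψ : wellRounded k Γ (n + 1) ⟶ Rep.trivial k Γ k}
    (h : ∀ f : altChains k IsCell n, φ.hom f = ψ.hom f) : φ = ψ :=
  Rep.hom_ext (Representation.IntertwiningMap.ext (LinearMap.ext h))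

/-- A criterion for the cohomology of a group acting on the well-rounded complex to be
one-dimensional. -/
theorem finrank_groupCohomology_of_chains [CharZero k] (n : ℕ) {φ₀ : altChains k IsCell (n + 1) →ₗ[k] k}
    (hφ₀ : IsInvariantFunctional Γ φ₀) (h0 : φ₀ ∘ₗ cellBoundaryMap cellFamily_isCell (n + 1) = 0)
    (h1 : ∀ ψ : altChains k IsCell n →ₗ[k] k, IsInvariantFunctional Γ ψ →
      φ₀ ≠ ψ ∘ₗ cellBoundaryMap cellFamily_isCell n)
    (h2 : ∀ φ : altChains k IsCell (n + 1) →ₗ[k] k, IsInvariantFunctional Γ φ →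
      φ ∘ₗ cellBoundaryMap cellFamily_isCell (n + 1) = 0 →
      ∃ (c : k) (ψ : altChains k IsCell n →ₗ[k] k), IsInvariantFunctional Γ ψ ∧
        φ = c • φ₀ + ψ ∘ₗ cellBoundaryMap cellFamily_isCell n) :
    Module.finrank k (groupCohomology (Rep.trivial k Γ k) (n + 2)) = 1 := by
  have hinv : ∀ {m : ℕ} (φ : wellRounded k Γ (m + 1) ⟶ Rep.trivial k Γ k),
      IsInvariantFunctional Γ φ.hom.toLinearMap := fun φ g f => Rep.hom_comm_apply φ g f
  refine Rep.finrank_groupCohomology_eq_one (wellRounded k Γ) (wellRoundedD k Γ)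
    (wellRoundedε k Γ) ?_ ?_ ?_ ?_ ?_ ?_ (n + 1) hφ₀.toHom ?_ ?_ ?_
  · rintro (_ | n)
    · exact projective_perfRep k Γ
    · exact projective_altRep k Γ n
  · rintro (_ | n)
    · refine Rep.hom_ext (Representation.IntertwiningMap.ext (LinearMap.ext fun f => Subtype.ext ?_))
      exact topBoundary_cellBoundary f.2
    · refine Rep.hom_ext (Representation.IntertwiningMap.ext (LinearMap.ext fun f => Subtype.ext ?_))
      exact cellBoundary_cellBoundary cellFamily_isCell f.2
  · exact Rep.hom_ext (Representation.IntertwiningMap.ext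
      (LinearMap.ext fun f => finsum_topBoundary f.2))
  · intro c
    have hA : formA ∈ Perf := ⟨1, Or.inl (coact_one _).symm⟩
    classical
    have h : (fun Q => if Q = formA then c else 0) ∈ perfChains k := by
      refine ⟨(Set.finite_singleton formA).subset fun Q hQ => ?_, fun Q hQ => ?_⟩
      · by_contra h
        exact hQ (if_neg h)
      · by_contra h
        exact hQ (if_neg fun e : Q = formA => h (e.symm ▸ hA))
    refine ⟨⟨_, h⟩, (finsum_eq_single _ formA fun Q hQ => if_neg hQ).trans (if_pos rfl)⟩
  · intro f hf
    obtain ⟨h, hh, e⟩ := topBoundary_exact_zero f.2 hf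
    exact ⟨⟨h, hh⟩, Subtype.ext e⟩
  · rintro (_ | n) f hf
    · obtain ⟨h, hh, e⟩ := topBoundary_exact_one f.2 (congrArg Subtype.val hf)
      exact ⟨⟨h, hh⟩, Subtype.ext e⟩
    · obtain ⟨h, hh, e⟩ := pivotData_isCell.exact cellFamily_isCell f.2 (congrArg Subtype.val hf)
      exact ⟨⟨h, hh⟩, Subtype.ext e⟩
  · exact hom_ext_altRep fun f => LinearMap.congr_fun h0 f
  · intro ψ e
    refine h1 ψ.hom.toLinearMap (hinv ψ) (LinearMap.ext fun f => ?_)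
    exact congrArg (fun φ : wellRounded k Γ (n + 2) ⟶ Rep.trivial k Γ k => φ.hom f) e
  · intro φ hφ
    obtain ⟨c, ψ, hψ, e⟩ := h2 φ.hom.toLinearMap (hinv φ) (LinearMap.ext fun f =>
      congrArg (fun φ : wellRounded k Γ (n + 3) ⟶ Rep.trivial k Γ k => φ.hom f) hφ)
    exact ⟨c, hψ.toHom, hom_ext_altRep fun f => LinearMap.congr_fun e f⟩

end Complex

section CellEvaluation

open scoped Classical

variable {k : Type} [Field k]

theorem cellDelta_of_not_nodup {x : List Mat} (h : ¬ x.Nodup) : cellDelta k x = 0 :=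
  funext fun _ => if_neg fun h' => h h'.1

theorem eq_cellDelta {f : List Mat → k} {x : List Mat} (hx : x.Nodup) (hf : IsAlt f)
    (h : ∀ l, f l ≠ 0 → l.Perm x) (hfx : f x = 1) : f = cellDelta k x := by
  funext l
  by_cases hl : l.Perm x
  · have := hf.mul_eq_mul_of_perm (isAlt_cellDelta x) hl
    rw [hfx, cellDelta_self hx, mul_one] at this
    have h2 := (isAlt_cellDelta (k := k) x).mul_eq_mul_of_perm (isAlt_cellDelta x) hl
    rw [cellDelta_self hx, mul_one] at h2
    exact mul_right_cancel₀ (left_ne_zero_of_mul (h2.trans_ne one_ne_zero)) (this.trans h2.symm)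
  · rw [cellDelta_eq_zero hl]
    exact not_not.1 fun h' => hl (h l h')

theorem isAlt_cellDelta_left (l : List Mat) : IsAlt fun x => cellDelta k x l := by
  intro l₁ a b l₂
  have hp := (List.Perm.swap b a l₂).append_left l₁
  by_cases hx : (l₁ ++ a :: b :: l₂).Nodup
  · have : (-cellDelta k (l₁ ++ b :: a :: l₂)) = cellDelta k (l₁ ++ a :: b :: l₂) := by
      refine eq_cellDelta hx (fun u c d v => ?_) (fun l hl => ?_) ?_
      · simp only [Pi.neg_apply, isAlt_cellDelta _ u c d v]
      · exact (cellDelta_ne_zero (neg_ne_zero.1 hl)).2.trans hp.symm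
      · rw [Pi.neg_apply, ← isAlt_cellDelta _ l₁ b a l₂, cellDelta_self (hp.nodup_iff.1 hx)]
    exact (congrFun this l).symm
  · change cellDelta k _ l = -cellDelta k _ l
    rw [cellDelta_of_not_nodup hx, cellDelta_of_not_nodup fun h => hx (hp.nodup_iff.2 h)]
    simp

theorem cellDelta_map_cong (g : SL4) (x : List Mat) (l : List Mat) :
    cellDelta k x (l.map (cong g⁻¹)) = cellDelta k (x.map (cong g)) l := by
  by_cases hx : x.Nodup
  · refine congrFun (eq_cellDelta ((List.nodup_map_iff (cong_injective g)).2 hx)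
      ((isAlt_cellDelta x).map (cong g⁻¹)) (fun l hl => ?_) ?_) l
    · have := (cellDelta_ne_zero hl).2.map (cong g)
      rwa [map_cong_map_cong_inv] at this
    · rw [map_cong_inv_map_cong, cellDelta_self hx]
  · rw [cellDelta_of_not_nodup hx,
      cellDelta_of_not_nodup fun h => hx ((List.nodup_map_iff (cong_injective g)).1 h)]
    rfl

variable {n : ℕ}

/-- The value of a functional on the alternating delta function at `x`. -/
noncomputable def cellEval (φ : altChains k IsCell n →ₗ[k] k) (x : List Mat) : k :=
  if h : cellDelta k x ∈ altChains k IsCell n then φ ⟨_, h⟩ else 0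

theorem cellEval_of_mem (φ : altChains k IsCell n →ₗ[k] k) {x : List Mat}
    (h : cellDelta k x ∈ altChains k IsCell n) : cellEval φ x = φ ⟨_, h⟩ := dif_pos h

theorem cellEval_eq_zero (φ : altChains k IsCell n →ₗ[k] k) {x : List Mat}
    (h : ¬ (IsCellList IsCell x ∧ x.length + n = 9)) : cellEval φ x = 0 := by
  by_cases hm : cellDelta k x ∈ altChains k IsCell n
  swap
  · exact dif_neg hm
  rw [cellEval_of_mem φ hm]
  by_cases hx : x.Nodup
  · exact absurd (hm.2.1 x (by rw [cellDelta_self hx]; exact one_ne_zero)) h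
  · have : (⟨_, hm⟩ : altChains k IsCell n) = 0 := Subtype.ext (cellDelta_of_not_nodup hx)
    rw [this, map_zero]

theorem isAlt_cellEval (φ : altChains k IsCell n →ₗ[k] k) : IsAlt (cellEval φ) := by
  intro l₁ a b l₂
  have hd : cellDelta k (l₁ ++ a :: b :: l₂) = -cellDelta k (l₁ ++ b :: a :: l₂) :=
    funext fun l => isAlt_cellDelta_left l l₁ a b l₂
  by_cases hm : cellDelta k (l₁ ++ b :: a :: l₂) ∈ altChains k IsCell n
  · rw [cellEval_of_mem φ hm, cellEval_of_mem φ (hd ▸ neg_mem hm), ← map_neg]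
    exact congrArg φ (Subtype.ext hd)
  · rw [cellEval, cellEval, dif_neg hm, dif_neg (fun h => hm ?_), neg_zero]
    rw [hd] at h
    exact neg_mem_iff.1 h

theorem cellEval_add (φ ψ : altChains k IsCell n →ₗ[k] k) (x : List Mat) :
    cellEval (φ + ψ) x = cellEval φ x + cellEval ψ x := by
  unfold cellEval; split <;> simp

theorem cellEval_sub (φ ψ : altChains k IsCell n →ₗ[k] k) (x : List Mat) :
    cellEval (φ - ψ) x = cellEval φ x - cellEval ψ x := by
  unfold cellEval; split <;> simp

theorem cellEval_smul (c : k) (φ : altChains k IsCell n →ₗ[k] k) (x : List Mat) :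
    cellEval (c • φ) x = c * cellEval φ x := by
  unfold cellEval; split <;> simp

theorem eq_zero_of_cellEval {φ : altChains k IsCell n →ₗ[k] k}
    (h : ∀ x, IsCellList IsCell x → x.length + n = 9 → cellEval φ x = 0) : φ = 0 := by
  have key : ∀ N, ∀ f : altChains k IsCell n, f.1.support.ncard = N → φ f = 0 := by
    intro N
    induction N using Nat.strong_induction_on with
    | _ N ih =>
      intro f hN
      by_cases hf : f.1 = 0
      · rw [show f = 0 from Subtype.ext hf, map_zero]
      obtain ⟨x, hx⟩ := Function.ne_iff.1 hf
      have hc := f.2.2.1 x hx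
      have hm := cellDelta_mem (k := k) hc.1.2 hc.2
      have h1 := h x hc.1 hc.2
      rw [cellEval_of_mem φ hm] at h1
      have h2 := ih _ ?_ (f - f.1 x • ⟨_, hm⟩) rfl
      · rwa [map_sub, map_smul, h1, smul_zero, sub_zero] at h2
      rw [← hN]
      refine Set.ncard_lt_ncard ⟨fun l hl => ?_, fun hs => ?_⟩ f.2.1
      · by_contra hl'
        have hl' : f.1 l = 0 := by simpa using hl'
        refine hl ?_
        change f.1 l - f.1 x * cellDelta k x l = 0
        rw [hl', cellDelta_eq_zero fun hp => hx (f.2.2.2.eq_zero_of_perm hp hl'), mul_zero, sub_zero]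
      · refine hs (a := x) hx ?_
        change f.1 x - f.1 x * cellDelta k x x = 0
        rw [cellDelta_self hc.1.1, mul_one, sub_self]
  exact LinearMap.ext fun f => key _ f rfl

theorem cellBoundary_cellDelta {x : List Mat} (hx : x.Nodup) {S : Finset Mat}
    (hS : ∀ w, w ∈ S ↔ IsCellList IsCell (w :: x)) :
    cellBoundary IsCell (cellDelta k x) = ∑ w ∈ S, cellDelta k (w :: x) := by
  funext l
  rw [Finset.sum_apply]
  by_cases hl : ∃ w ∈ S, l.Perm (w :: x)
  · obtain ⟨w, hw, hl⟩ := hl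
    have hwx := (hS w).1 hw
    rw [Finset.sum_eq_single_of_mem w hw]
    swap
    · intro w' _ hne
      refine cellDelta_eq_zero fun h' => hne ?_
      have h1 : w ∈ w' :: x := (hl.symm.trans h').subset List.mem_cons_self
      rcases List.mem_cons.1 h1 with h1 | h1
      · exact h1.symm
      · exact absurd h1 (List.nodup_cons.1 hwx.1).1
    rw [cellBoundary, if_pos ((isCellList_perm IsCell hl).2 hwx)]
    have h1 := (isAlt_cellDelta (k := k) x).faceSum.mul_eq_mul_of_perm
      (isAlt_cellDelta (w :: x)) hl
    have h2 := (isAlt_cellDelta (k := k) (w :: x)).mul_eq_mul_of_perm (isAlt_cellDelta (w :: x)) hl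
    have h3 : faceSum (cellDelta k x) (w :: x) = 1 := by
      rw [faceSum_cons, cellDelta_self hx, sub_eq_self]
      by_contra h
      obtain ⟨l', -, -, h'⟩ := faceSum_ne_zero h
      exact (List.nodup_cons.1 hwx.1).1 ((cellDelta_ne_zero h').2.subset List.mem_cons_self)
    rw [h3, cellDelta_self hwx.1, mul_one] at h1
    rw [cellDelta_self hwx.1, mul_one] at h2
    exact mul_right_cancel₀ (left_ne_zero_of_mul (h2.trans_ne one_ne_zero)) (h1.trans h2.symm)
  · rw [Finset.sum_eq_zero fun w hw => cellDelta_eq_zero fun h => hl ⟨w, hw, h⟩]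
    by_contra h
    rw [cellBoundary] at h
    split_ifs at h with hc
    swap
    · exact h rfl
    obtain ⟨l', hs, hlen, h'⟩ := faceSum_ne_zero h
    have hp := (cellDelta_ne_zero h').2
    obtain ⟨w, hw⟩ : ∃ w, l.Perm (w :: l') := by
      obtain ⟨r, hr⟩ := hs.subperm.exists_of_length_lt (by omega)
      refine ⟨r, (hr.perm_of_length_le ?_).symm⟩
      simp [hlen]
    have hw' := hw.trans (hp.cons w)
    exact hl ⟨w, (hS w).2 ((isCellList_perm IsCell hw').1 hc), hw'⟩

theorem cellEval_comp_boundary (φ : altChains k IsCell n →ₗ[k] k) {x : List Mat}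
    (hx : IsCellList IsCell x) (hn : x.length + (n + 1) = 9) {S : Finset Mat}
    (hS : ∀ w, w ∈ S ↔ IsCellList IsCell (w :: x)) :
    cellEval (φ ∘ₗ cellBoundaryMap cellFamily_isCell n) x = ∑ w ∈ S, cellEval φ (w :: x) := by
  have hm := cellDelta_mem (k := k) hx.2 hn
  rw [cellEval_of_mem _ hm]
  have hw : ∀ w ∈ S, cellDelta k (w :: x) ∈ altChains k IsCell n := fun w hw =>
    cellDelta_mem ((hS w).1 hw).2 (by rw [List.length_cons]; omega)
  rw [← Finset.sum_attach, Finset.sum_congr rfl fun w _ => cellEval_of_mem φ (hw w.1 w.2),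
    ← map_sum]
  refine congrArg φ (Subtype.ext ?_)
  refine (cellBoundary_cellDelta (k := k) hx.1 hS).trans ?_
  rw [Submodule.coe_sum]
  exact (Finset.sum_attach S fun w => cellDelta k (w :: x)).symm

theorem IsInvariantFunctional.cellEval_map {Γ : Subgroup SL4} {φ : altChains k IsCell n →ₗ[k] k}
    (h : IsInvariantFunctional Γ φ) {g : SL4} (hg : g ∈ Γ) (x : List Mat) :
    cellEval φ (x.map (cong g)) = cellEval φ x := by
  by_cases hx : IsCellList IsCell x ∧ x.length + n = 9
  · have hm := cellDelta_mem (k := k) hx.1.2 hx.2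
    have hm' := cellDelta_mem (k := k) (x := x.map (cong g)) (n := n)
      ((isCellList_map_cong g x).2 hx.1).2 (by rw [List.length_map, hx.2])
    rw [cellEval_of_mem φ hm, cellEval_of_mem φ hm', ← h ⟨g, hg⟩ ⟨_, hm⟩]
    refine congrArg φ (Subtype.ext (funext fun l => ?_))
    exact (cellDelta_map_cong (k := k) g x l).symm
  · rw [cellEval_eq_zero φ hx, cellEval_eq_zero φ]
    rwa [isCellList_map_cong, List.length_map]

end CellEvaluation

instance fact_prime_thirteen : Fact (Nat.Prime 13) := ⟨by norm_num⟩

section RowClasses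

open scoped Classical

/-- Reduction modulo `13` of an integral unimodular matrix. -/
def redMat (h : SL4) : Matrix (Fin 4) (Fin 4) (ZMod 13) := h.1.map (Int.castRingHom (ZMod 13))

/-- The last row of `g` is a nonzero multiple of `v` modulo `13`. -/
def HasRow (g : SL4) (v : Fin 4 → ZMod 13) : Prop := ∃ c : ZMod 13, c ≠ 0 ∧ redMat g 3 = c • v

theorem redMat_mul (g h : SL4) : redMat (g * h) = redMat g * redMat h := by
  rw [redMat, SL4.val_mul, Matrix.map_mul]; rfl

theorem redMat_one : redMat 1 = 1 := by
  rw [redMat, Matrix.SpecialLinearGroup.coe_one, Matrix.map_one _ (map_zero _) (map_one _)]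

theorem redMat_mul_row (g h : SL4) : redMat (g * h) 3 = redMat g 3 ᵥ* redMat h := by
  rw [redMat_mul]; rfl

variable {g g' h : SL4} {v : Fin 4 → ZMod 13}

theorem HasRow.mul (hg : HasRow g v) (h : SL4) : HasRow (g * h) (v ᵥ* redMat h) := by
  obtain ⟨c, hc, e⟩ := hg
  exact ⟨c, hc, by rw [redMat_mul_row, e, smul_vecMul]⟩

theorem hasRow_mul_iff (h : SL4) : HasRow (g * h) (v ᵥ* redMat h) ↔ HasRow g v := by
  refine ⟨fun hg => ?_, fun hg => hg.mul h⟩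
  have := hg.mul h⁻¹
  rwa [mul_inv_cancel_right, vecMul_vecMul, ← redMat_mul, mul_inv_cancel, redMat_one,
    vecMul_one] at this

theorem hasRow_smul_iff {c : ZMod 13} (hc : c ≠ 0) : HasRow g (c • v) ↔ HasRow g v := by
  constructor
  · rintro ⟨d, hd, e⟩
    exact ⟨d * c, mul_ne_zero hd hc, by rw [e, smul_smul]⟩
  · rintro ⟨d, hd, e⟩
    refine ⟨d * c⁻¹, mul_ne_zero hd (inv_ne_zero hc), ?_⟩
    rw [e, smul_smul, mul_assoc, inv_mul_cancel₀ hc, mul_one]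

theorem HasRow.mul_inv_mem (hg : HasRow g v) (hg' : HasRow g' v) : g' * g⁻¹ ∈ Gamma0 13 := by
  obtain ⟨c, hc, e⟩ := hg
  obtain ⟨c', -, e'⟩ := hg'
  have h1 : redMat g' 3 = (c' * c⁻¹) • redMat g 3 := by
    rw [e, e', smul_smul, mul_assoc, inv_mul_cancel₀ hc, mul_one]
  have h2 : redMat (g' * g⁻¹) 3 = (c' * c⁻¹) • (1 : Matrix (Fin 4) (Fin 4) (ZMod 13)) 3 := by
    rw [redMat_mul_row, h1, smul_vecMul, ← redMat_mul_row, mul_inv_cancel, redMat_one]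
  intro j hj
  rw [← ZMod.intCast_zmod_eq_zero_iff_dvd]
  have h3 := congrFun h2 j
  rw [Pi.smul_apply, Matrix.one_apply_ne' hj, smul_zero] at h3
  exact h3

theorem mul_mem_hasRow (hγ : h ∈ Gamma0 13) (hg : HasRow g v) : HasRow (h * g) v := by
  obtain ⟨c, hc, e⟩ := hg
  have h1 : redMat h 3 = redMat h 3 3 • Pi.single 3 1 := by
    funext j
    by_cases hj : j = 3
    · subst hj; simp
    · have := hγ j hj
      rw [Pi.smul_apply, Pi.single_eq_of_ne hj, smul_zero]
      exact (ZMod.intCast_zmod_eq_zero_iff_dvd _ _).2 this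
  have h2 : redMat (h * g) 3 = redMat h 3 3 • redMat g 3 := by
    rw [redMat_mul_row, h1, smul_vecMul, single_one_vecMul]
    simp
    rfl
  refine ⟨redMat h 3 3 * c, mul_ne_zero (fun h0 => ?_) hc, by rw [h2, e, smul_smul]⟩
  rw [h0, zero_smul] at h1
  have h3 : redMat (h * h⁻¹) 3 3 = 0 := by rw [redMat_mul_row, h1, zero_vecMul]; rfl
  rw [mul_inv_cancel, redMat_one] at h3
  simp at h3

theorem not_hasRow_zero (g : SL4) : ¬ HasRow g 0 := by
  rintro ⟨c, -, e⟩
  have h3 : redMat (g * g⁻¹) 3 3 = 0 := by rw [redMat_mul_row, e, smul_zero, zero_vecMul]; rfl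
  rw [mul_inv_cancel, redMat_one] at h3
  simp at h3

theorem exists_hasRow (hv : v ≠ 0) : ∃ g, HasRow g v := by
  obtain ⟨i, hi⟩ := Function.ne_iff.1 hv
  obtain ⟨w, hw, hwv⟩ : ∃ w : Fin 4 → ℤ, w i = 1 ∧ ∀ j, ((w j : ℤ) : ZMod 13) = (v i)⁻¹ * v j := by
    refine ⟨fun j => if j = i then 1 else (((v i)⁻¹ * v j).val : ℤ), if_pos rfl, fun j => ?_⟩
    dsimp only
    split_ifs with h
    · subst h; rw [inv_mul_cancel₀ hi, Int.cast_one]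
    · rw [Int.cast_natCast, ZMod.natCast_zmod_val]
  suffices h : ∃ g : SL4, g.1 3 = w by
    obtain ⟨g, hg⟩ := h
    refine ⟨g, (v i)⁻¹, inv_ne_zero hi, funext fun j => ?_⟩
    change ((g.1 3 j : ℤ) : ZMod 13) = _
    rw [hg, hwv]; rfl
  have key : ∀ A : Mat, A.det = 1 → A 3 = w → ∃ g : SL4, g.1 3 = w := fun A hA h => ⟨⟨A, hA⟩, h⟩
  have hw' : w = ![w 0, w 1, w 2, w 3] := by funext j; fin_cases j <;> rfl
  fin_cases i
  · refine key !![0, -1, 0, 0; 0, 0, 1, 0; 0, 0, 0, 1; w 0, w 1, w 2, w 3] ?_ hw'.symm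
    simp only [Fin.zero_eta] at hw
    simp [Matrix.det_succ_row_zero, Fin.sum_univ_succ, Fin.succAbove, hw]
  · refine key !![1, 0, 0, 0; 0, 0, 1, 0; 0, 0, 0, 1; w 0, w 1, w 2, w 3] ?_ hw'.symm
    simp only [Fin.mk_one] at hw
    simp [Matrix.det_succ_row_zero, Fin.sum_univ_succ, Fin.succAbove, hw]
  · refine key !![-1, 0, 0, 0; 0, 1, 0, 0; 0, 0, 0, 1; w 0, w 1, w 2, w 3] ?_ hw'.symm
    simp only [Fin.reduceFinMk] at hw
    simp [Matrix.det_succ_row_zero, Fin.sum_univ_succ, Fin.succAbove, hw]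
  · refine key !![1, 0, 0, 0; 0, 1, 0, 0; 0, 0, 1, 0; w 0, w 1, w 2, w 3] ?_ hw'.symm
    simp only [Fin.reduceFinMk] at hw
    simp [Matrix.det_succ_row_zero, Fin.sum_univ_succ, Fin.succAbove, hw]

end RowClasses

section RowValues

open scoped Classical

variable {k : Type} [Field k] {n : ℕ}

/-- The value of a functional at `g • x`, where `v` is the last row of `g` modulo `13`. -/
noncomputable def rowEval (φ : altChains k IsCell n →ₗ[k] k) (x : List Mat)
    (v : Fin 4 → ZMod 13) : k :=
  if h : ∃ g, HasRow g v then cellEval φ (x.map (cong h.choose)) else 0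

variable {φ ψ : altChains k IsCell n →ₗ[k] k}

theorem rowEval_eq (hφ : IsInvariantFunctional (Gamma0 13) φ) (x : List Mat) {g : SL4}
    {v : Fin 4 → ZMod 13} (hg : HasRow g v) : rowEval φ x v = cellEval φ (x.map (cong g)) := by
  have h : ∃ g, HasRow g v := ⟨g, hg⟩
  rw [rowEval, dif_pos h, ← hφ.cellEval_map (hg.mul_inv_mem h.choose_spec) (x.map (cong g)),
    ← map_cong_mul, inv_mul_cancel_right]

theorem rowEval_zero (φ : altChains k IsCell n →ₗ[k] k) (x : List Mat) : rowEval φ x 0 = 0 :=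
  dif_neg fun ⟨g, hg⟩ => not_hasRow_zero g hg

theorem rowEval_add (x : List Mat) (v : Fin 4 → ZMod 13) :
    rowEval (φ + ψ) x v = rowEval φ x v + rowEval ψ x v := by
  unfold rowEval; split_ifs
  · exact cellEval_add _ _ _
  · rw [add_zero]

theorem rowEval_sub (x : List Mat) (v : Fin 4 → ZMod 13) :
    rowEval (φ - ψ) x v = rowEval φ x v - rowEval ψ x v := by
  unfold rowEval; split_ifs
  · exact cellEval_sub _ _ _
  · rw [sub_zero]

theorem rowEval_smul (c : k) (x : List Mat) (v : Fin 4 → ZMod 13) :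
    rowEval (c • φ) x v = c * rowEval φ x v := by
  unfold rowEval; split_ifs
  · exact cellEval_smul _ _ _
  · rw [mul_zero]

theorem rowEval_smul_row (hφ : IsInvariantFunctional (Gamma0 13) φ) (x : List Mat)
    {c : ZMod 13} (hc : c ≠ 0) (v : Fin 4 → ZMod 13) : rowEval φ x (c • v) = rowEval φ x v := by
  by_cases h : ∃ g, HasRow g v
  · obtain ⟨g, hg⟩ := h
    rw [rowEval_eq hφ x hg, rowEval_eq hφ x ((hasRow_smul_iff hc).2 hg)]
  · rw [rowEval, rowEval, dif_neg h, dif_neg]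
    simpa only [hasRow_smul_iff hc] using h

theorem rowEval_map_cong (hφ : IsInvariantFunctional (Gamma0 13) φ) (x : List Mat)
    (h : SL4) (v : Fin 4 → ZMod 13) :
    rowEval φ (x.map (cong h)) v = rowEval φ x (v ᵥ* redMat h) := by
  by_cases hv : ∃ g, HasRow g v
  · obtain ⟨g, hg⟩ := hv
    rw [rowEval_eq hφ _ hg, rowEval_eq hφ x (hg.mul h), map_cong_mul]
  · rw [rowEval, rowEval, dif_neg hv, dif_neg]
    rintro ⟨g, hg⟩
    refine hv ⟨g * h⁻¹, (hasRow_mul_iff h).1 ?_⟩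
    rwa [inv_mul_cancel_right]

theorem isAlt_rowEval (φ : altChains k IsCell n →ₗ[k] k) (v : Fin 4 → ZMod 13) :
    IsAlt fun x => rowEval φ x v := by
  intro l₁ a b l₂
  dsimp only [rowEval]
  split_ifs
  · simp only [List.map_append, List.map_cons]
    exact isAlt_cellEval φ _ _ _ _
  · rw [neg_zero]

theorem rowEval_eq_zero {x : List Mat} (h : ¬ (IsCellList IsCell x ∧ x.length + n = 9))
    (v : Fin 4 → ZMod 13) : rowEval φ x v = 0 := by
  unfold rowEval; split_ifs
  · refine cellEval_eq_zero φ ?_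
    rwa [isCellList_map_cong, List.length_map]
  · rfl

theorem rowEval_comp_boundary (φ : altChains k IsCell n →ₗ[k] k) {x : List Mat}
    (hx : IsCellList IsCell x) (hn : x.length + (n + 1) = 9) {S : Finset Mat}
    (hS : ∀ w, w ∈ S ↔ IsCellList IsCell (w :: x)) (v : Fin 4 → ZMod 13) :
    rowEval (φ ∘ₗ cellBoundaryMap cellFamily_isCell n) x v = ∑ w ∈ S, rowEval φ (w :: x) v := by
  by_cases hv : ∃ g, HasRow g v
  · simp only [rowEval, dif_pos hv]
    rw [cellEval_comp_boundary φ ((isCellList_map_cong _ x).2 hx) (by rwa [List.length_map])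
      (S := S.image (cong hv.choose)), Finset.sum_image fun _ _ _ _ h => cong_injective _ h]
    · rfl
    · intro w
      rw [Finset.mem_image]
      constructor
      · rintro ⟨y, hy, rfl⟩
        exact (isCellList_map_cong hv.choose (y :: x)).2 ((hS y).1 hy)
      · intro hw
        refine ⟨cong hv.choose⁻¹ w, (hS _).2 ?_, cong_cong_inv _ _⟩
        rw [← isCellList_map_cong hv.choose, List.map_cons, cong_cong_inv]
        exact hw
  · simp only [rowEval, dif_neg hv, Finset.sum_const_zero]

theorem cellEval_map_eq_rowEval (hφ : IsInvariantFunctional (Gamma0 13) φ) (x : List Mat)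
    (g : SL4) : cellEval φ (x.map (cong g)) = rowEval φ x (redMat g 3) :=
  (rowEval_eq hφ x ⟨1, one_ne_zero, (one_smul _ _).symm⟩).symm

theorem IsInvariantFunctional.sub {Γ : Subgroup SL4} (hφ : IsInvariantFunctional Γ φ)
    (hψ : IsInvariantFunctional Γ ψ) : IsInvariantFunctional Γ (φ - ψ) := fun g f => by
  rw [LinearMap.sub_apply, LinearMap.sub_apply, hφ, hψ]

theorem IsInvariantFunctional.add {Γ : Subgroup SL4} (hφ : IsInvariantFunctional Γ φ)
    (hψ : IsInvariantFunctional Γ ψ) : IsInvariantFunctional Γ (φ + ψ) := fun g f => by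
  rw [LinearMap.add_apply, LinearMap.add_apply, hφ, hψ]

theorem IsInvariantFunctional.smul {Γ : Subgroup SL4} (c : k) (hφ : IsInvariantFunctional Γ φ) :
    IsInvariantFunctional Γ (c • φ) := fun g f => by
  rw [LinearMap.smul_apply, LinearMap.smul_apply, hφ]

theorem IsInvariantFunctional.zero {Γ : Subgroup SL4} :
    IsInvariantFunctional Γ (0 : altChains k IsCell n →ₗ[k] k) := fun _ _ => rfl

end RowValues

section Vectors

/-- Integral vectors, in a form suited to kernel computation. -/
structure IVec where
  a : ℤ
  b : ℤ
  c : ℤ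
  d : ℤ

namespace IVec

def fn (u : IVec) : Fin 4 → ℤ := ![u.a, u.b, u.c, u.d]

/-- The rank one form attached to a vector. -/
def sym (u : IVec) : Mat := rk1 u.fn

def neg (u : IVec) : IVec := ⟨-u.a, -u.b, -u.c, -u.d⟩

def beq (u v : IVec) : Bool :=
  (decide (u.a = v.a) && decide (u.b = v.b)) && (decide (u.c = v.c) && decide (u.d = v.d))

/-- Equality up to sign. -/
def equiv (u v : IVec) : Bool := u.beq v || u.beq v.neg

def dot (u v : IVec) : ℤ := u.a * v.a + u.b * v.b + u.c * v.c + u.d * v.d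

def det (u v w z : IVec) : ℤ :=
  (u.a * v.b - u.b * v.a) * (w.c * z.d - w.d * z.c) - (u.a * v.c - u.c * v.a) * (w.b * z.d - w.d * z.b)
    + (u.a * v.d - u.d * v.a) * (w.b * z.c - w.c * z.b) + (u.b * v.c - u.c * v.b) * (w.a * z.d - w.d * z.a)
    - (u.b * v.d - u.d * v.b) * (w.a * z.c - w.c * z.a) + (u.c * v.d - u.d * v.c) * (w.a * z.b - w.b * z.a)

theorem beq_iff {u v : IVec} : u.beq v = true ↔ u = v := by
  obtain ⟨a, b, c, d⟩ := u
  obtain ⟨a', b', c', d'⟩ := v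
  simp [beq, and_assoc]

theorem fn_neg (u : IVec) : u.neg.fn = -u.fn := by
  simp [neg, fn]

theorem sym_neg (u : IVec) : u.neg.sym = u.sym := by
  ext i j; simp [sym, fn_neg, rk1_apply]

theorem fn_injective : Function.Injective fn := by
  rintro ⟨a, b, c, d⟩ ⟨a', b', c', d'⟩ h
  have h0 := congrFun h 0
  have h1 := congrFun h 1
  have h2 := congrFun h 2
  have h3 := congrFun h 3
  simp only [fn, cons_val] at h0 h1 h2 h3
  subst h0 h1 h2 h3; rfl

theorem exists_fn_eq (w : Fin 4 → ℤ) : ∃ u : IVec, u.fn = w :=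
  ⟨⟨w 0, w 1, w 2, w 3⟩, by funext i; fin_cases i <;> rfl⟩

theorem equiv_iff_or {u v : IVec} : u.equiv v = true ↔ u = v ∨ u = v.neg := by
  rw [equiv, Bool.or_eq_true, beq_iff, beq_iff]

theorem det_of (u v w z : IVec) : (Matrix.of ![u.fn, v.fn, w.fn, z.fn]).det = det u v w z := by
  simp [Matrix.det_succ_row_zero, Fin.sum_univ_succ, Fin.succAbove, fn, det]
  ring

theorem sym_add (u v w z : IVec) : u.sym + (v.sym + (w.sym + z.sym))
    = (Matrix.of ![u.fn, v.fn, w.fn, z.fn])ᵀ * Matrix.of ![u.fn, v.fn, w.fn, z.fn] := by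
  ext i j
  simp [Matrix.mul_apply, Fin.sum_univ_four, sym, rk1_apply, add_assoc]

theorem det_sym_add (u v w z : IVec) :
    (u.sym + (v.sym + (w.sym + z.sym))).det = det u v w z ^ 2 := by
  rw [sym_add, Matrix.det_mul, Matrix.det_transpose, det_of, sq]

end IVec

theorem rk1_eq_iff {u v : Fin 4 → ℤ} : rk1 u = rk1 v ↔ u = v ∨ u = -v := by
  constructor
  · intro h
    have h' : ∀ i j, u i * u j = v i * v j := fun i j => congrFun (congrFun h i) j
    by_cases hu : u = 0
    · left; funext i
      have := h' i i
      rw [hu, Pi.zero_apply, mul_zero] at this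
      rw [hu, mul_self_eq_zero.1 this.symm]; rfl
    · obtain ⟨i, hi⟩ := Function.ne_iff.1 hu
      rcases mul_self_eq_mul_self_iff.1 (h' i i) with e | e
      · left; funext j
        have := h' i j
        rw [← e] at this
        exact mul_left_cancel₀ hi this
      · right; funext j
        have := h' i j
        rw [show v i = -u i by rw [e, neg_neg]] at this
        refine mul_left_cancel₀ hi (this.trans ?_)
        simp
  · rintro (rfl | rfl)
    · rfl
    · ext i j; simp [rk1_apply]

theorem IVec.equiv_iff {u v : IVec} : u.equiv v = true ↔ u.sym = v.sym := by
  rw [equiv_iff_or, sym, sym, rk1_eq_iff, ← fn_neg, fn_injective.eq_iff, fn_injective.eq_iff]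

/-- The list of rank one forms attached to a list of vectors. -/
def syms (l : List IVec) : List Mat := l.map IVec.sym

/-- Move the entry equal to `±a` to the front, recording the parity of its position. -/
def pull (a : IVec) : List IVec → Option (Bool × List IVec)
  | [] => none
  | b :: m => bif a.equiv b then some (false, m) else
    match pull a m with
    | none => none
    | some (p, r) => some (!p, b :: r)

/-- The parity of the permutation (up to signs of vectors) relating two lists. -/
def parity : List IVec → List IVec → Option Bool
  | [], [] => some false
  | [], _ :: _ => none
  | a :: l, m =>
    match pull a m with
    | none => none
    | some (p, r) =>
      match parity l r with
      | none => none
      | some q => some (p ^^ q)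

theorem pull_spec {k : Type} [Field k] {a : IVec} {m : List IVec} {p : Bool} {r : List IVec}
    (h : pull a m = some (p, r)) : (syms m).Perm (a.sym :: syms r) ∧ ∀ F : List Mat → k, IsAlt F →
      F (syms m) = (bif p then -1 else 1) * F (a.sym :: syms r) := by
  induction m generalizing p r with
  | nil => simp [pull] at h
  | cons b m ih =>
    rw [pull] at h
    cases hab : a.equiv b with
    | true =>
      rw [hab, cond_true, Option.some.injEq, Prod.mk.injEq] at h
      obtain ⟨rfl, rfl⟩ := h
      rw [syms, List.map_cons, IVec.equiv_iff.1 hab]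
      exact ⟨.refl _, fun F _ => by rw [cond_false, one_mul]; rfl⟩
    | false =>
      rw [hab, cond_false] at h
      cases hp : pull a m with
      | none => simp [hp] at h
      | some q =>
        obtain ⟨p', r'⟩ := q
        rw [hp] at h
        simp only [Option.some.injEq, Prod.mk.injEq] at h
        obtain ⟨rfl, rfl⟩ := h
        obtain ⟨h1, h2⟩ := ih hp
        refine ⟨(h1.cons b.sym).trans (List.Perm.swap _ _ _), fun F hF => ?_⟩
        refine (h2 (fun l => F (b.sym :: l)) (hF.cons _)).trans ?_
        have := hF [] b.sym a.sym (syms r')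
        rw [List.nil_append, List.nil_append] at this
        rw [this]
        cases p' <;> simp [syms]

theorem parity_spec {k : Type} [Field k] {l m : List IVec} {p : Bool} (h : parity l m = some p) :
    (syms m).Perm (syms l) ∧ ∀ F : List Mat → k, IsAlt F →
      F (syms m) = (bif p then -1 else 1) * F (syms l) := by
  induction l generalizing m p with
  | nil =>
    cases m with
    | nil =>
      rw [parity, Option.some.injEq] at h
      subst h
      exact ⟨.refl _, fun F _ => by simp⟩
    | cons b m => simp [parity] at h
  | cons a l ih =>
    rw [parity] at h
    cases hp : pull a m with
    | none => simp [hp] at h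
    | some q =>
      obtain ⟨p', r⟩ := q
      rw [hp] at h
      simp only at h
      cases hq : parity l r with
      | none => simp [hq] at h
      | some q =>
        rw [hq, Option.some.injEq] at h
        subst h
        obtain ⟨h1, h2⟩ := pull_spec (k := k) hp
        obtain ⟨h3, h4⟩ := ih hq
        refine ⟨h1.trans (h3.cons _), fun F hF => ?_⟩
        rw [h2 F hF, h4 _ (hF.cons a.sym)]
        rw [← mul_assoc]
        congr 1
        cases p' <;> cases q <;> simp

end Vectors

section Codes

/-- A signed matrix with entries in `{0, 1, -1}`; each row is a number whose four digits in base
`4096` are the residues of the entries modulo `13`. -/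
structure Ent where
  s : Nat
  r0 : Nat
  r1 : Nat
  r2 : Nat
  r3 : Nat

/-- The code, to base `13`, of the vector `(a, b, c, d)` scaled to have first nonzero entry `1`. -/
def nrm (a b c d : Nat) : Nat :=
  bif Nat.beq a 0 then bif Nat.beq b 0 then bif Nat.beq c 0 then bif Nat.beq d 0 then 0 else 1
    else 13 + c ^ 11 * d % 13 else 169 + 13 * (b ^ 11 * c % 13) + b ^ 11 * d % 13
    else 2197 + 169 * (a ^ 11 * b % 13) + 13 * (a ^ 11 * c % 13) + a ^ 11 * d % 13

def unp (p : Nat) : Nat :=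
  nrm (p / 68719476736 % 13) (p / 16777216 % 4096 % 13) (p / 4096 % 4096 % 13) (p % 4096 % 13)

/-- The code of the image of a row vector. -/
def Ent.act (e : Ent) (a b c d : Nat) : Nat := unp (a * e.r0 + b * e.r1 + c * e.r2 + d * e.r3)

def Ent.actCode (e : Ent) (n : Nat) : Nat := e.act (n / 2197) (n / 169 % 13) (n / 13 % 13) (n % 13)

def smallInt (n : Nat) : ℤ := bif Nat.beq n 12 then -1 else n

def rowVec (r : Nat) : IVec :=
  ⟨smallInt (r / 68719476736), smallInt (r / 16777216 % 4096), smallInt (r / 4096 % 4096),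
    smallInt (r % 4096)⟩

def rowOk (r : Nat) : Bool :=
  (Nat.blt (r / 68719476736) 13 && Nat.blt (r / 16777216 % 4096) 13) &&
    (Nat.blt (r / 4096 % 4096) 13 && Nat.blt (r % 4096) 13)

def Ent.mulVec (e : Ent) (u : IVec) : IVec :=
  ⟨(rowVec e.r0).dot u, (rowVec e.r1).dot u, (rowVec e.r2).dot u, (rowVec e.r3).dot u⟩

/-- `e` is a well formed matrix of determinant one mapping the list `x` to the list `y`, up to
signs and a permutation whose sign is recorded by `e`. -/
def Ent.check (e : Ent) (y x : List IVec) : Bool :=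
  ((rowOk e.r0 && rowOk e.r1) && (rowOk e.r2 && rowOk e.r3)) &&
  (decide (IVec.det (rowVec e.r0) (rowVec e.r1) (rowVec e.r2) (rowVec e.r3) = 1) &&
  match parity y (x.map e.mulVec) with
  | none => false
  | some false => Nat.beq e.s 0
  | some true => Nat.beq e.s 1)

def Ent.mat (e : Ent) : Mat :=
  Matrix.of ![(rowVec e.r0).fn, (rowVec e.r1).fn, (rowVec e.r2).fn, (rowVec e.r3).fn]

def Ent.sl (e : Ent) : SL4 := if h : e.mat.det = 1 then ⟨e.mat, h⟩ else 1

/-- The sign recorded by a flag. -/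
def sgn (k : Type) [Field k] (s : Nat) : k := bif Nat.beq s 1 then -1 else 1

def digits (a b c d : Nat) : Fin 4 → ZMod 13 := ![(a : ZMod 13), (b : ZMod 13), (c : ZMod 13), (d : ZMod 13)]

/-- The vector modulo `13` with a given code. -/
def codeVec (n : Nat) : Fin 4 → ZMod 13 := digits (n / 2197) (n / 169 % 13) (n / 13 % 13) (n % 13)

theorem pow_eleven_mul {a : ℕ} (ha : a % 13 ≠ 0) : ((a : ZMod 13) ^ 11) * a = 1 := by
  have h : (a : ZMod 13) ≠ 0 := fun h => ha (Nat.mod_eq_zero_of_dvd ((ZMod.natCast_eq_zero_iff _ _).1 h))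
  rw [← pow_succ]
  exact ZMod.pow_card_sub_one_eq_one h

theorem pow_eleven_ne_zero {a : ℕ} (ha : a % 13 ≠ 0) : ((a : ZMod 13) ^ 11) ≠ 0 := fun h => by
  have := pow_eleven_mul ha
  rw [h, zero_mul] at this
  exact zero_ne_one this

theorem digits_congr {a b c d : ℕ} {v : Fin 4 → ZMod 13} (ha : (a : ZMod 13) = v 0)
    (hb : (b : ZMod 13) = v 1) (hc : (c : ZMod 13) = v 2) (hd : (d : ZMod 13) = v 3) :
    digits a b c d = v := by
  funext j; fin_cases j
  · exact ha
  · exact hb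
  · exact hc
  · exact hd

theorem codeVec_nrm {a b c d : ℕ} (ha : a < 13) (hb : b < 13) (hc : c < 13) (hd : d < 13) :
    ∃ l : ZMod 13, l ≠ 0 ∧ codeVec (nrm a b c d) = l • digits a b c d := by
  have hx : ∀ p q : ℕ, p ^ 11 * q % 13 < 13 := fun p q => Nat.mod_lt _ (by norm_num)
  have hz : ∀ p : ℕ, p < 13 → p ≠ 0 → p % 13 ≠ 0 := fun p h h' => by rwa [Nat.mod_eq_of_lt h]
  unfold nrm
  simp only [cond_eq_ite, Nat.beq_eq]
  split_ifs with h1 h2 h3 h4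
  · subst h1 h2 h3 h4
    exact ⟨1, one_ne_zero, by rw [one_smul]; rfl⟩
  · subst h1 h2 h3
    refine ⟨_, pow_eleven_ne_zero (hz d hd h4), digits_congr ?_ ?_ ?_ ?_⟩ <;>
      simp [digits, pow_eleven_mul (hz d hd h4)]
  · subst h1 h2
    have := hx c d
    refine ⟨_, pow_eleven_ne_zero (hz c hc h3), digits_congr ?_ ?_ ?_ ?_⟩
    · rw [show (13 + c ^ 11 * d % 13) / 2197 = 0 by omega]; simp [digits]
    · rw [show (13 + c ^ 11 * d % 13) / 169 % 13 = 0 by omega]; simp [digits]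
    · rw [show (13 + c ^ 11 * d % 13) / 13 % 13 = 1 by omega]
      simp [digits, pow_eleven_mul (hz c hc h3)]
    · rw [show (13 + c ^ 11 * d % 13) % 13 = c ^ 11 * d % 13 by omega]; simp [digits]
  · subst h1
    have := hx b c
    have := hx b d
    refine ⟨_, pow_eleven_ne_zero (hz b hb h2), digits_congr ?_ ?_ ?_ ?_⟩
    · rw [show (169 + 13 * (b ^ 11 * c % 13) + b ^ 11 * d % 13) / 2197 = 0 by omega]; simp [digits]
    · rw [show (169 + 13 * (b ^ 11 * c % 13) + b ^ 11 * d % 13) / 169 % 13 = 1 by omega]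
      simp [digits, pow_eleven_mul (hz b hb h2)]
    · rw [show (169 + 13 * (b ^ 11 * c % 13) + b ^ 11 * d % 13) / 13 % 13 = b ^ 11 * c % 13 by omega]
      simp [digits]
    · rw [show (169 + 13 * (b ^ 11 * c % 13) + b ^ 11 * d % 13) % 13 = b ^ 11 * d % 13 by omega]
      simp [digits]
  · have := hx a b
    have := hx a c
    have := hx a d
    refine ⟨_, pow_eleven_ne_zero (hz a ha h1), digits_congr ?_ ?_ ?_ ?_⟩
    · rw [show (2197 + 169 * (a ^ 11 * b % 13) + 13 * (a ^ 11 * c % 13) + a ^ 11 * d % 13) / 2197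
        = 1 by omega]
      simp [digits, pow_eleven_mul (hz a ha h1)]
    · rw [show (2197 + 169 * (a ^ 11 * b % 13) + 13 * (a ^ 11 * c % 13) + a ^ 11 * d % 13) / 169 % 13
        = a ^ 11 * b % 13 by omega]
      simp [digits]
    · rw [show (2197 + 169 * (a ^ 11 * b % 13) + 13 * (a ^ 11 * c % 13) + a ^ 11 * d % 13) / 13 % 13
        = a ^ 11 * c % 13 by omega]
      simp [digits]
    · rw [show (2197 + 169 * (a ^ 11 * b % 13) + 13 * (a ^ 11 * c % 13) + a ^ 11 * d % 13) % 13
        = a ^ 11 * d % 13 by omega]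
      simp [digits]

theorem nrm_lt (a b c d : ℕ) : nrm a b c d < 4394 := by
  have hx : ∀ p q : ℕ, p ^ 11 * q % 13 < 13 := fun p q => Nat.mod_lt _ (by norm_num)
  have h1 := hx a b
  have h2 := hx a c
  have h3 := hx a d
  have h4 := hx b c
  have h5 := hx b d
  have h6 := hx c d
  unfold nrm
  simp only [cond_eq_ite, Nat.beq_eq]
  split_ifs <;> omega

theorem smallInt_cast (n : ℕ) : ((smallInt n : ℤ) : ZMod 13) = n := by
  unfold smallInt
  rw [cond_eq_ite]
  split_ifs with h'
  · rw [Nat.eq_of_beq_eq_true h']; rfl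
  · simp

variable {e : Ent} {x y : List IVec}

theorem Ent.check_iff : e.check y x = true ↔
    (rowOk e.r0 ∧ rowOk e.r1 ∧ rowOk e.r2 ∧ rowOk e.r3) ∧ e.mat.det = 1 ∧
      ((e.s = 0 ∧ parity y (x.map e.mulVec) = some false) ∨
        (e.s = 1 ∧ parity y (x.map e.mulVec) = some true)) := by
  rw [Ent.check, Ent.mat, IVec.det_of, Bool.and_eq_true, Bool.and_eq_true, Bool.and_eq_true,
    Bool.and_eq_true, Bool.and_eq_true, decide_eq_true_iff]
  refine and_congr and_assoc (and_congr_right fun _ => ?_)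
  split <;> rename_i h <;> rw [h] <;> simp

theorem Ent.sl_val (h : e.mat.det = 1) : e.sl.1 = e.mat :=
  congrArg Subtype.val (dif_pos h)

theorem Ent.fn_mulVec (e : Ent) (u : IVec) : (e.mulVec u).fn = e.mat *ᵥ u.fn := by
  funext i
  fin_cases i <;> simp [Ent.mulVec, Ent.mat, IVec.fn, IVec.dot, Matrix.mulVec, dotProduct, Fin.sum_univ_four]

theorem Ent.syms_map (h : e.mat.det = 1) (x : List IVec) :
    syms (x.map e.mulVec) = (syms x).map (cong e.sl) := by
  rw [syms, syms, List.map_map, List.map_map]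
  refine List.map_congr_left fun u _ => ?_
  rw [Function.comp_apply, Function.comp_apply, IVec.sym, IVec.sym, cong_rk1, Ent.fn_mulVec, Ent.sl_val h]

theorem Ent.check_perm (h : e.check y x = true) : ((syms x).map (cong e.sl)).Perm (syms y) := by
  obtain ⟨-, h2, h3⟩ := Ent.check_iff.1 h
  rw [← Ent.syms_map h2]
  rcases h3 with h3 | h3
  exacts [(parity_spec (k := ℚ) h3.2).1, (parity_spec (k := ℚ) h3.2).1]

theorem Ent.check_alt {k : Type} [Field k] (h : e.check y x = true) {F : List Mat → k}
    (hF : IsAlt F) : F ((syms x).map (cong e.sl)) = sgn k e.s * F (syms y) := by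
  obtain ⟨-, h2, h3⟩ := Ent.check_iff.1 h
  rw [← Ent.syms_map h2]
  rcases h3 with h3 | h3
  · rw [(parity_spec h3.2).2 F hF, h3.1]; rfl
  · rw [(parity_spec h3.2).2 F hF, h3.1]; rfl

theorem unp_spec {r0 r1 r2 r3 a b c d : ℕ} (h0 : rowOk r0) (h1 : rowOk r1) (h2 : rowOk r2)
    (h3 : rowOk r3) (ha : a < 13) (hb : b < 13) (hc : c < 13) (hd : d < 13) :
    ∃ l : ZMod 13, l ≠ 0 ∧ codeVec (unp (a * r0 + b * r1 + c * r2 + d * r3)) = l • (digits a b c d ᵥ*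
      (Matrix.of ![(rowVec r0).fn, (rowVec r1).fn, (rowVec r2).fn, (rowVec r3).fn]).map
        (Int.castRingHom (ZMod 13))) := by
  have key : ∀ r : ℕ, rowOk r → ∃ p q s t : ℕ, p < 13 ∧ q < 13 ∧ s < 13 ∧ t < 13 ∧
      r = 68719476736 * p + 16777216 * q + 4096 * s + t ∧
      rowVec r = ⟨smallInt p, smallInt q, smallInt s, smallInt t⟩ := by
    intro r hr
    simp only [rowOk, Bool.and_eq_true, Nat.blt_eq] at hr
    exact ⟨_, _, _, _, hr.1.1, hr.1.2, hr.2.1, hr.2.2, by omega, rfl⟩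
  obtain ⟨p0, q0, s0, t0, hp0, hq0, hs0, ht0, rfl, e0⟩ := key r0 h0
  obtain ⟨p1, q1, s1, t1, hp1, hq1, hs1, ht1, rfl, e1⟩ := key r1 h1
  obtain ⟨p2, q2, s2, t2, hp2, hq2, hs2, ht2, rfl, e2⟩ := key r2 h2
  obtain ⟨p3, q3, s3, t3, hp3, hq3, hs3, ht3, rfl, e3⟩ := key r3 h3
  have bd : ∀ x0 x1 x2 x3 : ℕ, x0 < 13 → x1 < 13 → x2 < 13 → x3 < 13 →
      a * x0 + b * x1 + c * x2 + d * x3 < 4096 := fun x0 x1 x2 x3 g0 g1 g2 g3 => by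
    have := Nat.mul_le_mul (Nat.le_of_lt_succ ha) (Nat.le_of_lt_succ g0)
    have := Nat.mul_le_mul (Nat.le_of_lt_succ hb) (Nat.le_of_lt_succ g1)
    have := Nat.mul_le_mul (Nat.le_of_lt_succ hc) (Nat.le_of_lt_succ g2)
    have := Nat.mul_le_mul (Nat.le_of_lt_succ hd) (Nat.le_of_lt_succ g3)
    omega
  have hP := bd p0 p1 p2 p3 hp0 hp1 hp2 hp3
  have hQ := bd q0 q1 q2 q3 hq0 hq1 hq2 hq3
  have hS := bd s0 s1 s2 s3 hs0 hs1 hs2 hs3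
  have hT := bd t0 t1 t2 t3 ht0 ht1 ht2 ht3
  rw [show a * (68719476736 * p0 + 16777216 * q0 + 4096 * s0 + t0) +
      b * (68719476736 * p1 + 16777216 * q1 + 4096 * s1 + t1) +
      c * (68719476736 * p2 + 16777216 * q2 + 4096 * s2 + t2) +
      d * (68719476736 * p3 + 16777216 * q3 + 4096 * s3 + t3) =
      68719476736 * (a * p0 + b * p1 + c * p2 + d * p3) +
      16777216 * (a * q0 + b * q1 + c * q2 + d * q3) +
      4096 * (a * s0 + b * s1 + c * s2 + d * s3) + (a * t0 + b * t1 + c * t2 + d * t3) by ring, unp]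
  set P := a * p0 + b * p1 + c * p2 + d * p3 with eP
  set Q := a * q0 + b * q1 + c * q2 + d * q3 with eQ
  set S := a * s0 + b * s1 + c * s2 + d * s3 with eS
  set T := a * t0 + b * t1 + c * t2 + d * t3 with eT
  set N := 68719476736 * P + 16777216 * Q + 4096 * S + T with eN
  rw [show N / 68719476736 = P by omega, show N / 16777216 % 4096 = Q by omega,
    show N / 4096 % 4096 = S by omega, show N % 4096 = T by omega]
  have h13 : 0 < 13 := by norm_num
  obtain ⟨l, hl, h⟩ := codeVec_nrm (Nat.mod_lt P h13) (Nat.mod_lt Q h13) (Nat.mod_lt S h13)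
    (Nat.mod_lt T h13)
  refine ⟨l, hl, h.trans (congrArg (l • ·) ?_)⟩
  rw [e0, e1, e2, e3]
  refine digits_congr ?_ ?_ ?_ ?_ <;>
    simp [digits, vecMul, dotProduct, Fin.sum_univ_four, IVec.fn, smallInt_cast, *]

variable {k : Type} [Field k] {n : ℕ} {φ ψ : altChains k IsCell n →ₗ[k] k}

/-- The value of a functional on a cell given by vectors, at the row with a given code. -/
noncomputable def codeEval (φ : altChains k IsCell n →ₗ[k] k) (x : List IVec) (m : ℕ) : k :=
  rowEval φ (syms x) (codeVec m)

theorem codeEval_nrm (hφ : IsInvariantFunctional (Gamma0 13) φ) (x : List IVec) {a b c d : ℕ}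
    (ha : a < 13) (hb : b < 13) (hc : c < 13) (hd : d < 13) :
    codeEval φ x (nrm a b c d) = rowEval φ (syms x) (digits a b c d) := by
  obtain ⟨l, hl, h⟩ := codeVec_nrm ha hb hc hd
  rw [codeEval, h, rowEval_smul_row hφ _ hl]

theorem Ent.codeVec_act (h : e.check y x = true) {a b c d : ℕ}
    (ha : a < 13) (hb : b < 13) (hc : c < 13) (hd : d < 13) :
    ∃ l : ZMod 13, l ≠ 0 ∧ codeVec (e.act a b c d) = l • (digits a b c d ᵥ* redMat e.sl) := by
  obtain ⟨⟨h0, h1, h2, h3⟩, hd', -⟩ := Ent.check_iff.1 h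
  rw [redMat, Ent.sl_val hd']
  exact unp_spec h0 h1 h2 h3 ha hb hc hd

theorem Ent.codeEval_act (hφ : IsInvariantFunctional (Gamma0 13) φ) (h : e.check y x = true)
    {a b c d : ℕ} (ha : a < 13) (hb : b < 13) (hc : c < 13) (hd : d < 13) :
    codeEval φ x (e.act a b c d) = sgn k e.s * rowEval φ (syms y) (digits a b c d) := by
  obtain ⟨l, hl, h'⟩ := e.codeVec_act h ha hb hc hd
  rw [codeEval, h', rowEval_smul_row hφ _ hl, ← rowEval_map_cong hφ,
    e.check_alt h (isAlt_rowEval φ _)]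

theorem Ent.codeEval_actCode (hφ : IsInvariantFunctional (Gamma0 13) φ) (h : e.check y x = true)
    {m : ℕ} (hm : m < 28561) : codeEval φ x (e.actCode m) = sgn k e.s * codeEval φ y m := by
  exact e.codeEval_act hφ h (by omega) (by omega) (by omega) (by omega)

theorem Ent.actCode_lt (e : Ent) (m : ℕ) : e.actCode m < 4394 := nrm_lt _ _ _ _

theorem sgn_mul_self (s : ℕ) : sgn k s * sgn k s = 1 := by
  rw [sgn]; cases Nat.beq s 1 <;> simp

end Codes

section Canonical

/-- A face of a cell: the extra vector, packed like the rows of an `Ent`, the type of the resulting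
cell and a matrix carrying the standard cell of that type to it. -/
structure Face where
  w : Nat
  t : Nat
  e : Ent

def stp (s m st : Nat) : Nat :=
  bif Nat.blt m (st / 3) then 3 * m + s else
    bif Nat.beq m (st / 3) then (bif Nat.beq (st % 3) s then st else 3 * m + 2) else st

def canonAux (a b c d : Nat) : List Ent → Nat
  | [] => 3 * nrm a b c d
  | e :: L => stp e.s (e.act a b c d) (canonAux a b c d L)

/-- `3 * m + i`, where `m` is the least code in the orbit of `n` and `i` is `0`, `1` or `2` according
to whether the matrices reaching it have sign `1`, sign `-1` or both. -/
def canon (L : List Ent) (n : Nat) : Nat :=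
  canonAux (n / 2197) (n / 169 % 13) (n / 13 % 13) (n % 13) L

def Face.term (stab : Nat → List Ent) (n : Nat) (f : Face) (r : List (Int × Nat)) :
    List (Int × Nat) :=
  let c := canon (stab f.t) (f.e.act (n / 2197) (n / 169 % 13) (n / 13 % 13) (n % 13))
  bif Nat.beq (c % 3) 2 then r else
    (bif Nat.beq ((c % 3 + f.e.s) % 2) 0 then 1 else -1, 4 * (c / 3) + f.t) :: r

/-- The boundary of a cell with a given row, as a formal sum. -/
def bdRow (stab : Nat → List Ent) (n : Nat) : List Face → List (Int × Nat)
  | [] => []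
  | f :: F => f.term stab n (bdRow stab n F)

def coef (k : Nat) : List (Int × Nat) → Int
  | [] => 0
  | (c, l) :: r => bif Nat.beq k l then c + coef k r else coef k r

theorem canonAux_le (a b c d : ℕ) (L : List Ent) (hs : ∀ e ∈ L, e.s ≤ 1) :
    canonAux a b c d L / 3 ≤ nrm a b c d ∧ ∀ e ∈ L, canonAux a b c d L / 3 ≤ e.act a b c d := by
  induction L with
  | nil => simp [canonAux]
  | cons e L ih =>
    obtain ⟨h1, h2⟩ := ih fun e he => hs e (List.mem_cons_of_mem _ he)
    have := hs e List.mem_cons_self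
    have key : stp e.s (e.act a b c d) (canonAux a b c d L) / 3 ≤ canonAux a b c d L / 3 ∧
        stp e.s (e.act a b c d) (canonAux a b c d L) / 3 ≤ e.act a b c d := by
      unfold stp
      simp only [cond_eq_ite, Nat.beq_eq, Nat.blt_eq]
      split_ifs <;> omega
    rw [canonAux]
    refine ⟨key.1.trans h1, fun e' he' => ?_⟩
    rcases List.mem_cons.1 he' with rfl | he'
    exacts [key.2, key.1.trans (h2 e' he')]

theorem canonAux_sign (a b c d : ℕ) (L : List Ent) (hs : ∀ e ∈ L, e.s ≤ 1)
    (h : canonAux a b c d L % 3 = 0) :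
    ∀ e ∈ L, e.act a b c d = canonAux a b c d L / 3 → e.s = 0 := by
  induction L with
  | nil => simp
  | cons e L ih =>
    have hs' : ∀ e ∈ L, e.s ≤ 1 := fun e he => hs e (List.mem_cons_of_mem _ he)
    have hle := (canonAux_le a b c d L hs').2
    have := hs e List.mem_cons_self
    rw [canonAux] at h ⊢
    unfold stp at h ⊢
    simp only [cond_eq_ite, Nat.beq_eq, Nat.blt_eq] at h ⊢
    intro e' he' hh
    rcases List.mem_cons.1 he' with rfl | he'
    · split_ifs at h hh <;> omega
    · have := hle e' he'
      split_ifs at h hh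
      · omega
      · exact ih hs' h e' he' hh
      · omega
      · exact ih hs' h e' he' hh

theorem canonAux_val {k : Type} [Field k] [CharZero k] (a b c d : ℕ) (L : List Ent)
    (hs : ∀ e ∈ L, e.s ≤ 1) {f : ℕ → k} {v : k} (h0 : f (nrm a b c d) = v)
    (h : ∀ e ∈ L, f (e.act a b c d) = sgn k e.s * v) :
    (canonAux a b c d L % 3 = 0 → f (canonAux a b c d L / 3) = v) ∧
    (canonAux a b c d L % 3 = 1 → f (canonAux a b c d L / 3) = -v) ∧
    (canonAux a b c d L % 3 = 2 → v = 0) := by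
  induction L with
  | nil => simp [canonAux, h0]
  | cons e L ih =>
    obtain ⟨i0, i1, i2⟩ := ih (fun e he => hs e (List.mem_cons_of_mem _ he))
      fun e he => h e (List.mem_cons_of_mem _ he)
    have h1 := hs e List.mem_cons_self
    have h2 := h e List.mem_cons_self
    have h3 : (e.s = 0 ∧ f (e.act a b c d) = v) ∨ (e.s = 1 ∧ f (e.act a b c d) = -v) := by
      rcases Nat.le_one_iff_eq_zero_or_eq_one.1 h1 with hs | hs
      · exact Or.inl ⟨hs, by rw [h2, hs, sgn]; exact one_mul v⟩
      · exact Or.inr ⟨hs, by rw [h2, hs, sgn]; exact neg_one_mul v⟩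
    rw [canonAux]
    generalize e.act a b c d = m at *
    generalize canonAux a b c d L = st at *
    unfold stp
    simp only [cond_eq_ite, Nat.beq_eq, Nat.blt_eq]
    split_ifs with c1 c2 c3
    · rw [show (3 * m + e.s) / 3 = m by omega, show (3 * m + e.s) % 3 = e.s by omega]
      rcases h3 with ⟨e1, e2⟩ | ⟨e1, e2⟩
      · exact ⟨fun _ => e2, by omega, by omega⟩
      · exact ⟨by omega, fun _ => e2, by omega⟩
    · exact ⟨i0, i1, i2⟩
    · refine ⟨by omega, by omega, fun _ => ?_⟩
      rw [← c2] at i0 i1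
      have h4 : st % 3 = 0 ∨ st % 3 = 1 ∨ st % 3 = 2 := by omega
      rcases h4 with h4 | h4 | h4
      · rcases h3 with ⟨e1, e2⟩ | ⟨e1, e2⟩
        · omega
        · exact self_eq_neg.1 ((i0 h4).symm.trans e2)
      · rcases h3 with ⟨e1, e2⟩ | ⟨e1, e2⟩
        · exact self_eq_neg.1 (e2.symm.trans (i1 h4))
        · omega
      · exact i2 h4
    · exact ⟨i0, i1, i2⟩

/-- The possible values of `nrm`. -/
def IsCode (n : ℕ) : Prop :=
  n = 0 ∨ n = 1 ∨ (13 ≤ n ∧ n < 26) ∨ (169 ≤ n ∧ n < 338) ∨ (2197 ≤ n ∧ n < 4394)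

theorem isCode_nrm (a b c d : ℕ) : IsCode (nrm a b c d) := by
  have hx : ∀ p q : ℕ, p ^ 11 * q % 13 < 13 := fun p q => Nat.mod_lt _ (by norm_num)
  have h1 := hx a b
  have h2 := hx a c
  have h3 := hx a d
  have h4 := hx b c
  have h5 := hx b d
  have h6 := hx c d
  unfold nrm IsCode
  simp only [cond_eq_ite, Nat.beq_eq]
  split_ifs <;> omega

theorem natCast_inj_of_lt {a b : ℕ} (ha : a < 13) (hb : b < 13) (h : (a : ZMod 13) = b) : a = b := by
  have := (ZMod.natCast_eq_natCast_iff' _ _ _).1 h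
  rwa [Nat.mod_eq_of_lt ha, Nat.mod_eq_of_lt hb] at this

theorem IsCode.eq_of_smul {m n : ℕ} (hm : IsCode m) (hn : IsCode n) {l : ZMod 13} (hl : l ≠ 0)
    (h : codeVec m = l • codeVec n) : m = n := by
  have key : ∀ n, IsCode n → n < 28561 ∧ (n / 2197 = 1 ∨ n / 2197 = 0 ∧ (n / 169 % 13 = 1 ∨
      n / 169 % 13 = 0 ∧ (n / 13 % 13 = 1 ∨ n / 13 % 13 = 0 ∧ (n % 13 = 1 ∨ n % 13 = 0)))) := by
    intro n hn
    unfold IsCode at hn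
    omega
  obtain ⟨hm', hm⟩ := key m hm
  obtain ⟨hn', hn⟩ := key n hn
  have e0 : ((m / 2197 : ℕ) : ZMod 13) = l * ((n / 2197 : ℕ) : ZMod 13) := congrFun h 0
  have e1 : ((m / 169 % 13 : ℕ) : ZMod 13) = l * ((n / 169 % 13 : ℕ) : ZMod 13) := congrFun h 1
  have e2 : ((m / 13 % 13 : ℕ) : ZMod 13) = l * ((n / 13 % 13 : ℕ) : ZMod 13) := congrFun h 2
  have e3 : ((m % 13 : ℕ) : ZMod 13) = l * ((n % 13 : ℕ) : ZMod 13) := congrFun h 3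
  have d : m = m / 2197 * 2197 + m / 169 % 13 * 169 + m / 13 % 13 * 13 + m % 13 := by omega
  have d' : n = n / 2197 * 2197 + n / 169 % 13 * 169 + n / 13 % 13 * 13 + n % 13 := by omega
  have b0 : m / 2197 < 13 := by omega
  have b1 : m / 169 % 13 < 13 := Nat.mod_lt _ (by norm_num)
  have b2 : m / 13 % 13 < 13 := Nat.mod_lt _ (by norm_num)
  have b3 : m % 13 < 13 := Nat.mod_lt _ (by norm_num)
  have b0' : n / 2197 < 13 := by omega
  have b1' : n / 169 % 13 < 13 := Nat.mod_lt _ (by norm_num)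
  have b2' : n / 13 % 13 < 13 := Nat.mod_lt _ (by norm_num)
  have b3' : n % 13 < 13 := Nat.mod_lt _ (by norm_num)
  rw [d, d']
  generalize m / 2197 = m0 at *
  generalize m / 169 % 13 = m1 at *
  generalize m / 13 % 13 = m2 at *
  generalize m % 13 = m3 at *
  generalize n / 2197 = n0 at *
  generalize n / 169 % 13 = n1 at *
  generalize n / 13 % 13 = n2 at *
  generalize n % 13 = n3 at *
  have fin : l = 1 → m0 * 2197 + m1 * 169 + m2 * 13 + m3 = n0 * 2197 + n1 * 169 + n2 * 13 + n3 := by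
    intro h1
    rw [h1, one_mul] at e0 e1 e2 e3
    rw [natCast_inj_of_lt b0 b0' e0, natCast_inj_of_lt b1 b1' e1, natCast_inj_of_lt b2 b2' e2,
      natCast_inj_of_lt b3 b3' e3]
  have one : ∀ {a b : ℕ}, a = 1 → b = 1 → (a : ZMod 13) = l * b → l = 1 := by
    rintro _ _ rfl rfl h
    simpa using h.symm
  have left : ∀ {a b : ℕ}, a = 1 → b = 0 → (a : ZMod 13) = l * b → False := by
    rintro _ _ rfl rfl h
    simp at h
  have right : ∀ {a b : ℕ}, a = 0 → b = 1 → (a : ZMod 13) = l * b → False := by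
    rintro _ _ rfl rfl h
    exact hl (by simpa using h.symm)
  rcases hm with hm | ⟨h0, hm⟩ <;> rcases hn with hn | ⟨h0', hn⟩
  · exact fin (one hm hn e0)
  · exact (left hm h0' e0).elim
  · exact (right h0 hn e0).elim
  rcases hm with hm | ⟨h1, hm⟩ <;> rcases hn with hn | ⟨h1', hn⟩
  · exact fin (one hm hn e1)
  · exact (left hm h1' e1).elim
  · exact (right h1 hn e1).elim
  rcases hm with hm | ⟨h2, hm⟩ <;> rcases hn with hn | ⟨h2', hn⟩
  · exact fin (one hm hn e2)
  · exact (left hm h2' e2).elim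
  · exact (right h2 hn e2).elim
  rcases hm with hm | hm <;> rcases hn with hn | hn
  · exact fin (one hm hn e3)
  · exact (left hm hn e3).elim
  · exact (right hm hn e3).elim
  · omega

variable {k : Type} [Field k] {n : ℕ} {φ : altChains k IsCell n →ₗ[k] k}

theorem Ent.s_le_one {e : Ent} {x y : List IVec} (h : e.check y x = true) : e.s ≤ 1 := by
  rcases (Ent.check_iff.1 h).2.2 with h | h <;> omega

theorem canon_val [CharZero k] (hφ : IsInvariantFunctional (Gamma0 13) φ) {L : List Ent}
    {x : List IVec} (hL : ∀ e ∈ L, e.check x x = true) {m : ℕ} (hm : m < 28561) :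
    (canon L m % 3 = 0 → codeEval φ x (canon L m / 3) = codeEval φ x m) ∧
    (canon L m % 3 = 1 → codeEval φ x (canon L m / 3) = -codeEval φ x m) ∧
    (canon L m % 3 = 2 → codeEval φ x m = 0) :=
  canonAux_val _ _ _ _ L (fun e he => e.s_le_one (hL e he))
    (codeEval_nrm hφ x (by omega) (by omega) (by omega) (by omega))
    fun e he => e.codeEval_actCode hφ (hL e he) hm

/-- The sum of the values of `v` along a formal sum. -/
def lsum (v : ℕ → k) : List (Int × Nat) → k
  | [] => 0
  | (c, l) :: r => c * v l + lsum v r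

theorem Face.lsum_term [CharZero k] (hφ : IsInvariantFunctional (Gamma0 13) φ)
    {stab : ℕ → List Ent} {X : ℕ → List IVec} {x : List IVec} {f : Face} (ht : f.t < 4)
    (hf : f.e.check (rowVec f.w :: x) (X f.t) = true)
    (hL : ∀ e ∈ stab f.t, e.check (X f.t) (X f.t) = true) {m : ℕ} (hm : m < 28561)
    (r : List (Int × Nat)) :
    lsum (fun l => codeEval φ (X (l % 4)) (l / 4)) (f.term stab m r) =
      codeEval φ (rowVec f.w :: x) m + lsum (fun l => codeEval φ (X (l % 4)) (l / 4)) r := by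
  have h1 := f.e.codeEval_actCode hφ hf hm
  have h2 := canon_val hφ hL (m := f.e.actCode m) ((f.e.actCode_lt m).trans (by norm_num))
  rw [h1] at h2
  have h3 := f.e.s_le_one hf
  unfold Face.term
  change lsum _ (bif Nat.beq (canon (stab f.t) (f.e.actCode m) % 3) 2 then r else
    (bif Nat.beq ((canon (stab f.t) (f.e.actCode m) % 3 + f.e.s) % 2) 0 then 1 else -1,
      4 * (canon (stab f.t) (f.e.actCode m) / 3) + f.t) :: r) = _
  change _ ∧ _ ∧ _ at h2
  generalize canon (stab f.t) (f.e.actCode m) = c at *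
  obtain ⟨i0, i1, i2⟩ := h2
  have h4 : (4 * (c / 3) + f.t) % 4 = f.t := by omega
  have h5 : (4 * (c / 3) + f.t) / 4 = c / 3 := by omega
  have h6 : f.e.s = 0 ∧ sgn k f.e.s = 1 ∨ f.e.s = 1 ∧ sgn k f.e.s = -1 := by
    rcases Nat.le_one_iff_eq_zero_or_eq_one.1 h3 with hs | hs <;> rw [hs]
    exacts [Or.inl ⟨rfl, rfl⟩, Or.inr ⟨rfl, rfl⟩]
  have h7 : c % 3 = 0 ∨ c % 3 = 1 ∨ c % 3 = 2 := by omega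
  rcases h6 with ⟨h6, h8⟩ | ⟨h6, h8⟩ <;> rw [h8] at i0 i1 i2 <;> rcases h7 with h7 | h7 | h7
  · rw [h7, h6]
    change (((1 : ℤ) : k)) * codeEval φ (X ((4 * (c / 3) + f.t) % 4)) ((4 * (c / 3) + f.t) / 4) +
      lsum _ r = _
    rw [h4, h5, i0 h7]; simp
  · rw [h7, h6]
    change (((-1 : ℤ) : k)) * codeEval φ (X ((4 * (c / 3) + f.t) % 4)) ((4 * (c / 3) + f.t) / 4) +
      lsum _ r = _
    rw [h4, h5, i1 h7]; simp
  · rw [h7, h6, show codeEval φ (rowVec f.w :: x) m = 0 by simpa using i2 h7, zero_add]; rfl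
  · rw [h7, h6]
    change (((-1 : ℤ) : k)) * codeEval φ (X ((4 * (c / 3) + f.t) % 4)) ((4 * (c / 3) + f.t) / 4) +
      lsum _ r = _
    rw [h4, h5, i0 h7]; simp
  · rw [h7, h6]
    change (((1 : ℤ) : k)) * codeEval φ (X ((4 * (c / 3) + f.t) % 4)) ((4 * (c / 3) + f.t) / 4) +
      lsum _ r = _
    rw [h4, h5, i1 h7]; simp
  · rw [h7, h6, show codeEval φ (rowVec f.w :: x) m = 0 by simpa using i2 h7, zero_add]; rfl

theorem lsum_bdRow [CharZero k] (hφ : IsInvariantFunctional (Gamma0 13) φ)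
    {stab : ℕ → List Ent} {X : ℕ → List IVec} {x : List IVec} {F : List Face}
    (hF : ∀ f ∈ F, f.t < 4 ∧ f.e.check (rowVec f.w :: x) (X f.t) = true ∧
      ∀ e ∈ stab f.t, e.check (X f.t) (X f.t) = true) {m : ℕ} (hm : m < 28561) :
    lsum (fun l => codeEval φ (X (l % 4)) (l / 4)) (bdRow stab m F) =
      (F.map fun f => codeEval φ (rowVec f.w :: x) m).sum := by
  induction F with
  | nil => rfl
  | cons f F ih =>
    obtain ⟨h1, h2, h3⟩ := hF f List.mem_cons_self
    rw [bdRow, f.lsum_term hφ h1 h2 h3 hm, ih fun f hf => hF f (List.mem_cons_of_mem _ hf),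
      List.map_cons, List.sum_cons]

theorem codeEval_comp_boundary [CharZero k] (hφ : IsInvariantFunctional (Gamma0 13) φ)
    {stab : ℕ → List Ent} {X : ℕ → List IVec} {x : List IVec} {F : List Face}
    (hF : ∀ f ∈ F, f.t < 4 ∧ f.e.check (rowVec f.w :: x) (X f.t) = true ∧
      ∀ e ∈ stab f.t, e.check (X f.t) (X f.t) = true)
    (hx : IsCellList IsCell (syms x)) (hn : x.length + (n + 1) = 9)
    (hd : (F.map fun f => (rowVec f.w).sym).Nodup)
    (hS : ∀ w, IsCellList IsCell (w :: syms x) ↔ ∃ f ∈ F, (rowVec f.w).sym = w)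
    {m : ℕ} (hm : m < 28561) :
    codeEval (φ ∘ₗ cellBoundaryMap cellFamily_isCell n) x m =
      lsum (fun l => codeEval φ (X (l % 4)) (l / 4)) (bdRow stab m F) := by
  classical
  rw [lsum_bdRow hφ hF hm, codeEval, rowEval_comp_boundary φ hx (by rwa [syms, List.length_map])
    (S := (F.map fun f => (rowVec f.w).sym).toFinset) (fun w => by simp [hS]),
    List.sum_toFinset _ hd, List.map_map]
  rfl

theorem lsum_eq_coef_mul {v : ℕ → k} {a : ℕ} {R : List (Int × Nat)}
    (h : ∀ q ∈ R, v q.2 = 0 ∨ coef q.2 R = 0 ∨ q.2 = a) : lsum v R = coef a R * v a := by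
  classical
  have key : ∀ (S : Finset ℕ) (R : List (Int × Nat)), (∀ q ∈ R, q.2 ∈ S) →
      lsum v R = ∑ l ∈ S, (coef l R : k) * v l := by
    intro S R hR
    induction R with
    | nil => simp [lsum, coef]
    | cons q R ih =>
      obtain ⟨c, l⟩ := q
      have hl : l ∈ S := hR _ List.mem_cons_self
      have : ∀ j ∈ S, (coef j ((c, l) :: R) : k) * v j =
          (if j = l then (c : k) * v l else 0) + (coef j R : k) * v j := by
        intro j _
        rw [coef, cond_eq_ite]
        simp only [Nat.beq_eq]
        split_ifs with hj
        · subst hj; push_cast; ring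
        · ring
      rw [lsum, ih fun q hq => hR q (List.mem_cons_of_mem _ hq), Finset.sum_congr rfl this,
        Finset.sum_add_distrib, Finset.sum_ite_eq' S l, if_pos hl]
  have hz : ∀ (R : List (Int × Nat)), (∀ q ∈ R, q.2 ≠ a) → coef a R = 0 := by
    intro R hR
    induction R with
    | nil => rfl
    | cons q R ih =>
      obtain ⟨c, l⟩ := q
      rw [coef, cond_eq_ite, if_neg, ih fun q hq => hR q (List.mem_cons_of_mem _ hq)]
      intro e
      exact hR _ List.mem_cons_self (Nat.eq_of_beq_eq_true e).symm
  rw [key (insert a (R.map Prod.snd).toFinset) R fun q hq => Finset.mem_insert_of_mem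
    (List.mem_toFinset.2 (List.mem_map_of_mem hq))]
  refine Finset.sum_eq_single_of_mem a (Finset.mem_insert_self _ _) fun l hl hla => ?_
  rcases Finset.mem_insert.1 hl with hl | hl
  · exact (hla hl).elim
  obtain ⟨q, hq, rfl⟩ := List.mem_map.1 (List.mem_toFinset.1 hl)
  rcases h q hq with h | h | h
  · rw [h, mul_zero]
  · rw [h, Int.cast_zero, zero_mul]
  · exact (hla h).elim

end Canonical

section OrbitSums

open scoped Classical

variable {k : Type} [Field k] {n : ℕ}

theorem IsCell.exists_rk1 {S : Finset Mat} (hS : IsCell S) : ∀ x ∈ S, ∃ w, x = rk1 w := by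
  obtain ⟨-, ⟨Q, -, h⟩, -⟩ := hS
  exact fun x hx => (h hx).imp fun w hw => hw.1

theorem finite_support_orbit {y : List Mat} (hy : IsCell y.toFinset) {f : List Mat → k}
    (hf : f.support.Finite) (v : Fin 4 → ZMod 13) :
    (Function.support fun g : SL4 => if HasRow g v then f (y.map (cong g)) else 0).Finite := by
  refine (finite_cong (T := hf.toFinset.biUnion List.toFinset) hy.2.2.1 hy.exists_rk1).subset
    fun g hg x hx => ?_
  have hg' : f (y.map (cong g)) ≠ 0 := fun h => hg (by simp [h])
  exact Finset.mem_biUnion.2 ⟨_, hf.mem_toFinset.2 hg',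
    List.mem_toFinset.2 (List.mem_map_of_mem (List.mem_toFinset.1 hx))⟩

/-- The functional summing the values of a chain over the translates of a cell by the matrices with a
given last row. -/
noncomputable def orbitSum {y : List Mat} (hy : IsCell y.toFinset) (v : Fin 4 → ZMod 13) :
    altChains k IsCell n →ₗ[k] k where
  toFun f := ∑ᶠ g : SL4, if HasRow g v then f.1 (y.map (cong g)) else 0
  map_add' f f' := by
    rw [← finsum_add_distrib (finite_support_orbit hy f.2.1 v) (finite_support_orbit hy f'.2.1 v)]
    refine finsum_congr fun g => ?_
    split_ifs
    · rfl
    · rw [add_zero]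
  map_smul' c f := by
    rw [RingHom.id_apply, smul_finsum' _ (finite_support_orbit hy f.2.1 v)]
    refine finsum_congr fun g => ?_
    split_ifs
    · rfl
    · rw [smul_zero]

variable {y : List Mat} (hy : IsCell y.toFinset) {v v' : Fin 4 → ZMod 13}

theorem isInvariantFunctional_orbitSum :
    IsInvariantFunctional (Gamma0 13) (orbitSum (k := k) (n := n) hy v) := by
  intro γ f
  change (∑ᶠ g : SL4, if HasRow g v then f.1 ((y.map (cong g)).map (cong (γ : SL4)⁻¹)) else 0) =
    ∑ᶠ g : SL4, if HasRow g v then f.1 (y.map (cong g)) else 0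
  rw [← finsum_comp_equiv (Equiv.mulLeft (γ : SL4))]
  refine finsum_congr fun g => ?_
  have h : HasRow (γ * g) v ↔ HasRow g v := by
    refine ⟨fun h => ?_, mul_mem_hasRow γ.2⟩
    have := mul_mem_hasRow (inv_mem γ.2) h
    rwa [inv_mul_cancel_left] at this
  rw [Equiv.coe_mulLeft, ← map_cong_mul, inv_mul_cancel_left]
  simp only [h]

theorem rowEval_orbitSum {x : List Mat} (hx : IsCellList IsCell x) (hn : x.length + n = 9) {g : SL4}
    (hg : HasRow g v') : rowEval (orbitSum (k := k) (n := n) hy v) x v' =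
      ∑ᶠ h : SL4, if HasRow (g * h) v then cellDelta k x (y.map (cong h)) else 0 := by
  have hx' := (isCellList_map_cong g x).2 hx
  rw [rowEval_eq (isInvariantFunctional_orbitSum hy) x hg, cellEval_of_mem]
  swap
  · exact cellDelta_mem hx'.2 (by rw [List.length_map, hn])
  change (∑ᶠ h : SL4, if HasRow h v then cellDelta k (x.map (cong g)) (y.map (cong h)) else 0) = _
  rw [← finsum_comp_equiv (Equiv.mulLeft g)]
  refine finsum_congr fun h => ?_
  rw [Equiv.coe_mulLeft, ← cellDelta_map_cong, ← map_cong_mul, inv_mul_cancel_left]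

theorem HasRow.exists_smul {g h : SL4} (hg : HasRow g v') (hh : HasRow (g * h) v) :
    ∃ l : ZMod 13, l ≠ 0 ∧ v = l • (v' ᵥ* redMat h) := by
  obtain ⟨c, hc, e⟩ := hh
  obtain ⟨c', hc', e'⟩ := hg.mul h
  refine ⟨c⁻¹ * c', mul_ne_zero (inv_ne_zero hc) hc', ?_⟩
  rw [mul_smul, ← e', e, smul_smul, inv_mul_cancel₀ hc, one_smul]

theorem exists_of_rowEval_orbitSum_ne_zero {x : List Mat}
    (h : rowEval (orbitSum (k := k) (n := n) hy v) x v' ≠ 0) :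
    ∃ h : SL4, (y.map (cong h)).Perm x ∧ ∃ l : ZMod 13, l ≠ 0 ∧ v = l • (v' ᵥ* redMat h) := by
  have hx : IsCellList IsCell x ∧ x.length + n = 9 := not_not.1 fun hx => h (rowEval_eq_zero hx v')
  have hv' : v' ≠ 0 := by rintro rfl; exact h (rowEval_zero _ _)
  obtain ⟨g, hg⟩ := exists_hasRow hv'
  rw [rowEval_orbitSum hy hx.1 hx.2 hg] at h
  obtain ⟨t, ht⟩ := not_forall.1 fun h' => h ((finsum_congr h').trans finsum_zero)
  have ht' : HasRow (g * t) v ∧ cellDelta k x (y.map (cong t)) ≠ 0 := by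
    rw [ite_eq_right_iff, Classical.not_imp] at ht
    exact ht
  exact ⟨t, (cellDelta_ne_zero ht'.2).2, hg.exists_smul ht'.1⟩

theorem rowEval_orbitSum_self_ne_zero [CharZero k] (hy' : y.Nodup) (hn : y.length + n = 9)
    (hv : v ≠ 0) (h : ∀ h : SL4, (y.map (cong h)).Perm y →
      (∃ l : ZMod 13, l ≠ 0 ∧ v = l • (v ᵥ* redMat h)) → cellDelta k y (y.map (cong h)) = 1) :
    rowEval (orbitSum (k := k) (n := n) hy v) y v ≠ 0 := by
  obtain ⟨g, hg⟩ := exists_hasRow hv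
  have hf := finite_support_orbit hy (cellDelta_mem (k := k) hy hn).1
  rw [rowEval_orbitSum hy ⟨hy', hy⟩ hn hg]
  have hv1 : ∀ t : SL4, (if HasRow (g * t) v then cellDelta k y (y.map (cong t)) else 0) ≠ 0 →
      (if HasRow (g * t) v then cellDelta k y (y.map (cong t)) else 0) = 1 := by
    intro t ht
    rw [ne_eq, ite_eq_right_iff, Classical.not_imp] at ht
    rw [if_pos ht.1, h t (cellDelta_ne_zero ht.2).2 (hg.exists_smul ht.1)]
  have hfin : (Function.support fun t : SL4 =>
      if HasRow (g * t) v then cellDelta k y (y.map (cong t)) else 0).Finite := by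
    refine (finite_cong (T := y.toFinset) hy.2.2.1 hy.exists_rk1).subset fun t ht x hx => ?_
    have ht' : cellDelta k y (y.map (cong t)) ≠ 0 := fun h => ht (by simp [h])
    exact List.mem_toFinset.2 ((cellDelta_ne_zero ht').2.subset
      (List.mem_map_of_mem (List.mem_toFinset.1 hx)))
  rw [finsum_eq_sum _ hfin, Finset.sum_congr rfl fun t ht => hv1 t (hfin.mem_toFinset.1 ht),
    Finset.sum_const, nsmul_one, Nat.cast_ne_zero]
  refine (Finset.card_pos.2 ⟨1, hfin.mem_toFinset.2 ?_⟩).ne'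
  have : y.map (cong 1) = y := by rw [funext cong_one, List.map_id']
  change (if HasRow (g * 1) v then cellDelta k y (y.map (cong 1)) else 0) ≠ 0
  rw [mul_one, if_pos hg, this, cellDelta_self hy']
  exact one_ne_zero

end OrbitSums

theorem cong_list_sum (g : SL4) (l : List Mat) : cong g l.sum = (l.map (cong g)).sum := by
  induction l with
  | nil => simp [cong]
  | cons a l ih =>
    rw [List.sum_cons, List.map_cons, List.sum_cons, ← ih]
    simp only [cong, mul_add, add_mul]

section DeltaFunctionals

/-- The list `L` represents the stabilizer of the cell `x` up to sign. -/
def IsStabList (L : List Ent) (x : List IVec) : Prop :=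
  (∀ e ∈ L, e.check x x = true) ∧ ∀ h : SL4, ((syms x).map (cong h)).Perm (syms x) →
    ∃ e ∈ L, h.1 = e.mat ∨ h.1 = -e.mat

theorem codeVec_act_of_eq {e : Ent} {x y : List IVec} (he : e.check y x = true) {h : SL4}
    (hh : h.1 = e.mat ∨ h.1 = -e.mat) {n : ℕ} (hn : n < 28561) :
    ∃ l : ZMod 13, l ≠ 0 ∧ codeVec (e.actCode n) = l • (codeVec n ᵥ* redMat h) := by
  obtain ⟨l, hl, h'⟩ := e.codeVec_act he (a := n / 2197) (b := n / 169 % 13) (c := n / 13 % 13)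
    (d := n % 13) (by omega) (by omega) (by omega) (by omega)
  have hv := e.sl_val (Ent.check_iff.1 he).2.1
  rcases hh with hh | hh
  · have : h = e.sl := Subtype.ext (hh.trans hv.symm)
    exact ⟨l, hl, by rw [this]; exact h'⟩
  · refine ⟨-l, neg_ne_zero.2 hl, ?_⟩
    have : redMat h = -redMat e.sl := by
      rw [redMat, redMat, hv, hh]
      ext i j
      simp
    rw [this, vecMul_neg, neg_smul_neg]
    exact h'

theorem cong_eq_of_eq {e : Ent} {x y : List IVec} (he : e.check y x = true) {h : SL4}
    (hh : h.1 = e.mat ∨ h.1 = -e.mat) : cong h = cong e.sl := by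
  have hv := e.sl_val (Ent.check_iff.1 he).2.1
  funext z
  rcases hh with hh | hh
  · rw [cong, cong, hv, hh]
  · rw [cong, cong, hv, hh, transpose_neg]
    simp

theorem isCode_actCode (e : Ent) (n : ℕ) : IsCode (e.actCode n) := isCode_nrm _ _ _ _

theorem IsCode.lt {n : ℕ} (h : IsCode n) : n < 28561 := by
  unfold IsCode at h; omega

theorem IsStabList.exists_act {L : List Ent} {x : List IVec} (hL : IsStabList L x) {h : SL4}
    (hh : ((syms x).map (cong h)).Perm (syms x)) {m n : ℕ} (hm : IsCode m) (hn : n < 28561)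
    (hl : ∃ l : ZMod 13, l ≠ 0 ∧ codeVec m = l • (codeVec n ᵥ* redMat h)) :
    ∃ e ∈ L, e.actCode n = m ∧ (h.1 = e.mat ∨ h.1 = -e.mat) := by
  obtain ⟨e, he, heh⟩ := hL.2 h hh
  obtain ⟨l, hl0, hl⟩ := hl
  obtain ⟨l', hl0', hl'⟩ := codeVec_act_of_eq (hL.1 e he) heh hn
  refine ⟨e, he, (isCode_actCode e n).eq_of_smul hm (mul_ne_zero hl0' (inv_ne_zero hl0)) ?_, heh⟩
  rw [hl', hl, smul_smul, mul_assoc, inv_mul_cancel₀ hl0, mul_one]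

/-- The codes `m` and `n` are related by an automorphism of the cell `x`. -/
def CodeRel (x : List IVec) (m n : ℕ) : Prop :=
  ∃ h : SL4, ((syms x).map (cong h)).Perm (syms x) ∧
    ∃ l : ZMod 13, l ≠ 0 ∧ codeVec m = l • (codeVec n ᵥ* redMat h)

theorem map_cong_one (x : List Mat) : x.map (cong 1) = x := by
  rw [funext cong_one, List.map_id']

theorem CodeRel.symm {x : List IVec} {m n : ℕ} (h : CodeRel x m n) : CodeRel x n m := by
  obtain ⟨g, hg, l, hl, e⟩ := h
  refine ⟨g⁻¹, ?_, l⁻¹, inv_ne_zero hl, ?_⟩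
  · have := hg.map (cong g⁻¹)
    rw [map_cong_inv_map_cong] at this
    exact this.symm
  · rw [e, smul_vecMul, smul_smul, inv_mul_cancel₀ hl, one_smul, vecMul_vecMul, ← redMat_mul,
      mul_inv_cancel, redMat_one, vecMul_one]

theorem CodeRel.trans {x : List IVec} {m n p : ℕ} (h : CodeRel x m n) (h' : CodeRel x n p) :
    CodeRel x m p := by
  obtain ⟨g, hg, l, hl, e⟩ := h
  obtain ⟨g', hg', l', hl', e'⟩ := h'
  refine ⟨g' * g, ?_, l * l', mul_ne_zero hl hl', ?_⟩
  · rw [map_cong_mul]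
    exact (hg.map _).trans hg'
  · rw [e, e', smul_vecMul, smul_smul, vecMul_vecMul, ← redMat_mul]

theorem codeRel_act {e : Ent} {x : List IVec} (he : e.check x x = true) {n : ℕ} (hn : n < 28561) :
    CodeRel x (e.actCode n) n :=
  ⟨e.sl, e.check_perm he,
    codeVec_act_of_eq he (Or.inl (e.sl_val (Ent.check_iff.1 he).2.1)) hn⟩

theorem codeRel_nrm (x : List IVec) {n : ℕ} (hn : n < 28561) :
    CodeRel x (nrm (n / 2197) (n / 169 % 13) (n / 13 % 13) (n % 13)) n := by
  obtain ⟨l, hl, h⟩ := codeVec_nrm (a := n / 2197) (b := n / 169 % 13) (c := n / 13 % 13)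
    (d := n % 13) (by omega) (by omega) (by omega) (by omega)
  refine ⟨1, by rw [map_cong_one], l, hl, ?_⟩
  rw [redMat_one, vecMul_one]
  exact h

theorem canonAux_mem (a b c d : ℕ) (L : List Ent) (hs : ∀ e ∈ L, e.s ≤ 1) :
    canonAux a b c d L / 3 = nrm a b c d ∨ ∃ e ∈ L, canonAux a b c d L / 3 = e.act a b c d := by
  induction L with
  | nil => exact Or.inl (Nat.mul_div_cancel_left _ (by norm_num))
  | cons e L ih =>
    have h1 := hs e List.mem_cons_self
    have h2 : canonAux a b c d L / 3 = nrm a b c d ∨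
        ∃ e' ∈ e :: L, canonAux a b c d L / 3 = e'.act a b c d :=
      (ih fun e he => hs e (List.mem_cons_of_mem _ he)).imp_right fun ⟨e', he', h⟩ =>
        ⟨e', List.mem_cons_of_mem _ he', h⟩
    rw [canonAux, stp]
    cases Nat.blt (e.act a b c d) (canonAux a b c d L / 3)
    · cases Nat.beq (e.act a b c d) (canonAux a b c d L / 3)
      · exact h2
      · cases Nat.beq (canonAux a b c d L % 3) e.s
        · exact Or.inr ⟨e, List.mem_cons_self, by simp only [cond_false, cond_true]; omega⟩
        · exact h2
    · exact Or.inr ⟨e, List.mem_cons_self, by simp only [cond_true]; omega⟩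

variable {L : List Ent} {x : List IVec} {n : ℕ}

theorem codeRel_canon (hL : ∀ e ∈ L, e.check x x = true) (hn : n < 28561) :
    CodeRel x (canon L n / 3) n := by
  rcases canonAux_mem (n / 2197) (n / 169 % 13) (n / 13 % 13) (n % 13) L
    fun e he => e.s_le_one (hL e he) with h | ⟨e, he, h⟩
  · rw [canon, h]; exact codeRel_nrm x hn
  · rw [canon, h]; exact codeRel_act (hL e he) hn

theorem isCode_canon (hL : ∀ e ∈ L, e.check x x = true) (n : ℕ) : IsCode (canon L n / 3) := by
  rcases canonAux_mem (n / 2197) (n / 169 % 13) (n / 13 % 13) (n % 13) L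
    fun e he => e.s_le_one (hL e he) with h | ⟨e, -, h⟩
  · rw [canon, h]; exact isCode_nrm _ _ _ _
  · rw [canon, h]; exact isCode_nrm _ _ _ _

theorem IsStabList.canon_le (hL : IsStabList L x) {m : ℕ} (hm : IsCode m) (hn : n < 28561)
    (h : CodeRel x m n) : canon L n / 3 ≤ m := by
  obtain ⟨g, hg, hl⟩ := h
  obtain ⟨e, he, rfl, -⟩ := hL.exists_act hg hm hn hl
  exact (canonAux_le _ _ _ _ L fun e he => e.s_le_one (hL.1 e he)).2 e he

theorem codeVec_ne_zero {u : ℕ} (hu : IsCode u) (h0 : u ≠ 0) : codeVec u ≠ 0 := fun h =>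
  h0 (hu.eq_of_smul (Or.inl rfl) one_ne_zero (by
    rw [h]; funext i; fin_cases i <;> simp [codeVec, digits]))

variable {k : Type} [Field k]

theorem IsStabList.exists_deltaFunctional [CharZero k] (hL : IsStabList L x)
    (hx : IsCellList IsCell (syms x)) (hn : x.length + n = 9) {u : ℕ} (hu : canon L u = 3 * u)
    (h0 : u ≠ 0) : ∃ ψ : altChains k IsCell n →ₗ[k] k, IsInvariantFunctional (Gamma0 13) ψ ∧
      codeEval ψ x u = 1 ∧
      (∀ p < 28561, canon L p / 3 ≠ u → codeEval ψ x (canon L p / 3) = 0) ∧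
      ∀ x' : List IVec, (syms x').sum.det ≠ (syms x).sum.det → ∀ m, codeEval ψ x' m = 0 := by
  have hu' : canon L u / 3 = u := by omega
  have hc : IsCode u := hu' ▸ isCode_canon hL.1 u
  have hψ := isInvariantFunctional_orbitSum (k := k) (n := n) hx.2 (v := codeVec u)
  have h1 : codeEval (orbitSum (k := k) (n := n) hx.2 (codeVec u)) x u ≠ 0 := by
    refine rowEval_orbitSum_self_ne_zero hx.2 hx.1 (by rwa [syms, List.length_map])
      (codeVec_ne_zero hc h0) fun h hh hl => ?_
    obtain ⟨e, he, hem, heh⟩ := hL.exists_act hh hc hc.lt hl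
    have hs : e.s = 0 := canonAux_sign (u / 2197) (u / 169 % 13) (u / 13 % 13) (u % 13) L
      (fun e he => e.s_le_one (hL.1 e he))
      (by change canon L u % 3 = 0; omega) e he (by change e.actCode u = canon L u / 3; omega)
    rw [cong_eq_of_eq (hL.1 e he) heh, e.check_alt (hL.1 e he) (isAlt_cellDelta _),
      cellDelta_self hx.1, hs]
    exact mul_one 1
  refine ⟨(codeEval (orbitSum (k := k) (n := n) hx.2 (codeVec u)) x u)⁻¹ •
    orbitSum (k := k) (n := n) hx.2 (codeVec u), hψ.smul _, ?_, fun p hp hpu => ?_,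
    fun x' hx' m => ?_⟩
  · rw [codeEval, rowEval_smul, ← codeEval, inv_mul_cancel₀ h1]
  · rw [codeEval, rowEval_smul]
    refine mul_eq_zero_of_right _ (not_not.1 fun h => hpu ?_)
    obtain ⟨t, ht, hl⟩ := exists_of_rowEval_orbitSum_ne_zero hx.2 h
    have hr : CodeRel x u (canon L p / 3) := ⟨t, ht, hl⟩
    have hcp := isCode_canon hL.1 p
    exact le_antisymm (hL.canon_le hc hp (hr.trans (codeRel_canon hL.1 hp)))
      (hu' ▸ hL.canon_le hcp hc.lt hr.symm)
  · rw [codeEval, rowEval_smul]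
    refine mul_eq_zero_of_right _ (not_not.1 fun h => hx' ?_)
    obtain ⟨t, ht, -⟩ := exists_of_rowEval_orbitSum_ne_zero hx.2 h
    rw [← ht.sum_eq, ← det_cong t (syms x).sum, cong_list_sum]

theorem mem_bdRow {stab : ℕ → List Ent} {m : ℕ} {F : List Face} {q : ℤ × ℕ} (h : q ∈ bdRow stab m F) :
    ∃ f ∈ F, ∃ p < 28561, q.2 = 4 * (canon (stab f.t) p / 3) + f.t := by
  induction F with
  | nil => simp [bdRow] at h
  | cons f F ih =>
    have h' : q ∈ bdRow stab m F → ∃ f' ∈ f :: F, ∃ p < 28561,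
        q.2 = 4 * (canon (stab f'.t) p / 3) + f'.t := fun h =>
      (ih h).imp fun _ => And.imp_left (List.mem_cons_of_mem _)
    rw [bdRow, Face.term] at h
    cases hb : Nat.beq (canon (stab f.t) (f.e.act (m / 2197) (m / 169 % 13) (m / 13 % 13) (m % 13)) % 3) 2
    · rw [hb, cond_false, List.mem_cons] at h
      rcases h with rfl | h
      · exact ⟨f, List.mem_cons_self, _, (nrm_lt _ _ _ _).trans (by norm_num), rfl⟩
      · exact h' h
    · rw [hb] at h
      exact h' h

end DeltaFunctionals

section Frames

theorem exists_det_ne_zero {W : Finset (Fin 4 → ℤ)} (hW : ∀ v, (∀ w ∈ W, v ⬝ᵥ w = 0) → v = 0) :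
    ∃ u : Fin 4 → Fin 4 → ℤ, (∀ i, u i ∈ W) ∧ (Matrix.of u).det ≠ 0 := by
  set c : (Fin 4 → ℤ) → Fin 4 → ℚ := fun w i => (w i : ℚ) with hc
  have htop : Submodule.span ℚ (c '' W) = ⊤ := by
    by_contra h
    obtain ⟨f, hf, hle⟩ := Submodule.exists_le_ker_of_lt_top _ (lt_top_iff_ne_top.2 h)
    obtain ⟨b, hb⟩ := IsLocalization.exist_integer_multiples_of_finite (nonZeroDivisors ℤ)
      fun i : Fin 4 => f (Pi.single i 1)
    choose a ha using hb
    have ha' : ∀ i, (a i : ℚ) = (b : ℤ) * f (Pi.single i 1) := fun i => by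
      have := ha i
      rwa [zsmul_eq_mul] at this
    have h0 : a = 0 := hW a fun w hw => by
      have h1 : f (c w) = 0 := hle (Submodule.subset_span ⟨w, hw, rfl⟩)
      rw [LinearMap.pi_apply_eq_sum_univ f (c w)] at h1
      have h2 : ((a ⬝ᵥ w : ℤ) : ℚ) = (b : ℤ) * ∑ i, c w i • f (fun j => if i = j then 1 else 0) := by
        rw [dotProduct, Int.cast_sum, Finset.mul_sum]
        refine Finset.sum_congr rfl fun i _ => ?_
        have : (fun j => if i = j then (1 : ℚ) else 0) = Pi.single i 1 := by
          funext j; simp [Pi.single_apply, eq_comm]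
        rw [this, Int.cast_mul, ha', smul_eq_mul, hc]
        ring
      rw [h1, mul_zero] at h2
      exact_mod_cast h2
    refine hf (LinearMap.pi_ext' fun i => LinearMap.ext_ring ?_)
    have h1 := ha' i
    rw [h0, Pi.zero_apply, Int.cast_zero, zero_eq_mul] at h1
    exact h1.resolve_left (Int.cast_ne_zero.2 (nonZeroDivisors.coe_ne_zero b))
  obtain ⟨s, hs, hspan, hli⟩ := exists_linearIndependent ℚ (c '' (W : Set (Fin 4 → ℤ)))
  have B : Module.Basis s ℚ (Fin 4 → ℚ) := Module.Basis.mk hli (by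
    rw [Subtype.range_coe, hspan, htop])
  have : Finite s := Module.Finite.finite_basis B
  have : Fintype s := Fintype.ofFinite s
  have hcard : Fintype.card s = Fintype.card (Fin 4) := by
    rw [← Module.finrank_eq_card_basis B, Module.finrank_fintype_fun_eq_card]
  let e : Fin 4 ≃ s := (Fintype.equivOfCardEq hcard).symm
  choose u hu huc using fun i => hs (e i).2
  refine ⟨u, hu, fun h => ?_⟩
  have hli' : LinearIndependent ℚ fun i => c (u i) := by
    have h := hli.comp e e.injective
    have he : (fun i => c (u i)) = Subtype.val ∘ e := funext huc
    rw [he]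
    exact h
  have hunit := (Matrix.linearIndependent_rows_iff_isUnit (A := Matrix.of fun i => c (u i))).1 hli'
  rw [Matrix.isUnit_iff_isUnit_det, isUnit_iff_ne_zero] at hunit
  refine hunit ?_
  have := (Int.castRingHom ℚ).map_det (Matrix.of u)
  rw [h, map_zero] at this
  exact this.symm

/-- The minimal vectors of the two base forms. -/
def minIVec : ℤ → List IVec
  | 0 => (minVec 0).map fun w => ⟨w 0, w 1, w 2, w 3⟩
  | _ => (minVec 1).map fun w => ⟨w 0, w 1, w 2, w 3⟩

theorem det_minIVec : ∀ t ∈ ([0, 1] : List ℤ), ∀ a ∈ minIVec t, ∀ b ∈ minIVec t, ∀ c ∈ minIVec t,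
    ∀ d ∈ minIVec t, ((IVec.det a b c d).natAbs == 0 || (IVec.det a b c d).natAbs == 1 ||
      (IVec.det a b c d).natAbs == 2) = true := by decide +kernel

theorem exists_sym_minIVec {Q : Mat} {t : ℤ} (ht : t = 0 ∨ t = 1) {g : SL4} (hQ : Q = coact g (baseForm t))
    {x : Mat} (hx : x ∈ MinSet Q) : ∃ u ∈ minIVec t, cong g⁻¹ x = u.sym := by
  rw [hQ, mem_MinSet_coact] at hx
  rw [mem_MinSet_baseForm t ht] at hx
  obtain ⟨w, hw, h⟩ := hx
  have hu : (⟨w 0, w 1, w 2, w 3⟩ : IVec).fn = w := by funext i; fin_cases i <;> rfl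
  refine ⟨⟨w 0, w 1, w 2, w 3⟩, ?_, by rw [h, IVec.sym, hu]⟩
  rcases ht with rfl | rfl
  · exact List.mem_map_of_mem hw
  · exact List.mem_map_of_mem hw

theorem det_sq_of_mem_MinSet {Q : Mat} (hQ : Q ∈ Perf) {a b c d : IVec} (ha : a.sym ∈ MinSet Q)
    (hb : b.sym ∈ MinSet Q) (hc : c.sym ∈ MinSet Q) (hd : d.sym ∈ MinSet Q) :
    IVec.det a b c d ^ 2 = 0 ∨ IVec.det a b c d ^ 2 = 1 ∨ IVec.det a b c d ^ 2 = 4 := by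
  obtain ⟨g, t, ht, hQ⟩ : ∃ (g : SL4) (t : ℤ), (t = 0 ∨ t = 1) ∧ Q = coact g (baseForm t) := by
    obtain ⟨g, h | h⟩ := hQ
    exacts [⟨g, 0, Or.inl rfl, h⟩, ⟨g, 1, Or.inr rfl, h⟩]
  obtain ⟨a', ha', ea⟩ := exists_sym_minIVec ht hQ ha
  obtain ⟨b', hb', eb⟩ := exists_sym_minIVec ht hQ hb
  obtain ⟨c', hc', ec⟩ := exists_sym_minIVec ht hQ hc
  obtain ⟨d', hd', ed⟩ := exists_sym_minIVec ht hQ hd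
  have h : IVec.det a b c d ^ 2 = IVec.det a' b' c' d' ^ 2 := by
    have := det_cong g⁻¹ [a.sym, b.sym, c.sym, d.sym].sum
    rw [cong_list_sum] at this
    simp only [List.map_cons, List.map_nil, List.sum_cons, List.sum_nil, add_zero, ea, eb, ec, ed,
      IVec.det_sym_add] at this
    exact this.symm
  rw [h, ← Int.natAbs_sq, ← Int.natAbs_sq]
  have key := det_minIVec t (by simpa using ht) a' ha' b' hb' c' hc' d' hd'
  simp only [Bool.or_eq_true, beq_iff_eq] at key
  rcases key with (h | h) | h <;> rw [h] <;> simp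

/-- The vectors of the standard basis. -/
def baseFrame : List IVec := [⟨1, 0, 0, 0⟩, ⟨0, 1, 0, 0⟩, ⟨0, 0, 1, 0⟩, ⟨0, 0, 0, 1⟩]

variable {S : Finset Mat}

theorem IsCell.det_sq_le (hS : IsCell S) {a b c d : IVec} (ha : a.sym ∈ S) (hb : b.sym ∈ S)
    (hc : c.sym ∈ S) (hd : d.sym ∈ S) : IVec.det a b c d ^ 2 ≤ 1 := by
  classical
  obtain ⟨-, ⟨Q, hQ, hm⟩, -, hu⟩ := hS
  rcases det_sq_of_mem_MinSet hQ (hm ha) (hm hb) (hm hc) (hm hd) with h | h | h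
  · omega
  · omega
  exfalso
  have hn : [a.sym, b.sym, c.sym, d.sym].Nodup := by
    have key : ∀ u v : IVec, u.sym = v.sym → u = v ∨ u = v.neg := fun u v h =>
      IVec.equiv_iff_or.1 (IVec.equiv_iff.2 h)
    have h0 : IVec.det a b c d ≠ 0 := fun h0 => by rw [h0] at h; norm_num at h
    simp only [List.nodup_cons, List.mem_cons, List.not_mem_nil, or_false, not_or, not_false_eq_true,
      List.nodup_nil, and_true]
    refine ⟨⟨?_, ?_, ?_⟩, ⟨?_, ?_⟩, ?_⟩ <;> intro e <;> rcases key _ _ e with rfl | rfl <;>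
      exact h0 (by simp only [IVec.det, IVec.neg]; ring)
  refine hu [a.sym, b.sym, c.sym, d.sym].toFinset (fun x hx => ?_) (List.toFinset_card_of_nodup hn) ?_
  · rw [List.mem_toFinset] at hx
    simp only [List.mem_cons, List.not_mem_nil, or_false] at hx
    rcases hx with rfl | rfl | rfl | rfl <;> assumption
  · have : ∑ x ∈ [a.sym, b.sym, c.sym, d.sym].toFinset, x = [a.sym, b.sym, c.sym, d.sym].sum := by
      rw [List.sum_toFinset _ hn, List.map_id']
    rw [this]
    simp only [List.sum_cons, List.sum_nil, add_zero, IVec.det_sym_add]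
    exact h

theorem IsCell.exists_frame (hS : IsCell S) : ∃ g : SL4, ∀ x ∈ syms baseFrame, cong g x ∈ S := by
  obtain ⟨W, hWS, hW⟩ := exists_vectors hS.2.2.1 hS.exists_rk1
  obtain ⟨u, huW, hu⟩ := exists_det_ne_zero hW
  choose v hv using fun i => IVec.exists_fn_eq (u i)
  have hvS : ∀ i, (v i).sym ∈ S := fun i => by rw [IVec.sym, hv]; exact hWS _ (huW i)
  have hdet : (Matrix.of u).det = IVec.det (v 0) (v 1) (v 2) (v 3) := by
    rw [← IVec.det_of]
    congr 2
    funext i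
    fin_cases i <;> simp [hv]
  have hle := hS.det_sq_le (hvS 0) (hvS 1) (hvS 2) (hvS 3)
  rw [← hdet] at hle
  have h1 : (Matrix.of u).det = 1 ∨ (Matrix.of u).det = -1 := by
    have : -1 ≤ (Matrix.of u).det := by nlinarith
    have : (Matrix.of u).det ≤ 1 := by nlinarith
    omega
  have key : ∀ u' : Fin 4 → Fin 4 → ℤ, (∀ i, rk1 (u' i) ∈ S) → (Matrix.of u').det = 1 →
      ∃ g : SL4, ∀ x ∈ syms baseFrame, cong g x ∈ S := by
    intro u' hu' h
    have hcol : ∀ i, (Matrix.of u')ᵀ *ᵥ (Pi.single i 1) = u' i := fun i => by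
      rw [mulVec_single_one]; rfl
    obtain ⟨g, hg⟩ : ∃ g : SL4, g.1 = (Matrix.of u')ᵀ := ⟨⟨_, (Matrix.det_transpose _).trans h⟩, rfl⟩
    have hc : ∀ i, cong g (rk1 (Pi.single i 1)) ∈ S := fun i => by
      rw [cong_rk1, hg, hcol]
      exact hu' i
    refine ⟨g, fun x hx => ?_⟩
    simp only [syms, baseFrame, List.map_cons, List.map_nil, List.mem_cons, List.not_mem_nil, or_false,
      IVec.sym] at hx
    have e0 : (⟨1, 0, 0, 0⟩ : IVec).fn = Pi.single 0 1 := by funext i; fin_cases i <;> rfl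
    have e1 : (⟨0, 1, 0, 0⟩ : IVec).fn = Pi.single 1 1 := by funext i; fin_cases i <;> rfl
    have e2 : (⟨0, 0, 1, 0⟩ : IVec).fn = Pi.single 2 1 := by funext i; fin_cases i <;> rfl
    have e3 : (⟨0, 0, 0, 1⟩ : IVec).fn = Pi.single 3 1 := by funext i; fin_cases i <;> rfl
    rcases hx with rfl | rfl | rfl | rfl <;> simp only [e0, e1, e2, e3, hc]
  rcases h1 with h1 | h1
  · exact key u (fun i => hWS _ (huW i)) h1
  · refine key (Function.update u 0 (-u 0)) (fun i => ?_) ?_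
    · by_cases hi : i = 0
      · subst hi
        rw [Function.update_self, rk1_eq_iff.2 (Or.inr rfl : -u 0 = u 0 ∨ -u 0 = -u 0)]
        exact hWS _ (huW 0)
      · rw [Function.update_of_ne hi]
        exact hWS _ (huW i)
    · have := Matrix.det_updateRow_smul (Matrix.of u) 0 (-1) (u 0)
      rw [neg_one_smul, neg_one_mul] at this
      rw [show (Matrix.of u).updateRow 0 (u 0) = Matrix.of u from Function.update_eq_self _ _, h1] at this
      exact this

end Frames

section CellCertificates

/-- Evaluation of the form `A₄`. -/
def IVec.qA (u : IVec) : ℤ :=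
  u.a * u.a + u.b * u.b + u.c * u.c + u.d * u.d + (u.a + u.b + u.c + u.d) * (u.a + u.b + u.c + u.d)

/-- A certificate that the list `x` is a cell, where `e` maps it to minimal vectors of `A₄`. -/
def cellOk (e : Ent) (x : List IVec) : Bool :=
  (decide (x.length ≤ 9) && baseFrame.all fun u => x.any fun v => v.beq u) &&
  (decide (x.Pairwise fun u v => u.equiv v = false) &&
  ((decide (IVec.det (rowVec e.r0) (rowVec e.r1) (rowVec e.r2) (rowVec e.r3) = 1) &&
    x.all fun u => decide ((e.mulVec u).qA = 2)) &&
  x.all fun a => x.all fun b => x.all fun c => x.all fun d => !(Nat.beq (IVec.det a b c d).natAbs 2)))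

theorem spanning_of_baseFrame {S : Finset Mat} (h : ∀ x ∈ syms baseFrame, x ∈ S) : Spanning S := by
  intro v hv
  have key : ∀ u ∈ baseFrame, v ⬝ᵥ u.fn = 0 := fun u hu => by
    have := hv u.sym (h _ (List.mem_map_of_mem hu))
    rw [IVec.sym, dotProduct_rk1_mulVec] at this
    exact pow_eq_zero_iff two_ne_zero |>.1 this
  simp only [baseFrame, List.forall_mem_cons, IVec.fn, dotProduct, Fin.sum_univ_four] at key
  simp at key
  obtain ⟨h0, h1, h2, h3⟩ := key
  funext i
  fin_cases i <;> assumption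

theorem nodup_syms {x : List IVec} (h : x.Pairwise fun u v => u.equiv v = false) : (syms x).Nodup := by
  refine List.pairwise_map.2 (h.imp fun huv e => ?_)
  rw [IVec.equiv_iff.2 e] at huv
  exact Bool.noConfusion huv

theorem isCellList_of_cellOk {e : Ent} {x : List IVec} (h : cellOk e x = true) :
    IsCellList IsCell (syms x) := by
  classical
  simp only [cellOk, Bool.and_eq_true, decide_eq_true_eq, List.all_eq_true, List.any_eq_true,
    Bool.not_eq_true', IVec.beq_iff] at h
  obtain ⟨⟨hlen, hb⟩, hnd, ⟨hdet, hA⟩, hu⟩ := h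
  have hn := nodup_syms hnd
  have hdet' : e.mat.det = 1 := by rw [Ent.mat, IVec.det_of, hdet]
  refine ⟨hn, ?_, ⟨coact e.sl⁻¹ formA, ⟨_, Or.inl rfl⟩, ?_⟩, spanning_of_baseFrame ?_, ?_⟩
  · rw [List.toFinset_card_of_nodup hn, syms, List.length_map]
    exact hlen
  · intro y hy
    rw [Finset.mem_coe, List.mem_toFinset, syms, List.mem_map] at hy
    obtain ⟨u, hux, rfl⟩ := hy
    rw [mem_MinSet_coact, inv_inv]
    have h1 : cong e.sl u.sym = (e.mulVec u).sym := by
      rw [IVec.sym, cong_rk1, IVec.sym, e.fn_mulVec, e.sl_val hdet']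
    refine ⟨_, h1, ?_⟩
    rw [h1]
    have := pair_baseForm 0 (e.mulVec u).fn
    rw [baseForm] at this
    rw [IVec.sym, this, ← hA u hux]
    rfl
  · intro y hy
    rw [syms, List.mem_map] at hy
    obtain ⟨u, hu, rfl⟩ := hy
    obtain ⟨v, hv, rfl⟩ := hb u hu
    exact List.mem_toFinset.2 (List.mem_map_of_mem hv)
  · intro T hT hT4 hdT
    have hl : T.toList.length = 4 := by rw [Finset.length_toList, hT4]
    have hmem : ∀ y ∈ T.toList, ∃ u ∈ x, u.sym = y := fun y hy => by
      have := hT (Finset.mem_toList.1 hy)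
      rwa [List.mem_toFinset, syms, List.mem_map] at this
    have hs : T.toList.sum.det = 4 := by rw [Finset.sum_toList, hdT]
    match hTl : T.toList, hl with
    | [a, b, c, d], _ =>
      rw [hTl] at hmem hs
      obtain ⟨a, ha, rfl⟩ := hmem a (by simp)
      obtain ⟨b, hb, rfl⟩ := hmem b (by simp)
      obtain ⟨c, hc, rfl⟩ := hmem c (by simp)
      obtain ⟨d, hd, rfl⟩ := hmem d (by simp)
      simp only [List.sum_cons, List.sum_nil, add_zero, IVec.det_sym_add] at hs
      refine Nat.ne_of_beq_eq_false (hu a ha b hb c hc d hd) ?_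
      rw [← Int.natAbs_sq] at hs
      have : ((IVec.det a b c d).natAbs : ℤ) ^ 2 = 2 ^ 2 := hs
      exact_mod_cast (pow_left_inj₀ (by positivity) (by norm_num) two_ne_zero).1 this

theorem IsCell.subset {S T : Finset Mat} (hS : IsCell S) (hT : T ⊆ S) (h : Spanning T) : IsCell T := by
  obtain ⟨h1, ⟨Q, hQ, hm⟩, -, h4⟩ := hS
  exact ⟨(Finset.card_le_card hT).trans h1, ⟨Q, hQ, fun y hy => hm (hT hy)⟩, h, h4.mono hT⟩

theorem IsCellList.of_cons_append {w : Mat} {l l' : List Mat} (h : IsCellList IsCell (w :: (l ++ l')))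
    (hl : ∀ x ∈ syms baseFrame, x ∈ l) : IsCellList IsCell (w :: l) := by
  have hs : (w :: l).Sublist (w :: (l ++ l')) := (List.sublist_append_left l l').cons_cons w
  refine ⟨h.1.sublist hs, h.2.subset (fun y hy => List.mem_toFinset.2 (hs.subset (List.mem_toFinset.1 hy)))
    (spanning_of_baseFrame fun x hx => ?_)⟩
  rw [List.mem_toFinset]
  exact List.mem_cons_of_mem _ (hl x hx)

end CellCertificates

section Stabilizers

def colMul (a b c d v : IVec) : IVec :=
  ⟨v.a * a.a + v.b * b.a + v.c * c.a + v.d * d.a, v.a * a.b + v.b * b.b + v.c * c.b + v.d * d.b,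
    v.a * a.c + v.b * b.c + v.c * c.c + v.d * d.c, v.a * a.d + v.b * b.d + v.c * c.d + v.d * d.d⟩

/-- The matrix with columns `a, b, c, d` either is not an automorphism of `x` or occurs in `L`. -/
def stabColOk (L : List Ent) (x : List IVec) (a b c d : IVec) : Bool :=
  !(decide (IVec.det a b c d = 1)) || (!(x.all fun v => x.any fun y => (colMul a b c d v).equiv y) ||
    L.any fun e => ((e.mulVec ⟨1, 0, 0, 0⟩).beq a && (e.mulVec ⟨0, 1, 0, 0⟩).beq b) &&
      ((e.mulVec ⟨0, 0, 1, 0⟩).beq c && (e.mulVec ⟨0, 0, 0, 1⟩).beq d))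

def stabOk (L : List Ent) (x : List IVec) : Bool :=
  ((baseFrame.all fun u => x.any fun v => v.beq u) && L.all fun e => e.check x x) &&
  x.all fun a => x.all fun b => x.all fun c => x.all fun d =>
    !(Nat.beq (IVec.det a b c d).natAbs 1) ||
    [b, b.neg].all fun b => [c, c.neg].all fun c => [d, d.neg].all fun d => stabColOk L x a b c d

theorem fn_colMul {M : Mat} {a b c d : IVec} (ha : M *ᵥ (⟨1, 0, 0, 0⟩ : IVec).fn = a.fn)
    (hb : M *ᵥ (⟨0, 1, 0, 0⟩ : IVec).fn = b.fn) (hc : M *ᵥ (⟨0, 0, 1, 0⟩ : IVec).fn = c.fn)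
    (hd : M *ᵥ (⟨0, 0, 0, 1⟩ : IVec).fn = d.fn) (v : IVec) : M *ᵥ v.fn = (colMul a b c d v).fn := by
  have key : v.fn = v.a • (⟨1, 0, 0, 0⟩ : IVec).fn + v.b • (⟨0, 1, 0, 0⟩ : IVec).fn
      + v.c • (⟨0, 0, 1, 0⟩ : IVec).fn + v.d • (⟨0, 0, 0, 1⟩ : IVec).fn := by
    funext i
    fin_cases i <;> simp [IVec.fn]
  rw [key]
  simp only [mulVec_add, mulVec_smul, ha, hb, hc, hd]
  funext i
  fin_cases i <;> simp [IVec.fn, colMul]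

theorem det_eq_of_mulVec {M : Mat} {a b c d : IVec} (ha : M *ᵥ (⟨1, 0, 0, 0⟩ : IVec).fn = a.fn)
    (hb : M *ᵥ (⟨0, 1, 0, 0⟩ : IVec).fn = b.fn) (hc : M *ᵥ (⟨0, 0, 1, 0⟩ : IVec).fn = c.fn)
    (hd : M *ᵥ (⟨0, 0, 0, 1⟩ : IVec).fn = d.fn) : Mᵀ = Matrix.of ![a.fn, b.fn, c.fn, d.fn] := by
  rw [← ha, ← hb, ← hc, ← hd]
  ext i j
  fin_cases i <;> simp [mulVec, dotProduct, Fin.sum_univ_four, IVec.fn]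

theorem isStabList_of_stabOk {L : List Ent} {x : List IVec} (h : stabOk L x = true) : IsStabList L x := by
  simp only [stabOk, Bool.and_eq_true, List.all_eq_true, List.any_eq_true, IVec.beq_iff] at h
  obtain ⟨⟨hb, hL⟩, h⟩ := h
  refine ⟨hL, fun g hg => ?_⟩
  have hgx : ∀ v ∈ x, ∃ y ∈ x, g.1 *ᵥ v.fn = y.fn ∨ g.1 *ᵥ v.fn = y.neg.fn := fun v hv => by
    have := hg.subset (List.mem_map_of_mem (List.mem_map_of_mem hv))
    rw [syms, List.mem_map] at this
    obtain ⟨y, hy, hyv⟩ := this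
    rw [IVec.sym, IVec.sym, cong_rk1, eq_comm, rk1_eq_iff, ← IVec.fn_neg] at hyv
    exact ⟨y, hy, hyv⟩
  have hbx : ∀ u ∈ baseFrame, u ∈ x := fun u hu => by
    obtain ⟨v, hv, rfl⟩ := hb u hu
    exact hv
  obtain ⟨M, hM, hMd, hMx, a, hax, ha⟩ : ∃ M : Mat, (g.1 = M ∨ g.1 = -M) ∧ M.det = 1 ∧
      (∀ v ∈ x, ∃ y ∈ x, M *ᵥ v.fn = y.fn ∨ M *ᵥ v.fn = y.neg.fn) ∧
      ∃ a ∈ x, M *ᵥ (⟨1, 0, 0, 0⟩ : IVec).fn = a.fn := by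
    obtain ⟨a, hax, ha | ha⟩ := hgx ⟨1, 0, 0, 0⟩ (hbx _ (by simp [baseFrame]))
    · exact ⟨g.1, Or.inl rfl, g.2, hgx, a, hax, ha⟩
    · refine ⟨-g.1, Or.inr (neg_neg _).symm, ?_, fun v hv => ?_, a, hax, ?_⟩
      · rw [det_neg, g.2]; rfl
      · obtain ⟨y, hy, h⟩ := hgx v hv
        refine ⟨y, hy, ?_⟩
        rw [neg_mulVec, neg_eq_iff_eq_neg, neg_eq_iff_eq_neg, ← IVec.fn_neg, ← IVec.fn_neg]
        rw [show y.neg.neg = y by simp [IVec.neg]]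
        exact h.symm
      · rw [neg_mulVec, ha, IVec.fn_neg, neg_neg]
  have hsig : ∀ u ∈ baseFrame, ∃ y ∈ x, ∃ z ∈ [y, y.neg], M *ᵥ u.fn = z.fn := fun u hu => by
    obtain ⟨y, hy, h | h⟩ := hMx u (hbx u hu)
    exacts [⟨y, hy, y, by simp, h⟩, ⟨y, hy, y.neg, by simp, h⟩]
  obtain ⟨b, hbx', b', hb', hMb⟩ := hsig ⟨0, 1, 0, 0⟩ (by simp [baseFrame])
  obtain ⟨c, hcx, c', hc', hMc⟩ := hsig ⟨0, 0, 1, 0⟩ (by simp [baseFrame])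
  obtain ⟨d, hdx, d', hd', hMd'⟩ := hsig ⟨0, 0, 0, 1⟩ (by simp [baseFrame])
  have hT := det_eq_of_mulVec ha hMb hMc hMd'
  have hdet : IVec.det a b' c' d' = 1 := by rw [← IVec.det_of, ← hT, det_transpose, hMd]
  have hnat : (IVec.det a b c d).natAbs = 1 := by
    have hsgn : ∀ {y z : IVec}, z ∈ [y, y.neg] → z.sym = y.sym := fun {y z} hz => by
      simp only [List.mem_cons, List.not_mem_nil, or_false] at hz
      rcases hz with rfl | rfl
      exacts [rfl, IVec.sym_neg _]
    have : IVec.det a b c d ^ 2 = 1 := by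
      rw [← IVec.det_sym_add, ← hsgn hb', ← hsgn hc', ← hsgn hd', IVec.det_sym_add, hdet, one_pow]
    rcases sq_eq_one_iff.1 this with h | h <;> rw [h] <;> rfl
  have key := h a hax b hbx' c hcx d hdx
  rw [hnat] at key
  simp only [Nat.beq_refl, Bool.not_true, Bool.false_or, List.all_eq_true] at key
  have key := key b' hb' c' hc' d' hd'
  simp only [stabColOk, Bool.or_eq_true, Bool.not_eq_true', decide_eq_false_iff_not, hdet,
    not_true_eq_false, false_or] at key
  rcases key with key | key
  · exfalso
    rw [← Bool.not_eq_true] at key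
    refine key (List.all_eq_true.2 fun v hv => List.any_eq_true.2 ?_)
    obtain ⟨y, hy, h⟩ := hMx v hv
    rw [fn_colMul ha hMb hMc hMd'] at h
    exact ⟨y, hy, IVec.equiv_iff_or.2 (h.imp (fun h => IVec.fn_injective h) fun h => IVec.fn_injective h)⟩
  · simp only [List.any_eq_true, Bool.and_eq_true, IVec.beq_iff] at key
    obtain ⟨e, he, ⟨rfl, rfl⟩, rfl, rfl⟩ := key
    have : M = e.mat := by
      rw [← transpose_inj, hT, ← det_eq_of_mulVec (M := e.mat) (e.fn_mulVec _).symm (e.fn_mulVec _).symm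
        (e.fn_mulVec _).symm (e.fn_mulVec _).symm]
    rw [this] at hM
    exact ⟨e, he, hM⟩

end Stabilizers

section Tables

/-- Representatives of the cells with five vectors. -/
def frameC (t : Nat) : List IVec :=
  baseFrame ++ [match t with | 0 => ⟨0, 0, 1, -1⟩ | 1 => ⟨0, 1, -1, -1⟩ | _ => ⟨1, -1, -1, -1⟩]

/-- Representatives of some cells with six vectors. -/
def frameD (t : Nat) : List IVec :=
  baseFrame ++ match t with
    | 0 => [⟨0, 0, 1, -1⟩, ⟨0, 1, -1, 0⟩]
    | 1 => [⟨0, 0, 1, -1⟩, ⟨1, -1, -1, 0⟩]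
    | 2 => [⟨0, 0, 1, -1⟩, ⟨1, -1, 0, 0⟩]
    | _ => [⟨0, 1, -1, -1⟩, ⟨1, -1, 0, 1⟩]

/-- The symmetries of the standard basis, up to sign. -/
def stabB0 : List Ent := [
  ⟨0, 68719476736, 16777216, 4096, 1⟩,
  ⟨0, 68719476736, 16777216, 49152, 12⟩,
  ⟨0, 68719476736, 201326592, 4096, 12⟩,
  ⟨0, 68719476736, 201326592, 49152, 1⟩,
  ⟨1, 68719476736, 16777216, 12, 4096⟩,
  ⟨1, 68719476736, 16777216, 1, 49152⟩,
  ⟨1, 68719476736, 201326592, 1, 4096⟩,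
  ⟨1, 68719476736, 201326592, 12, 49152⟩,
  ⟨1, 68719476736, 4096, 16777216, 12⟩,
  ⟨1, 68719476736, 49152, 16777216, 1⟩,
  ⟨1, 68719476736, 4096, 201326592, 1⟩,
  ⟨1, 68719476736, 49152, 201326592, 12⟩,
  ⟨0, 68719476736, 1, 16777216, 4096⟩,
  ⟨0, 68719476736, 12, 16777216, 49152⟩,
  ⟨0, 68719476736, 12, 201326592, 4096⟩,
  ⟨0, 68719476736, 1, 201326592, 49152⟩,
  ⟨0, 68719476736, 4096, 1, 16777216⟩,
  ⟨0, 68719476736, 49152, 12, 16777216⟩,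
  ⟨0, 68719476736, 4096, 12, 201326592⟩,
  ⟨0, 68719476736, 49152, 1, 201326592⟩,
  ⟨1, 68719476736, 12, 4096, 16777216⟩,
  ⟨1, 68719476736, 1, 49152, 16777216⟩,
  ⟨1, 68719476736, 1, 4096, 201326592⟩,
  ⟨1, 68719476736, 12, 49152, 201326592⟩,
  ⟨1, 16777216, 68719476736, 4096, 12⟩,
  ⟨1, 16777216, 68719476736, 49152, 1⟩,
  ⟨1, 201326592, 68719476736, 4096, 1⟩,
  ⟨1, 201326592, 68719476736, 49152, 12⟩,
  ⟨0, 16777216, 68719476736, 1, 4096⟩,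
  ⟨0, 16777216, 68719476736, 12, 49152⟩,
  ⟨0, 201326592, 68719476736, 12, 4096⟩,
  ⟨0, 201326592, 68719476736, 1, 49152⟩,
  ⟨0, 4096, 68719476736, 16777216, 1⟩,
  ⟨0, 49152, 68719476736, 16777216, 12⟩,
  ⟨0, 4096, 68719476736, 201326592, 12⟩,
  ⟨0, 49152, 68719476736, 201326592, 1⟩,
  ⟨1, 12, 68719476736, 16777216, 4096⟩,
  ⟨1, 1, 68719476736, 16777216, 49152⟩,
  ⟨1, 1, 68719476736, 201326592, 4096⟩,
  ⟨1, 12, 68719476736, 201326592, 49152⟩,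
  ⟨1, 4096, 68719476736, 12, 16777216⟩,
  ⟨1, 49152, 68719476736, 1, 16777216⟩,
  ⟨1, 4096, 68719476736, 1, 201326592⟩,
  ⟨1, 49152, 68719476736, 12, 201326592⟩,
  ⟨0, 1, 68719476736, 4096, 16777216⟩,
  ⟨0, 12, 68719476736, 49152, 16777216⟩,
  ⟨0, 12, 68719476736, 4096, 201326592⟩,
  ⟨0, 1, 68719476736, 49152, 201326592⟩,
  ⟨0, 16777216, 4096, 68719476736, 1⟩,
  ⟨0, 16777216, 49152, 68719476736, 12⟩,
  ⟨0, 201326592, 4096, 68719476736, 12⟩,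
  ⟨0, 201326592, 49152, 68719476736, 1⟩,
  ⟨1, 16777216, 12, 68719476736, 4096⟩,
  ⟨1, 16777216, 1, 68719476736, 49152⟩,
  ⟨1, 201326592, 1, 68719476736, 4096⟩,
  ⟨1, 201326592, 12, 68719476736, 49152⟩,
  ⟨1, 4096, 16777216, 68719476736, 12⟩,
  ⟨1, 49152, 16777216, 68719476736, 1⟩,
  ⟨1, 4096, 201326592, 68719476736, 1⟩,
  ⟨1, 49152, 201326592, 68719476736, 12⟩,
  ⟨0, 1, 16777216, 68719476736, 4096⟩,
  ⟨0, 12, 16777216, 68719476736, 49152⟩,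
  ⟨0, 12, 201326592, 68719476736, 4096⟩,
  ⟨0, 1, 201326592, 68719476736, 49152⟩,
  ⟨0, 4096, 1, 68719476736, 16777216⟩,
  ⟨0, 49152, 12, 68719476736, 16777216⟩,
  ⟨0, 4096, 12, 68719476736, 201326592⟩,
  ⟨0, 49152, 1, 68719476736, 201326592⟩,
  ⟨1, 12, 4096, 68719476736, 16777216⟩,
  ⟨1, 1, 49152, 68719476736, 16777216⟩,
  ⟨1, 1, 4096, 68719476736, 201326592⟩,
  ⟨1, 12, 49152, 68719476736, 201326592⟩,
  ⟨1, 16777216, 4096, 12, 68719476736⟩,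
  ⟨1, 16777216, 49152, 1, 68719476736⟩,
  ⟨1, 201326592, 4096, 1, 68719476736⟩,
  ⟨1, 201326592, 49152, 12, 68719476736⟩,
  ⟨0, 16777216, 1, 4096, 68719476736⟩,
  ⟨0, 16777216, 12, 49152, 68719476736⟩,
  ⟨0, 201326592, 12, 4096, 68719476736⟩,
  ⟨0, 201326592, 1, 49152, 68719476736⟩,
  ⟨0, 4096, 16777216, 1, 68719476736⟩,
  ⟨0, 49152, 16777216, 12, 68719476736⟩,
  ⟨0, 4096, 201326592, 12, 68719476736⟩,
  ⟨0, 49152, 201326592, 1, 68719476736⟩,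
  ⟨1, 12, 16777216, 4096, 68719476736⟩,
  ⟨1, 1, 16777216, 49152, 68719476736⟩,
  ⟨1, 1, 201326592, 4096, 68719476736⟩,
  ⟨1, 12, 201326592, 49152, 68719476736⟩,
  ⟨1, 4096, 12, 16777216, 68719476736⟩,
  ⟨1, 49152, 1, 16777216, 68719476736⟩,
  ⟨1, 4096, 1, 201326592, 68719476736⟩,
  ⟨1, 49152, 12, 201326592, 68719476736⟩,
  ⟨0, 1, 4096, 16777216, 68719476736⟩,
  ⟨0, 12, 49152, 16777216, 68719476736⟩,
  ⟨0, 12, 4096, 201326592, 68719476736⟩,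
  ⟨0, 1, 49152, 201326592, 68719476736⟩]

/-- Symmetries of the cells of `frameC`. -/
def stabC0 : List Ent := [
  ⟨0, 68719476736, 16777216, 4096, 1⟩,
  ⟨0, 68719476736, 16777216, 49152, 12⟩,
  ⟨1, 68719476736, 201326592, 4097, 12⟩,
  ⟨1, 68719476736, 201326592, 49164, 1⟩,
  ⟨1, 68719476736, 201326592, 1, 4096⟩,
  ⟨1, 68719476736, 201326592, 12, 49152⟩,
  ⟨0, 68719476736, 16777216, 12, 4097⟩,
  ⟨0, 68719476736, 16777216, 1, 49164⟩,
  ⟨0, 68719476736, 16777216, 4097, 49152⟩,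
  ⟨0, 68719476736, 16777216, 49164, 4096⟩,
  ⟨1, 68719476736, 201326592, 4096, 49164⟩,
  ⟨1, 68719476736, 201326592, 49152, 4097⟩,
  ⟨1, 201326592, 68719476736, 4096, 1⟩,
  ⟨1, 201326592, 68719476736, 49152, 12⟩,
  ⟨0, 16777216, 68719476736, 4097, 12⟩,
  ⟨0, 16777216, 68719476736, 49164, 1⟩,
  ⟨0, 16777216, 68719476736, 1, 4096⟩,
  ⟨0, 16777216, 68719476736, 12, 49152⟩,
  ⟨1, 201326592, 68719476736, 12, 4097⟩,
  ⟨1, 201326592, 68719476736, 1, 49164⟩,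
  ⟨1, 201326592, 68719476736, 4097, 49152⟩,
  ⟨1, 201326592, 68719476736, 49164, 4096⟩,
  ⟨0, 16777216, 68719476736, 4096, 49164⟩,
  ⟨0, 16777216, 68719476736, 49152, 4097⟩]

def stabC1 : List Ent := [
  ⟨0, 68719476736, 16777216, 4096, 1⟩,
  ⟨1, 68719476736, 201326604, 49153, 1⟩,
  ⟨1, 68719476736, 201326592, 12, 49152⟩,
  ⟨0, 68719476736, 16777217, 12, 4108⟩,
  ⟨0, 68719476736, 16781312, 49153, 49152⟩,
  ⟨1, 68719476736, 201375744, 4096, 4108⟩,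
  ⟨1, 68719476736, 4096, 16777216, 12⟩,
  ⟨0, 68719476736, 49153, 201326604, 12⟩,
  ⟨0, 68719476736, 12, 201326592, 4096⟩,
  ⟨1, 68719476736, 12, 16777217, 49153⟩,
  ⟨1, 68719476736, 49153, 16781312, 4096⟩,
  ⟨0, 68719476736, 4096, 201375744, 49153⟩,
  ⟨0, 68719476736, 49152, 1, 201326592⟩,
  ⟨1, 68719476736, 4108, 1, 16777217⟩,
  ⟨1, 68719476736, 1, 49152, 16777216⟩,
  ⟨0, 68719476736, 1, 4108, 201326604⟩,
  ⟨0, 68719476736, 4108, 49152, 201375744⟩,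
  ⟨1, 68719476736, 49152, 4108, 16781312⟩,
  ⟨1, 68719476736, 16781312, 201326604, 201326592⟩,
  ⟨0, 68719476736, 201375744, 16777216, 16777217⟩,
  ⟨0, 68719476736, 201326604, 16781312, 16777216⟩,
  ⟨1, 68719476736, 16777216, 201375744, 201326604⟩,
  ⟨1, 68719476736, 16777217, 201326592, 201375744⟩,
  ⟨0, 68719476736, 201326592, 16777217, 16781312⟩]

def stabC2 : List Ent := [
  ⟨0, 68719476736, 16777216, 4096, 1⟩,
  ⟨0, 68719476737, 16777228, 12, 4108⟩,
  ⟨0, 68719480832, 16826368, 49153, 49152⟩,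
  ⟨0, 68719476737, 4108, 16777228, 12⟩,
  ⟨0, 68719476736, 1, 16777216, 4096⟩,
  ⟨0, 68719480832, 49152, 16826368, 49153⟩,
  ⟨0, 68719476736, 4096, 1, 16777216⟩,
  ⟨0, 68719476737, 12, 4108, 16777228⟩,
  ⟨0, 68719480832, 49153, 49152, 16826368⟩,
  ⟨0, 68736253952, 201330688, 201326592, 201326593⟩,
  ⟨0, 68736253952, 201326593, 201330688, 201326592⟩,
  ⟨0, 68736253952, 201326592, 201326593, 201330688⟩,
  ⟨0, 16777228, 68719476737, 49153, 1⟩,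
  ⟨0, 16777216, 68719476736, 12, 49152⟩,
  ⟨0, 16826368, 68719480832, 4096, 4108⟩,
  ⟨0, 4096, 68719476736, 201326592, 12⟩,
  ⟨0, 12, 68719476737, 201326593, 49153⟩,
  ⟨0, 49153, 68719480832, 201330688, 4096⟩,
  ⟨0, 4108, 68719476737, 1, 201326593⟩,
  ⟨0, 1, 68719476736, 49152, 201326592⟩,
  ⟨0, 49152, 68719480832, 4108, 201330688⟩,
  ⟨0, 201330688, 68736253952, 16777228, 16777216⟩,
  ⟨0, 201326592, 68736253952, 16826368, 16777228⟩,
  ⟨0, 201326593, 68736253952, 16777216, 16826368⟩,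
  ⟨0, 16777216, 49152, 68719476736, 12⟩,
  ⟨0, 16777228, 1, 68719476737, 49153⟩,
  ⟨0, 16826368, 4108, 68719480832, 4096⟩,
  ⟨0, 4108, 201326593, 68719476737, 1⟩,
  ⟨0, 1, 201326592, 68719476736, 49152⟩,
  ⟨0, 49152, 201330688, 68719480832, 4108⟩,
  ⟨0, 4096, 12, 68719476736, 201326592⟩,
  ⟨0, 12, 49153, 68719476737, 201326593⟩,
  ⟨0, 49153, 4096, 68719480832, 201330688⟩,
  ⟨0, 201330688, 16777216, 68736253952, 16777228⟩,
  ⟨0, 201326593, 16826368, 68736253952, 16777216⟩,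
  ⟨0, 201326592, 16777228, 68736253952, 16826368⟩,
  ⟨0, 16777228, 49153, 1, 68719476737⟩,
  ⟨0, 16777216, 12, 49152, 68719476736⟩,
  ⟨0, 16826368, 4096, 4108, 68719480832⟩,
  ⟨0, 4096, 201326592, 12, 68719476736⟩,
  ⟨0, 12, 201326593, 49153, 68719476737⟩,
  ⟨0, 49153, 201330688, 4096, 68719480832⟩,
  ⟨0, 4108, 1, 201326593, 68719476737⟩,
  ⟨0, 1, 49152, 201326592, 68719476736⟩,
  ⟨0, 49152, 4108, 201330688, 68719480832⟩,
  ⟨0, 201330688, 16777228, 16777216, 68736253952⟩,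
  ⟨0, 201326592, 16826368, 16777228, 68736253952⟩,
  ⟨0, 201326593, 16777216, 16826368, 68736253952⟩,
  ⟨0, 68736253952, 824633769984, 824633720844, 824633720832⟩,
  ⟨0, 68736253952, 824633720832, 824633769984, 824633720844⟩,
  ⟨0, 68736253952, 824633720844, 824633720832, 824633769984⟩,
  ⟨0, 68719480832, 824835047424, 824633720832, 824633720844⟩,
  ⟨0, 68719476737, 824835047424, 824633769984, 824633720832⟩,
  ⟨0, 68719476736, 824835047424, 824633720844, 824633769984⟩,
  ⟨0, 68719480832, 824633720844, 824835047424, 824633720832⟩,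
  ⟨0, 68719476736, 824633769984, 824835047424, 824633720844⟩,
  ⟨0, 68719476737, 824633720832, 824835047424, 824633769984⟩,
  ⟨0, 68719480832, 824633720832, 824633720844, 824835047424⟩,
  ⟨0, 68719476737, 824633769984, 824633720832, 824835047424⟩,
  ⟨0, 68719476736, 824633720844, 824633769984, 824835047424⟩]

/-- Symmetries of the cells of `frameD`. -/
def stabD0 : List Ent := [
  ⟨0, 68719476736, 16777216, 4096, 1⟩,
  ⟨1, 68719476736, 201326592, 49164, 1⟩,
  ⟨0, 68719476736, 12, 49152, 201326592⟩,
  ⟨1, 68719476736, 12, 4097, 16777216⟩,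
  ⟨1, 68719476736, 1, 16781312, 201326592⟩,
  ⟨0, 68719476736, 1, 201375756, 16777216⟩,
  ⟨1, 68719476736, 16777216, 201375744, 12⟩,
  ⟨0, 68719476736, 201326592, 16781313, 12⟩]

def stabD1 : List Ent := [
  ⟨0, 68719476736, 16777216, 4096, 1⟩,
  ⟨0, 68736253952, 201326592, 201330689, 12⟩,
  ⟨0, 16777216, 68719476736, 49164, 1⟩,
  ⟨0, 201326592, 68736253952, 16826368, 12⟩,
  ⟨0, 68736253952, 824633720832, 824633769984, 12⟩,
  ⟨0, 68719476736, 824835047424, 824633769996, 1⟩]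

def stabD2 : List Ent := [
  ⟨0, 68719476736, 16777216, 4096, 1⟩,
  ⟨0, 68719476736, 16777216, 49152, 12⟩,
  ⟨0, 68719476736, 16777216, 12, 4097⟩,
  ⟨0, 68719476736, 16777216, 1, 49164⟩,
  ⟨0, 68719476736, 16777216, 4097, 49152⟩,
  ⟨0, 68719476736, 16777216, 49164, 4096⟩,
  ⟨0, 68736253952, 201326592, 4097, 12⟩,
  ⟨0, 68736253952, 201326592, 49164, 1⟩,
  ⟨0, 68736253952, 201326592, 1, 4096⟩,
  ⟨0, 68736253952, 201326592, 12, 49152⟩,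
  ⟨0, 68736253952, 201326592, 4096, 49164⟩,
  ⟨0, 68736253952, 201326592, 49152, 4097⟩,
  ⟨0, 16777216, 68719476736, 4097, 12⟩,
  ⟨0, 16777216, 68719476736, 49164, 1⟩,
  ⟨0, 16777216, 68719476736, 1, 4096⟩,
  ⟨0, 16777216, 68719476736, 12, 49152⟩,
  ⟨0, 16777216, 68719476736, 4096, 49164⟩,
  ⟨0, 16777216, 68719476736, 49152, 4097⟩,
  ⟨0, 201326592, 68736253952, 4096, 1⟩,
  ⟨0, 201326592, 68736253952, 49152, 12⟩,
  ⟨0, 201326592, 68736253952, 12, 4097⟩,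
  ⟨0, 201326592, 68736253952, 1, 49164⟩,
  ⟨0, 201326592, 68736253952, 4097, 49152⟩,
  ⟨0, 201326592, 68736253952, 49164, 4096⟩,
  ⟨1, 4096, 1, 68719476736, 16777216⟩,
  ⟨1, 49152, 12, 68719476736, 16777216⟩,
  ⟨1, 12, 4097, 68719476736, 16777216⟩,
  ⟨1, 1, 49164, 68719476736, 16777216⟩,
  ⟨1, 4097, 49152, 68719476736, 16777216⟩,
  ⟨1, 49164, 4096, 68719476736, 16777216⟩,
  ⟨1, 4097, 12, 68736253952, 201326592⟩,
  ⟨1, 49164, 1, 68736253952, 201326592⟩,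
  ⟨1, 1, 4096, 68736253952, 201326592⟩,
  ⟨1, 12, 49152, 68736253952, 201326592⟩,
  ⟨1, 4096, 49164, 68736253952, 201326592⟩,
  ⟨1, 49152, 4097, 68736253952, 201326592⟩,
  ⟨1, 4097, 12, 16777216, 68719476736⟩,
  ⟨1, 49164, 1, 16777216, 68719476736⟩,
  ⟨1, 1, 4096, 16777216, 68719476736⟩,
  ⟨1, 12, 49152, 16777216, 68719476736⟩,
  ⟨1, 4096, 49164, 16777216, 68719476736⟩,
  ⟨1, 49152, 4097, 16777216, 68719476736⟩,
  ⟨1, 4096, 1, 201326592, 68736253952⟩,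
  ⟨1, 49152, 12, 201326592, 68736253952⟩,
  ⟨1, 12, 4097, 201326592, 68736253952⟩,
  ⟨1, 1, 49164, 201326592, 68736253952⟩,
  ⟨1, 4097, 49152, 201326592, 68736253952⟩,
  ⟨1, 49164, 4096, 201326592, 68736253952⟩,
  ⟨1, 4096, 1, 68736253952, 824633720832⟩,
  ⟨1, 49152, 12, 68736253952, 824633720832⟩,
  ⟨1, 12, 4097, 68736253952, 824633720832⟩,
  ⟨1, 1, 49164, 68736253952, 824633720832⟩,
  ⟨1, 4097, 49152, 68736253952, 824633720832⟩,
  ⟨1, 49164, 4096, 68736253952, 824633720832⟩,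
  ⟨1, 4097, 12, 68719476736, 824835047424⟩,
  ⟨1, 49164, 1, 68719476736, 824835047424⟩,
  ⟨1, 1, 4096, 68719476736, 824835047424⟩,
  ⟨1, 12, 49152, 68719476736, 824835047424⟩,
  ⟨1, 4096, 49164, 68719476736, 824835047424⟩,
  ⟨1, 49152, 4097, 68719476736, 824835047424⟩,
  ⟨0, 68736253952, 824633720832, 4096, 1⟩,
  ⟨0, 68736253952, 824633720832, 49152, 12⟩,
  ⟨0, 68736253952, 824633720832, 12, 4097⟩,
  ⟨0, 68736253952, 824633720832, 1, 49164⟩,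
  ⟨0, 68736253952, 824633720832, 4097, 49152⟩,
  ⟨0, 68736253952, 824633720832, 49164, 4096⟩,
  ⟨0, 68719476736, 824835047424, 4097, 12⟩,
  ⟨0, 68719476736, 824835047424, 49164, 1⟩,
  ⟨0, 68719476736, 824835047424, 1, 4096⟩,
  ⟨0, 68719476736, 824835047424, 12, 49152⟩,
  ⟨0, 68719476736, 824835047424, 4096, 49164⟩,
  ⟨0, 68719476736, 824835047424, 49152, 4097⟩]

def stabD3 : List Ent := [
  ⟨0, 68719476736, 16777216, 4096, 1⟩,
  ⟨1, 68719476736, 12, 16777217, 49153⟩,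
  ⟨0, 68719476736, 4108, 49152, 201375744⟩,
  ⟨1, 68719476736, 16781312, 201326604, 201326592⟩,
  ⟨1, 16777217, 68719480844, 49152, 49153⟩,
  ⟨0, 4096, 68719476748, 16777217, 1⟩,
  ⟨0, 49152, 68736258048, 201326604, 201375744⟩,
  ⟨1, 201326604, 68736253952, 4096, 201326592⟩,
  ⟨0, 16777217, 4108, 68719476736, 1⟩,
  ⟨1, 49152, 16781312, 68719476736, 49153⟩,
  ⟨1, 4096, 12, 68719476736, 201326592⟩,
  ⟨0, 201326604, 16777216, 68719476736, 201375744⟩,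
  ⟨1, 201326604, 1, 49152, 68719476748⟩,
  ⟨0, 4096, 49153, 201326604, 68719480844⟩,
  ⟨0, 49152, 201326592, 16777217, 68736253952⟩,
  ⟨1, 16777217, 201375744, 4096, 68736258048⟩,
  ⟨0, 16777217, 68719476748, 824633720832, 824633769985⟩,
  ⟨1, 4096, 68736253952, 824633720832, 824633720833⟩,
  ⟨1, 49152, 68719480844, 824633720832, 824835096576⟩,
  ⟨0, 201326604, 68736258048, 824633720832, 824835047424⟩,
  ⟨0, 68719476736, 824835096576, 4096, 68719480844⟩,
  ⟨1, 68719476736, 824633769985, 201326604, 68719476748⟩,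
  ⟨0, 68719476736, 824633720833, 49152, 68736253952⟩,
  ⟨1, 68719476736, 824835047424, 16777217, 68736258048⟩]

/-- The faces of the standard basis. -/
def faceB0 : List Face := [
  ⟨4108, 0, ⟨0, 68719476736, 16777216, 4097, 49152⟩⟩,
  ⟨4097, 0, ⟨0, 68719476736, 201326592, 4097, 4096⟩⟩,
  ⟨16826380, 1, ⟨1, 68719476736, 16781312, 201326604, 201326592⟩⟩,
  ⟨16826368, 0, ⟨0, 68719476736, 4097, 49152, 16777216⟩⟩,
  ⟨16826369, 1, ⟨1, 68719476736, 201375744, 16777217, 201326592⟩⟩,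
  ⟨16777228, 0, ⟨1, 68719476736, 4097, 201326592, 49152⟩⟩,
  ⟨16777217, 0, ⟨1, 68719476736, 4097, 16777216, 4096⟩⟩,
  ⟨16781324, 1, ⟨1, 68719476736, 201375744, 201326604, 16777216⟩⟩,
  ⟨16781312, 0, ⟨0, 68719476736, 4097, 4096, 201326592⟩⟩,
  ⟨16781313, 1, ⟨1, 68719476736, 16781312, 16777217, 16777216⟩⟩,
  ⟨68920852492, 2, ⟨0, 68736253952, 824633769984, 824633720844, 824633720832⟩⟩,
  ⟨68920852480, 1, ⟨0, 201375744, 16777217, 16777216, 68719476736⟩⟩,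
  ⟨68920852481, 2, ⟨1, 68736253952, 824633769984, 824633720832, 68719476737⟩⟩,
  ⟨68920803340, 1, ⟨1, 16781312, 201326604, 68719476736, 201326592⟩⟩,
  ⟨68920803328, 0, ⟨0, 4097, 49152, 68719476736, 16777216⟩⟩,
  ⟨68920803329, 1, ⟨1, 201375744, 16777217, 68719476736, 201326592⟩⟩,
  ⟨68920807436, 2, ⟨1, 68736253952, 824633769984, 68719476736, 824633720844⟩⟩,
  ⟨68920807424, 1, ⟨0, 16781312, 201326604, 16777216, 68719476736⟩⟩,
  ⟨68920807425, 2, ⟨0, 68736253952, 824633769984, 68719476737, 68719476736⟩⟩,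
  ⟨68719525900, 1, ⟨0, 201375744, 68719476736, 16777217, 16777216⟩⟩,
  ⟨68719525888, 0, ⟨1, 4097, 68719476736, 49152, 201326592⟩⟩,
  ⟨68719525889, 1, ⟨0, 16781312, 68719476736, 201326604, 16777216⟩⟩,
  ⟨68719476748, 0, ⟨0, 4097, 68719476736, 16777216, 49152⟩⟩,
  ⟨68719476737, 0, ⟨0, 4097, 68719476736, 201326592, 4096⟩⟩,
  ⟨68719480844, 1, ⟨0, 16781312, 68719476736, 16777217, 201326592⟩⟩,
  ⟨68719480832, 0, ⟨1, 4097, 68719476736, 4096, 16777216⟩⟩,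
  ⟨68719480833, 1, ⟨0, 201375744, 68719476736, 201326604, 201326592⟩⟩,
  ⟨68736303116, 2, ⟨1, 68736253952, 68719480832, 824633720832, 824633720844⟩⟩,
  ⟨68736303104, 1, ⟨0, 16781312, 16777217, 201326592, 68719476736⟩⟩,
  ⟨68736303105, 2, ⟨0, 68736253952, 68719480832, 824633720844, 68719476736⟩⟩,
  ⟨68736253964, 1, ⟨1, 201375744, 201326604, 68719476736, 16777216⟩⟩,
  ⟨68736253952, 0, ⟨0, 4097, 4096, 68719476736, 201326592⟩⟩,
  ⟨68736253953, 1, ⟨1, 16781312, 16777217, 68719476736, 16777216⟩⟩,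
  ⟨68736258060, 2, ⟨0, 68736253952, 68719480832, 68719476737, 824633720832⟩⟩,
  ⟨68736258048, 1, ⟨0, 201375744, 201326604, 201326592, 68719476736⟩⟩,
  ⟨68736258049, 2, ⟨1, 68736253952, 68719480832, 68719476736, 68719476737⟩⟩]

/-- The faces of the cells of `frameC`. -/
def faceC0 : List Face := [
  ⟨16826368, 0, ⟨0, 68719476736, 16777216, 201375744, 12⟩⟩,
  ⟨16826369, 0, ⟨0, 68719476736, 16777216, 201375756, 16781312⟩⟩,
  ⟨16777228, 0, ⟨1, 68719476736, 201326592, 1, 16781312⟩⟩,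
  ⟨16777217, 0, ⟨1, 68719476736, 201326592, 12, 201375744⟩⟩,
  ⟨16781324, 0, ⟨0, 68719476736, 16777216, 16781313, 201375744⟩⟩,
  ⟨16781312, 0, ⟨0, 68719476736, 16777216, 16781312, 1⟩⟩,
  ⟨68920852480, 1, ⟨1, 68736253952, 824633720832, 824633769984, 12⟩⟩,
  ⟨68920852481, 1, ⟨1, 68736253952, 824633720832, 824633769996, 68719480832⟩⟩,
  ⟨68920803340, 1, ⟨1, 68736253952, 824633720832, 1, 824633769996⟩⟩,
  ⟨68920803328, 2, ⟨1, 68736253952, 824633720832, 4096, 1⟩⟩,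
  ⟨68920803329, 1, ⟨1, 68736253952, 824633720832, 12, 68719480833⟩⟩,
  ⟨68920807436, 1, ⟨1, 68736253952, 824633720832, 68719480833, 824633769984⟩⟩,
  ⟨68920807424, 1, ⟨1, 68736253952, 824633720832, 68719480832, 1⟩⟩,
  ⟨68719525888, 0, ⟨1, 201326592, 68719476736, 16781312, 1⟩⟩,
  ⟨68719525889, 0, ⟨1, 201326592, 68719476736, 16781313, 201375744⟩⟩,
  ⟨68719476748, 0, ⟨0, 16777216, 68719476736, 12, 201375744⟩⟩,
  ⟨68719476737, 0, ⟨0, 16777216, 68719476736, 1, 16781312⟩⟩,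
  ⟨68719480844, 0, ⟨1, 201326592, 68719476736, 201375756, 16781312⟩⟩,
  ⟨68719480832, 0, ⟨1, 201326592, 68719476736, 201375744, 12⟩⟩,
  ⟨68736303104, 1, ⟨0, 68736253952, 68719476736, 824633769996, 1⟩⟩,
  ⟨68736303105, 1, ⟨0, 68736253952, 68719476736, 824633769984, 68719480833⟩⟩,
  ⟨68736253964, 1, ⟨0, 68736253952, 68719476736, 12, 824633769984⟩⟩,
  ⟨68736253952, 2, ⟨0, 68736253952, 68719476736, 4097, 12⟩⟩,
  ⟨68736253953, 1, ⟨0, 68736253952, 68719476736, 1, 68719480832⟩⟩,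
  ⟨68736258060, 1, ⟨0, 68736253952, 68719476736, 68719480832, 824633769996⟩⟩,
  ⟨68736258048, 1, ⟨0, 68736253952, 68719476736, 68719480833, 12⟩⟩]

def faceC1 : List Face := [
  ⟨4097, 0, ⟨0, 68719476736, 201326592, 49164, 49152⟩⟩,
  ⟨16826368, 0, ⟨0, 68719476736, 201375744, 4096, 12⟩⟩,
  ⟨16777228, 0, ⟨1, 68719476736, 16781312, 1, 49152⟩⟩,
  ⟨68920803328, 1, ⟨1, 1, 4096, 68719476736, 201326592⟩⟩,
  ⟨68920803329, 3, ⟨1, 68719476736, 824835096576, 4096, 68719480844⟩⟩,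
  ⟨68920807424, 3, ⟨1, 68719476736, 824835047424, 68719476748, 49152⟩⟩,
  ⟨68920807425, 1, ⟨0, 1, 68719480832, 16826368, 49152⟩⟩,
  ⟨68719525900, 3, ⟨1, 68719476736, 201326604, 824633769985, 824633720833⟩⟩,
  ⟨68719525888, 1, ⟨0, 1, 68719476736, 4096, 16777216⟩⟩,
  ⟨68719476748, 1, ⟨0, 12, 68719476736, 16777216, 4097⟩⟩,
  ⟨68719476737, 1, ⟨1, 12, 68719476736, 16777216, 4096⟩⟩,
  ⟨68719480832, 1, ⟨1, 1, 68719476736, 4097, 16777216⟩⟩,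
  ⟨68719480833, 3, ⟨0, 68719476736, 16777217, 68719476748, 68719480844⟩⟩,
  ⟨68736303116, 1, ⟨1, 1, 68719480833, 16826380, 49164⟩⟩,
  ⟨68736303104, 3, ⟨0, 68719476736, 68736258048, 824633769985, 49152⟩⟩,
  ⟨68736253964, 3, ⟨0, 68719476736, 68736253952, 4096, 824633720833⟩⟩,
  ⟨68736253952, 1, ⟨0, 1, 4097, 68719476736, 201326592⟩⟩]

def faceC2 : List Face := [
  ⟨4097, 1, ⟨1, 68719476736, 16777216, 4096, 4097⟩⟩,
  ⟨16777217, 1, ⟨1, 68719476736, 4097, 16777216, 4096⟩⟩,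
  ⟨16781312, 1, ⟨1, 68719476736, 4096, 4097, 16777216⟩⟩,
  ⟨16781313, 1, ⟨1, 1, 68719480832, 201330688, 4096⟩⟩,
  ⟨68920852480, 1, ⟨1, 68719480833, 16826380, 49164, 12⟩⟩,
  ⟨68920803340, 1, ⟨1, 68719480832, 16826368, 1, 49152⟩⟩,
  ⟨68920803328, 1, ⟨1, 4096, 49164, 68719476736, 201326592⟩⟩,
  ⟨68719525900, 1, ⟨1, 68719480833, 12, 16826380, 49164⟩⟩,
  ⟨68719525888, 1, ⟨1, 4097, 68719476736, 49152, 201326592⟩⟩,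
  ⟨68719476748, 1, ⟨1, 4096, 68719476736, 201326592, 49164⟩⟩]

/-- Pivots for the coboundary operator into degree `4`: the entry `(K, u)` eliminates the value
at the key `K` of `frameC` by a functional supported at the key `u` of `frameD`. -/
def pivots : List (Nat × Nat) := [
  (778, 1297), (12166, 17073), (9669, 17061), (9524, 9525), (9468, 10145), (10254, 17085), (11325, 11453), (9813, 13353),
  (9534, 12693), (9530, 9533), (10996, 10124), (9536, 9692), (9717, 9636), (10828, 8880), (10366, 10573), (10497, 10372),
  (9861, 9596), (9542, 12953), (9544, 10112), (10260, 10653), (10148, 10825), (9540, 9541), (12172, 9088), (12450, 12709),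
  (12228, 11005), (10421, 17077), (9765, 12733), (12505, 883), (10144, 729), (8845, 1253), (734, 785), (10820, 9032),
  (9969, 9760), (10200, 10128), (10597, 10367), (10442, 10545), (10369, 10945), (10325, 10688), (10948, 10950), (10264, 10408),
  (11773, 11017), (10314, 10493), (11053, 11089), (10329, 10561), (10328, 9896), (12296, 9784), (11777, 11809), (12232, 10068),
  (8905, 801), (11045, 11404), (10373, 10684), (10318, 11001), (10952, 10484), (10317, 10641), (12264, 10902), (10313, 11633),
  (10284, 9960), (10960, 9792), (8925, 925), (826, 985), (9769, 13325), (11154, 11125), (9577, 10257), (9578, 10301),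
  (10204, 9624), (9593, 9904), (9584, 10044), (9488, 9120), (8865, 773), (9472, 8940), (830, 961), (9586, 9697),
  (9598, 11109), (9601, 10369), (9581, 9736), (9873, 10691), (9865, 10595), (10321, 10467), (10228, 10469), (10212, 10461),
  (10310, 12965), (9869, 10497), (11000, 10910), (9605, 10313), (11008, 10776), (10208, 10564), (10220, 9836), (9592, 9716),
  (9585, 9992), (10164, 9144), (8957, 769), (738, 981), (746, 893), (9633, 9788), (10266, 11833), (11058, 12077),
  (11097, 10379), (11049, 10677), (10593, 12969), (10262, 11709), (10258, 10385), (10365, 10740), (10896, 9844), (11004, 8976),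
  (8901, 753), (8965, 1261), (9913, 11805), (9689, 12689), (9013, 9084), (9693, 9948), (12248, 11248), (11041, 807),
  (750, 865), (742, 869), (8913, 873), (8917, 857), (10309, 10464), (12236, 9708), (12260, 9704), (12288, 10326),
  (10990, 11249), (10276, 10012), (10272, 9996), (11056, 10436), (10545, 10376), (10645, 10488), (10892, 9020), (10268, 8928),
  (10324, 949), (8909, 969), (9641, 10557), (9821, 10365), (794, 877), (10224, 9140), (10956, 817), (8961, 825),
  (10904, 9764), (10936, 9756), (10888, 10537), (10216, 9924), (8969, 945), (9637, 9639), (9589, 9591), (850, 10309),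
  (10380, 10322), (10320, 977), (9645, 10589), (9817, 10349), (798, 853), (9594, 11521), (9590, 11501), (9597, 10929),
  (9596, 810), (10840, 8916), (970, 709), (12252, 9064), (12240, 9052), (9649, 10645), (854, 10297), (9484, 10161),
  (8921, 9040), (10160, 802), (797, 856), (804, 944), (808, 848), (10908, 849), (10884, 881), (8877, 845),
  (744, 68), (65, 833), (10832, 862), (9704, 918), (9690, 10153), (8849, 71), (8881, 793), (10156, 10157),
  (874, 9689), (882, 713), (9476, 690), (12184, 9044), (9526, 9529), (8869, 63), (10824, 781), (8857, 937),
  (8873, 957), (793, 968), (9634, 9645), (10912, 10040), (752, 76), (748, 72), (740, 64), (9652, 9653),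
  (9582, 9641), (9588, 9589), (9638, 9701), (9646, 9649), (12453, 12192), (10261, 10156), (11725, 9915), (10257, 9695),
  (9537, 9484), (10269, 9871), (10265, 9691), (9533, 9531), (9529, 9476), (10989, 747), (741, 888), (10993, 9771),
  (11721, 9579), (10997, 9595), (9541, 9527), (9525, 739), (737, 684), (66, 11493), (62, 10817), (10816, 66),
  (58, 10141), (10140, 62), (6, 677), (9464, 6)]

/-- A cycle detecting the cohomology class of `phiData`. -/
def zetaData : List (Int × Nat) := [
  (-2, 850), (3, 8917), (3, 8913), (6, 750), (-6, 9013), (-4, 8965), (3, 10820), (3, 12172),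
  (-4, 10828), (-2, 10840), (-4, 738), (2, 742), (1, 8909), (-3, 8881), (-3, 12184), (-3, 8849),
  (2, 12176), (2, 746), (-2, 8901), (-1, 10156), (-1, 10836), (-4, 8957), (1, 8905), (1, 8921),
  (-2, 734), (-1, 8969), (1, 8873), (-1, 10152), (1, 8857), (2, 10160), (2, 9484), (-2, 970),
  (3, 8869), (3, 10824), (3, 8861), (-2, 854), (1, 8925), (-1, 9476), (1, 874), (-1, 9480),
  (1, 882), (-1, 8877), (1, 10832), (-1, 8853), (-1, 8961)]

/-- A cocycle, given by its values at the keys of `frameC`. -/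
def phiData : List (Int × Nat) := [
  (1, 9921), (1, 9648), (1, 10900), (1, 10152), (1, 10332), (-1, 10944), (1, 12176)]

/-- A key at which the cocycle `phiData` has the value `1`. -/
def phiKey : Nat := 9921

/-- Equations `(m, K)` for a cocycle: the one of the row with code `m` determines the value at `K`. -/
def eqData : List (Nat × Nat) := [
  (199, 860), (200, 800), (212, 8853), (2380, 9522), (2383, 9532), (2385, 9538), (2394, 10236), (2396, 10232),
  (2398, 10280), (2436, 9642), (2437, 8861), (2579, 12308), (2582, 10940), (2583, 10332), (198, 61), (2384, 11266),
  (2578, 9917), (2580, 10900), (2581, 10944), (2381, 9528), (2382, 10876), (2409, 9648), (2410, 9602), (2411, 9644),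
  (2424, 12176), (2395, 10880), (2397, 10836), (2408, 9480), (2423, 10152)]

def stabC : Nat → List Ent
  | 0 => stabC0
  | 1 => stabC1
  | _ => stabC2

def stabD : Nat → List Ent
  | 0 => stabD0
  | 1 => stabD1
  | 2 => stabD2
  | _ => stabD3

def faceC : Nat → List Face
  | 0 => faceC0
  | 1 => faceC1
  | _ => faceC2

/-- The boundary of a cell of `frameC`, in terms of keys. -/
def rowC (k : Nat) : List (Int × Nat) := bdRow stabD (k / 4) (faceC (k % 4))

/-- The boundary of the standard basis, in terms of keys. -/
def rowB (n : Nat) : List (Int × Nat) := bdRow stabC n faceB0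

/-- The set of elements of a list, as a bit mask. -/
def bits (l : List Nat) : Nat := l.foldr (fun k m => m ||| 1 <<< k) 0

/-- The coefficients of `R` vanish at the keys in the set `m`. -/
def offBits (m : Nat) (R : List (Int × Nat)) : List (Int × Nat) → Bool
  | [] => true
  | (_, k) :: r => (!(m.testBit k) || coef k R == 0) && offBits m R r

/-- The pivots are nonzero, and in triangular position. -/
def chkP : List (Nat × Nat) → Nat × Bool
  | [] => (0, true)
  | (k, u) :: l => ((chkP l).1 ||| 1 <<< u, (!(coef u (rowC k) == 0) && offBits (chkP l).1 (rowC k) (rowC k)) && (chkP l).2)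

/-- The coefficients of `R` vanish at the keys outside the set `m`. -/
def onBits (m : Nat) (R : List (Int × Nat)) : List (Int × Nat) → Bool
  | [] => true
  | (_, k) :: r => (m.testBit k || coef k R == 0) && onBits m R r

/-- Each equation determines a new value from those at the keys in `m` and the earlier ones. -/
def chkE (m : Nat) : List (Nat × Nat) → Bool
  | [] => true
  | (n, k) :: l => !(coef k (rowB n) == 0) && onBits (m ||| 1 <<< k) (rowB n) (rowB n) && chkE (m ||| 1 <<< k) l

/-- The standard pairing of formal sums. -/
def dotp (r : List (Int × Nat)) : List (Int × Nat) → Int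
  | [] => 0
  | (c, k) :: l => c * coef k r + dotp r l

/-- Scalar multiples of a formal sum. -/
def scl (c : Int) (r : List (Int × Nat)) : List (Int × Nat) := r.map fun q => (c * q.1, q.2)

/-- All coefficients of a formal sum vanish. -/
def chkS : Nat → List (Int × Nat) → Bool
  | 0, l => l.isEmpty
  | _ + 1, [] => true
  | f + 1, (c, k) :: l => (c + coef k l == 0) && chkS f (l.filter fun q => !(Nat.beq k q.2))

/-- The code in the key `k` is least in its orbit, and no symmetry fixing it reverses orientation. -/
def minChk (m : Nat) (stab : Nat → List Ent) (k : Nat) : Bool :=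
  (Nat.blt (k % 4) m && Nat.blt 0 (k / 4)) && Nat.beq (canon (stab (k % 4)) (k / 4)) (3 * (k / 4))

/-- Some symmetry in `L` decreases the code `n`, or fixes it and reverses orientation. -/
def descends (L : List Ent) (n : Nat) : Bool :=
  L.any fun e => bif Nat.blt (e.act (n / 2197) (n / 169 % 13) (n / 13 % 13) (n % 13)) n then true else
    (bif Nat.beq (e.act (n / 2197) (n / 169 % 13) (n / 13 % 13) (n % 13)) n then Nat.beq e.s 1 else false)

/-- All codes in `[lo, lo + n)` are in the set `m` or can be decreased. -/
def cov (m : Nat) (stab : Nat → List Ent) (t : Nat) (lo : Nat) : Nat → Bool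
  | 0 => true
  | n + 1 => (m.testBit (4 * (lo + n) + t) || descends (stab t) (lo + n)) && cov m stab t lo n

/-- All normalized codes are in the set `m` or can be decreased. -/
def covs (m : Nat) (stab : Nat → List Ent) (t : Nat) : Bool :=
  (cov m stab t 1 1 && cov m stab t 13 13) && (cov m stab t 169 169 && cov m stab t 2197 2197)

/-- The keys of `frameC` at which values are prescribed. -/
def maskC : Nat := bits (phiKey :: (pivots.map Prod.fst ++ eqData.map Prod.snd))

/-- The keys of the standard basis at which equations are imposed. -/
def maskB : Nat := bits (eqData.map fun q => 4 * q.1)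

/-- The faces in `F` of `x` have the recorded types, and are pairwise distinct. -/
def facesOk (m : Nat) (X : Nat → List IVec) (F : List Face) (x : List IVec) : Bool :=
  (F.all fun f => Nat.blt f.t m && f.e.check (rowVec f.w :: x) (X f.t)) &&
    decide ((F.map fun f => rowVec f.w).Pairwise fun u v => u.equiv v = false)

/-- The vector `u` extends the standard basis by one of the faces in `F`, unless it is excluded. -/
def faceOf (F : List Face) (u : IVec) : Bool :=
  (u.beq ⟨0, 0, 0, 0⟩ || baseFrame.any fun v => u.equiv v) || F.any fun f => (rowVec f.w).equiv u

/-- A face of the standard basis not in `F` cannot be added together with `v`. -/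
def excludes (F : List Face) (v u : IVec) : Bool :=
  (u.equiv v || baseFrame.any fun a => baseFrame.any fun b =>
    Nat.ble 2 (IVec.det u v a b).natAbs) || F.any fun f => (rowVec f.w).equiv u

/-- Matrices mapping the cells of `frameC` to minimal vectors of `A₄`. -/
def certC (t : Nat) : Ent := match t with
  | 0 => ⟨0, 12, 4097, 201375744, 68736253952⟩
  | 1 => ⟨0, 12, 49153, 16781312, 68920803328⟩
  | _ => ⟨0, 1, 49152, 201330688, 68736253952⟩

/-- Matrices mapping the cells of `frameD` to minimal vectors of `A₄`. -/
def certD (t : Nat) : Ent := match t with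
  | 0 => ⟨0, 12, 4097, 201375744, 68736253952⟩
  | 1 => ⟨0, 1, 49164, 201330688, 68736253952⟩
  | 2 => ⟨0, 12, 4097, 201375744, 68736253952⟩
  | _ => ⟨0, 1, 49152, 201326604, 68736258048⟩

theorem cellOk_baseFrame : cellOk ⟨0, 1, 4108, 16826368, 68920803328⟩ baseFrame = true := by decide +kernel

theorem cellOk_frameC : ∀ t, cellOk (certC t) (frameC t) = true
  | 0 | 1 => by decide +kernel
  | _ + 2 => (by decide +kernel : cellOk (certC 2) (frameC 2) = true)

theorem cellOk_frameD : ∀ t, cellOk (certD t) (frameD t) = true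
  | 0 | 1 | 2 => by decide +kernel
  | _ + 3 => (by decide +kernel : cellOk (certD 3) (frameD 3) = true)

theorem stabOk_stabC : ∀ t, stabOk (stabC t) (frameC t) = true
  | 0 | 1 => by decide +kernel
  | _ + 2 => (by decide +kernel : stabOk (stabC 2) (frameC 2) = true)

theorem stabOk_stabD : ∀ t, stabOk (stabD t) (frameD t) = true
  | 0 | 1 | 2 => by decide +kernel
  | _ + 3 => (by decide +kernel : stabOk (stabD 3) (frameD 3) = true)

theorem check_stabB0 : (stabB0.all fun e => e.check baseFrame baseFrame) = true := by decide +kernel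

theorem facesOk_faceB0 : facesOk 3 frameC faceB0 baseFrame = true := by decide +kernel

theorem facesOk_faceC : ∀ t, facesOk 4 frameD (faceC t) (frameC t) = true
  | 0 | 1 => by decide +kernel
  | _ + 2 => (by decide +kernel : facesOk 4 frameD (faceC 2) (frameC 2) = true)

theorem faceOf_faceB0 : ∀ a ∈ ([-1, 0, 1] : List ℤ), ∀ b ∈ ([-1, 0, 1] : List ℤ),
    ∀ c ∈ ([-1, 0, 1] : List ℤ), ∀ d ∈ ([-1, 0, 1] : List ℤ), faceOf faceB0 ⟨a, b, c, d⟩ = true := by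
  decide +kernel

theorem excludes_faceC : ∀ t, ((frameC t).drop 4).all (fun v =>
    faceB0.all fun f => excludes (faceC t) v (rowVec f.w)) = true
  | 0 | 1 => by decide +kernel
  | _ + 2 => (by decide +kernel : ((frameC 2).drop 4).all (fun v =>
    faceB0.all fun f => excludes (faceC 2) v (rowVec f.w)) = true)

theorem det_sum_frameC : ∀ s < 3, ∀ t < 3,
    (syms (frameC s)).sum.det = (syms (frameC t)).sum.det → s = t := by decide +kernel

theorem det_sum_frameD : ∀ s < 4, ∀ t < 4,
    (syms (frameD s)).sum.det = (syms (frameD t)).sum.det → s = t := by decide +kernel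

end Tables

section Certificates

theorem chkP_pivots : (chkP pivots).2 = true := by decide +kernel

theorem chkE_eqData : chkE (bits (phiKey :: pivots.map Prod.fst)) eqData = true := by decide +kernel

theorem dotp_rowB_phiData : (eqData.all fun q => dotp (rowB q.1) phiData == 0) = true := by
  decide +kernel

theorem chkS_zetaData : chkS 1000 (zetaData.flatMap fun q => scl q.1 (rowC q.2)) = true := by
  decide +kernel

theorem dotp_phiData_zetaData : (dotp phiData zetaData == 0) = false := by decide +kernel

theorem minChk_pivots : (pivots.all fun q => minChk 4 stabD q.2) = true := by decide +kernel

theorem minChk_pivotKeys : (pivots.all fun q => minChk 3 stabC q.1) = true := by decide +kernel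

theorem minChk_phiData : (phiData.all fun q => minChk 3 stabC q.2) = true := by decide +kernel

theorem minChk_zetaData : (zetaData.all fun q => minChk 3 stabC q.2) = true := by decide +kernel

theorem phiKey_phiData : coef phiKey phiData = 1 ∧
    (pivots.all fun q => phiData.all fun r => !(Nat.beq q.1 r.2)) = true := by decide +kernel

theorem eqData_lt : (eqData.all fun q => Nat.blt q.1 28561) = true := by decide +kernel

theorem covs_stabC : ∀ t < 3, covs maskC stabC t = true := by decide +kernel

theorem covs_stabB0 : covs maskB (fun _ => stabB0) 0 = true := by decide +kernel

end Certificates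

section Classification

theorem facesOk_iff {m : ℕ} {X : ℕ → List IVec} {F : List Face} {x : List IVec} (h : facesOk m X F x = true) :
    (∀ f ∈ F, f.t < m ∧ f.e.check (rowVec f.w :: x) (X f.t) = true) ∧
      (F.map fun f => (rowVec f.w).sym).Nodup := by
  simp only [facesOk, Bool.and_eq_true, List.all_eq_true, decide_eq_true_eq] at h
  refine ⟨fun f hf => ⟨by simpa using (h.1 f hf).1, (h.1 f hf).2⟩, ?_⟩
  have := nodup_syms h.2
  rwa [syms, List.map_map] at this

theorem isCellList_of_check {e : Ent} {x y : List IVec} (h : e.check y x = true)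
    (hx : IsCellList IsCell (syms x)) : IsCellList IsCell (syms y) := by
  rw [← isCellList_perm _ (Ent.check_perm h), isCellList_map_cong]
  exact hx

theorem isCellList_baseFrame : IsCellList IsCell (syms baseFrame) := isCellList_of_cellOk cellOk_baseFrame

theorem isCellList_frameC (t : ℕ) : IsCellList IsCell (syms (frameC t)) := isCellList_of_cellOk (cellOk_frameC t)

theorem isCellList_frameD (t : ℕ) : IsCellList IsCell (syms (frameD t)) := isCellList_of_cellOk (cellOk_frameD t)

theorem mem_smallRange {a : ℤ} (h : a ^ 2 ≤ 1) : a ∈ ([-1, 0, 1] : List ℤ) := by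
  have h1 : -1 ≤ a := by nlinarith
  have h2 : a ≤ 1 := by nlinarith
  simp only [List.mem_cons, List.not_mem_nil, or_false]
  omega

theorem IsCellList.exists_sym {w : Mat} {l : List Mat} (h : IsCellList IsCell (w :: l)) :
    ∃ u : IVec, u ≠ ⟨0, 0, 0, 0⟩ ∧ u.sym = w := by
  obtain ⟨-, -, ⟨Q, -, hm⟩, -⟩ := h
  obtain ⟨v, rfl, h2⟩ := hm (List.mem_toFinset.2 List.mem_cons_self)
  obtain ⟨u, rfl⟩ := IVec.exists_fn_eq v
  refine ⟨u, ?_, rfl⟩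
  rintro rfl
  rw [pair_rk1, show (⟨0, 0, 0, 0⟩ : IVec).fn = 0 by funext i; fin_cases i <;> rfl] at h2
  simp at h2

theorem isCellList_cons_baseFrame_iff (w : Mat) :
    IsCellList IsCell (w :: syms baseFrame) ↔ ∃ f ∈ faceB0, (rowVec f.w).sym = w := by
  constructor
  · intro h
    obtain ⟨u, hu0, rfl⟩ := h.exists_sym
    have hmem : ∀ v ∈ baseFrame, v.sym ∈ (u.sym :: syms baseFrame).toFinset := fun v hv =>
      List.mem_toFinset.2 (List.mem_cons_of_mem _ (List.mem_map_of_mem hv))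
    have hu : u.sym ∈ (u.sym :: syms baseFrame).toFinset := List.mem_toFinset.2 List.mem_cons_self
    have h0 := hmem ⟨1, 0, 0, 0⟩ (by simp [baseFrame])
    have h1 := hmem ⟨0, 1, 0, 0⟩ (by simp [baseFrame])
    have h2 := hmem ⟨0, 0, 1, 0⟩ (by simp [baseFrame])
    have h3 := hmem ⟨0, 0, 0, 1⟩ (by simp [baseFrame])
    have ha := h.2.det_sq_le hu h1 h2 h3
    have hb := h.2.det_sq_le h0 hu h2 h3
    have hc := h.2.det_sq_le h0 h1 hu h3
    have hd := h.2.det_sq_le h0 h1 h2 hu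
    simp [IVec.det] at ha hb hc hd
    have key := faceOf_faceB0 u.a (mem_smallRange (by simpa using ha)) u.b (mem_smallRange (by simpa using hb))
      u.c (mem_smallRange (by simpa using hc)) u.d (mem_smallRange (by simpa using hd))
    simp only [faceOf, Bool.or_eq_true, IVec.beq_iff, List.any_eq_true] at key
    rcases key with (key | ⟨v, hv, key⟩) | ⟨f, hf, key⟩
    · exact absurd key hu0
    · rw [IVec.equiv_iff] at key
      refine absurd ?_ (List.nodup_cons.1 h.1).1
      change u.sym = v.sym at key
      rw [key]
      exact List.mem_map_of_mem hv
    · exact ⟨f, hf, IVec.equiv_iff.1 key⟩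
  · rintro ⟨f, hf, rfl⟩
    exact isCellList_of_check ((facesOk_iff facesOk_faceB0).1 f hf).2 (isCellList_frameC f.t)

theorem frameC_eq (t : ℕ) : ∃ v, frameC t = baseFrame ++ [v] := ⟨_, rfl⟩

theorem isCellList_cons_frameC_iff (t : ℕ) (w : Mat) :
    IsCellList IsCell (w :: syms (frameC t)) ↔ ∃ f ∈ faceC t, (rowVec f.w).sym = w := by
  constructor
  · intro h
    have key := excludes_faceC t
    obtain ⟨v, hv⟩ := frameC_eq t
    rw [hv, show List.drop 4 (baseFrame ++ [v]) = [v] from rfl, List.all_cons, List.all_nil, Bool.and_true,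
      List.all_eq_true] at key
    rw [hv, syms, List.map_append] at h
    obtain ⟨f, hf, rfl⟩ := (isCellList_cons_baseFrame_iff w).1 (h.of_cons_append fun _ hx => hx)
    have key := key f hf
    simp only [excludes, Bool.or_eq_true, List.any_eq_true, IVec.equiv_iff] at key
    rcases key with (key | ⟨a, ha, b, hb, key⟩) | ⟨f', hf', key⟩
    · refine absurd ?_ (List.nodup_cons.1 h.1).1
      rw [key]
      simp
    · exfalso
      have hmem : ∀ u ∈ baseFrame, u.sym ∈
          ((rowVec f.w).sym :: (baseFrame.map IVec.sym ++ [v].map IVec.sym)).toFinset := fun u hu =>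
        List.mem_toFinset.2 (List.mem_cons_of_mem _ (List.mem_append_left _ (List.mem_map_of_mem hu)))
      have := h.2.det_sq_le (a := rowVec f.w) (b := v) (List.mem_toFinset.2 List.mem_cons_self)
        (List.mem_toFinset.2 (by simp)) (hmem a ha) (hmem b hb)
      have h2 := Nat.le_of_ble_eq_true key
      rw [← Int.natAbs_sq] at this
      have h3 : ((rowVec f.w).det v a b).natAbs ^ 2 ≤ 1 := by exact_mod_cast this
      exact absurd ((Nat.pow_le_pow_left h2 2).trans h3) (by norm_num)
    · exact ⟨f', hf', key⟩
  · rintro ⟨f, hf, rfl⟩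
    exact isCellList_of_check ((facesOk_iff (facesOk_faceC t)).1 f hf).2 (isCellList_frameD f.t)

theorem IsCellList.exists_subperm {l : List Mat} (h : IsCellList IsCell l) :
    ∃ g : SL4, ((syms baseFrame).map (cong g)).Subperm l := by
  obtain ⟨g, hg⟩ := h.2.exists_frame
  refine ⟨g, List.subperm_of_subset ?_ fun y hy => ?_⟩
  · exact isCellList_baseFrame.1.map (cong_injective g)
  · obtain ⟨x, hx, rfl⟩ := List.mem_map.1 hy
    exact List.mem_toFinset.1 (hg x hx)

theorem IsCellList.exists_perm_baseFrame {l : List Mat} (h : IsCellList IsCell l) (hl : l.length = 4) :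
    ∃ g : SL4, ((syms baseFrame).map (cong g)).Perm l := by
  obtain ⟨g, hg⟩ := h.exists_subperm
  exact ⟨g, hg.perm_of_length_le (by rw [hl]; simp [syms, baseFrame])⟩

theorem IsCellList.exists_perm_frameC {l : List Mat} (h : IsCellList IsCell l) (hl : l.length = 5) :
    ∃ t < 3, ∃ g : SL4, ((syms (frameC t)).map (cong g)).Perm l := by
  obtain ⟨g, hg⟩ := h.exists_subperm
  obtain ⟨a, ha⟩ := hg.exists_of_length_lt (by rw [hl]; simp [syms, baseFrame])
  have hp := ha.perm_of_length_le (by rw [hl]; simp [syms, baseFrame])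
  have he : a :: (syms baseFrame).map (cong g) = (cong g⁻¹ a :: syms baseFrame).map (cong g) := by
    rw [List.map_cons, cong_cong_inv]
  rw [he] at hp
  have hc := (isCellList_perm _ hp).2 h
  rw [isCellList_map_cong] at hc
  obtain ⟨f, hf, hfa⟩ := (isCellList_cons_baseFrame_iff _).1 hc
  obtain ⟨ht, hchk⟩ := (facesOk_iff facesOk_faceB0).1 f hf
  refine ⟨f.t, ht, g * f.e.sl, ?_⟩
  rw [map_cong_mul]
  have h1 : syms (rowVec f.w :: baseFrame) = cong g⁻¹ a :: syms baseFrame := by rw [← hfa]; rfl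
  have h2 := (Ent.check_perm hchk).map (cong g)
  rw [h1] at h2
  exact h2.trans hp

variable {k : Type} [Field k] {n : ℕ} {φ : altChains k IsCell n →ₗ[k] k}

theorem exists_codeEval_eq (hφ : IsInvariantFunctional (Gamma0 13) φ) (x : List IVec) (v : Fin 4 → ZMod 13) :
    ∃ m, IsCode m ∧ rowEval φ (syms x) v = codeEval φ x m := by
  refine ⟨nrm (v 0).val (v 1).val (v 2).val (v 3).val, isCode_nrm _ _ _ _, ?_⟩
  rw [codeEval_nrm hφ x (ZMod.val_lt _) (ZMod.val_lt _) (ZMod.val_lt _) (ZMod.val_lt _)]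
  congr 1
  funext i
  fin_cases i <;> simp [digits]

theorem cellEval_eq_zero_of_codeEval (hφ : IsInvariantFunctional (Gamma0 13) φ) {x : List IVec}
    (h : ∀ m, IsCode m → codeEval φ x m = 0) {g : SL4} {l : List Mat}
    (hl : ((syms x).map (cong g)).Perm l) : cellEval φ l = 0 := by
  refine (isAlt_cellEval φ).eq_zero_of_perm hl ?_
  rw [cellEval_map_eq_rowEval hφ]
  obtain ⟨m, hm, he⟩ := exists_codeEval_eq hφ x (redMat g 3)
  rw [he, h m hm]

theorem eq_zero_of_codeEval_baseFrame {φ : altChains k IsCell 5 →ₗ[k] k}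
    (hφ : IsInvariantFunctional (Gamma0 13) φ) (h : ∀ m, IsCode m → codeEval φ baseFrame m = 0) : φ = 0 :=
  eq_zero_of_cellEval fun l hl hn => by
    obtain ⟨g, hg⟩ := hl.exists_perm_baseFrame (by omega)
    exact cellEval_eq_zero_of_codeEval hφ h hg

theorem eq_zero_of_codeEval_frameC {φ : altChains k IsCell 4 →ₗ[k] k}
    (hφ : IsInvariantFunctional (Gamma0 13) φ)
    (h : ∀ t < 3, ∀ m, IsCode m → codeEval φ (frameC t) m = 0) : φ = 0 :=
  eq_zero_of_cellEval fun l hl hn => by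
    obtain ⟨t, ht, g, hg⟩ := hl.exists_perm_frameC (by omega)
    exact cellEval_eq_zero_of_codeEval hφ (h t ht) hg

end Classification

section BitLists

theorem testBit_bits {l : List ℕ} {a : ℕ} : (bits l).testBit a = true ↔ a ∈ l := by
  induction l with
  | nil => simp [bits]
  | cons b l ih =>
    change (bits l ||| 1 <<< b).testBit a = true ↔ _
    rw [Nat.testBit_or, Bool.or_eq_true, ih, Nat.one_shiftLeft, Nat.testBit_two_pow, List.mem_cons,
      decide_eq_true_eq]
    exact ⟨fun h => h.symm.imp_left Eq.symm, fun h => h.symm.imp_right Eq.symm⟩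

theorem chkP_fst (l : List (ℕ × ℕ)) : (chkP l).1 = bits (l.map Prod.snd) := by
  induction l with
  | nil => rfl
  | cons q l ih => rw [chkP, ih]; rfl

theorem offBits_spec {m : ℕ} {R r : List (ℤ × ℕ)} (h : offBits m R r = true) :
    ∀ q ∈ r, m.testBit q.2 = true → coef q.2 R = 0 := by
  induction r with
  | nil => simp
  | cons q r ih =>
    simp only [offBits, Bool.and_eq_true, Bool.or_eq_true, Bool.not_eq_true', beq_iff_eq] at h
    rintro p hp hb
    rcases List.mem_cons.1 hp with rfl | hp
    · exact h.1.resolve_left (by simp [hb])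
    · exact ih h.2 p hp hb

theorem onBits_spec {m : ℕ} {R r : List (ℤ × ℕ)} (h : onBits m R r = true) :
    ∀ q ∈ r, m.testBit q.2 = true ∨ coef q.2 R = 0 := by
  induction r with
  | nil => simp
  | cons q r ih =>
    simp only [onBits, Bool.and_eq_true, Bool.or_eq_true, beq_iff_eq] at h
    rintro p hp
    rcases List.mem_cons.1 hp with rfl | hp
    · exact h.1
    · exact ih h.2 p hp

theorem cov_spec {m t lo n : ℕ} {stab : ℕ → List Ent} (h : cov m stab t lo n = true) {i : ℕ} (hi : i < n) :
    m.testBit (4 * (lo + i) + t) = true ∨ descends (stab t) (lo + i) = true := by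
  induction n with
  | zero => omega
  | succ n ih =>
    simp only [cov, Bool.and_eq_true, Bool.or_eq_true] at h
    rcases Nat.lt_succ_iff_lt_or_eq.1 hi with hi | rfl
    · exact ih h.2 hi
    · exact h.1

theorem covs_spec {m t : ℕ} {stab : ℕ → List Ent} (h : covs m stab t = true) {n : ℕ} (hn : IsCode n)
    (h0 : n ≠ 0) : m.testBit (4 * n + t) = true ∨ descends (stab t) n = true := by
  simp only [covs, Bool.and_eq_true] at h
  have key : ∀ lo, cov m stab t lo lo = true → lo ≤ n ∧ n < lo + lo →
      m.testBit (4 * n + t) = true ∨ descends (stab t) n = true := fun lo hc hlo => by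
    have := cov_spec hc (i := n - lo) (by omega)
    rwa [Nat.add_sub_cancel' hlo.1] at this
  rcases hn with hn | hn | hn | hn | hn
  · exact absurd hn h0
  · exact key 1 h.1.1 (by omega)
  · exact key 13 h.1.2 (by omega)
  · exact key 169 h.2.1 (by omega)
  · exact key 2197 h.2.2 (by omega)

theorem minChk_iff {m K : ℕ} {stab : ℕ → List Ent} : minChk m stab K = true ↔
    (K % 4 < m ∧ 0 < K / 4) ∧ canon (stab (K % 4)) (K / 4) = 3 * (K / 4) := by
  rw [minChk, Bool.and_eq_true, Bool.and_eq_true, Nat.blt_eq, Nat.blt_eq, Nat.beq_eq]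

end BitLists

section FormalSums

variable {k : Type} [Field k] {v w : ℕ → k}

theorem coef_cons (a : ℕ) (q : ℤ × ℕ) (r : List (ℤ × ℕ)) :
    coef a (q :: r) = (if a = q.2 then q.1 else 0) + coef a r := by
  obtain ⟨c, l⟩ := q
  rw [coef, cond_eq_ite]
  simp only [Nat.beq_eq]
  split_ifs <;> simp

theorem coef_eq_zero {a : ℕ} {r : List (ℤ × ℕ)} (h : ∀ q ∈ r, a ≠ q.2) : coef a r = 0 := by
  induction r with
  | nil => rfl
  | cons q r ih =>
    rw [coef_cons, if_neg (h q List.mem_cons_self), zero_add,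
      ih fun p hp => h p (List.mem_cons_of_mem _ hp)]

theorem lsum_congr {R : List (ℤ × ℕ)} (h : ∀ q ∈ R, v q.2 = w q.2) : lsum v R = lsum w R := by
  induction R with
  | nil => rfl
  | cons q R ih =>
    rw [lsum, lsum, h q List.mem_cons_self, ih fun p hp => h p (List.mem_cons_of_mem _ hp)]

theorem lsum_eq_zero {R : List (ℤ × ℕ)} (h : ∀ q ∈ R, v q.2 = 0 ∨ coef q.2 R = 0) : lsum v R = 0 := by
  rcases R with _ | ⟨q, R⟩
  · rfl
  · rw [lsum_eq_coef_mul (a := q.2) fun p hp => (h p hp).imp_right Or.inl]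
    rcases h q List.mem_cons_self with h | h <;> simp [h]

theorem lsum_append (R S : List (ℤ × ℕ)) : lsum v (R ++ S) = lsum v R + lsum v S := by
  induction R with
  | nil => simp [lsum]
  | cons q R ih => rw [List.cons_append, lsum, lsum, ih, add_assoc]

theorem lsum_scl (c : ℤ) (R : List (ℤ × ℕ)) : lsum v (scl c R) = c * lsum v R := by
  induction R with
  | nil => simp [lsum, scl]
  | cons q R ih =>
    change lsum v ((c * q.1, q.2) :: scl c R) = c * lsum v ((q.1, q.2) :: R)
    rw [lsum, lsum, ih]; push_cast; ring

theorem lsum_flatMap_scl (l : List (ℤ × ℕ)) (F : ℕ → List (ℤ × ℕ)) :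
    lsum v (l.flatMap fun q => scl q.1 (F q.2)) = lsum (fun K => lsum v (F K)) l := by
  induction l with
  | nil => rfl
  | cons q l ih => rw [List.flatMap_cons, lsum_append, lsum_scl, ih, lsum]

theorem lsum_coef (r l : List (ℤ × ℕ)) : lsum (fun a => (coef a r : k)) l = (dotp r l : ℤ) := by
  induction l with
  | nil => simp [lsum, dotp]
  | cons q l ih => rw [lsum, dotp, ih]; push_cast; rfl

theorem dotp_cons (q : ℤ × ℕ) (r l : List (ℤ × ℕ)) : dotp (q :: r) l = q.1 * coef q.2 l + dotp r l := by
  induction l with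
  | nil => simp [dotp, coef]
  | cons p l ih =>
    rw [dotp, ih, coef_cons, coef_cons, dotp, if_congr (eq_comm (a := p.2)) rfl rfl]
    split_ifs with h
    · ring
    · ring

theorem dotp_comm (r l : List (ℤ × ℕ)) : dotp r l = dotp l r := by
  induction r with
  | nil => induction l with
    | nil => rfl
    | cons q l ih =>
      change q.1 * 0 + dotp [] l = 0
      rw [ih, mul_zero, zero_add, dotp]
  | cons q r ih => rw [dotp_cons, ih, dotp]

theorem lsum_filter (a : ℕ) (R : List (ℤ × ℕ)) :
    lsum v R = coef a R * v a + lsum v (R.filter fun q => !(Nat.beq a q.2)) := by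
  induction R with
  | nil => simp [lsum, coef]
  | cons q R ih =>
    rw [lsum, ih, coef_cons]
    by_cases h : a = q.2
    · rw [if_pos h, List.filter_cons_of_neg (by simp [h]), h]; push_cast; ring
    · rw [if_neg h, List.filter_cons_of_pos (by
        rw [Bool.not_eq_true', Bool.eq_false_iff, ne_eq, Nat.beq_eq]; exact h), lsum]; push_cast; ring

theorem lsum_eq_zero_of_chkS {f : ℕ} {R : List (ℤ × ℕ)} (h : chkS f R = true) : lsum v R = 0 := by
  induction f generalizing R with
  | zero => rw [List.isEmpty_iff.1 h]; rfl
  | succ f ih =>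
    rcases R with _ | ⟨⟨c, a⟩, R⟩
    · rfl
    · simp only [chkS, Bool.and_eq_true, beq_iff_eq] at h
      have h1 : (c : k) + (coef a R : k) = 0 := by exact_mod_cast congrArg (Int.cast (R := k)) h.1
      rw [lsum, lsum_filter a R, ih h.2, add_zero, ← add_mul, h1, zero_mul]

end FormalSums

section Functionals

/-- The keys whose codes are least in their orbits. -/
def IsMinKey (m : ℕ) (stab : ℕ → List Ent) (K : ℕ) : Prop :=
  ∃ t < m, ∃ p < 28561, K = 4 * (canon (stab t) p / 3) + t

theorem isMinKey_of_minChk {m K : ℕ} {stab : ℕ → List Ent} {X : ℕ → List IVec}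
    (hL : ∀ t, IsStabList (stab t) (X t)) (h : minChk m stab K = true) :
    K / 4 < 28561 ∧ IsMinKey m stab K := by
  obtain ⟨⟨h1, h2⟩, h3⟩ := minChk_iff.1 h
  have h4 : canon (stab (K % 4)) (K / 4) / 3 = K / 4 := by omega
  have h5 : K / 4 < 28561 := h4 ▸ (isCode_canon (hL _).1 (K / 4)).lt
  exact ⟨h5, K % 4, h1, K / 4, h5, by omega⟩

variable {k : Type} [Field k] {n : ℕ} {φ ψ : altChains k IsCell n →ₗ[k] k} {X : ℕ → List IVec}

/-- The value of a functional at a key, which consists of a code and the type of a cell. -/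
noncomputable def keyEval (X : ℕ → List IVec) (φ : altChains k IsCell n →ₗ[k] k) (K : ℕ) : k :=
  codeEval φ (X (K % 4)) (K / 4)

theorem keyEval_add (K : ℕ) : keyEval X (φ + ψ) K = keyEval X φ K + keyEval X ψ K := rowEval_add _ _

theorem keyEval_sub (K : ℕ) : keyEval X (φ - ψ) K = keyEval X φ K - keyEval X ψ K := rowEval_sub _ _

theorem keyEval_smul (c : k) (K : ℕ) : keyEval X (c • φ) K = c * keyEval X φ K := rowEval_smul _ _ _

theorem IsInvariantFunctional.comp_cellBoundaryMap {Γ : Subgroup SL4} (h : IsInvariantFunctional Γ φ) :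
    IsInvariantFunctional Γ (φ ∘ₗ cellBoundaryMap cellFamily_isCell n) := fun g f =>
  (congrArg φ (Rep.hom_comm_apply (wellRoundedD k Γ (n + 1)) g f)).trans (h g _)

theorem comp_cellBoundaryMap_comp_cellBoundaryMap (φ : altChains k IsCell n →ₗ[k] k) :
    (φ ∘ₗ cellBoundaryMap cellFamily_isCell n) ∘ₗ cellBoundaryMap cellFamily_isCell (n + 1) = 0 :=
  LinearMap.ext fun f => (congrArg φ (Subtype.ext
    (cellBoundary_cellBoundary cellFamily_isCell f.2))).trans (map_zero φ)

variable [CharZero k]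

/-- An invariant functional with prescribed values at the minimal keys. -/
theorem exists_keyEval_eq_coef {m : ℕ} (hm : m ≤ 4) {stab : ℕ → List Ent}
    (hL : ∀ t, IsStabList (stab t) (X t)) (hx : ∀ t, IsCellList IsCell (syms (X t)))
    (hn : ∀ t, (X t).length + n = 9)
    (hdet : ∀ s < m, ∀ t < m, (syms (X s)).sum.det = (syms (X t)).sum.det → s = t)
    {l : List (ℤ × ℕ)} (hl : ∀ q ∈ l, minChk m stab q.2 = true) :
    ∃ φ : altChains k IsCell n →ₗ[k] k, IsInvariantFunctional (Gamma0 13) φ ∧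
      ∀ K, IsMinKey m stab K → keyEval X φ K = coef K l := by
  induction l with
  | nil =>
    refine ⟨0, .zero, fun K _ => ?_⟩
    rw [← sub_self (0 : altChains k IsCell n →ₗ[k] k), keyEval_sub, sub_self, coef, Int.cast_zero]
  | cons q l ih =>
    obtain ⟨φ, hφ, h⟩ := ih fun p hp => hl p (List.mem_cons_of_mem _ hp)
    obtain ⟨⟨h1, h2⟩, h3⟩ := minChk_iff.1 (hl q List.mem_cons_self)
    obtain ⟨ψ, hψ, hψ1, hψ2, hψ3⟩ := (hL (q.2 % 4)).exists_deltaFunctional (k := k) (hx _) (hn _) h3 h2.ne'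
    refine ⟨(q.1 : k) • ψ + φ, (hψ.smul _).add hφ, fun K hK => ?_⟩
    rw [keyEval_add, keyEval_smul, h K hK, coef_cons]
    by_cases hq : K = q.2
    · rw [if_pos hq, hq, keyEval, hψ1]; push_cast; ring
    · rw [if_neg hq, keyEval]
      obtain ⟨t, ht, p, hp, rfl⟩ := hK
      rw [show (4 * (canon (stab t) p / 3) + t) % 4 = t by omega,
        show (4 * (canon (stab t) p / 3) + t) / 4 = canon (stab t) p / 3 by omega]
      by_cases hqt : t = q.2 % 4
      · rw [hqt, hψ2 p hp (by rw [← hqt]; omega)]; push_cast; ring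
      · rw [hψ3 _ (fun e => hqt (hdet _ ht _ h1 e))]; push_cast; ring

theorem codeEval_eq_zero_of_descends (hφ : IsInvariantFunctional (Gamma0 13) φ) {L : List Ent} {x : List IVec}
    (hL : ∀ e ∈ L, e.check x x = true)
    (h : ∀ m, IsCode m → m ≠ 0 → codeEval φ x m = 0 ∨ descends L m = true) :
    ∀ m, IsCode m → codeEval φ x m = 0 := by
  intro m
  induction m using Nat.strong_induction_on with
  | _ m ih =>
    intro hm
    by_cases h0 : m = 0
    · rw [codeEval, show codeVec m = 0 by rw [h0]; funext i; fin_cases i <;> simp [codeVec, digits],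
        rowEval_zero]
    rcases h m hm h0 with h | h
    · exact h
    simp only [descends, List.any_eq_true] at h
    obtain ⟨e, he, h⟩ := h
    have hv := e.codeEval_actCode hφ (hL e he) hm.lt
    change (bif Nat.blt (e.actCode m) m then true else
      (bif Nat.beq (e.actCode m) m then Nat.beq e.s 1 else false)) = true at h
    simp only [cond_eq_ite, Nat.blt_eq, Nat.beq_eq, Bool.if_true_left, Bool.if_false_right,
      Bool.or_eq_true, Bool.and_eq_true, decide_eq_true_eq] at h
    rcases h with h | ⟨h1, h2⟩
    · rw [ih _ h (isCode_actCode e m)] at hv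
      exact (mul_eq_zero.1 hv.symm).resolve_left fun h0 => one_ne_zero (α := k) (by
        rw [← sgn_mul_self e.s, h0, zero_mul])
    · rw [h1, h2] at hv
      have : sgn k 1 = -1 := rfl
      rw [this, neg_one_mul] at hv
      exact self_eq_neg.1 hv

theorem isStabList_stabC (t : ℕ) : IsStabList (stabC t) (frameC t) := isStabList_of_stabOk (stabOk_stabC t)

theorem isStabList_stabD (t : ℕ) : IsStabList (stabD t) (frameD t) := isStabList_of_stabOk (stabOk_stabD t)

theorem isMinKey_of_mem_rowC {K : ℕ} {q : ℤ × ℕ} (hq : q ∈ rowC K) : IsMinKey 4 stabD q.2 := by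
  obtain ⟨f, hf, p, hp, h⟩ := mem_bdRow hq
  exact ⟨f.t, ((facesOk_iff (facesOk_faceC _)).1 f hf).1, p, hp, h⟩

theorem isMinKey_of_mem_rowB {m : ℕ} {q : ℤ × ℕ} (hq : q ∈ rowB m) : IsMinKey 3 stabC q.2 := by
  obtain ⟨f, hf, p, hp, h⟩ := mem_bdRow hq
  exact ⟨f.t, ((facesOk_iff facesOk_faceB0).1 f hf).1, p, hp, h⟩

theorem keyEval_comp_boundary {ψ : altChains k IsCell 3 →ₗ[k] k} (hψ : IsInvariantFunctional (Gamma0 13) ψ)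
    {K : ℕ} (hK : K / 4 < 28561) : keyEval frameC (ψ ∘ₗ cellBoundaryMap cellFamily_isCell 3) K =
      lsum (keyEval frameD ψ) (rowC K) :=
  have h := facesOk_iff (facesOk_faceC (K % 4))
  codeEval_comp_boundary hψ (fun f hf => ⟨(h.1 f hf).1, (h.1 f hf).2, (isStabList_stabD _).1⟩)
    (isCellList_frameC _) rfl h.2 (isCellList_cons_frameC_iff _) hK

theorem codeEval_baseFrame_comp_boundary {φ : altChains k IsCell 4 →ₗ[k] k}
    (hφ : IsInvariantFunctional (Gamma0 13) φ) {m : ℕ} (hm : m < 28561) :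
    codeEval (φ ∘ₗ cellBoundaryMap cellFamily_isCell 4) baseFrame m = lsum (keyEval frameC φ) (rowB m) :=
  have h := facesOk_iff facesOk_faceB0
  codeEval_comp_boundary hφ (fun f hf => ⟨(h.1 f hf).1.trans (by norm_num), (h.1 f hf).2,
    (isStabList_stabC _).1⟩) isCellList_baseFrame rfl h.2 isCellList_cons_baseFrame_iff hm

theorem length_frameD_add (t : ℕ) : (frameD t).length + 3 = 9 := by
  match t with
  | 0 | 1 | 2 | _ + 3 => rfl

/-- Elimination with the pivots in `l`. -/
theorem exists_keyEval_sub_eq_zero {l : List (ℕ × ℕ)} (hl : (chkP l).2 = true)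
    (hu : ∀ q ∈ l, minChk 4 stabD q.2 = true) (hk : ∀ q ∈ l, q.1 / 4 < 28561)
    {φ : altChains k IsCell 4 →ₗ[k] k} (hφ : IsInvariantFunctional (Gamma0 13) φ) :
    ∃ ψ : altChains k IsCell 3 →ₗ[k] k, IsInvariantFunctional (Gamma0 13) ψ ∧
      (∀ K, IsMinKey 4 stabD K → K ∉ l.map Prod.snd → keyEval frameD ψ K = 0) ∧
      ∀ q ∈ l, keyEval frameC (φ - ψ ∘ₗ cellBoundaryMap cellFamily_isCell 3) q.1 = 0 := by
  induction l generalizing φ with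
  | nil =>
    refine ⟨0, .zero, fun K _ _ => ?_, fun q hq => absurd hq List.not_mem_nil⟩
    rw [← sub_self (0 : altChains k IsCell 3 →ₗ[k] k), keyEval_sub, sub_self]
  | cons q l ih =>
    obtain ⟨K, u⟩ := q
    simp only [chkP, Bool.and_eq_true, Bool.not_eq_true', beq_eq_false_iff_ne, chkP_fst] at hl
    obtain ⟨⟨hc, ho⟩, hl⟩ := hl
    have hK := hk _ List.mem_cons_self
    obtain ⟨δ, hδ, hδ'⟩ := exists_keyEval_eq_coef (k := k) (n := 3) le_rfl isStabList_stabD isCellList_frameD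
      length_frameD_add det_sum_frameD (l := [(1, u)])
      fun p hp => by rw [List.mem_singleton.1 hp]; exact hu _ List.mem_cons_self
    simp only [coef_cons] at hδ'
    simp only [coef, add_zero] at hδ'
    have hrow : keyEval frameC (δ ∘ₗ cellBoundaryMap cellFamily_isCell 3) K = coef u (rowC K) := by
      rw [keyEval_comp_boundary hδ hK, lsum_eq_coef_mul (a := u) fun p hp => ?_,
        hδ' u (isMinKey_of_minChk isStabList_stabD (hu _ List.mem_cons_self)).2, if_pos rfl,
        Int.cast_one, mul_one]
      by_cases hpu : p.2 = u
      · exact Or.inr (Or.inr hpu)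
      · rw [hδ' p.2 (isMinKey_of_mem_rowC hp), if_neg hpu]
        exact Or.inl Int.cast_zero
    have hc' : (coef u (rowC K) : k) ≠ 0 := Int.cast_ne_zero.2 hc
    set c := keyEval frameC φ K / (coef u (rowC K) : k) with hcd
    obtain ⟨ψ, hψ, hψ1, hψ2⟩ := ih hl (fun p hp => hu p (List.mem_cons_of_mem _ hp))
      (fun p hp => hk p (List.mem_cons_of_mem _ hp)) (hφ.sub (hδ.smul c).comp_cellBoundaryMap)
    have he : φ - (c • δ + ψ) ∘ₗ cellBoundaryMap cellFamily_isCell 3 =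
        φ - (c • δ) ∘ₗ cellBoundaryMap cellFamily_isCell 3 - ψ ∘ₗ cellBoundaryMap cellFamily_isCell 3 := by
      rw [LinearMap.add_comp, sub_sub]
    refine ⟨c • δ + ψ, (hδ.smul c).add hψ, fun L hL hLl => ?_, fun p hp => ?_⟩
    · rw [List.map_cons, List.mem_cons, not_or] at hLl
      rw [keyEval_add, keyEval_smul, hδ' L hL, if_neg hLl.1, hψ1 L hL hLl.2, Int.cast_zero, mul_zero,
        add_zero]
    · rw [he]
      rcases List.mem_cons.1 hp with rfl | hp
      · rw [keyEval_sub, keyEval_sub, LinearMap.smul_comp, keyEval_smul, hrow, hcd, div_mul_cancel₀ _ hc',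
          sub_self, zero_sub, neg_eq_zero, keyEval_comp_boundary hψ hK]
        refine lsum_eq_zero fun r hr => ?_
        by_cases hrl : r.2 ∈ l.map Prod.snd
        · exact Or.inr (offBits_spec ho r hr (testBit_bits.2 hrl))
        · exact Or.inl (hψ1 _ (isMinKey_of_mem_rowC hr) hrl)
      · exact hψ2 p hp

/-- Back substitution in the equations saying that a functional is a cocycle. -/
theorem keyEval_eq_zero_of_chkE {φ : altChains k IsCell 4 →ₗ[k] k}
    (hφ : IsInvariantFunctional (Gamma0 13) φ) (hd : φ ∘ₗ cellBoundaryMap cellFamily_isCell 4 = 0)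
    {S : List ℕ} (hS : ∀ K ∈ S, keyEval frameC φ K = 0) {l : List (ℕ × ℕ)} (hl : chkE (bits S) l = true)
    (hlt : ∀ q ∈ l, q.1 < 28561) : ∀ q ∈ l, keyEval frameC φ q.2 = 0 := by
  induction l generalizing S with
  | nil => simp
  | cons q l ih =>
    obtain ⟨m, K⟩ := q
    simp only [chkE, Bool.and_eq_true, Bool.not_eq_true', beq_eq_false_iff_ne] at hl
    obtain ⟨⟨hc, ho⟩, hl⟩ := hl
    have hrow := codeEval_baseFrame_comp_boundary hφ (hlt _ List.mem_cons_self)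
    rw [hd, lsum_eq_coef_mul (a := K) fun p hp => ?_] at hrow
    · have h0 : codeEval (0 : altChains k IsCell 5 →ₗ[k] k) baseFrame m = 0 := by
        rw [← sub_self (0 : altChains k IsCell 5 →ₗ[k] k), codeEval, rowEval_sub, sub_self]
      have hK : keyEval frameC φ K = 0 :=
        (mul_eq_zero.1 (hrow.symm.trans h0)).resolve_left (Int.cast_ne_zero.2 hc)
      have hS' : ∀ L ∈ K :: S, keyEval frameC φ L = 0 := List.forall_mem_cons.2 ⟨hK, hS⟩
      exact List.forall_mem_cons.2 ⟨hK, ih hS' hl fun p hp => hlt p (List.mem_cons_of_mem _ hp)⟩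
    · rcases onBits_spec ho p hp with h | h
      · rcases List.mem_cons.1 (testBit_bits (l := K :: S) |>.1 h) with h | h
        · exact Or.inr (Or.inr h)
        · exact Or.inl (hS _ h)
      · exact Or.inr (Or.inl h)

end Functionals

section Computation

variable {k : Type} [Field k] [CharZero k]

theorem eq_zero_of_keyEval {φ : altChains k IsCell 4 →ₗ[k] k} (hφ : IsInvariantFunctional (Gamma0 13) φ)
    (h : ∀ K ∈ phiKey :: (pivots.map Prod.fst ++ eqData.map Prod.snd), keyEval frameC φ K = 0) : φ = 0 :=
  eq_zero_of_codeEval_frameC hφ fun t ht =>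
    codeEval_eq_zero_of_descends hφ (isStabList_stabC t).1 fun m hm h0 =>
      (covs_spec (covs_stabC t ht) hm h0).imp_left fun hb => by
        have := h _ (testBit_bits.1 hb)
        rwa [keyEval, show (4 * m + t) % 4 = t by omega, show (4 * m + t) / 4 = m by omega] at this

theorem comp_boundary_eq_zero {φ : altChains k IsCell 4 →ₗ[k] k} (hφ : IsInvariantFunctional (Gamma0 13) φ)
    (h : ∀ q ∈ eqData, lsum (keyEval frameC φ) (rowB q.1) = 0) :
    φ ∘ₗ cellBoundaryMap cellFamily_isCell 4 = 0 :=
  eq_zero_of_codeEval_baseFrame hφ.comp_cellBoundaryMap <|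
    codeEval_eq_zero_of_descends hφ.comp_cellBoundaryMap (List.all_eq_true.1 check_stabB0) fun m hm h0 =>
      (covs_spec covs_stabB0 hm h0).imp_left fun hb => by
        obtain ⟨q, hq, he⟩ := List.mem_map.1 (testBit_bits.1 hb)
        obtain rfl : q.1 = m := by omega
        rw [codeEval_baseFrame_comp_boundary hφ hm.lt, h q hq]

theorem exists_cocycle : ∃ φ : altChains k IsCell 4 →ₗ[k] k, IsInvariantFunctional (Gamma0 13) φ ∧
    ∀ K, IsMinKey 3 stabC K → keyEval frameC φ K = coef K phiData :=
  exists_keyEval_eq_coef (by norm_num) isStabList_stabC isCellList_frameC (fun _ => rfl) det_sum_frameC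
    (List.all_eq_true.1 minChk_phiData)

variable {φ₀ : altChains k IsCell 4 →ₗ[k] k}

theorem cocycle_comp_boundary (hφ₀ : IsInvariantFunctional (Gamma0 13) φ₀)
    (h₀ : ∀ K, IsMinKey 3 stabC K → keyEval frameC φ₀ K = coef K phiData) :
    φ₀ ∘ₗ cellBoundaryMap cellFamily_isCell 4 = 0 :=
  comp_boundary_eq_zero hφ₀ fun q hq => by
    have := List.all_eq_true.1 dotp_rowB_phiData q hq
    rw [lsum_congr (w := fun K => (coef K phiData : k)) fun r hr => h₀ _ (isMinKey_of_mem_rowB hr),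
      lsum_coef, dotp_comm, beq_iff_eq.1 this, Int.cast_zero]

theorem cocycle_ne_comp_boundary (h₀ : ∀ K, IsMinKey 3 stabC K → keyEval frameC φ₀ K = coef K phiData)
    {ψ : altChains k IsCell 3 →ₗ[k] k} (hψ : IsInvariantFunctional (Gamma0 13) ψ) :
    φ₀ ≠ ψ ∘ₗ cellBoundaryMap cellFamily_isCell 3 := fun h => by
  have hz := fun q hq => isMinKey_of_minChk isStabList_stabC (List.all_eq_true.1 minChk_zetaData q hq)
  have h1 : lsum (keyEval frameC φ₀) zetaData = (dotp phiData zetaData : ℤ) := by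
    rw [← lsum_coef]
    exact lsum_congr fun q hq => h₀ _ (hz q hq).2
  have h2 : lsum (keyEval frameC φ₀) zetaData = 0 := by
    rw [lsum_congr (w := fun K => lsum (keyEval frameD ψ) (rowC K)) fun q hq => ?_, ← lsum_flatMap_scl,
      lsum_eq_zero_of_chkS chkS_zetaData]
    rw [h, keyEval_comp_boundary hψ (hz q hq).1]
  exact beq_eq_false_iff_ne.1 dotp_phiData_zetaData (Int.cast_eq_zero.1 (h1.symm.trans h2))

theorem exists_eq_smul_cocycle_add (hφ₀ : IsInvariantFunctional (Gamma0 13) φ₀)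
    (h₀ : ∀ K, IsMinKey 3 stabC K → keyEval frameC φ₀ K = coef K phiData)
    {φ : altChains k IsCell 4 →ₗ[k] k}
    (hφ : IsInvariantFunctional (Gamma0 13) φ) (hd : φ ∘ₗ cellBoundaryMap cellFamily_isCell 4 = 0) :
    ∃ (c : k) (ψ : altChains k IsCell 3 →ₗ[k] k), IsInvariantFunctional (Gamma0 13) ψ ∧
      φ = c • φ₀ + ψ ∘ₗ cellBoundaryMap cellFamily_isCell 3 := by
  have hp := fun q hq => isMinKey_of_minChk isStabList_stabC (List.all_eq_true.1 minChk_pivotKeys q hq)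
  obtain ⟨ψ, hψ, -, hv⟩ := exists_keyEval_sub_eq_zero chkP_pivots (List.all_eq_true.1 minChk_pivots)
    (fun q hq => (hp q hq).1) hφ
  set φ₁ := φ - ψ ∘ₗ cellBoundaryMap cellFamily_isCell 3 with hφ₁
  set c := keyEval frameC φ₁ phiKey with hc
  have hi : IsInvariantFunctional (Gamma0 13) (φ₁ - c • φ₀) := (hφ.sub hψ.comp_cellBoundaryMap).sub (hφ₀.smul c)
  have hb : (φ₁ - c • φ₀) ∘ₗ cellBoundaryMap cellFamily_isCell 4 = 0 := by
    rw [hφ₁, LinearMap.sub_comp, LinearMap.sub_comp, hd, comp_cellBoundaryMap_comp_cellBoundaryMap,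
      LinearMap.smul_comp, cocycle_comp_boundary hφ₀ h₀, smul_zero, sub_zero, sub_zero]
  have hk : phiKey ∈ phiData.map Prod.snd := List.mem_cons_self
  obtain ⟨r, hr, hrk⟩ := List.mem_map.1 hk
  have hS : ∀ K ∈ phiKey :: pivots.map Prod.fst, keyEval frameC (φ₁ - c • φ₀) K = 0 := by
    refine List.forall_mem_cons.2 ⟨?_, fun K hK => ?_⟩
    · rw [keyEval_sub, keyEval_smul, h₀ phiKey (hrk ▸ (isMinKey_of_minChk isStabList_stabC
        (List.all_eq_true.1 minChk_phiData r hr)).2), phiKey_phiData.1, Int.cast_one, mul_one, hc, sub_self]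
    · obtain ⟨q, hq, rfl⟩ := List.mem_map.1 hK
      rw [keyEval_sub, keyEval_smul, hv q hq, h₀ _ (hp q hq).2, coef_eq_zero fun s hs e => ?_,
        Int.cast_zero, mul_zero, sub_zero]
      have := List.all_eq_true.1 (List.all_eq_true.1 phiKey_phiData.2 q hq) s hs
      simp [e] at this
  have hE := keyEval_eq_zero_of_chkE hi hb hS chkE_eqData fun q hq => by
    simpa using List.all_eq_true.1 eqData_lt q hq
  have h0 := eq_zero_of_keyEval hi fun K hK => by
    rw [← List.cons_append, List.mem_append] at hK
    rcases hK with hK | hK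
    · exact hS K hK
    · obtain ⟨q, hq, rfl⟩ := List.mem_map.1 hK
      exact hE q hq
  exact ⟨c, ψ, hψ, by rw [← sub_eq_zero.1 h0, hφ₁, sub_add_cancel]⟩

end Computation

end Voronoi

/-- `dim_ℂ H^5(Γ₀(13), ℂ) = 1`. -/
theorem finrank_H5_Gamma0_13 :
    Module.finrank ℂ (groupCohomology (Rep.trivial ℂ (Gamma0 13) ℂ) 5) = 1 := by
  obtain ⟨φ₀, hφ₀, h₀⟩ := exists_cocycle (k := ℂ)
  exact finrank_groupCohomology_of_chains 3 hφ₀ (cocycle_comp_boundary hφ₀ h₀)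
    (fun ψ hψ => cocycle_ne_comp_boundary h₀ hψ) fun φ hφ hd => exists_eq_smul_cocycle_add hφ₀ h₀ hφ hd
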